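/- Assume, in addition to the context, that c^- = 0 and that only finitely many of the a_i^- and b_i^- are nonzero. Then there exist a probability space (Ω, ℱ, ℙ) and functions Y_i : ℝ × Ω → ℝ (i ≥ 1), with Y_i(t,·) measurable for every t ∈ ℝ, such that: (a) Y_i(t,ω) > Y_{i+1}(t,ω) for every i ≥ 1, t ∈ ℝ and ω ∈ Ω; and (b) for every m ∈ ℕ and all s₁ < s₂ < ⋯ < s_m in ℝ with A = {s₁,…,s_m}, the random measure M(ω,·) = ∑_{i≥1}∑_{j=1}^m δ_{(s_j, Y_i(s_j,ω))} is a point process on ℝ² which is determinantal with correlation kernel K_{a,b,c} and reference measure μ_A × λ, where μ_A is the counting measure on A and λ is Lebesgue measure on ℝ (i.e., for all pairwise disjoint bounded Borel B₁,…,B_r ⊆ ℝ² and n₁,…,n_r ∈ ℕ with n = ∑ n_j, E[∏_{j=1}^r M(B_j)!/(M(B_j)−n_j)!] = ∫_{B₁^{n₁}×⋯×B_r^{n_r}} det[K_{a,b,c}(t_i,x_i;t_j,x_j)]_{i,j=1}^n (μ_A×λ)^n(d(t,x))). -/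

import Mathlib

open MeasureTheory Filter Topology Complex intervalIntegral
open scoped ENNReal

noncomputable section

/-- The parameters of the Airy wanderer kernel: four summable nonincreasing
sequences of nonnegative reals and two nonnegative constants. -/
structure AWParams where
  ap : ℕ → ℝ
  am : ℕ → ℝ
  bp : ℕ → ℝ
  bm : ℕ → ℝ
  cp : ℝ
  cm : ℝ
  ap_nonneg : ∀ i, 0 ≤ ap i
  am_nonneg : ∀ i, 0 ≤ am i
  bp_nonneg : ∀ i, 0 ≤ bp i
  bm_nonneg : ∀ i, 0 ≤ bm i
  ap_anti : Antitone ap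
  am_anti : Antitone am
  bp_anti : Antitone bp
  bm_anti : Antitone bm
  sum_fin : Summable fun i => ap i + am i + bp i + bm i
  cp_nonneg : 0 ≤ cp
  cm_nonneg : 0 ≤ cm

namespace AWParams

/-- The threshold `ā ∈ [0, ∞]`. -/
def abar (P : AWParams) : EReal :=
  if 0 < P.am 0 + P.bm 0 + P.cm then (0 : EReal)
  else if P.ap 0 = 0 then (⊤ : EReal)
  else (((P.ap 0)⁻¹ : ℝ) : EReal)

/-- The threshold `b̄ ∈ [-∞, 0]`. -/
def bbar (P : AWParams) : EReal :=
  if 0 < P.am 0 + P.bm 0 + P.cm then (0 : EReal)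
  else if P.bp 0 = 0 then (⊥ : EReal)
  else ((-(P.bp 0)⁻¹ : ℝ) : EReal)

/-- The function `Φ_{a,b,c}`. -/
def Phi (P : AWParams) (z : ℂ) : ℂ :=
  Complex.exp ((P.cp : ℂ) * z + (P.cm : ℂ) / z) *
    ∏' i : ℕ,
      ((1 + (P.bp i : ℂ) * z) * (1 + (P.bm i : ℂ) / z)) /
        ((1 - (P.ap i : ℂ) * z) * (1 - (P.am i : ℂ) / z))

end AWParams

/-- Arc-length parametrization of `Γ_a^+` (increasing imaginary part). -/
def gammaP (a y : ℝ) : ℂ :=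
  (a : ℂ) + ((|y| : ℝ) : ℂ) / ((Real.sqrt 2 : ℝ) : ℂ) +
    ((y : ℝ) : ℂ) * Complex.I / ((Real.sqrt 2 : ℝ) : ℂ)

/-- The (a.e.) derivative of the parametrization of `Γ_a^+`. -/
def gammaPD (y : ℝ) : ℂ :=
  (((Real.sign y : ℝ)) : ℂ) / ((Real.sqrt 2 : ℝ) : ℂ) +
    Complex.I / ((Real.sqrt 2 : ℝ) : ℂ)

/-- Arc-length parametrization of `Γ_a^-` (increasing imaginary part). -/
def gammaM (a y : ℝ) : ℂ :=
  (a : ℂ) - ((|y| : ℝ) : ℂ) / ((Real.sqrt 2 : ℝ) : ℂ) +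
    ((y : ℝ) : ℂ) * Complex.I / ((Real.sqrt 2 : ℝ) : ℂ)

/-- The (a.e.) derivative of the parametrization of `Γ_a^-`. -/
def gammaMD (y : ℝ) : ℂ :=
  -(((Real.sign y : ℝ)) : ℂ) / ((Real.sqrt 2 : ℝ) : ℂ) +
    Complex.I / ((Real.sqrt 2 : ℝ) : ℂ)

/-- The integrand of `K³_{a,b,c}`. -/
def K3Integrand (P : AWParams) (t₁ x₁ t₂ x₂ : ℝ) (z w : ℂ) : ℂ :=
  Complex.exp (z ^ 3 / 3 - (x₁ : ℂ) * z - w ^ 3 / 3 + (x₂ : ℂ) * w) /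
      (z + (t₁ : ℂ) - w - (t₂ : ℂ)) *
    (P.Phi (z + (t₁ : ℂ)) / P.Phi (w + (t₂ : ℂ)))

/-- The integrand of `K³_{a,b,c}` in the parametrization of `Γ_α^+ × Γ_β^-`,
including the derivative factors. -/
def K3param (P : AWParams) (α β t₁ x₁ t₂ x₂ : ℝ) (y₁ y₂ : ℝ) : ℂ :=
  K3Integrand P t₁ x₁ t₂ x₂ (gammaP α y₁) (gammaM β y₂) * gammaPD y₁ * gammaMD y₂

/-- `K³_{a,b,c}` with contours `Γ_α^+`, `Γ_β^-`. -/
def K3 (P : AWParams) (α β t₁ x₁ t₂ x₂ : ℝ) : ℂ :=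
  (1 / (2 * (Real.pi : ℂ) * Complex.I)) ^ 2 *
    ∫ p : ℝ × ℝ, K3param P α β t₁ x₁ t₂ x₂ p.1 p.2

/-- `K²_{a,b,c}`. -/
def K2 (t₁ x₁ t₂ x₂ : ℝ) : ℂ :=
  if t₁ < t₂ then
    -((((Real.sqrt (4 * Real.pi * (t₂ - t₁)))⁻¹ : ℝ) : ℂ) *
      Complex.exp
        (((-(x₂ - x₁) ^ 2 / (4 * (t₂ - t₁)) - (t₂ - t₁) * (x₂ + x₁) / 2 +
            (t₂ - t₁) ^ 3 / 12 : ℝ)) : ℂ))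
  else 0

/-- The point `w = (α+t₁+β+t₂)/2 + i s` of the vertical segment in `K¹`. -/
def K1seg (α β t₁ t₂ s : ℝ) : ℂ :=
  (((α + t₁ + β + t₂) / 2 : ℝ) : ℂ) + (s : ℂ) * Complex.I

/-- `K¹_{a,b,c}`: zero unless the contours cross, in which case it is the integral
over the vertical segment from `u₋` to `u₊` (parametrized by the imaginary part,
with `dw = i ds`). -/
def K1 (α β t₁ x₁ t₂ x₂ : ℝ) : ℂ :=
  if α + t₁ < β + t₂ then
    (1 / (2 * (Real.pi : ℂ) * Complex.I)) *
      ∫ s in (-((β + t₂ - (α + t₁)) / 2))..((β + t₂ - (α + t₁)) / 2),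
        Complex.exp
          (((t₂ - t₁ : ℝ) : ℂ) * (K1seg α β t₁ t₂ s) ^ 2 +
            ((t₁ ^ 2 - t₂ ^ 2 : ℝ) : ℂ) * K1seg α β t₁ t₂ s +
            K1seg α β t₁ t₂ s * ((x₂ - x₁ : ℝ) : ℂ) +
            ((x₁ * t₁ - x₂ * t₂ - t₁ ^ 3 / 3 + t₂ ^ 3 / 3 : ℝ) : ℂ)) * Complex.I
  else 0

/-- The Airy wanderer kernel `K_{a,b,c}`, computed with contours `Γ_α^+`, `Γ_β^-`. -/
def KabcAt (P : AWParams) (α β t₁ x₁ t₂ x₂ : ℝ) : ℂ :=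
  K1 α β t₁ x₁ t₂ x₂ + K2 t₁ x₁ t₂ x₂ + K3 P α β t₁ x₁ t₂ x₂

/-- The Airy wanderer kernel `K_{a,b,c}` (with the canonical admissible choice
`α = -t₁ - 1`, `β = -t₂ + 1`; the value is independent of the admissible choice). -/
def Kabc (P : AWParams) (t₁ x₁ t₂ x₂ : ℝ) : ℂ :=
  KabcAt P (-t₁ - 1) (-t₂ + 1) t₁ x₁ t₂ x₂


/-- A point process on `ℝ²`. -/
def IsPointProcess2 {Ω : Type*} [MeasurableSpace Ω] (M : Ω → Measure (ℝ × ℝ)) : Prop :=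
  (∀ A : Set (ℝ × ℝ), MeasurableSet A → Measurable fun ω => M ω A) ∧
  (∀ ω, ∀ B : Set (ℝ × ℝ), MeasurableSet B → Bornology.IsBounded B →
    ∃ n : ℕ, M ω B = n)

/-- Descending factorial `x (x-1) ⋯ (x-n+1)` in `ℝ≥0∞`. -/
def descFactE (x : ℝ≥0∞) (n : ℕ) : ℝ≥0∞ := ∏ i ∈ Finset.range n, (x - (i : ℝ≥0∞))

/-- The counting measure `μ_𝒜` on the finite set `{s 0, …, s (m-1)} ⊆ ℝ`. -/
def muA {m : ℕ} (s : Fin m → ℝ) : Measure ℝ :=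
  Measure.sum fun j : Fin m => Measure.dirac (s j)

instance muA_finite {m : ℕ} (s : Fin m → ℝ) : IsFiniteMeasure (muA s) := by
  constructor
  rw [muA, Measure.sum_apply _ MeasurableSet.univ]
  simp [tsum_fintype]

/-- The process `M` is determinantal with correlation kernel `Kk` and reference
measure `μ_𝒜 × λ`, in the sense of joint factorial moments: for all pairwise
disjoint bounded Borel sets `B₁,…,B_r` and positive integers `n₁,…,n_r`,
`E[∏_j M(B_j)!/(M(B_j)-n_j)!] = ∫_{B₁^{n₁}×⋯×B_r^{n_r}} det[Kk(p_i, p_j)] d(μ_𝒜 × λ)^n`. -/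
def IsDeterminantalOn {Ω : Type*} [MeasurableSpace Ω] (P : Measure Ω)
    (M : Ω → Measure (ℝ × ℝ)) (Kk : ℝ → ℝ → ℝ → ℝ → ℂ)
    {m : ℕ} (s : Fin m → ℝ) : Prop :=
  ∀ (r : ℕ) (n : Fin r → ℕ) (B : Fin r → Set (ℝ × ℝ)),
    0 < r → (∀ j, 0 < n j) →
    (∀ j, MeasurableSet (B j)) → (∀ j, Bornology.IsBounded (B j)) →
    (∀ i j, i ≠ j → Disjoint (B i) (B j)) →
    (∫⁻ ω, ∏ j, descFactE (M ω (B j)) (n j) ∂P) ≠ ⊤ ∧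
    (((∫⁻ ω, ∏ j, descFactE (M ω (B j)) (n j) ∂P).toReal : ℝ) : ℂ) =
      ∫ x in {x : ((j : Fin r) × Fin (n j)) → ℝ × ℝ | ∀ p, x p ∈ B p.1},
        Matrix.det (Matrix.of fun p q : (j : Fin r) × Fin (n j) =>
          Kk (x p).1 (x p).2 (x q).1 (x q).2)
        ∂(Measure.pi fun _ : (j : Fin r) × Fin (n j) =>
            (muA s).prod (volume : Measure ℝ))

namespace AW

lemma det_bordered {ι : Type*} [Fintype ι] [DecidableEq ι] (A : Matrix ι ι ℝ) (u v : ι → ℝ) (d : ℝ) :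
    (Matrix.fromBlocks A (Matrix.replicateCol Unit u) (Matrix.replicateRow Unit v)
      (Matrix.of fun _ _ : Unit => d)).det
      = d * A.det - ∑ i, ∑ j, v i * (A.adjugate i j * u j) := by
  have key : ∀ A : Matrix ι ι ℝ, A.det ≠ 0 →
      (Matrix.fromBlocks A (Matrix.replicateCol Unit u) (Matrix.replicateRow Unit v)
      (Matrix.of fun _ _ : Unit => d)).det
      = d * A.det - ∑ i, ∑ j, v i * (A.adjugate i j * u j) := by
    intro A hA
    have : Invertible A := Matrix.invertibleOfIsUnitDet A (isUnit_iff_ne_zero.mpr hA)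
    rw [Matrix.det_fromBlocks₁₁, Matrix.invOf_eq_nonsing_inv, Matrix.inv_def]
    simp only [Matrix.det_unique, Matrix.sub_apply, Matrix.mul_apply, Matrix.smul_apply, Matrix.of_apply,
      Matrix.replicateCol_apply, Matrix.replicateRow_apply, Ring.inverse_eq_inv', smul_eq_mul]
    rw [mul_sub, mul_comm d]
    congr 1
    rw [Finset.sum_comm, Finset.mul_sum]
    refine Finset.sum_congr rfl fun j _ => ?_
    rw [Finset.sum_mul, Finset.mul_sum]
    refine Finset.sum_congr rfl fun i _ => ?_
    field_simp
  have hev : ∀ᶠ e : ℝ in 𝓝[≠] 0, (A + Matrix.scalar ι e).det ≠ 0 := by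
    have hp : (-A).charpoly ≠ 0 := (Matrix.charpoly_monic _).ne_zero
    have hfin : (((-A).charpoly.roots.toFinset : Set ℝ) \ {0}).Finite :=
      (Finset.finite_toSet _).subset Set.sdiff_subset
    have : ∀ᶠ e : ℝ in 𝓝 0, e ∉ (((-A).charpoly.roots.toFinset : Set ℝ) \ {0}) :=
      hfin.isClosed.isOpen_compl.mem_nhds (by simp)
    filter_upwards [this.filter_mono nhdsWithin_le_nhds, self_mem_nhdsWithin] with e he he0 hdet
    apply he
    refine ⟨?_, he0⟩
    simp only [Finset.mem_coe, Multiset.mem_toFinset]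
    rw [Polynomial.mem_roots hp, Polynomial.IsRoot.def, Matrix.eval_charpoly, sub_neg_eq_add, add_comm]
    exact hdet
  have c1 : Continuous fun e : ℝ => A + Matrix.scalar ι e := by
    have : (fun e : ℝ => A + Matrix.scalar ι e) = fun e : ℝ => A + e • (1 : Matrix ι ι ℝ) := by
      funext e; simp [Matrix.smul_one_eq_diagonal]
    rw [this]; fun_prop
  have cL : Continuous fun e : ℝ => (Matrix.fromBlocks (A + Matrix.scalar ι e) (Matrix.replicateCol Unit u) (Matrix.replicateRow Unit v)
      (Matrix.of fun _ _ : Unit => d)).det := by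
    apply Continuous.matrix_det
    exact c1.matrix_fromBlocks continuous_const continuous_const continuous_const
  have cR : Continuous fun e : ℝ => d * (A + Matrix.scalar ι e).det - ∑ i, ∑ j, v i * ((A + Matrix.scalar ι e).adjugate i j * u j) := by
    have := c1.matrix_adjugate
    have h2 := c1.matrix_det
    have h3 : ∀ i j, Continuous fun e : ℝ => (A + Matrix.scalar ι e).adjugate i j := fun i j => this.matrix_elem i j
    fun_prop
  have e1 := (cL.tendsto 0).mono_left (nhdsWithin_le_nhds (s := {0}ᶜ))
  have e2 := (cR.tendsto 0).mono_left (nhdsWithin_le_nhds (s := {0}ᶜ))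
  have := tendsto_nhds_unique (e1.congr' (hev.mono fun e he => key _ he)) e2
  simpa using this

/-- Eynard–Mehta system on levels `L` with `κ` many particles per level. -/
structure EMSys (L κ : Type*) [LinearOrder L] [Fintype κ] [DecidableEq κ] where
  φ : κ → L → ℝ → ℝ
  ψ : κ → L → ℝ → ℝ
  p : L → L → ℝ → ℝ → ℝ
  mφ : ∀ j t, Measurable (φ j t)
  mψ : ∀ j t, Measurable (ψ j t)
  mp : ∀ s t, Measurable fun z : ℝ × ℝ => p s t z.1 z.2
  i1 : ∀ i j t, Integrable fun y => ψ i t y * φ j t y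
  e1 : ∀ i j t, ∫ y, ψ i t y * φ j t y = if i = j then 1 else 0
  i2 : ∀ j s t, s < t → ∀ x, Integrable fun y => p s t x y * φ j t y
  e2 : ∀ j s t, s < t → ∀ x, ∫ y, p s t x y * φ j t y = φ j s x
  i3 : ∀ j t r, t < r → ∀ z, Integrable fun y => ψ j t y * p t r y z
  e3 : ∀ j t r, t < r → ∀ z, ∫ y, ψ j t y * p t r y z = ψ j r z
  i4 : ∀ s t r, s < t → t < r → ∀ x z, Integrable fun y => p s t x y * p t r y z
  e4 : ∀ s t r, s < t → t < r → ∀ x z, ∫ y, p s t x y * p t r y z = p s r x z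

namespace EMSys
variable {L κ : Type*} [LinearOrder L] [Fintype κ] [DecidableEq κ] (E : EMSys L κ)

def K (a b : L × ℝ) : ℝ :=
  (∑ j, E.φ j a.1 a.2 * E.ψ j b.1 b.2) - if a.1 < b.1 then E.p a.1 b.1 a.2 b.2 else 0

lemma mK (s t : L) : Measurable fun z : ℝ × ℝ => E.K (s, z.1) (t, z.2) := by
  unfold K
  have := E.mφ; have := E.mψ; have := E.mp
  refine Measurable.sub ?_ ?_
  · refine Finset.measurable_sum _ fun j _ => ?_
    exact ((E.mφ j s).comp measurable_fst).mul ((E.mψ j t).comp measurable_snd)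
  · by_cases h : s < t
    · simpa [h] using E.mp s t
    · simp [h]

lemma repro (a b : L × ℝ) (t : L) :
    Integrable (fun y => E.K a (t, y) * E.K (t, y) b) ∧
    ∫ y, E.K a (t, y) * E.K (t, y) b =
      E.K a b * ((if t ≤ a.1 then 1 else 0) - (if t < b.1 then 1 else 0)) := by
  have expand : ∀ y, E.K a (t, y) * E.K (t, y) b =
      (∑ i, ∑ j, E.φ i a.1 a.2 * E.ψ j b.1 b.2 * (E.ψ i t y * E.φ j t y))
      - (∑ i, E.φ i a.1 a.2 * (E.ψ i t y * (if t < b.1 then E.p t b.1 y b.2 else 0)))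
      - (∑ j, E.ψ j b.1 b.2 * ((if a.1 < t then E.p a.1 t a.2 y else 0) * E.φ j t y))
      + (if a.1 < t then E.p a.1 t a.2 y else 0) * (if t < b.1 then E.p t b.1 y b.2 else 0) := by
    intro y
    simp only [K]
    rw [sub_mul, mul_sub, mul_sub, Finset.sum_mul_sum, Finset.sum_mul, Finset.mul_sum]
    have h1 : ∀ i j, E.φ i a.1 a.2 * E.ψ i t y * (E.φ j t y * E.ψ j b.1 b.2) =
      E.φ i a.1 a.2 * E.ψ j b.1 b.2 * (E.ψ i t y * E.φ j t y) := fun i j => by ring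
    simp only [h1]
    have h2 : ∀ i, E.φ i a.1 a.2 * E.ψ i t y * (if t < b.1 then E.p t b.1 y b.2 else 0) =
      E.φ i a.1 a.2 * (E.ψ i t y * (if t < b.1 then E.p t b.1 y b.2 else 0)) := fun i => by ring
    simp only [h2]
    have h3 : ∀ j, (if a.1 < t then E.p a.1 t a.2 y else 0) * (E.φ j t y * E.ψ j b.1 b.2) =
      E.ψ j b.1 b.2 * ((if a.1 < t then E.p a.1 t a.2 y else 0) * E.φ j t y) := fun i => by ring
    simp only [h3]
    ring
  simp_rw [expand]
  have I1 : Integrable fun y => (∑ i, ∑ j, E.φ i a.1 a.2 * E.ψ j b.1 b.2 * (E.ψ i t y * E.φ j t y)) :=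
    integrable_finsetSum _ fun i _ => integrable_finsetSum _ fun j _ => (E.i1 i j t).const_mul _
  have I2' : ∀ i, Integrable fun y => E.ψ i t y * (if t < b.1 then E.p t b.1 y b.2 else 0) := by
    intro i
    by_cases h : t < b.1
    · simpa [h] using E.i3 i t b.1 h b.2
    · simp [h]
  have I2 : Integrable fun y => (∑ i, E.φ i a.1 a.2 * (E.ψ i t y * (if t < b.1 then E.p t b.1 y b.2 else 0))) :=
    integrable_finsetSum _ fun i _ => (I2' i).const_mul _
  have I3' : ∀ j, Integrable fun y => (if a.1 < t then E.p a.1 t a.2 y else 0) * E.φ j t y := by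
    intro i
    by_cases h : a.1 < t
    · simpa [h] using E.i2 i a.1 t h a.2
    · simp [h]
  have I3 : Integrable fun y => (∑ j, E.ψ j b.1 b.2 * ((if a.1 < t then E.p a.1 t a.2 y else 0) * E.φ j t y)) :=
    integrable_finsetSum _ fun i _ => (I3' i).const_mul _
  have I4 : Integrable fun y => (if a.1 < t then E.p a.1 t a.2 y else 0) * (if t < b.1 then E.p t b.1 y b.2 else 0) := by
    by_cases h : a.1 < t
    · by_cases h' : t < b.1
      · simpa [h, h'] using E.i4 a.1 t b.1 h h' a.2 b.2
      · simp [h']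
    · simp [h]
  refine ⟨((I1.sub I2).sub I3).add I4, ?_⟩
  rw [integral_add (by exact (I1.sub I2).sub I3) I4, integral_sub (by exact I1.sub I2) I3, integral_sub I1 I2]
  rw [integral_finsetSum _ fun i _ => (integrable_finsetSum _ fun j _ => (E.i1 i j t).const_mul _)]
  rw [integral_finsetSum _ fun i _ => (I2' i).const_mul _, integral_finsetSum _ fun i _ => (I3' i).const_mul _]
  have J1 : ∀ i, ∫ y, ∑ j, E.φ i a.1 a.2 * E.ψ j b.1 b.2 * (E.ψ i t y * E.φ j t y) = E.φ i a.1 a.2 * E.ψ i b.1 b.2 := by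
    intro i
    rw [integral_finsetSum _ fun j _ => (E.i1 i j t).const_mul _]
    simp only [MeasureTheory.integral_const_mul, E.e1]
    simp
  have J2 : ∀ i, ∫ y, E.φ i a.1 a.2 * (E.ψ i t y * (if t < b.1 then E.p t b.1 y b.2 else 0)) =
      (if t < b.1 then 1 else 0) * (E.φ i a.1 a.2 * E.ψ i b.1 b.2) := by
    intro i
    rw [MeasureTheory.integral_const_mul]
    by_cases h : t < b.1
    · simp [h, E.e3 i t b.1 h]
    · simp [h]
  have J3 : ∀ j, ∫ y, E.ψ j b.1 b.2 * ((if a.1 < t then E.p a.1 t a.2 y else 0) * E.φ j t y) =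
      (if a.1 < t then 1 else 0) * (E.φ j a.1 a.2 * E.ψ j b.1 b.2) := by
    intro j
    rw [MeasureTheory.integral_const_mul]
    by_cases h : a.1 < t
    · simp only [h, if_true, E.e2 j a.1 t h]; ring
    · simp [h]
  simp only [J1, J2, J3, ← Finset.mul_sum]
  unfold K
  by_cases h : a.1 < t
  · by_cases h' : t < b.1
    · have := E.e4 a.1 t b.1 h h' a.2 b.2
      simp [h, h', not_le.mpr h, h.trans h', this]
      ring
    · simp [h, h', not_le.mpr h]
  · have h1 : t ≤ a.1 := not_lt.mp h
    by_cases h' : t < b.1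
    · simp [h, h', h1]
    · have : ¬ a.1 < b.1 := fun h3 => h' (h1.trans_lt h3)
      simp [h, h', h1, this]

lemma diag_int (t : L) : Integrable (fun y => E.K (t, y) (t, y)) ∧
    ∫ y, E.K (t, y) (t, y) = Fintype.card κ := by
  have : ∀ y, E.K (t, y) (t, y) = ∑ j, E.ψ j t y * E.φ j t y := by
    intro y; simp [K, mul_comm]
  simp_rw [this]
  refine ⟨integrable_finsetSum _ fun j _ => E.i1 j j t, ?_⟩
  rw [integral_finsetSum _ fun j _ => E.i1 j j t]
  simp [E.e1]

lemma gaudin {ι : Type*} [Fintype ι] [DecidableEq ι] (τ : ι → L) (x : ι → ℝ) (t : L) :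
    Integrable (fun y => (Matrix.of fun p q : Option ι =>
      E.K (p.elim (t, y) fun i => (τ i, x i)) (q.elim (t, y) fun i => (τ i, x i))).det) ∧
    ∫ y, (Matrix.of fun p q : Option ι =>
      E.K (p.elim (t, y) fun i => (τ i, x i)) (q.elim (t, y) fun i => (τ i, x i))).det
    = ((Fintype.card κ : ℝ) - (Finset.univ.filter fun i => τ i = t).card) *
      (Matrix.of fun p q : ι => E.K (τ p, x p) (τ q, x q)).det := by
  set A : Matrix ι ι ℝ := Matrix.of fun p q : ι => E.K (τ p, x p) (τ q, x q) with hA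
  have hd : ∀ y, (Matrix.of fun p q : Option ι =>
      E.K (p.elim (t, y) fun i => (τ i, x i)) (q.elim (t, y) fun i => (τ i, x i))).det =
      E.K (t, y) (t, y) * A.det - ∑ i, ∑ j, E.K (t, y) (τ i, x i) * (A.adjugate i j * E.K (τ j, x j) (t, y)) := by
    intro y
    rw [← det_bordered A (fun j => E.K (τ j, x j) (t, y)) (fun i => E.K (t, y) (τ i, x i)),
      ← Matrix.det_submatrix_equiv_self (Equiv.optionEquivSumPUnit ι)]
    congr 1
    ext p q
    rcases p with _ | p <;> rcases q with _ | q <;> simp [hA]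
  have hd2 : ∀ y i j, E.K (t, y) (τ i, x i) * (A.adjugate i j * E.K (τ j, x j) (t, y)) =
      A.adjugate i j * (E.K (τ j, x j) (t, y) * E.K (t, y) (τ i, x i)) := fun y i j => by ring
  simp_rw [hd, hd2]
  have I1 := (E.diag_int t).1.mul_const A.det
  have I2 : Integrable fun y => ∑ i, ∑ j, A.adjugate i j * (E.K (τ j, x j) (t, y) * E.K (t, y) (τ i, x i)) :=
    integrable_finsetSum _ fun i _ => integrable_finsetSum _ fun j _ => ((E.repro _ _ t).1).const_mul _
  refine ⟨I1.sub I2, ?_⟩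
  rw [integral_sub I1 I2, MeasureTheory.integral_mul_const, (E.diag_int t).2]
  have J0 : ∫ y, ∑ i, ∑ j, A.adjugate i j * (E.K (τ j, x j) (t, y) * E.K (t, y) (τ i, x i)) =
      ∑ i, ∫ y, ∑ j, A.adjugate i j * (E.K (τ j, x j) (t, y) * E.K (t, y) (τ i, x i)) :=
    integral_finsetSum _ fun i _ => integrable_finsetSum _ fun j _ => ((E.repro _ _ t).1).const_mul _
  rw [J0]
  have J : ∀ i, ∫ y, ∑ j, A.adjugate i j * (E.K (τ j, x j) (t, y) * E.K (t, y) (τ i, x i)) =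
     ∑ j, A.adjugate i j * (A j i * ((if t ≤ τ j then 1 else 0) - (if t < τ i then 1 else 0))) := by
    intro i
    refine (integral_finsetSum _ fun j _ => ((E.repro _ _ t).1).const_mul _).trans ?_
    refine Finset.sum_congr rfl fun j _ => ?_
    rw [MeasureTheory.integral_const_mul, (E.repro _ _ t).2]
    rfl
  simp_rw [J]
  rw [sub_mul]
  congr 1
  have h1 : ∀ j, ∑ i, A j i * A.adjugate i j = A.det := by
    intro j; rw [← Matrix.mul_apply, Matrix.mul_adjugate]; simp
  have h2 : ∀ i, ∑ j, A.adjugate i j * A j i = A.det := by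
    intro j; rw [← Matrix.mul_apply, Matrix.adjugate_mul]; simp
  have h3 : ∀ i j, A.adjugate i j * (A j i * ((if t ≤ τ j then (1:ℝ) else 0) - (if t < τ i then 1 else 0)))
      = (A j i * A.adjugate i j) * (if t ≤ τ j then 1 else 0) - (A.adjugate i j * A j i) * (if t < τ i then 1 else 0) :=
    fun i j => by ring
  simp_rw [h3, Finset.sum_sub_distrib]
  rw [Finset.sum_comm]
  simp_rw [← Finset.sum_mul, h1, h2]
  rw [← Finset.mul_sum, ← Finset.mul_sum, ← mul_sub, ← Finset.sum_sub_distrib, mul_comm]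
  congr 1
  rw [Finset.card_filter, Nat.cast_sum]
  refine Finset.sum_congr rfl fun i _ => ?_
  rcases lt_trichotomy (τ i) t with h | h | h
  · simp [h.ne, not_le.mpr h, not_lt.mpr h.le]
  · simp [h]
  · simp [h.ne', h, h.le]

end EMSys
end AW

namespace AW

namespace EMSys
variable {L κ : Type*} [LinearOrder L] [Fintype L] [Fintype κ] [DecidableEq κ] (E : EMSys L κ)

/-- determinant over a finset of slots -/
def D (S : Finset (L × κ)) (x : L × κ → ℝ) : ℝ :=
  (Matrix.of fun p q : S => E.K (p.1.1, x p.1) (q.1.1, x q.1)).det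

/-- determinant over a general indexing family -/
def Dt {α : Type*} [Fintype α] [DecidableEq α] (τ : α → L) (z : α → ℝ) : ℝ :=
  (Matrix.of fun p q : α => E.K (τ p, z p) (τ q, z q)).det

lemma mDt {α : Type*} [Fintype α] [DecidableEq α] (τ : α → L) : Measurable (E.Dt τ) := by
  unfold Dt
  simp only [Matrix.det_apply]
  refine Finset.measurable_sum _ fun σ _ => ?_
  refine Measurable.const_smul ?_ _
  refine Finset.measurable_prod _ fun i _ => ?_
  have h : Measurable fun z : α → ℝ => (z (σ i), z i) := (measurable_pi_apply _).prodMk (measurable_pi_apply _)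
  exact (E.mK (τ (σ i)) (τ i)).comp h

lemma Dt_equiv {α β : Type*} [Fintype α] [DecidableEq α] [Fintype β] [DecidableEq β] (e : α ≃ β)
    (τ : β → L) (z : β → ℝ) : E.Dt (τ ∘ e) (z ∘ e) = E.Dt τ z := by
  unfold Dt
  rw [← Matrix.det_submatrix_equiv_self e]
  rfl

lemma D_eq (S : Finset (L × κ)) (x : L × κ → ℝ) :
    E.D S x = E.Dt (fun p : S => p.1.1) (fun p : S => x p.1) := rfl

lemma D_eq_Dt {α : Type*} [Fintype α] [DecidableEq α] (e : α → L × κ) (he : Function.Injective e)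
    (x : L × κ → ℝ) : E.D (Finset.univ.image e) x = E.Dt (fun p => (e p).1) (fun p => x (e p)) := by
  let e' : α ≃ (Finset.univ.image e : Finset (L × κ)) :=
    Equiv.ofBijective (fun a => ⟨e a, by simp⟩) ⟨fun a b h => he (by simpa using h), by
      rintro ⟨b, hb⟩
      obtain ⟨a, -, rfl⟩ := Finset.mem_image.mp hb
      exact ⟨a, rfl⟩⟩
  rw [D_eq, ← E.Dt_equiv e']
  rfl

lemma mD (S : Finset (L × κ)) : Measurable (E.D S) :=
  (E.mDt (fun p : S => p.1.1)).comp (measurable_pi_lambda _ fun _ => measurable_pi_apply _)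

/-- number of slots of `S` at level `k` -/
def nn (S : Finset (L × κ)) (k : L) : ℕ := (S.filter fun s => s.1 = k).card

lemma D_insert (S : Finset (L × κ)) (s : L × κ) (hs : s ∉ S) (x : L × κ → ℝ) :
    Integrable (fun y => E.D (insert s S) (Function.update x s y)) ∧
    ∫ y, E.D (insert s S) (Function.update x s y) =
      ((Fintype.card κ : ℝ) - nn S s.1) * E.D S x := by
  have h := E.gaudin (fun p : S => p.1.1) (fun p : S => x p.1) s.1
  have e : ∀ y, E.D (insert s S) (Function.update x s y) = (Matrix.of fun p q : Option S =>
      E.K (p.elim (s.1, y) fun i => (i.1.1, x i.1)) (q.elim (s.1, y) fun i => (i.1.1, x i.1))).det := by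
    intro y
    unfold D
    rw [← Matrix.det_submatrix_equiv_self (Finset.subtypeInsertEquivOption hs).symm]
    congr 1
    have hne : ∀ p : S, p.1 ≠ s := fun p h => hs (h ▸ p.2)
    ext p q
    rcases p with _ | p <;> rcases q with _ | q <;>
      simp [Finset.subtypeInsertEquivOption, Function.update_of_ne, hne]
  simp_rw [e]
  refine ⟨h.1, h.2.trans ?_⟩
  have : (Finset.univ.filter fun i : S => i.1.1 = s.1).card = nn S s.1 := by
    unfold nn
    rw [← Finset.card_map (Function.Embedding.subtype _)]
    congr 1
    ext z
    simp
    tauto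
  rw [this]
  rfl

lemma nn_insert (S : Finset (L × κ)) (s : L × κ) (hs : s ∉ S) (k : L) :
    nn (insert s S) k = nn S k + if s.1 = k then 1 else 0 := by
  unfold nn
  rw [Finset.filter_insert]
  split_ifs with h
  · rw [Finset.card_insert_of_notMem (by simp [hs])]
  · simp

lemma nn_le (S : Finset (L × κ)) (k : L) : nn S k ≤ Fintype.card κ := by
  unfold nn
  calc _ ≤ (Finset.univ.filter fun s : L × κ => s.1 = k).card :=
        Finset.card_le_card (Finset.filter_subset_filter _ (Finset.subset_univ _))
    _ ≤ (Finset.univ.image fun j : κ => (k, j)).card := Finset.card_le_card (by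
        rintro ⟨a, b⟩ h; simp at h; simp [h])
    _ ≤ _ := Finset.card_image_le

lemma marg (hpos : ∀ x, 0 ≤ E.D Finset.univ x) (T : Finset (L × κ)) :
    (∀ x, 0 ≤ E.D Tᶜ x) ∧ ∀ x, (∫⋯∫⁻_T, (fun x => ENNReal.ofReal (E.D Finset.univ x)) ∂(fun _ => volume)) x =
      ((∏ k, (Fintype.card κ - nn Tᶜ k).factorial : ℕ) : ℝ≥0∞) * ENNReal.ofReal (E.D Tᶜ x) := by
  induction T using Finset.induction_on with
  | empty =>
    refine ⟨by simpa using hpos, fun x => ?_⟩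
    have : ∀ k, Fintype.card κ - nn (Finset.univ : Finset (L × κ)) k = 0 := by
      intro k
      rw [Nat.sub_eq_zero_iff_le]
      unfold nn
      calc Fintype.card κ = (Finset.univ.image fun j : κ => (k, j)).card := by
            rw [Finset.card_image_of_injective _ (fun a b h => by simpa using h)]; simp
        _ ≤ _ := Finset.card_le_card (by
            intro a h; obtain ⟨j, -, rfl⟩ := Finset.mem_image.mp h; simp)
    simp [this]
  | insert s T hs ih =>
    have hc : Tᶜ = insert s (insert s T)ᶜ := by
      ext a; by_cases h : a = s
      · subst h; simp [hs]
      · simp [h]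
    have hs' : s ∉ (insert s T)ᶜ := by simp
    set S := (insert s T)ᶜ with hS
    rw [hc] at ih
    have hlt : nn S s.1 < Fintype.card κ := by
      have h1 := nn_le (insert s S) s.1
      rw [nn_insert S s hs'] at h1; simp at h1; omega
    have hgap : (0:ℝ) < (Fintype.card κ : ℝ) - nn S s.1 := by
      have : (nn S s.1 : ℝ) < Fintype.card κ := by exact_mod_cast hlt
      linarith
    have hnn : ∀ x, 0 ≤ E.D S x := by
      intro x
      have h := (E.D_insert S s hs' x).2
      have h0 : 0 ≤ ∫ y, E.D (insert s S) (Function.update x s y) := integral_nonneg fun y => ih.1 _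
      rw [h] at h0
      exact nonneg_of_mul_nonneg_right h0 hgap
    refine ⟨hnn, fun x => ?_⟩
    rw [lmarginal_insert _ (E.mD _).ennreal_ofReal hs]
    simp_rw [ih.2]
    have hm : Measurable fun y => E.D (insert s S) (Function.update x s y) :=
      (E.mD _).comp (measurable_update x)
    rw [lintegral_const_mul _ hm.ennreal_ofReal, ← ofReal_integral_eq_lintegral_ofReal (E.D_insert S s hs' x).1
      (Eventually.of_forall fun y => ih.1 _), (E.D_insert S s hs' x).2, ENNReal.ofReal_mul hgap.le, ← mul_assoc]
    congr 1
    have : (Fintype.card κ : ℝ) - nn S s.1 = ((Fintype.card κ - nn S s.1 : ℕ) : ℝ) := by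
      rw [Nat.cast_sub hlt.le]
    rw [this, ENNReal.ofReal_natCast, ← Nat.cast_mul]
    congr 1
    rw [← Finset.prod_erase_mul _ _ (Finset.mem_univ s.1), ← Finset.prod_erase_mul (a := s.1) _ _ (Finset.mem_univ s.1), mul_assoc]
    congr 1
    · refine Finset.prod_congr rfl fun k hk => ?_
      rw [nn_insert S s hs', if_neg (Finset.ne_of_mem_erase hk).symm]; simp
    · rw [nn_insert S s hs', if_pos rfl]
      have : Fintype.card κ - nn S s.1 = (Fintype.card κ - (nn S s.1 + 1)) + 1 := by omega
      rw [this, Nat.factorial_succ]; ring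

lemma marg_inj (hpos : ∀ x, 0 ≤ E.D Finset.univ x) {α : Type*} [Fintype α] [DecidableEq α]
    (e : α → L × κ) (he : Function.Injective e) (H : (α → ℝ) → ℝ≥0∞) (hH : Measurable H) :
    ∫⁻ x : L × κ → ℝ, ENNReal.ofReal (E.D Finset.univ x) * H (fun p => x (e p)) =
      ((∏ k, (Fintype.card κ - (Finset.univ.filter fun p => (e p).1 = k).card).factorial : ℕ) : ℝ≥0∞) *
        ∫⁻ z : α → ℝ, ENNReal.ofReal (E.Dt (fun p => (e p).1) z) * H z := by
  set S := Finset.univ.image e with hS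
  have hm : Measurable fun x : L × κ → ℝ => ENNReal.ofReal (E.D Finset.univ x) * H (fun p => x (e p)) :=
    (E.mD _).ennreal_ofReal.mul (hH.comp (measurable_pi_lambda _ fun _ => measurable_pi_apply _))
  rw [volume_pi, lintegral_eq_lmarginal_univ (0 : L × κ → ℝ)]
  have hU : (Finset.univ : Finset (L × κ)) = S ∪ Sᶜ := by simp
  have hUU := lmarginal_union (fun _ : L × κ => (volume : Measure ℝ)) _ hm (disjoint_compl_right (a := S))
  rw [← hU] at hUU
  rw [hUU]
  have inner : (∫⋯∫⁻_Sᶜ, (fun x : L × κ → ℝ => ENNReal.ofReal (E.D Finset.univ x) * H (fun p => x (e p))) ∂(fun _ => volume))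
     = fun x => (((∏ k, (Fintype.card κ - (Finset.univ.filter fun p => (e p).1 = k).card).factorial : ℕ) : ℝ≥0∞) *
       (ENNReal.ofReal (E.Dt (fun p => (e p).1) (fun p => x (e p))) * H (fun p => x (e p)))) := by
    funext x
    have h1 : (∫⋯∫⁻_Sᶜ, (fun x : L × κ → ℝ => ENNReal.ofReal (E.D Finset.univ x) * H (fun p => x (e p))) ∂(fun _ => volume)) x
       = (∫⋯∫⁻_Sᶜ, (fun x : L × κ → ℝ => ENNReal.ofReal (E.D Finset.univ x)) ∂(fun _ => volume)) x * H (fun p => x (e p)) := by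
      unfold lmarginal
      refine Eq.trans ?_ (lintegral_mul_const _ ((E.mD _).ennreal_ofReal.comp measurable_updateFinset))
      refine lintegral_congr fun y => ?_
      simp only [Function.comp]
      congr 2
      funext p
      simp [Function.updateFinset, hS]
    rw [h1, (E.marg hpos Sᶜ).2, compl_compl, hS, E.D_eq_Dt e he, mul_assoc]
    congr 3
    funext k
    congr 2
    unfold nn
    rw [Finset.filter_image, Finset.card_image_of_injective _ he]
  rw [inner]
  have hm2 : Measurable fun z : α → ℝ => ENNReal.ofReal (E.Dt (fun p => (e p).1) z) * H z :=
    (E.mDt _).ennreal_ofReal.mul hH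
  have := lmarginal_image (μ := fun _ : L × κ => (volume : Measure ℝ)) he Finset.univ (f := fun z : α → ℝ => (((∏ k, (Fintype.card κ - (Finset.univ.filter fun p => (e p).1 = k).card).factorial : ℕ) : ℝ≥0∞) *
       (ENNReal.ofReal (E.Dt (fun p => (e p).1) z) * H z))) (hm2.const_mul _) (0 : L × κ → ℝ)
  refine this.trans ?_
  rw [lmarginal_univ]
  exact lintegral_const_mul _ hm2

lemma card_inj {α : Type*} [Fintype α] (τ : α → L)
    [Fintype {ι : α → κ // Function.Injective fun p => (τ p, ι p)}] :
    Fintype.card {ι : α → κ // Function.Injective fun p => (τ p, ι p)} =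
      ∏ k, (Fintype.card κ).descFactorial (Finset.univ.filter fun p => τ p = k).card := by
  classical
  let e : {ι : α → κ // Function.Injective fun p => (τ p, ι p)} ≃ (∀ k : L, {p // τ p = k} ↪ κ) :=
    { toFun := fun ι k => ⟨fun p => ι.1 p.1, fun p q h => Subtype.ext (ι.2 (by
        simp only [Prod.mk.injEq]; exact ⟨p.2.trans q.2.symm, h⟩))⟩
      invFun := fun g => ⟨fun p => g (τ p) ⟨p, rfl⟩, fun p q h => by
        simp only [Prod.mk.injEq] at h
        obtain ⟨h1, h2⟩ := h
        have : ∀ (k : L) (hp : τ p = k) (hq : τ q = k), g (τ p) ⟨p, rfl⟩ = g (τ q) ⟨q, rfl⟩ → p = q := by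
          intro k hp hq h
          subst hp
          have h3 : g (τ q) ⟨q, rfl⟩ = g (τ p) ⟨q, hq⟩ := by
            have : ∀ k' (hk : τ q = k'), g (τ q) ⟨q, rfl⟩ = g k' ⟨q, hk⟩ := by
              intro k' hk; subst hk; rfl
            exact this _ hq
          rw [h3] at h
          exact congrArg Subtype.val ((g (τ p)).injective h)
        exact this _ rfl h1.symm h2⟩
      left_inv := fun ι => by ext p; rfl
      right_inv := fun g => by
        funext k; ext p
        obtain ⟨p, rfl⟩ := p; rfl }
  rw [Fintype.card_congr e, Fintype.card_pi]
  refine Finset.prod_congr rfl fun k _ => ?_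
  rw [Fintype.card_embedding_eq, Fintype.card_subtype]

/-- The prelimit probability measure. -/
def ℙ : Measure (L × κ → ℝ) :=
  volume.withDensity fun x => ENNReal.ofReal (E.D Finset.univ x) / ((Fintype.card κ).factorial ^ Fintype.card L : ℕ)

open Classical in
lemma correl (hpos : ∀ x, 0 ≤ E.D Finset.univ x) {α : Type*} [Fintype α] [DecidableEq α]
    (τ : α → L) (hα : Fintype.card α ≤ Fintype.card κ) (H : (α → ℝ) → ℝ≥0∞) (hH : Measurable H) :
    ∫⁻ x, ∑ ι : {ι : α → κ // Function.Injective fun p => (τ p, ι p)}, H (fun p => x (τ p, ι.1 p)) ∂E.ℙ =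
      ∫⁻ z : α → ℝ, ENNReal.ofReal (E.Dt τ z) * H z := by
  have hmH : ∀ ι : {ι : α → κ // Function.Injective fun p => (τ p, ι p)},
      Measurable fun x : L × κ → ℝ => H (fun p => x (τ p, ι.1 p)) := fun ι =>
    hH.comp (measurable_pi_lambda _ fun _ => measurable_pi_apply _)
  set c : ℝ≥0∞ := (((Fintype.card κ).factorial ^ Fintype.card L : ℕ) : ℝ≥0∞) with hc
  have hc0 : c ≠ 0 := by
    rw [hc]; exact_mod_cast (pow_pos (Nat.factorial_pos _) _).ne'
  have hct : c ≠ ⊤ := by rw [hc]; exact ENNReal.natCast_ne_top _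
  rw [lintegral_finsetSum _ fun ι _ => hmH ι]
  have each : ∀ ι : {ι : α → κ // Function.Injective fun p => (τ p, ι p)},
      ∫⁻ x, H (fun p => x (τ p, ι.1 p)) ∂E.ℙ =
      (((∏ k, (Fintype.card κ - (Finset.univ.filter fun p => τ p = k).card).factorial : ℕ) : ℝ≥0∞) / c) *
        ∫⁻ z : α → ℝ, ENNReal.ofReal (E.Dt τ z) * H z := by
    intro ι
    unfold ℙ
    rw [lintegral_withDensity_eq_lintegral_mul _ ((E.mD _).ennreal_ofReal.div_const _) (hmH ι)]
    have : ∀ x : L × κ → ℝ, ((fun x => ENNReal.ofReal (E.D Finset.univ x) / c) * fun x : L × κ → ℝ => H (fun p => x (τ p, ι.1 p))) x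
       = c⁻¹ * (ENNReal.ofReal (E.D Finset.univ x) * H (fun p => x (τ p, ι.1 p))) := by
      intro x; simp only [Pi.mul_apply, div_eq_mul_inv]; ring
    rw [← hc]
    simp_rw [this]
    have hmm : Measurable fun x : L × κ → ℝ => ENNReal.ofReal (E.D Finset.univ x) * H (fun p => x (τ p, ι.1 p)) :=
      (E.mD _).ennreal_ofReal.mul (hmH ι)
    rw [lintegral_const_mul _ hmm, E.marg_inj hpos (fun p => (τ p, ι.1 p)) ι.2 H hH, div_eq_mul_inv]
    ring
  simp_rw [each]
  rw [Finset.sum_const, Finset.card_univ, card_inj, nsmul_eq_mul, ← mul_assoc]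
  convert one_mul _
  rw [← mul_div_assoc, ← Nat.cast_mul, ← Finset.prod_mul_distrib]
  have : ∀ k, (Fintype.card κ).descFactorial (Finset.univ.filter fun p => τ p = k).card *
      (Fintype.card κ - (Finset.univ.filter fun p => τ p = k).card).factorial = (Fintype.card κ).factorial := by
    intro k
    rw [mul_comm]
    exact Nat.factorial_mul_descFactorial ((Finset.card_le_univ _).trans hα)
  simp_rw [this]
  rw [Finset.prod_const, Finset.card_univ]
  exact ENNReal.div_self hc0 hct

lemma Dt_nonneg (hpos : ∀ x, 0 ≤ E.D Finset.univ x) {α : Type*} [Fintype α] [DecidableEq α]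
    (τ : α → L) (hα : Fintype.card α ≤ Fintype.card κ) (z : α → ℝ) : 0 ≤ E.Dt τ z := by
  classical
  obtain ⟨f⟩ := Function.Embedding.nonempty_of_card_le hα
  have he : Function.Injective fun p => (τ p, f p) := fun p q h => f.injective (by simpa using (Prod.mk.inj h).2)
  have h := (E.marg hpos (Finset.univ.image fun p => (τ p, f p))ᶜ).1
    (fun s => if h : ∃ p, (τ p, f p) = s then z h.choose else 0)
  rw [compl_compl, E.D_eq_Dt _ he] at h
  convert h with p
  have hex : ∃ q, (τ q, f q) = (τ p, f p) := ⟨p, rfl⟩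
  rw [dif_pos hex, he hex.choose_spec]

lemma isProb (hpos : ∀ x, 0 ≤ E.D Finset.univ x) : IsProbabilityMeasure E.ℙ := by
  constructor
  classical
  have h := E.correl hpos (α := Empty) (fun p => p.elim) (by simp) (fun _ => 1) measurable_const
  have hc : Fintype.card {ι : Empty → κ // Function.Injective fun p => ((p.elim : L), ι p)} = 1 := by
    rw [Fintype.card_eq_one_iff]
    exact ⟨⟨fun p => p.elim, fun p => p.elim⟩, fun y => Subtype.ext (funext fun p => p.elim)⟩
  simp only [Finset.sum_const, Finset.card_univ, hc, one_smul] at h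
  have hv : (volume : Measure (Empty → ℝ)) Set.univ = 1 := by
    rw [volume_pi, Measure.pi_univ]; simp
  simpa [Dt, hv] using h

end EMSys
end AW

namespace AW

namespace EMSys

section
variable {L κ : Type*} [LinearOrder L] [Fintype L] [Fintype κ] [DecidableEq κ] (E : EMSys L κ)

lemma not_nonpos (hneg : ∀ x, E.D Finset.univ x ≤ 0) : False := by
  have key : ∀ T : Finset (L × κ), ∀ x, E.D Tᶜ x ≤ 0 := by
    intro T
    induction T using Finset.induction_on with
    | empty => simpa using hneg
    | insert s T hs ih =>
      have hc : Tᶜ = insert s (insert s T)ᶜ := by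
        ext a; by_cases h : a = s
        · subst h; simp [hs]
        · simp [h]
      have hs' : s ∉ (insert s T)ᶜ := by simp
      set S := (insert s T)ᶜ with hS
      rw [hc] at ih
      have hlt : nn S s.1 < Fintype.card κ := by
        have h1 := nn_le (insert s S) s.1
        rw [nn_insert S s hs'] at h1; simp at h1; omega
      have hgap : (0:ℝ) < (Fintype.card κ : ℝ) - nn S s.1 := by
        have : (nn S s.1 : ℝ) < Fintype.card κ := by exact_mod_cast hlt
        linarith
      intro x
      have h := (E.D_insert S s hs' x).2
      have h0 : ∫ y, E.D (insert s S) (Function.update x s y) ≤ 0 := integral_nonpos fun y => ih _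
      rw [h] at h0
      by_contra hlt'
      push Not at hlt'
      nlinarith [mul_pos hgap hlt']
  have := key Finset.univ 0
  rw [Finset.compl_univ] at this
  simp [D] at this
  linarith

lemma D_zero_of_eq (x : L × κ → ℝ) (k : L) (i j : κ) (hij : i ≠ j) (h : x (k, i) = x (k, j)) :
    E.D Finset.univ x = 0 := by
  unfold D
  refine Matrix.det_zero_of_row_eq (i := ⟨(k, i), Finset.mem_univ _⟩) (j := ⟨(k, j), Finset.mem_univ _⟩)
    (by simpa using hij) ?_
  funext q
  simp [h]

end

section
variable {L κ : Type*} [LinearOrder L] [Fintype L] [Fintype κ] [DecidableEq κ] (E : EMSys L κ)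

/-- rows: virtual block first -/
def rowEq {m : ℕ} (e : Fin (m + 1) ≃o L) : Fin (m + 2) × κ ≃ κ ⊕ (L × κ) where
  toFun z := Fin.cases (motive := fun _ => κ ⊕ (L × κ)) (Sum.inl z.2) (fun k => Sum.inr (e k, z.2)) z.1
  invFun := Sum.elim (fun i => (0, i)) (fun y => ((e.symm y.1).succ, y.2))
  left_inv := by
    rintro ⟨k, i⟩
    refine Fin.cases ?_ (fun k => ?_) k <;> simp
  right_inv := by
    rintro (i | ⟨l, i⟩) <;> simp

/-- columns: virtual block last -/
def colEq {m : ℕ} (e : Fin (m + 1) ≃o L) : Fin (m + 2) × κ ≃ κ ⊕ (L × κ) where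
  toFun z := Fin.lastCases (motive := fun _ => κ ⊕ (L × κ)) (Sum.inl z.2) (fun k => Sum.inr (e k, z.2)) z.1
  invFun := Sum.elim (fun i => (Fin.last _, i)) (fun y => ((e.symm y.1).castSucc, y.2))
  left_inv := by
    rintro ⟨k, i⟩
    refine Fin.lastCases ?_ (fun k => ?_) k <;> simp
  right_inv := by
    rintro (i | ⟨l, i⟩) <;> simp

def bigM (x : L × κ → ℝ) : Matrix (κ ⊕ (L × κ)) (κ ⊕ (L × κ)) ℝ :=
  Matrix.fromBlocks 1 (Matrix.of fun j q => E.ψ j q.1 (x q)) (Matrix.of fun p j => E.φ j p.1 (x p))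
    (Matrix.of fun p q => if p.1 < q.1 then E.p p.1 q.1 (x p) (x q) else 0)

lemma det_bigM (x : L × κ → ℝ) : (E.bigM x).det = (-1) ^ Fintype.card (L × κ) * E.D Finset.univ x := by
  unfold bigM
  rw [Matrix.det_fromBlocks_one₁₁]
  have : E.D Finset.univ x = (Matrix.of fun p q : L × κ => E.K (p.1, x p) (q.1, x q)).det := by
    unfold D
    rw [← Matrix.det_submatrix_equiv_self (Equiv.subtypeUnivEquiv (p := fun s => s ∈ (Finset.univ : Finset (L × κ))) (fun s => Finset.mem_univ s)).symm]
    rfl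
  rw [this, ← Matrix.det_neg]
  congr 1
  ext p q
  simp [Matrix.mul_apply, K]

lemma det_chain {m : ℕ} (e : Fin (m + 1) ≃o L) : ∃ ε : ℝ, ε ≠ 0 ∧ ∀ x : L × κ → ℝ,
    ε * E.D Finset.univ x = (Matrix.of fun j i => E.ψ j (e 0) (x (e 0, i))).det *
      (∏ k : Fin m, (Matrix.of fun i j => E.p (e k.castSucc) (e k.succ) (x (e k.castSucc, i)) (x (e k.succ, j))).det) *
      (Matrix.of fun i j => E.φ j (e (Fin.last m)) (x (e (Fin.last m), i))).det := by
  set σ : Equiv.Perm (Fin (m + 2) × κ) := (colEq e).trans (rowEq e).symm with hσ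
  refine ⟨((Equiv.Perm.sign σ : ℤ) : ℝ) * (-1) ^ Fintype.card (L × κ), ?_, fun x => ?_⟩
  · refine mul_ne_zero ?_ (pow_ne_zero _ (by norm_num))
    exact_mod_cast (Units.ne_zero (Equiv.Perm.sign σ))
  rw [mul_assoc, ← det_bigM, ← Matrix.det_submatrix_equiv_self (rowEq e) (E.bigM x), ← Matrix.det_permute']
  have hB : (((E.bigM x).submatrix (rowEq e) (rowEq e)).submatrix id σ).BlockTriangular Prod.fst := by
    rintro ⟨a, i⟩ ⟨b, j⟩ hab
    simp only [Matrix.submatrix_apply, id, hσ, Equiv.trans_apply, Equiv.apply_symm_apply]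
    revert hab
    refine Fin.cases ?_ (fun k => ?_) a
    · intro h; simp at h
    · refine Fin.lastCases ?_ (fun l => ?_) b
      · intro h; exact absurd h (not_lt.mpr (Fin.le_last _))
      · intro h
        simp only at h
        have : ¬ k < l := by
          intro h'; simp only [Fin.lt_def, Fin.val_castSucc, Fin.val_succ] at h h'; omega
        simp [bigM, rowEq, colEq, this]
  rw [hB.det_fintype]
  have hblk : ∀ k : Fin (m + 2), ((((E.bigM x).submatrix (rowEq e) (rowEq e)).submatrix id σ).toSquareBlock Prod.fst k).det
      = (Matrix.of fun i j : κ => E.bigM x (rowEq e (k, i)) (colEq e (k, j))).det := by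
    intro k
    let f : κ ≃ {a : Fin (m + 2) × κ // a.1 = k} :=
      { toFun := fun i => ⟨(k, i), rfl⟩
        invFun := fun a => a.1.2
        left_inv := fun i => rfl
        right_inv := by rintro ⟨⟨a, i⟩, rfl⟩; rfl }
    rw [← Matrix.det_submatrix_equiv_self f]
    congr 1
    ext i j
    simp [f, Matrix.toSquareBlock_def, hσ]
  simp_rw [hblk]
  rw [Fin.prod_univ_succ, Fin.prod_univ_castSucc, ← mul_assoc]
  have hz : (0 : Fin (m + 2)) = Fin.castSucc 0 := rfl
  congr 1
  · congr 1
    · congr 1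
      ext i j
      have : colEq e ((0 : Fin (m + 2)), j) = Sum.inr (e 0, j) := by
        rw [hz]; simp only [colEq, Equiv.coe_fn_mk, Fin.lastCases_castSucc]
      simp [rowEq, this, bigM]
    · refine Finset.prod_congr rfl fun k _ => ?_
      congr 1
      ext i j
      have : colEq e ((k.castSucc.succ : Fin (m + 2)), j) = Sum.inr (e k.succ, j) := by
        rw [← Fin.castSucc_succ]; simp only [colEq, Equiv.coe_fn_mk, Fin.lastCases_castSucc]
      simp [rowEq, this, bigM, Fin.castSucc_lt_succ]
  · congr 1
    ext i j
    have : colEq e ((Fin.last m).succ, j) = Sum.inl j := by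
      rw [Fin.succ_last]; simp only [colEq, Equiv.coe_fn_mk, Fin.lastCases_last]
    have h2 : rowEq e ((Fin.last m).succ, i) = Sum.inr (e (Fin.last m), i) := by
      simp only [rowEq, Equiv.coe_fn_mk, Fin.cases_succ]
    simp only [Matrix.of_apply, this, h2, bigM, Matrix.fromBlocks_apply₂₁]

lemma D_nonneg (V : (κ → ℝ) → ℝ) (hV : ∀ z, V z = 0 → ∃ i j, i ≠ j ∧ z i = z j) (sψ sφ : ℝ)
    (hsψ : sψ ≠ 0) (hsφ : sφ ≠ 0)
    (hψ : ∀ t z, 0 ≤ sψ * (Matrix.of fun j i => E.ψ j t (z i)).det * V z)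
    (hφ : ∀ t z, 0 ≤ sφ * (Matrix.of fun i j => E.φ j t (z i)).det * V z)
    (hp : ∀ s t, s < t → ∀ z w, 0 ≤ (Matrix.of fun i j => E.p s t (z i) (w j)).det * (V z * V w))
    (x : L × κ → ℝ) : 0 ≤ E.D Finset.univ x := by
  rcases hm : Fintype.card L with _ | m
  · have : IsEmpty L := Fintype.card_eq_zero_iff.mp hm
    have : (Finset.univ : Finset (L × κ)) = ∅ := Finset.univ_eq_empty
    rw [this]; simp [D]
  let e : Fin (m + 1) ≃o L := Fintype.orderIsoFinOfCardEq L hm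
  obtain ⟨ε, hε, hD⟩ := E.det_chain e
  set c := sψ * sφ * ε with hc
  have hc0 : c ≠ 0 := mul_ne_zero (mul_ne_zero hsψ hsφ) hε
  have hsgn : ∀ x, 0 ≤ c * E.D Finset.univ x := by
    intro x
    by_cases hall : ∀ k : Fin (m + 1), V (fun i => x (e k, i)) ≠ 0
    · have hprod : 0 ≤ (sψ * (Matrix.of fun j i => E.ψ j (e 0) (x (e 0, i))).det * V (fun i => x (e 0, i))) *
        (∏ k : Fin m, ((Matrix.of fun i j => E.p (e k.castSucc) (e k.succ) (x (e k.castSucc, i)) (x (e k.succ, j))).det *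
          (V (fun i => x (e k.castSucc, i)) * V (fun i => x (e k.succ, i))))) *
        (sφ * (Matrix.of fun i j => E.φ j (e (Fin.last m)) (x (e (Fin.last m), i))).det * V (fun i => x (e (Fin.last m), i))) := by
        refine mul_nonneg (mul_nonneg (hψ _ _) (Finset.prod_nonneg fun k _ => ?_)) (hφ _ _)
        exact hp _ _ (e.lt_iff_lt.mpr (Fin.castSucc_lt_succ)) (fun i => x (e k.castSucc, i)) (fun j => x (e k.succ, j))
      have h1 : (∏ k : Fin (m+1), V (fun i => x (e k, i))) = (∏ k : Fin m, V (fun i => x (e k.castSucc, i))) * V (fun i => x (e (Fin.last m), i)) :=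
        Fin.prod_univ_castSucc _
      have h2 : (∏ k : Fin (m+1), V (fun i => x (e k, i))) = V (fun i => x (e 0, i)) * (∏ k : Fin m, V (fun i => x (e k.succ, i))) :=
        Fin.prod_univ_succ _
      set W := ∏ k : Fin (m+1), V (fun i => x (e k, i)) with hW
      have hW0 : W ≠ 0 := Finset.prod_ne_zero_iff.mpr fun k _ => hall k
      rw [Finset.prod_mul_distrib, Finset.prod_mul_distrib] at hprod
      have : 0 ≤ c * E.D Finset.univ x * (W * W) := by
        have h3 : c * E.D Finset.univ x = sψ * sφ * (ε * E.D Finset.univ x) := by rw [hc]; ring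
        rw [h3, hD x]
        calc (0:ℝ) ≤ _ := hprod
          _ = _ := by
            conv_rhs => rw [show W * W = (V (fun i => x (e 0, i)) * (∏ k : Fin m, V (fun i => x (e k.succ, i)))) * ((∏ k : Fin m, V (fun i => x (e k.castSucc, i))) * V (fun i => x (e (Fin.last m), i))) by rw [← h1, ← h2]]
            ring
      have hWW : 0 < W * W := mul_self_pos.mpr hW0
      exact nonneg_of_mul_nonneg_left this hWW
    · push Not at hall
      obtain ⟨k, hk⟩ := hall
      obtain ⟨i, j, hij, h⟩ := hV _ hk
      rw [E.D_zero_of_eq x (e k) i j hij h]; simp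
  rcases lt_or_gt_of_ne hc0 with h | h
  · exfalso
    refine E.not_nonpos fun x => ?_
    by_contra hx
    push Not at hx
    nlinarith [hsgn x, mul_neg_of_neg_of_pos h hx]
  · exact nonneg_of_mul_nonneg_right (hsgn x) h

end
end EMSys
end AW

namespace AW

lemma det_integral {ι : Type*} [Fintype ι] [DecidableEq ι] (μ : ι → Measure ℝ) [∀ i, SigmaFinite (μ i)]
    (f : ι → ι → ℝ → ℝ) (hf : ∀ i j, Integrable (f i j) (μ i)) :
    Integrable (fun s : ι → ℝ => (Matrix.of fun i j => f i j (s i)).det) (Measure.pi μ) ∧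
    (Matrix.of fun i j => ∫ s, f i j s ∂(μ i)).det =
      ∫ s : ι → ℝ, (Matrix.of fun i j => f i j (s i)).det ∂(Measure.pi μ) := by
  have hI : ∀ σ : Equiv.Perm ι, Integrable (fun s : ι → ℝ => ∏ i, f i (σ i) (s i)) (Measure.pi μ) := fun σ =>
    Integrable.fintype_prod_dep (f := fun i => f i (σ i)) (fun i => hf i (σ i))
  have hexp : ∀ M : Matrix ι ι ℝ, M.det = ∑ σ : Equiv.Perm ι, ((Equiv.Perm.sign σ : ℤ) : ℝ) * ∏ i, M i (σ i) := by
    intro M; rw [← Matrix.det_transpose, Matrix.det_apply']; rfl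
  simp_rw [hexp]
  simp only [Matrix.of_apply]
  refine ⟨integrable_finsetSum _ fun σ _ => (hI σ).const_mul _, ?_⟩
  rw [integral_finsetSum _ fun σ _ => (hI σ).const_mul _]
  refine Finset.sum_congr rfl fun σ _ => ?_
  rw [MeasureTheory.integral_const_mul, integral_fintype_prod_eq_prod (f := fun i => f i (σ i))]

lemma tp_sorted : ∀ n : ℕ, ∀ x y : Fin n → ℝ, Monotone x → Monotone y →
    0 ≤ (Matrix.of fun i j => Real.exp (x i * y j)).det := by
  intro n
  induction n with
  | zero => intro x y _ _; simp
  | succ n ih =>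
    intro x y hx hy
    have h1 : (Matrix.of fun i j => Real.exp (x i * y j)).det =
        (∏ i, Real.exp (x i * y 0)) * (Matrix.of fun i j => Real.exp (x i * (y j - y 0))).det := by
      rw [← Matrix.det_mul_column]
      congr 1
      ext i j
      simp only [Matrix.of_apply, ← Real.exp_add]
      congr 1; ring
    rw [h1]
    refine mul_nonneg (Finset.prod_nonneg fun i _ => (Real.exp_pos _).le) ?_
    set d : Fin (n + 1) → ℝ := fun j => y j - y 0 with hd
    have hd0 : d 0 = 0 := by simp [hd]
    let B : Matrix (Fin (n + 1)) (Fin (n + 1)) ℝ := Matrix.of fun i j =>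
      Fin.cases (motive := fun _ => ℝ) (Real.exp (x 0 * d j)) (fun i => Real.exp (x i.succ * d j) - Real.exp (x i.castSucc * d j)) i
    have h2 : (Matrix.of fun i j => Real.exp (x i * (y j - y 0))).det = B.det := by
      refine Matrix.det_eq_of_forall_row_eq_smul_add_pred (fun _ => 1) ?_ ?_
      · intro j; rfl
      · intro i j; simp [B, hd]
    rw [h2, Matrix.det_succ_column_zero, Fin.sum_univ_succ]
    have h3 : ∀ i : Fin n, B i.succ 0 = 0 := by intro i; simp [B, hd0]
    have h4 : B 0 0 = 1 := by simp [B, hd0]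
    simp only [h3, h4]
    simp only [Fin.val_zero, pow_zero, Fin.succAbove_zero, mul_zero, zero_mul,
      Finset.sum_const_zero, add_zero, one_mul]
    let μ : Fin n → Measure ℝ := fun i => volume.restrict (Set.Ioc (x i.castSucc) (x i.succ))
    have hle : ∀ i : Fin n, x i.castSucc ≤ x i.succ := fun i => hx (Fin.castSucc_lt_succ).le
    have hF : ∀ i j : Fin n, Integrable (fun s => d j.succ * Real.exp (s * d j.succ)) (μ i) := by
      intro i j
      have : Continuous fun s : ℝ => d j.succ * Real.exp (s * d j.succ) := by fun_prop
      exact (intervalIntegrable_iff_integrableOn_Ioc_of_le (hle i)).mp (this.intervalIntegrable _ _)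
    have h5 : B.submatrix Fin.succ Fin.succ = Matrix.of fun i j => ∫ s, d j.succ * Real.exp (s * d j.succ) ∂(μ i) := by
      ext i j
      simp only [Matrix.submatrix_apply, Matrix.of_apply, μ, B, Fin.cases_succ]
      rw [← intervalIntegral.integral_of_le (hle i)]
      symm
      refine intervalIntegral.integral_eq_sub_of_hasDerivAt (f := fun s => Real.exp (s * d j.succ)) (fun s _ => ?_) ?_
      · have := ((hasDerivAt_id s).mul_const (d j.succ)).exp
        refine this.congr_deriv ?_
        simp only [id]
        ring
      · exact Continuous.intervalIntegrable (by fun_prop) _ _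
    rw [h5, (det_integral μ (fun i j s => d j.succ * Real.exp (s * d j.succ)) hF).2]
    refine integral_nonneg_of_ae ?_
    have hmem : ∀ᵐ s ∂(Measure.pi μ), ∀ i, s i ∈ Set.Ioc (x i.castSucc) (x i.succ) := by
      rw [ae_all_iff]
      intro i
      have : ∀ᵐ s ∂(μ i), s ∈ Set.Ioc (x i.castSucc) (x i.succ) := ae_restrict_mem measurableSet_Ioc
      exact (Measure.quasiMeasurePreserving_eval (μ := μ) i).ae this
    filter_upwards [hmem] with s hs
    have : (Matrix.of fun i j : Fin n => d j.succ * Real.exp (s i * d j.succ)).det =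
        (∏ j : Fin n, d j.succ) * (Matrix.of fun i j : Fin n => Real.exp (s i * d j.succ)).det := by
      rw [← Matrix.det_mul_row]
      rfl
    simp only [Pi.zero_apply]
    rw [this]
    refine mul_nonneg (Finset.prod_nonneg fun j _ => sub_nonneg.mpr (hy (Fin.zero_le _))) (ih s (fun j => d j.succ) ?_ ?_)
    · intro i j hij
      rcases eq_or_lt_of_le hij with h | h
      · rw [h]
      · refine (hs i).2.trans ((hx ?_).trans (hs j).1.le)
        rw [Fin.le_def]; simp only [Fin.val_succ, Fin.val_castSucc]; exact h
    · intro i j hij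
      simp only [hd]
      exact sub_le_sub_right (hy (Fin.succ_le_succ_iff.mpr hij)) _

def V {n : ℕ} (z : Fin n → ℝ) : ℝ := (Matrix.vandermonde z).det

lemma V_perm {n : ℕ} (z : Fin n → ℝ) (σ : Equiv.Perm (Fin n)) : V (z ∘ σ) = ((Equiv.Perm.sign σ : ℤ) : ℝ) * V z := by
  unfold V
  rw [← Matrix.det_permute]; rfl

lemma V_nonneg {n : ℕ} (z : Fin n → ℝ) (hz : Monotone z) : 0 ≤ V z := by
  unfold V
  rw [Matrix.det_vandermonde]
  exact Finset.prod_nonneg fun i _ => Finset.prod_nonneg fun j hj => sub_nonneg.mpr (hz (Finset.mem_Ioi.mp hj).le)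

lemma V_add {n : ℕ} (z : Fin n → ℝ) (a : ℝ) : V (fun i => z i + a) = V z := Matrix.det_vandermonde_add z a

lemma V_zero {n : ℕ} (z : Fin n → ℝ) (h : V z = 0) : ∃ i j, i ≠ j ∧ z i = z j := by
  obtain ⟨i, j, h1, h2⟩ := Matrix.det_vandermonde_eq_zero_iff.mp h
  exact ⟨i, j, h2, h1⟩

lemma V_ne {n : ℕ} (z : Fin n → ℝ) (h : Function.Injective z) : V z ≠ 0 :=
  Matrix.det_vandermonde_ne_zero_iff.mpr h

lemma V_smul {n : ℕ} (z : Fin n → ℝ) (c : ℝ) (hc : 0 < c) : ∃ C : ℝ, 0 < C ∧ V (fun i => c * z i) = C * V z := by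
  refine ⟨∏ i : Fin n, ∏ j ∈ Finset.Ioi i, c, Finset.prod_pos fun i _ => Finset.prod_pos fun j _ => hc, ?_⟩
  unfold V
  rw [Matrix.det_vandermonde, Matrix.det_vandermonde, ← Finset.prod_mul_distrib]
  refine Finset.prod_congr rfl fun i _ => ?_
  rw [← Finset.prod_mul_distrib]
  refine Finset.prod_congr rfl fun j _ => by ring

lemma tp_exp {n : ℕ} (x y : Fin n → ℝ) : 0 ≤ (Matrix.of fun i j => Real.exp (x i * y j)).det * (V x * V y) := by
  set σ := Tuple.sort x
  set τ := Tuple.sort y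
  have hσ : Monotone (x ∘ σ) := Tuple.monotone_sort x
  have hτ : Monotone (y ∘ τ) := Tuple.monotone_sort y
  have h := mul_nonneg (tp_sorted n _ _ hσ hτ) (mul_nonneg (V_nonneg _ hσ) (V_nonneg _ hτ))
  have hdet : (Matrix.of fun i j => Real.exp ((x ∘ σ) i * (y ∘ τ) j)).det =
      ((Equiv.Perm.sign σ : ℤ) : ℝ) * (((Equiv.Perm.sign τ : ℤ) : ℝ) * (Matrix.of fun i j => Real.exp (x i * y j)).det) := by
    rw [← Matrix.det_permute', ← Matrix.det_permute]; rfl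
  rw [hdet, V_perm, V_perm] at h
  have s1 : ((Equiv.Perm.sign σ : ℤ) : ℝ) * ((Equiv.Perm.sign σ : ℤ) : ℝ) = 1 := by
    exact_mod_cast Int.units_coe_mul_self _
  have s2 : ((Equiv.Perm.sign τ : ℤ) : ℝ) * ((Equiv.Perm.sign τ : ℤ) : ℝ) = 1 := by
    exact_mod_cast Int.units_coe_mul_self _
  calc (0:ℝ) ≤ _ := h
    _ = (((Equiv.Perm.sign σ : ℤ) : ℝ) * ((Equiv.Perm.sign σ : ℤ) : ℝ)) * (((Equiv.Perm.sign τ : ℤ) : ℝ) * ((Equiv.Perm.sign τ : ℤ) : ℝ)) *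
        ((Matrix.of fun i j => Real.exp (x i * y j)).det * (V x * V y)) := by ring
    _ = _ := by rw [s1, s2]; ring

/-- the Gaussian transition density with variance `2τ` -/
def gp (τ y : ℝ) : ℝ := (Real.sqrt (4 * Real.pi * τ))⁻¹ * Real.exp (-y ^ 2 / (4 * τ))

lemma tp_gp {n : ℕ} (τ : ℝ) (hτ : 0 < τ) (x y : Fin n → ℝ) :
    0 ≤ (Matrix.of fun i j => gp τ (x i - y j)).det * (V x * V y) := by
  set g : ℝ → ℝ := fun u => Real.exp (-u ^ 2 / (4 * τ)) with hg
  have h1 : (Matrix.of fun i j => gp τ (x i - y j)).det =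
      (∏ i, ((Real.sqrt (4 * Real.pi * τ))⁻¹ * g (x i))) * ((∏ j, g (y j)) * (Matrix.of fun i j => Real.exp (((2 * τ)⁻¹ * x i) * y j)).det) := by
    rw [← Matrix.det_mul_row, ← Matrix.det_mul_column]
    congr 1
    ext i j
    simp only [Matrix.of_apply, gp, hg]
    have : Real.exp (-(x i - y j) ^ 2 / (4 * τ)) = Real.exp (-(x i) ^ 2 / (4 * τ)) * (Real.exp (-(y j) ^ 2 / (4 * τ)) * Real.exp ((2 * τ)⁻¹ * x i * y j)) := by
      rw [← Real.exp_add, ← Real.exp_add]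
      congr 1
      field_simp
      ring
    rw [this]
    ring
  obtain ⟨C, hC, hV⟩ := V_smul x (2 * τ)⁻¹ (by positivity)
  have h := tp_exp (fun i => (2 * τ)⁻¹ * x i) y
  rw [hV] at h
  rw [h1]
  have hh : 0 ≤ (Matrix.of fun i j => Real.exp (((2 * τ)⁻¹ * x i) * y j)).det * (V x * V y) := by
    have : 0 ≤ C * ((Matrix.of fun i j => Real.exp (((2 * τ)⁻¹ * x i) * y j)).det * (V x * V y)) := by
      calc (0:ℝ) ≤ _ := h
        _ = _ := by ring
    exact nonneg_of_mul_nonneg_right this hC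
  have p1 : 0 ≤ (∏ i, ((Real.sqrt (4 * Real.pi * τ))⁻¹ * g (x i))) := Finset.prod_nonneg fun i _ => by positivity
  have p2 : 0 ≤ (∏ j, g (y j)) := Finset.prod_nonneg fun i _ => by positivity
  calc (0:ℝ) ≤ _ := mul_nonneg (mul_nonneg p1 p2) hh
    _ = _ := by ring

/-- Andréief-type sign lemma -/
lemma tp_andreief {n : ℕ} (μ : Measure ℝ) [SigmaFinite μ] (g : ℝ → ℝ → ℝ) (h : Fin n → ℝ → ℝ) (c : ℝ)
    (hiv : ∀ x j, Integrable (fun y => g x y * h j y) μ)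
    (hg : ∀ x y : Fin n → ℝ, 0 ≤ (Matrix.of fun i j => g (x i) (y j)).det * (V x * V y))
    (hh : ∀ y : Fin n → ℝ, 0 ≤ (Matrix.of fun i j => h j (y i)).det * (V y * c)) (x : Fin n → ℝ) :
    0 ≤ (Matrix.of fun i j => ∫ y, g (x i) y * h j y ∂μ).det * (V x * c) := by
  obtain ⟨hI, hD⟩ := det_integral (fun _ : Fin n => μ) (fun i j y => g (x i) y * h j y) (fun i j => hiv _ _)
  rw [hD]
  have e1 : ∀ y : Fin n → ℝ, (Matrix.of fun i j => g (x i) (y i) * h j (y i)).det =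
      (∏ i, g (x i) (y i)) * (Matrix.of fun i j => h j (y i)).det := by
    intro y; rw [← Matrix.det_mul_column]; rfl
  simp_rw [e1] at hI ⊢
  set F : (Fin n → ℝ) → ℝ := fun y => (∏ i, g (x i) (y i)) * (Matrix.of fun i j => h j (y i)).det with hF
  have mp : ∀ σ : Equiv.Perm (Fin n), MeasurePreserving (fun y : Fin n → ℝ => y ∘ σ) (Measure.pi fun _ => μ) (Measure.pi fun _ => μ) := by
    intro σ
    have := measurePreserving_piCongrLeft (α := fun _ : Fin n => ℝ) (fun _ => μ) σ.symm
    convert this using 1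
    funext y i
    simp [MeasurableEquiv.piCongrLeft, Equiv.piCongrLeft, Equiv.piCongrLeft']
  have emb : ∀ σ : Equiv.Perm (Fin n), MeasurableEmbedding (fun y : Fin n → ℝ => y ∘ σ) := by
    intro σ
    have := (MeasurableEquiv.piCongrLeft (fun _ : Fin n => ℝ) σ.symm).measurableEmbedding
    convert this using 1
    funext y i
    simp [MeasurableEquiv.piCongrLeft, Equiv.piCongrLeft, Equiv.piCongrLeft']
  have e2 : ∀ σ : Equiv.Perm (Fin n), ∫ y, F y ∂(Measure.pi fun _ => μ) = ∫ y, F (y ∘ σ) ∂(Measure.pi fun _ => μ) := fun σ =>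
    ((mp σ).integral_comp (emb σ) F).symm
  have I2 : ∀ σ : Equiv.Perm (Fin n), Integrable (fun y => F (y ∘ σ)) (Measure.pi fun _ => μ) := fun σ =>
    ((mp σ).integrable_comp_emb (emb σ)).mpr hI
  have e3 : ∀ y, ∑ σ : Equiv.Perm (Fin n), F (y ∘ σ) = (Matrix.of fun i j => g (x i) (y j)).det * (Matrix.of fun i j => h j (y i)).det := by
    intro y
    have hd : (Matrix.of fun i j => g (x i) (y j)).det = ∑ σ : Equiv.Perm (Fin n), ((Equiv.Perm.sign σ : ℤ) : ℝ) * ∏ i, g (x i) (y (σ i)) := by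
      rw [← Matrix.det_transpose, Matrix.det_apply']; rfl
    rw [hd, Finset.sum_mul]
    refine Finset.sum_congr rfl fun σ _ => ?_
    have : (Matrix.of fun i j => h j ((y ∘ σ) i)).det = ((Equiv.Perm.sign σ : ℤ) : ℝ) * (Matrix.of fun i j => h j (y i)).det := by
      rw [← Matrix.det_permute]; rfl
    simp only [hF]
    rw [this]
    simp only [Function.comp]
    ring
  have e4 : (Fintype.card (Equiv.Perm (Fin n)) : ℝ) * ∫ y, F y ∂(Measure.pi fun _ => μ) =
      ∫ y, (Matrix.of fun i j => g (x i) (y j)).det * (Matrix.of fun i j => h j (y i)).det ∂(Measure.pi fun _ => μ) := by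
    simp_rw [← e3]
    rw [integral_finsetSum _ fun σ _ => I2 σ]
    simp_rw [← e2]
    simp
  have pos : (0:ℝ) < Fintype.card (Equiv.Perm (Fin n)) := by exact_mod_cast Fintype.card_pos
  have e5 : 0 ≤ (Fintype.card (Equiv.Perm (Fin n)) : ℝ) * ((∫ y, F y ∂(Measure.pi fun _ => μ)) * (V x * c)) := by
    rw [← mul_assoc, e4, ← MeasureTheory.integral_mul_const]
    refine integral_nonneg fun y => ?_
    simp only [Pi.zero_apply]
    by_cases hy : V y = 0
    · obtain ⟨i, j, hij, hyy⟩ := V_zero y hy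
      have : (Matrix.of fun i j => h j (y i)).det = 0 :=
        Matrix.det_zero_of_row_eq hij (by funext k; simp [hyy])
      rw [this]; simp
    · have := mul_nonneg (hg x y) (hh y)
      have h2 : 0 < V y * V y := mul_self_pos.mpr hy
      refine nonneg_of_mul_nonneg_left (b := V y * V y) ?_ h2
      calc (0:ℝ) ≤ _ := this
        _ = _ := by ring
  exact nonneg_of_mul_nonneg_right e5 pos

lemma fub (μ : Measure ℝ) [SigmaFinite μ] (h w H : ℝ → ℝ) (g : ℝ → ℝ → ℝ) (hh : Measurable h) (hw : Measurable w)
    (hg : Measurable fun z : ℝ × ℝ => g z.1 z.2) (h0 : ∀ y, 0 ≤ h y) (w0 : ∀ y, 0 ≤ w y) (g0 : ∀ x y, 0 ≤ g x y)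
    (hi : ∀ η, Integrable fun y => h y * g y η) (hH : ∀ η, ∫ y, h y * g y η = H η)
    (hHw : Integrable (fun η => H η * w η) μ) :
    Integrable (fun y => h y * ∫ η, g y η * w η ∂μ) ∧ ∫ y, h y * ∫ η, g y η * w η ∂μ = ∫ η, H η * w η ∂μ := by
  have mF : Measurable fun z : ℝ × ℝ => h z.1 * (g z.1 z.2 * w z.2) := by fun_prop
  have hF : Integrable (fun z : ℝ × ℝ => h z.1 * (g z.1 z.2 * w z.2)) (volume.prod μ) := by
    rw [integrable_prod_iff' mF.aestronglyMeasurable]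
    constructor
    · refine Filter.Eventually.of_forall fun η => ?_
      have := (hi η).mul_const (w η)
      refine this.congr (Filter.Eventually.of_forall fun y => ?_)
      simp only; ring
    · refine hHw.congr (Filter.Eventually.of_forall fun η => ?_)
      simp only
      rw [← hH η, ← MeasureTheory.integral_mul_const]
      refine integral_congr_ae (Filter.Eventually.of_forall fun y => ?_)
      simp only
      rw [Real.norm_of_nonneg (mul_nonneg (h0 _) (mul_nonneg (g0 _ _) (w0 _)))]; ring
  have e : (fun y => h y * ∫ η, g y η * w η ∂μ) = fun y => ∫ η, h y * (g y η * w η) ∂μ := by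
    funext y; rw [MeasureTheory.integral_const_mul]
  rw [e]
  refine ⟨hF.integral_prod_left, ?_⟩
  rw [integral_integral_swap hF]
  refine integral_congr_ae (Filter.Eventually.of_forall fun η => ?_)
  simp only
  rw [← hH η, ← MeasureTheory.integral_mul_const]
  refine integral_congr_ae (Filter.Eventually.of_forall fun y => ?_)
  simp only; ring

lemma gauss_quad (a b c : ℝ) (ha : 0 < a) : Integrable (fun y : ℝ => Real.exp (-a * y ^ 2 + b * y + c)) ∧
    ∫ y : ℝ, Real.exp (-a * y ^ 2 + b * y + c) = Real.sqrt (Real.pi / a) * Real.exp (b ^ 2 / (4 * a) + c) := by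
  have e : (fun y : ℝ => Real.exp (-a * y ^ 2 + b * y + c)) =
      fun y : ℝ => (fun u : ℝ => Real.exp (-a * u ^ 2)) (y - b / (2 * a)) * Real.exp (b ^ 2 / (4 * a) + c) := by
    funext y
    simp only
    rw [← Real.exp_add]
    congr 1
    field_simp
    ring
  rw [e]
  refine ⟨((integrable_exp_neg_mul_sq ha).comp_sub_right _).mul_const _, ?_⟩
  rw [MeasureTheory.integral_mul_const, integral_sub_right_eq_self (fun u : ℝ => Real.exp (-a * u ^ 2)), integral_gaussian]

lemma gp_nonneg (τ y : ℝ) : 0 ≤ gp τ y := by unfold gp; positivity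

lemma gp_meas (τ : ℝ) : Measurable (gp τ) := by unfold gp; fun_prop

lemma gp_neg (τ y : ℝ) : gp τ (-y) = gp τ y := by unfold gp; simp

lemma gp_exp (s x β : ℝ) (hs : 0 < s) : Integrable (fun y => gp s (x - y) * Real.exp (β * y)) ∧
    ∫ y, gp s (x - y) * Real.exp (β * y) = Real.exp (β * x + s * β ^ 2) := by
  have e : (fun y => gp s (x - y) * Real.exp (β * y)) = fun y =>
      (Real.sqrt (4 * Real.pi * s))⁻¹ * Real.exp (-(1 / (4 * s)) * y ^ 2 + (x / (2 * s) + β) * y + (-x ^ 2 / (4 * s))) := by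
    funext y
    unfold gp
    rw [mul_assoc, ← Real.exp_add]
    congr 2
    field_simp
    ring
  rw [e]
  obtain ⟨h1, h2⟩ := gauss_quad (1 / (4 * s)) (x / (2 * s) + β) (-x ^ 2 / (4 * s)) (by positivity)
  refine ⟨h1.const_mul _, ?_⟩
  rw [MeasureTheory.integral_const_mul, h2]
  have : Real.pi / (1 / (4 * s)) = 4 * Real.pi * s := by field_simp
  rw [this, ← mul_assoc, inv_mul_cancel₀ (by positivity), one_mul]
  congr 1
  field_simp
  ring

lemma gp_conv (s t x z : ℝ) (hs : 0 < s) (ht : 0 < t) : Integrable (fun y => gp s (x - y) * gp t (y - z)) ∧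
    ∫ y, gp s (x - y) * gp t (y - z) = gp (s + t) (x - z) := by
  have e : (fun y => gp s (x - y) * gp t (y - z)) = fun y =>
      ((Real.sqrt (4 * Real.pi * s))⁻¹ * (Real.sqrt (4 * Real.pi * t))⁻¹) * Real.exp (-(1 / (4 * s) + 1 / (4 * t)) * y ^ 2 + (x / (2 * s) + z / (2 * t)) * y + (-x ^ 2 / (4 * s) - z ^ 2 / (4 * t))) := by
    funext y
    unfold gp
    have : Real.exp (-(1 / (4 * s) + 1 / (4 * t)) * y ^ 2 + (x / (2 * s) + z / (2 * t)) * y + (-x ^ 2 / (4 * s) - z ^ 2 / (4 * t))) = Real.exp (-(x - y) ^ 2 / (4 * s)) * Real.exp (-(y - z) ^ 2 / (4 * t)) := by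
      rw [← Real.exp_add]
      congr 1
      field_simp
      ring
    rw [this]; ring
  rw [e]
  obtain ⟨h1, h2⟩ := gauss_quad (1 / (4 * s) + 1 / (4 * t)) (x / (2 * s) + z / (2 * t)) (-x ^ 2 / (4 * s) - z ^ 2 / (4 * t)) (by positivity)
  refine ⟨h1.const_mul _, ?_⟩
  rw [MeasureTheory.integral_const_mul, h2, ← mul_assoc]
  unfold gp
  congr 1
  · rw [← Real.sqrt_inv, ← Real.sqrt_inv, ← Real.sqrt_inv, ← Real.sqrt_mul (by positivity), ← Real.sqrt_mul (by positivity)]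
    congr 1
    have := Real.pi_pos
    field_simp
    ring
  · congr 1
    field_simp
    ring

/-- `E_α(s,x)` -/
def Eal (α s x : ℝ) : ℝ := ∫ y in Set.Ioi (0:ℝ), gp s (x - y) * Real.exp (-α * y)

lemma Eal_meas (α s : ℝ) : Measurable (Eal α s) := by
  have : Measurable fun z : ℝ × ℝ => gp s (z.1 - z.2) * Real.exp (-α * z.2) := by
    have := gp_meas s
    fun_prop
  exact (this.stronglyMeasurable.integral_prod_right (ν := volume.restrict (Set.Ioi 0))).measurable

lemma Eal_int (α s x : ℝ) (hs : 0 < s) : IntegrableOn (fun y => gp s (x - y) * Real.exp (-α * y)) (Set.Ioi 0) :=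
  (gp_exp s x (-α) hs).1.integrableOn

lemma Eal_psi (α β s : ℝ) (hs : 0 < s) (h : β < α) :
    Integrable (fun y => Real.exp (β * y - s * β ^ 2) * Eal α s y) ∧
    ∫ y, Real.exp (β * y - s * β ^ 2) * Eal α s y = 1 / (α - β) := by
  have hmg := gp_meas s
  have hI := integrableOn_exp_mul_Ioi (show β - α < 0 by linarith) 0
  have key : ∀ η, Integrable (fun y => Real.exp (β * y - s * β ^ 2) * gp s (y - η)) ∧
      ∫ y, Real.exp (β * y - s * β ^ 2) * gp s (y - η) = Real.exp (β * η) := by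
    intro η
    obtain ⟨h1, h2⟩ := gp_exp s η β hs
    have e : (fun y => Real.exp (β * y - s * β ^ 2) * gp s (y - η)) = fun y => Real.exp (- s * β ^ 2) * (gp s (η - y) * Real.exp (β * y)) := by
      funext y
      rw [← gp_neg, neg_sub, sub_eq_add_neg, Real.exp_add]; ring_nf
    rw [e]
    refine ⟨h1.const_mul _, ?_⟩
    rw [MeasureTheory.integral_const_mul, h2, ← Real.exp_add]
    congr 1; ring
  have hHw : (fun η => Real.exp (β * η) * Real.exp (-α * η)) = fun η => Real.exp ((β - α) * η) := by
    funext η; rw [← Real.exp_add]; congr 1; ring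
  have := fub (volume.restrict (Set.Ioi (0:ℝ))) (fun y => Real.exp (β * y - s * β ^ 2)) (fun η => Real.exp (-α * η))
    (fun η => Real.exp (β * η)) (fun y η => gp s (y - η)) (by fun_prop) (by fun_prop) (by fun_prop)
    (fun _ => (Real.exp_pos _).le) (fun _ => (Real.exp_pos _).le) (fun _ _ => gp_nonneg _ _)
    (fun η => (key η).1) (fun η => (key η).2) (by rw [hHw]; exact hI)
  refine ⟨this.1, this.2.trans ?_⟩
  rw [hHw, integral_exp_mul_Ioi (by linarith)]
  have : β - α ≠ 0 := by linarith
  have : α - β ≠ 0 := by linarith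
  simp
  field_simp
  ring

lemma Eal_conv (α s τ x : ℝ) (hs : 0 < s) (hτ : 0 < τ) :
    Integrable (fun y => gp τ (x - y) * Eal α s y) ∧ ∫ y, gp τ (x - y) * Eal α s y = Eal α (τ + s) x := by
  have hmg := gp_meas s
  have hmg' := gp_meas τ
  have := fub (volume.restrict (Set.Ioi (0:ℝ))) (fun y => gp τ (x - y)) (fun η => Real.exp (-α * η))
    (fun η => gp (τ + s) (x - η)) (fun y η => gp s (y - η)) (by fun_prop) (by fun_prop) (by fun_prop)
    (fun _ => gp_nonneg _ _) (fun _ => (Real.exp_pos _).le) (fun _ _ => gp_nonneg _ _)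
    (fun η => (gp_conv τ s x η hτ hs).1) (fun η => (gp_conv τ s x η hτ hs).2) (Eal_int _ _ _ (by positivity))
  exact this

lemma psi_conv (β s τ z : ℝ) (hτ : 0 < τ) :
    Integrable (fun y => Real.exp (β * y - (τ + s) * β ^ 2) * gp τ (y - z)) ∧
    ∫ y, Real.exp (β * y - (τ + s) * β ^ 2) * gp τ (y - z) = Real.exp (β * z - s * β ^ 2) := by
  obtain ⟨h1, h2⟩ := gp_exp τ z β hτ
  have e : (fun y => Real.exp (β * y - (τ + s) * β ^ 2) * gp τ (y - z)) = fun y => Real.exp (- (τ + s) * β ^ 2) * (gp τ (z - y) * Real.exp (β * y)) := by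
    funext y
    rw [← gp_neg, neg_sub, sub_eq_add_neg, Real.exp_add]; ring_nf
  rw [e]
  refine ⟨h1.const_mul _, ?_⟩
  rw [MeasureTheory.integral_const_mul, h2, ← Real.exp_add]
  congr 1; ring

/-- partial fractions -/
lemma pf {𝕜 ι : Type*} [Field 𝕜] [Fintype ι] [DecidableEq ι] (α : ι → 𝕜) (hα : Function.Injective α)
    (P : Polynomial 𝕜) (hP : P.degree < Fintype.card ι) (v : 𝕜) (hv : ∀ i, v ≠ α i) :
    P.eval v / ∏ i, (v - α i) = ∑ k, P.eval (α k) / (∏ i ∈ Finset.univ.erase k, (α k - α i)) / (v - α k) := by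
  have h1 : P = Lagrange.interpolate Finset.univ α (fun i => P.eval (α i)) :=
    Lagrange.eq_interpolate (hα.injOn) (by simpa using hP)
  have h2 := Lagrange.eval_interpolate_not_at_node (s := Finset.univ) (v := α) (fun i => P.eval (α i)) (x := v) (fun i _ => hv i)
  rw [← h1, Lagrange.eval_nodal] at h2
  have h3 : ∏ i, (v - α i) ≠ 0 := Finset.prod_ne_zero_iff.mpr fun i _ => sub_ne_zero.mpr (hv i)
  rw [h2, mul_div_cancel_left₀ _ h3]
  refine Finset.sum_congr rfl fun k _ => ?_
  rw [Lagrange.nodalWeight, Finset.prod_inv_distrib]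
  ring

variable {N : ℕ}

def cco (α β : Fin N → ℝ) (j : Fin N) : ℝ := (∏ i, (α i - β j)) / ∏ k ∈ Finset.univ.erase j, (β j - β k)

def Cco (α β : Fin N → ℝ) (j k : Fin N) : ℝ :=
  cco α β j * (∏ i ∈ Finset.univ.erase j, (α k - β i)) / ∏ i ∈ Finset.univ.erase k, (α i - α k)

lemma prod_neg_one_sub {𝕜 ι : Type*} [Field 𝕜] (s : Finset ι) (a : ι → 𝕜) (v : 𝕜) :
    ∏ i ∈ s, (a i - v) = (-1) ^ s.card * ∏ i ∈ s, (v - a i) := by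
  rw [← Finset.prod_const, ← Finset.prod_mul_distrib]
  exact Finset.prod_congr rfl fun i _ => by ring

lemma rho_eq (α β : Fin N → ℝ) (hα : Function.Injective α) (j : Fin N) (v : ℂ) (hv : ∀ i, v ≠ α i) :
    ∑ k, (Cco α β j k : ℂ) / ((α k : ℂ) - v) =
      (cco α β j : ℂ) * (∏ i ∈ Finset.univ.erase j, (v - (β i : ℂ))) / ∏ i, ((α i : ℂ) - v) := by
  have hα' : Function.Injective (fun i => (α i : ℂ)) := fun i j h => hα (by simpa using h)
  have h := pf (fun i => (α i : ℂ)) hα' (∏ i ∈ Finset.univ.erase j, (Polynomial.X - Polynomial.C (β i : ℂ))) (by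
    rw [Polynomial.degree_prod]
    simp only [Polynomial.degree_X_sub_C, Finset.sum_const, Finset.card_erase_of_mem (Finset.mem_univ j), Finset.card_univ, Fintype.card_fin]
    have hN : 0 < N := Fin.pos j
    rw [nsmul_eq_mul, mul_one]
    exact_mod_cast Nat.sub_lt hN one_pos) v hv
  simp only [Polynomial.eval_prod, Polynomial.eval_sub, Polynomial.eval_X, Polynomial.eval_C] at h
  rw [prod_neg_one_sub Finset.univ (fun i => (α i : ℂ)) v]
  have : ∀ k, (Cco α β j k : ℂ) / ((α k : ℂ) - v) = (cco α β j : ℂ) * ((-1) ^ N)⁻¹ * ((∏ i ∈ Finset.univ.erase j, ((α k : ℂ) - (β i : ℂ))) / (∏ i ∈ Finset.univ.erase k, ((α k : ℂ) - α i)) / (v - α k)) := by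
    intro k
    have h5 : (∏ i ∈ Finset.univ.erase k, (α i - α k : ℂ)) = (-1) ^ (N - 1) * ∏ i ∈ Finset.univ.erase k, ((α k : ℂ) - α i) := by
      rw [prod_neg_one_sub, Finset.card_erase_of_mem (Finset.mem_univ k), Finset.card_univ, Fintype.card_fin]
    have h6 : ((-1 : ℂ)) ^ N = - (-1) ^ (N - 1) := by
      obtain ⟨M, rfl⟩ : ∃ M, N = M + 1 := ⟨N - 1, (Nat.succ_pred_eq_of_pos (Fin.pos k)).symm⟩
      simp [pow_succ]
    rw [Cco]
    push_cast
    rw [h5, h6, show ((α k : ℂ) - v) = -(v - α k) by ring]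
    have h7 : (v - α k : ℂ) ≠ 0 := sub_ne_zero.mpr (hv k)
    have h8 : ((-1 : ℂ)) ^ (N - 1) ≠ 0 := by simp
    have h9 : ∏ i ∈ Finset.univ.erase k, ((α k : ℂ) - α i) ≠ 0 :=
      Finset.prod_ne_zero_iff.mpr fun i hi => sub_ne_zero.mpr fun h => (Finset.ne_of_mem_erase hi) (hα' h).symm
    field_simp
  simp_rw [this]
  rw [← Finset.mul_sum, ← h, Finset.card_univ, Fintype.card_fin]
  ring

lemma Cco_beta (α β : Fin N → ℝ) (hα : Function.Injective α) (hβ : Function.Injective β) (hab : ∀ i j, β j < α i) (i j : Fin N) :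
    ∑ k, Cco α β j k * (1 / (α k - β i)) = if i = j then 1 else 0 := by
  have h := rho_eq α β hα j (β i : ℂ) (fun k h => (hab k i).ne (by simpa using h))
  have h2 : ((∑ k, Cco α β j k * (1 / (α k - β i)) : ℝ) : ℂ) = ((if i = j then 1 else 0 : ℝ) : ℂ) := by
    push_cast
    simp only [mul_one_div]
    rw [h]
    split_ifs with hij
    · subst hij
      rw [cco]
      push_cast
      have h9 : ∏ k ∈ Finset.univ.erase i, ((β i : ℂ) - β k) ≠ 0 :=
        Finset.prod_ne_zero_iff.mpr fun k hk => sub_ne_zero.mpr fun h => (Finset.ne_of_mem_erase hk) (hβ (by simpa using h)).symm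
      have h10 : ∏ k, ((α k : ℂ) - β i) ≠ 0 :=
        Finset.prod_ne_zero_iff.mpr fun k hk => sub_ne_zero.mpr fun h => (hab k i).ne' (by simpa using h)
      field_simp
    · have : ∏ k ∈ Finset.univ.erase j, ((β i : ℂ) - β k) = 0 :=
        Finset.prod_eq_zero (i := i) (by simp [hij]) (by simp)
      rw [this]; simp
  exact_mod_cast h2

/-- the resolvent identity -/
lemma resolvent (α β : Fin N → ℝ) (hα : Function.Injective α) (hβ : Function.Injective β)
    (v u : ℂ) (hv : ∀ i, v ≠ α i) (hvb : ∀ i, v ≠ β i) (hu : ∀ i, u ≠ β i) (hua : ∀ i, u ≠ α i) (huv : u ≠ v) :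
    ∑ j, (∑ k, (Cco α β j k : ℂ) / ((α k : ℂ) - v)) * (1 / (u - β j)) =
      ((∏ i, (v - β i)) / (∏ i, (α i - v)) / ((∏ i, (u - β i)) / (∏ i, (α i - u))) - 1) / (v - u) := by
  have hβ' : Function.Injective (fun i => (β i : ℂ)) := fun i j h => hβ (by simpa using h)
  let nd : Option (Fin N) → ℂ := fun o => o.elim v (fun i => (β i : ℂ))
  have hnd : Function.Injective nd := by
    intro a b h
    rcases a with _ | a <;> rcases b with _ | b
    · rfl
    · exact absurd h (hvb b)
    · exact absurd h.symm (hvb a)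
    · exact congrArg some (hβ' h)
  have h := pf nd hnd (∏ i, (Polynomial.C (α i : ℂ) - Polynomial.X)) (by
    rw [Polynomial.degree_prod]
    have : ∀ i, (Polynomial.C (α i : ℂ) - Polynomial.X).degree = 1 := fun i => by
      rw [← neg_sub, Polynomial.degree_neg, Polynomial.degree_X_sub_C]
    simp only [this, Finset.sum_const, Finset.card_univ, Fintype.card_fin, Fintype.card_option]
    rw [nsmul_eq_mul, mul_one]
    exact_mod_cast Nat.lt_succ_self N) u (by
    intro o; rcases o with _ | i
    · exact huv
    · exact hu i)
  simp only [Polynomial.eval_prod, Polynomial.eval_sub, Polynomial.eval_X, Polynomial.eval_C, Fintype.sum_option, Fintype.prod_option] at h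
  have e0 : Finset.univ.erase (none : Option (Fin N)) = Finset.univ.map Function.Embedding.some := by
    ext o; rcases o with _ | o <;> simp
  have e1 : ∀ j, ∏ o ∈ Finset.univ.erase (some j : Option (Fin N)), (nd (some j) - nd o) = (β j - v) * ∏ k ∈ Finset.univ.erase j, ((β j : ℂ) - β k) := by
    intro j
    have : Finset.univ.erase (some j : Option (Fin N)) = insert none ((Finset.univ.erase j).map Function.Embedding.some) := by
      ext o; rcases o with _ | o <;> simp
    rw [this, Finset.prod_insert (by simp), Finset.prod_map]
    rfl
  rw [e0, Finset.prod_map] at h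
  simp only [e1] at h
  simp only [nd, Option.elim, Function.Embedding.some_apply] at h
  have hA : ∏ i, ((α i : ℂ) - v) ≠ 0 := Finset.prod_ne_zero_iff.mpr fun i _ => sub_ne_zero.mpr (hv i).symm
  have hAu : ∏ i, ((α i : ℂ) - u) ≠ 0 := Finset.prod_ne_zero_iff.mpr fun i _ => sub_ne_zero.mpr (hua i).symm
  have hB : ∏ i, (v - (β i : ℂ)) ≠ 0 := Finset.prod_ne_zero_iff.mpr fun i _ => sub_ne_zero.mpr (hvb i)
  have hBu : ∏ i, (u - (β i : ℂ)) ≠ 0 := Finset.prod_ne_zero_iff.mpr fun i _ => sub_ne_zero.mpr (hu i)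
  have huv' : u - v ≠ 0 := sub_ne_zero.mpr huv
  have huv'' : v - u ≠ 0 := sub_ne_zero.mpr huv.symm
  have e2 : ∑ j, (∑ k, (Cco α β j k : ℂ) / ((α k : ℂ) - v)) * (1 / (u - β j)) =
      - ((∏ i, (v - β i)) / (∏ i, ((α i : ℂ) - v))) * ∑ j, (∏ i, ((α i : ℂ) - β j)) / ((β j - v) * ∏ k ∈ Finset.univ.erase j, ((β j : ℂ) - β k)) / (u - β j) := by
    rw [Finset.mul_sum]
    refine Finset.sum_congr rfl fun j _ => ?_
    rw [rho_eq α β hα j v hv, ← Finset.mul_prod_erase Finset.univ (fun i => v - (β i : ℂ)) (Finset.mem_univ j), cco]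
    push_cast
    have h9 : ∏ k ∈ Finset.univ.erase j, ((β j : ℂ) - β k) ≠ 0 :=
      Finset.prod_ne_zero_iff.mpr fun k hk => sub_ne_zero.mpr fun h => (Finset.ne_of_mem_erase hk) (hβ' h).symm
    have h10 : (u - β j : ℂ) ≠ 0 := sub_ne_zero.mpr (hu j)
    have h11 : (β j - v : ℂ) ≠ 0 := sub_ne_zero.mpr (hvb j).symm
    rw [show v - (β j : ℂ) = -(β j - v) by ring]
    field_simp
  have e3 := eq_sub_of_add_eq' h.symm
  rw [e2, e3]
  rw [show (v - u) = - (u - v) by ring]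
  field_simp

end AW

namespace AW

variable {N : ℕ} {L : Type*} [LinearOrder L]

lemma Cco_det (α β : Fin N → ℝ) (hα : Function.Injective α) (hβ : Function.Injective β) (hab : ∀ i j, β j < α i) :
    (Matrix.of (Cco α β)).det ≠ 0 := by
  have : (Matrix.of (Cco α β)) * (Matrix.of fun k i => 1 / (α k - β i)) = 1 := by
    ext j i
    rw [Matrix.mul_apply]
    simp only [Matrix.of_apply]
    rw [Cco_beta α β hα hβ hab i j, Matrix.one_apply]
    simp [eq_comm]
  intro h
  have h2 := congrArg Matrix.det this
  rw [Matrix.det_mul, h] at h2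
  simp at h2

/-- the concrete Eynard–Mehta system -/
def emG (α β : Fin N → ℝ) (hα : Function.Injective α) (hβ : Function.Injective β) (hab : ∀ i j, β j < α i)
    (s h : L → ℝ) (hs : StrictAnti s) (hs0 : ∀ l, 0 < s l) : EMSys L (Fin N) where
  φ j l x := ∑ k, Cco α β j k * Eal (α k) (s l) (x + h l)
  ψ j l x := Real.exp (β j * (x + h l) - s l * β j ^ 2)
  p l l' x y := gp (s l - s l') (x + h l - (y + h l'))
  mφ j l := by
    have := fun k => Eal_meas (α k) (s l)
    fun_prop
  mψ j l := by fun_prop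
  mp l l' := by
    have := gp_meas (s l - s l')
    fun_prop
  i1 i j l := by
    have : ∀ k, Integrable fun y => Cco α β j k * (Real.exp (β i * (y + h l) - s l * β i ^ 2) * Eal (α k) (s l) (y + h l)) := fun k =>
      ((Eal_psi (α k) (β i) (s l) (hs0 l) (hab k i)).1.comp_add_right (h l)).const_mul _
    refine (integrable_finsetSum Finset.univ fun k _ => this k).congr (Filter.Eventually.of_forall fun y => ?_)
    simp only [Finset.mul_sum]
    exact Finset.sum_congr rfl fun k _ => by ring
  e1 i j l := by
    have h1 : ∀ k, Integrable fun y => Cco α β j k * (Real.exp (β i * (y + h l) - s l * β i ^ 2) * Eal (α k) (s l) (y + h l)) := fun k =>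
      ((Eal_psi (α k) (β i) (s l) (hs0 l) (hab k i)).1.comp_add_right (h l)).const_mul _
    rw [← Cco_beta α β hα hβ hab i j]
    calc _ = ∫ y, ∑ k, Cco α β j k * (Real.exp (β i * (y + h l) - s l * β i ^ 2) * Eal (α k) (s l) (y + h l)) := by
          refine integral_congr_ae (Filter.Eventually.of_forall fun y => ?_)
          simp only [Finset.mul_sum]
          exact Finset.sum_congr rfl fun k _ => by ring
      _ = _ := by
          rw [integral_finsetSum _ fun k _ => h1 k]
          refine Finset.sum_congr rfl fun k _ => ?_
          rw [MeasureTheory.integral_const_mul,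
            integral_add_right_eq_self (fun y => Real.exp (β i * y - s l * β i ^ 2) * Eal (α k) (s l) y),
            (Eal_psi (α k) (β i) (s l) (hs0 l) (hab k i)).2]
  i2 j l l' hl x := by
    have hτ : 0 < s l - s l' := sub_pos.mpr (hs hl)
    have : ∀ k, Integrable fun y => Cco α β j k * (gp (s l - s l') (x + h l - (y + h l')) * Eal (α k) (s l') (y + h l')) := fun k =>
      ((Eal_conv (α k) (s l') (s l - s l') (x + h l) (hs0 l') hτ).1.comp_add_right (h l')).const_mul _
    refine (integrable_finsetSum Finset.univ fun k _ => this k).congr (Filter.Eventually.of_forall fun y => ?_)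
    simp only [Finset.mul_sum]
    exact Finset.sum_congr rfl fun k _ => by ring
  e2 j l l' hl x := by
    have hτ : 0 < s l - s l' := sub_pos.mpr (hs hl)
    have h1 : ∀ k, Integrable fun y => Cco α β j k * (gp (s l - s l') (x + h l - (y + h l')) * Eal (α k) (s l') (y + h l')) := fun k =>
      ((Eal_conv (α k) (s l') (s l - s l') (x + h l) (hs0 l') hτ).1.comp_add_right (h l')).const_mul _
    calc _ = ∫ y, ∑ k, Cco α β j k * (gp (s l - s l') (x + h l - (y + h l')) * Eal (α k) (s l') (y + h l')) := by
          refine integral_congr_ae (Filter.Eventually.of_forall fun y => ?_)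
          simp only [Finset.mul_sum]
          exact Finset.sum_congr rfl fun k _ => by ring
      _ = _ := by
          rw [integral_finsetSum _ fun k _ => h1 k]
          refine Finset.sum_congr rfl fun k _ => ?_
          rw [MeasureTheory.integral_const_mul,
            integral_add_right_eq_self (fun y => gp (s l - s l') (x + h l - y) * Eal (α k) (s l') y),
            (Eal_conv (α k) (s l') (s l - s l') (x + h l) (hs0 l') hτ).2, sub_add_cancel]
  i3 j l l' hl z := by
    have hτ : 0 < s l - s l' := sub_pos.mpr (hs hl)
    have := (psi_conv (β j) (s l') (s l - s l') (z + h l') hτ).1.comp_add_right (h l)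
    rw [sub_add_cancel] at this
    exact this
  e3 j l l' hl z := by
    have hτ : 0 < s l - s l' := sub_pos.mpr (hs hl)
    have := (psi_conv (β j) (s l') (s l - s l') (z + h l') hτ).2
    rw [sub_add_cancel, ← integral_add_right_eq_self _ (h l)] at this
    exact this
  i4 l l' l'' h1 h2 x z := by
    exact (gp_conv (s l - s l') (s l' - s l'') (x + h l) (z + h l'') (sub_pos.mpr (hs h1)) (sub_pos.mpr (hs h2))).1.comp_add_right (h l')
  e4 l l' l'' h1 h2 x z := by
    have := (gp_conv (s l - s l') (s l' - s l'') (x + h l) (z + h l'') (sub_pos.mpr (hs h1)) (sub_pos.mpr (hs h2))).2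
    rw [← integral_add_right_eq_self _ (h l'), sub_add_sub_cancel] at this
    exact this

lemma emG_pos [Fintype L] (α β : Fin N → ℝ) (hα : Function.Injective α) (hβ : Function.Injective β) (hab : ∀ i j, β j < α i)
    (s h : L → ℝ) (hs : StrictAnti s) (hs0 : ∀ l, 0 < s l) (x : L × Fin N → ℝ) :
    0 ≤ (emG α β hα hβ hab s h hs hs0).D Finset.univ x := by
  have hα' : Function.Injective (fun i => -α i) := fun i j h => hα (by simpa using h)
  refine EMSys.D_nonneg _ V V_zero (V β) ((Matrix.of (Cco α β)).det * V (fun i => - α i)) (V_ne β hβ)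
    (mul_ne_zero (Cco_det α β hα hβ hab) (V_ne _ hα')) ?_ ?_ ?_ x
  · intro t z
    have e : (Matrix.of fun j i => (emG α β hα hβ hab s h hs hs0).ψ j t (z i)).det =
        (∏ j, Real.exp (-(s t * β j ^ 2))) * (Matrix.of fun j i => Real.exp (β j * (z i + h t))).det := by
      rw [← Matrix.det_mul_column]
      congr 1
      ext j i
      simp only [emG, Matrix.of_apply]
      rw [← Real.exp_add]; congr 1; ring
    rw [e]
    have h1 := tp_exp β (fun i => z i + h t)
    rw [V_add] at h1
    have h2 : 0 ≤ ∏ j, Real.exp (-(s t * β j ^ 2)) := Finset.prod_nonneg fun j _ => (Real.exp_pos _).le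
    calc (0:ℝ) ≤ _ := mul_nonneg h2 h1
      _ = _ := by ring
  · intro t z
    have e : (Matrix.of fun i j => (emG α β hα hβ hab s h hs hs0).φ j t (z i)).det =
        (Matrix.of fun i k => Eal (α k) (s t) (z i + h t)).det * (Matrix.of (Cco α β)).det := by
      rw [← Matrix.det_transpose (Matrix.of (Cco α β)), ← Matrix.det_mul]
      congr 1
      ext i j
      simp only [emG, Matrix.of_apply, Matrix.mul_apply, Matrix.transpose_apply]
      exact Finset.sum_congr rfl fun k _ => by ring
    rw [e]
    have h1 := tp_andreief (n := N) (volume.restrict (Set.Ioi (0:ℝ))) (fun x y => gp (s t) (x - y))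
      (fun k y => Real.exp (-α k * y)) (V (fun i => - α i)) (fun x j => Eal_int _ _ _ (hs0 t))
      (fun x y => tp_gp _ (hs0 t) x y) (fun y => by
        have := tp_exp y (fun i => - α i)
        simp only [mul_comm (y _)] at this
        exact this) (fun i => z i + h t)
    rw [V_add] at h1
    calc (0:ℝ) ≤ _ := mul_nonneg (mul_self_nonneg (Matrix.of (Cco α β)).det) h1
      _ = _ := by unfold Eal; ring
  · intro l l' hl z w
    have := tp_gp _ (sub_pos.mpr (hs hl)) (fun i => z i + h l) (fun i => w i + h l')
    rw [V_add, V_add] at this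
    exact this

end AW

namespace AW

lemma rot_aux (G : ℂ → ℂ) (c : ℂ) (θ₁ θ₂ : ℝ) (hθ : θ₁ ≤ θ₂)
    (hd : ∀ r : ℝ, 0 ≤ r → ∀ θ ∈ Set.Icc θ₁ θ₂, DifferentiableAt ℂ G (c + r * cexp (θ * I)))
    (C R : ℝ) (hR : 0 < R) (hb : ∀ r : ℝ, R ≤ r → ∀ θ ∈ Set.Icc θ₁ θ₂, ‖G (c + r * cexp (θ * I))‖ ≤ C / r ^ 2) :
    ∃ C' : ℝ, 0 ≤ C' ∧ ∀ r : ℝ, 0 < r → ∀ θ ∈ Set.Icc θ₁ θ₂, ‖G (c + r * cexp (θ * I))‖ * r ≤ C' * Real.exp (-|Real.log r|) := by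
  have hcomp : IsCompact (Set.Icc (0:ℝ) R ×ˢ Set.Icc θ₁ θ₂) := isCompact_Icc.prod isCompact_Icc
  obtain ⟨M, hM⟩ := hcomp.exists_bound_of_continuousOn (f := fun z : ℝ × ℝ => G (c + z.1 * cexp (z.2 * I))) (by
    intro z hz
    refine ContinuousAt.continuousWithinAt ?_
    have := (hd z.1 hz.1.1 z.2 hz.2).continuousAt
    exact ContinuousAt.comp (f := fun z : ℝ × ℝ => c + z.1 * cexp (z.2 * I)) this (by fun_prop))
  have hM0 : 0 ≤ M := (norm_nonneg _).trans (hM (0, θ₁) ⟨⟨le_rfl, hR.le⟩, ⟨le_rfl, hθ⟩⟩)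
  have hC0 : 0 ≤ C := by
    have := (norm_nonneg _).trans (hb R le_rfl θ₁ ⟨le_rfl, hθ⟩)
    rcases le_or_gt 0 C with h | h
    · exact h
    · exact absurd this (not_le.mpr (div_neg_of_neg_of_pos h (by positivity)))
  refine ⟨M * (R ^ 2 + 1) + C * (1 + R⁻¹ ^ 2), by positivity, fun r hr θ hθ' => ?_⟩
  have e : Real.exp (-|Real.log r|) = if r ≤ 1 then r else r⁻¹ := by
    split_ifs with h
    · rw [abs_of_nonpos (Real.log_nonpos hr.le h), neg_neg, Real.exp_log hr]
    · rw [abs_of_nonneg (Real.log_nonneg (not_le.mp h).le), Real.exp_neg, Real.exp_log hr]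
  have q1 : r * r⁻¹ = 1 := mul_inv_cancel₀ hr.ne'
  have q2 : 0 < r⁻¹ := inv_pos.mpr hr
  rw [e]
  rcases le_or_gt r R with h | h
  · have h1 := hM (r, θ) ⟨⟨hr.le, h⟩, hθ'⟩
    simp only at h1
    refine (mul_le_mul_of_nonneg_right h1 hr.le).trans ?_
    split_ifs with h2
    · refine mul_le_mul_of_nonneg_right ?_ hr.le
      nlinarith [mul_nonneg hM0 (sq_nonneg R), mul_nonneg hC0 (sq_nonneg R⁻¹)]
    · have : M * r = (M * r ^ 2) * r⁻¹ := by field_simp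
      rw [this]
      refine mul_le_mul_of_nonneg_right ?_ q2.le
      have : r ^ 2 ≤ R ^ 2 := by gcongr
      nlinarith [mul_le_mul_of_nonneg_left this hM0, mul_nonneg hC0 (sq_nonneg R⁻¹)]
  · refine (mul_le_mul_of_nonneg_right (hb r h.le θ hθ') hr.le).trans ?_
    split_ifs with h2
    · refine mul_le_mul_of_nonneg_right ?_ hr.le
      have : C / r ^ 2 ≤ C * R⁻¹ ^ 2 := by
        rw [div_eq_mul_inv, inv_pow]
        gcongr
      nlinarith [mul_nonneg hM0 (sq_nonneg R)]
    · have : C / r ^ 2 * r = C * r⁻¹ := by field_simp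
      rw [this]
      refine mul_le_mul_of_nonneg_right ?_ q2.le
      nlinarith [mul_nonneg hM0 (sq_nonneg R), mul_nonneg hC0 (sq_nonneg R⁻¹)]

lemma int_half {E : Type*} [NormedAddCommGroup E] [NormedSpace ℝ E] (F : ℝ → E) (h1 : IntegrableOn F (Set.Ioi 0)) (h2 : IntegrableOn (fun r => F (-r)) (Set.Ioi 0)) :
    Integrable F ∧ ∫ y, F y = (∫ r in Set.Ioi (0:ℝ), F r) + ∫ r in Set.Ioi (0:ℝ), F (-r) := by
  have h3 : IntegrableOn F (Set.Iio 0) := by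
    have h4 : Integrable (F ∘ Neg.neg) (volume.restrict (Neg.neg ⁻¹' (Set.Iio (0:ℝ)))) := by
      simpa [Function.comp_def, IntegrableOn] using h2
    exact ((Measure.measurePreserving_neg (volume : Measure ℝ)).restrict_preimage_emb (Homeomorph.neg ℝ).measurableEmbedding (Set.Iio 0)).integrable_comp_emb (Homeomorph.neg ℝ).measurableEmbedding |>.mp h4
  have h5 : IntegrableOn F (Set.Iic 0) := h3.congr_set_ae Iio_ae_eq_Iic.symm
  have h6 : Integrable F := by
    rw [← integrableOn_univ, ← Set.Iic_union_Ioi (a := (0:ℝ))]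
    exact h5.union h1
  refine ⟨h6, ?_⟩
  rw [integral_comp_neg_Ioi, neg_zero, add_comm, ← setIntegral_univ, ← Set.Iic_union_Ioi (a := (0:ℝ)),
    setIntegral_union (Set.Iic_disjoint_Ioi le_rfl) measurableSet_Ioi h5 h1]

lemma int_exp_abs' (ε : ℝ) (hε : 0 < ε) : Integrable fun x : ℝ => Real.exp (-(ε * |x|)) := by
  have h : IntegrableOn (fun x : ℝ => Real.exp (-(ε * |x|))) (Set.Ioi 0) := by
    refine (integrableOn_exp_mul_Ioi (neg_lt_zero.mpr hε) 0).congr_fun (fun x hx => ?_) measurableSet_Ioi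
    simp only
    rw [abs_of_pos hx, neg_mul]
  exact (int_half _ h (by simpa using h)).1

lemma int_exp_abs : Integrable fun x : ℝ => Real.exp (-|x|) := by
  simpa using int_exp_abs' 1 one_pos

lemma ray_eq (G : ℂ → ℂ) (c : ℂ) (θ : ℝ) :
    ∫ x : ℝ, G (c + cexp (x + θ * I)) * cexp (x + θ * I) = ∫ r in Set.Ioi (0:ℝ), G (c + r * cexp (θ * I)) * cexp (θ * I) := by
  have := integral_image_eq_integral_abs_deriv_smul (s := Set.univ) (f := Real.exp) (f' := Real.exp) MeasurableSet.univ
    (fun x _ => (Real.hasDerivAt_exp x).hasDerivWithinAt) Real.exp_injective.injOn (fun r : ℝ => G (c + r * cexp (θ * I)) * cexp (θ * I))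
  rw [Set.image_univ, Real.range_exp, setIntegral_univ] at this
  rw [this]
  refine integral_congr_ae (Filter.Eventually.of_forall fun x => ?_)
  simp only
  rw [abs_of_pos (Real.exp_pos x), Complex.exp_add, Complex.real_smul]
  push_cast
  ring

lemma ray_int (G : ℂ → ℂ) (c : ℂ) (θ : ℝ)
    (hd : ∀ r : ℝ, 0 ≤ r → DifferentiableAt ℂ G (c + r * cexp (θ * I)))
    (C R : ℝ) (hR : 0 < R) (hb : ∀ r : ℝ, R ≤ r → ‖G (c + r * cexp (θ * I))‖ ≤ C / r ^ 2) :
    IntegrableOn (fun r : ℝ => G (c + r * cexp (θ * I)) * cexp (θ * I)) (Set.Ioi 0) := by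
  refine Integrable.mul_const ?_ _
  have hc : ContinuousOn (fun r : ℝ => G (c + r * cexp (θ * I))) (Set.Ici 0) := by
    intro r hr
    refine ContinuousAt.continuousWithinAt ?_
    exact ContinuousAt.comp (f := fun r : ℝ => c + r * cexp (θ * I)) (hd r hr).continuousAt (by fun_prop)
  have h1 : IntegrableOn (fun r : ℝ => G (c + r * cexp (θ * I))) (Set.Icc 0 R) :=
    (hc.mono Set.Icc_subset_Ici_self).integrableOn_Icc
  have h2 : IntegrableOn (fun r : ℝ => G (c + r * cexp (θ * I))) (Set.Ioi R) := by
    have h3 : IntegrableOn (fun r : ℝ => C * r ^ (-2 : ℝ)) (Set.Ioi R) := (integrableOn_Ioi_rpow_of_lt (by norm_num) hR).const_mul C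
    refine Integrable.mono' h3 ((hc.mono fun r hr => hR.le.trans (le_of_lt hr)).aestronglyMeasurable measurableSet_Ioi) ?_
    refine (ae_restrict_mem measurableSet_Ioi).mono fun r hr => ?_
    refine (hb r (le_of_lt hr)).trans_eq ?_
    rw [Real.rpow_neg (hR.le.trans (le_of_lt hr)), div_eq_mul_inv]
    norm_num
  refine (h1.union h2).mono_set ?_
  intro r hr
  rcases le_or_gt r R with h | h
  · exact Or.inl ⟨le_of_lt hr, h⟩
  · exact Or.inr h

lemma rot (G : ℂ → ℂ) (c : ℂ) (θ₁ θ₂ : ℝ) (hθ : θ₁ ≤ θ₂)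
    (hd : ∀ r : ℝ, 0 ≤ r → ∀ θ ∈ Set.Icc θ₁ θ₂, DifferentiableAt ℂ G (c + r * cexp (θ * I)))
    (C R : ℝ) (hR : 0 < R) (hb : ∀ r : ℝ, R ≤ r → ∀ θ ∈ Set.Icc θ₁ θ₂, ‖G (c + r * cexp (θ * I))‖ ≤ C / r ^ 2) :
    ∫ r in Set.Ioi (0:ℝ), G (c + r * cexp (θ₁ * I)) * cexp (θ₁ * I) =
    ∫ r in Set.Ioi (0:ℝ), G (c + r * cexp (θ₂ * I)) * cexp (θ₂ * I) := by
  obtain ⟨C', hC0, hC'⟩ := rot_aux G c θ₁ θ₂ hθ hd C R hR hb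
  rw [← ray_eq, ← ray_eq]
  set f : ℂ → ℂ := fun ζ => G (c + cexp ζ) * cexp ζ with hf
  have hexp : ∀ (x θ : ℝ), cexp (x + θ * I) = (Real.exp x : ℂ) * cexp (θ * I) := by
    intro x θ; rw [Complex.exp_add]; push_cast; rfl
  have hfd : ∀ (x θ : ℝ), θ ∈ Set.Icc θ₁ θ₂ → DifferentiableAt ℂ f (x + θ * I) := by
    intro x θ h
    have h1 := hd (Real.exp x) (Real.exp_pos x).le θ h
    rw [← hexp] at h1
    have h2 : DifferentiableAt ℂ (fun ζ => c + cexp ζ) (x + θ * I) := by fun_prop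
    exact (DifferentiableAt.comp (f := fun ζ => c + cexp ζ) _ h1 h2).mul (by fun_prop)
  have hfb : ∀ (x θ : ℝ), θ ∈ Set.Icc θ₁ θ₂ → ‖f (x + θ * I)‖ ≤ C' * Real.exp (-|x|) := by
    intro x θ h
    have h1 := hC' (Real.exp x) (Real.exp_pos x) θ h
    rw [Real.log_exp] at h1
    refine le_trans (le_of_eq ?_) h1
    simp only [hf]
    rw [norm_mul, hexp, norm_mul, Complex.norm_exp_ofReal_mul_I, mul_one, Complex.norm_real, Real.norm_of_nonneg (Real.exp_pos x).le]
  have hfi : ∀ θ ∈ Set.Icc θ₁ θ₂, Integrable (fun x : ℝ => f (x + θ * I)) := by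
    intro θ h
    refine Integrable.mono' (int_exp_abs.const_mul C') ?_ (Filter.Eventually.of_forall fun x => hfb x θ h)
    refine Continuous.aestronglyMeasurable ?_
    rw [continuous_iff_continuousAt]
    intro x
    exact ContinuousAt.comp (f := fun x : ℝ => (x : ℂ) + θ * I) (hfd x θ h).continuousAt (by fun_prop)
  have m1 : θ₁ ∈ Set.Icc θ₁ θ₂ := ⟨le_rfl, hθ⟩
  have m2 : θ₂ ∈ Set.Icc θ₁ θ₂ := ⟨hθ, le_rfl⟩
  have hrect : ∀ ρ : ℝ, 0 ≤ ρ → (∫ x : ℝ in (-ρ)..ρ, f (x + θ₁ * I)) - (∫ x : ℝ in (-ρ)..ρ, f (x + θ₂ * I)) =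
      I • (∫ y : ℝ in θ₁..θ₂, f ((-ρ : ℝ) + y * I)) - I • (∫ y : ℝ in θ₁..θ₂, f (ρ + y * I)) := by
    intro ρ hρ
    have := Complex.integral_boundary_rect_eq_zero_of_differentiableOn f ((-ρ : ℝ) + θ₁ * I) ((ρ : ℝ) + θ₂ * I) (by
      intro ζ hζ
      refine DifferentiableAt.differentiableWithinAt ?_
      have h2 := hζ.2
      simp only [Set.mem_preimage] at h2
      rw [Set.uIcc_of_le (by simpa using hθ)] at h2
      have := hfd ζ.re ζ.im (by simpa using h2)
      rwa [Complex.re_add_im] at this)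
    simp only [add_re, ofReal_re, mul_re, I_re, mul_zero, ofReal_im, I_im,
      mul_one, sub_self, add_zero, add_im, mul_im, zero_add, sub_zero, zero_mul] at this
    linear_combination this
  have hside : ∀ ρ : ℝ, ‖I • (∫ y : ℝ in θ₁..θ₂, f (ρ + y * I))‖ ≤ C' * Real.exp (-|ρ|) * |θ₂ - θ₁| := by
    intro ρ
    rw [norm_smul, Complex.norm_I, one_mul]
    refine intervalIntegral.norm_integral_le_of_norm_le_const fun y hy => hfb ρ y ?_
    rw [Set.uIoc_of_le hθ] at hy
    exact ⟨hy.1.le, hy.2⟩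
  have hto : Tendsto (fun ρ : ℝ => C' * Real.exp (-|ρ|) * |θ₂ - θ₁|) atTop (𝓝 0) := by
    have : Tendsto (fun ρ : ℝ => Real.exp (-|ρ|)) atTop (𝓝 0) :=
      Real.tendsto_exp_neg_atTop_nhds_zero.comp tendsto_abs_atTop_atTop
    simpa using (this.const_mul C').mul_const |θ₂ - θ₁|
  have l1 : Tendsto (fun ρ : ℝ => (∫ x : ℝ in (-ρ)..ρ, f (x + θ₁ * I)) - (∫ x : ℝ in (-ρ)..ρ, f (x + θ₂ * I))) atTop
      (𝓝 ((∫ x : ℝ, f (x + θ₁ * I)) - ∫ x : ℝ, f (x + θ₂ * I))) :=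
    (intervalIntegral_tendsto_integral (hfi θ₁ m1) tendsto_neg_atTop_atBot tendsto_id).sub
      (intervalIntegral_tendsto_integral (hfi θ₂ m2) tendsto_neg_atTop_atBot tendsto_id)
  have l2 : Tendsto (fun ρ : ℝ => (∫ x : ℝ in (-ρ)..ρ, f (x + θ₁ * I)) - (∫ x : ℝ in (-ρ)..ρ, f (x + θ₂ * I))) atTop (𝓝 0) := by
    have h0 : Tendsto (fun ρ : ℝ => I • (∫ y : ℝ in θ₁..θ₂, f ((-ρ : ℝ) + y * I)) - I • (∫ y : ℝ in θ₁..θ₂, f (ρ + y * I))) atTop (𝓝 (0 - 0)) := by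
      refine Tendsto.sub ?_ ?_
      · refine squeeze_zero_norm (fun ρ => hside (-ρ)) ?_
        simpa using hto
      · exact squeeze_zero_norm (fun ρ => hside ρ) hto
    rw [sub_zero] at h0
    refine h0.congr' ?_
    filter_upwards [eventually_ge_atTop 0] with ρ hρ
    rw [hrect ρ hρ]
  exact sub_eq_zero.mp (tendsto_nhds_unique l1 l2)

def cP (A : ℝ) (g : ℂ → ℂ) : ℂ := ∫ y, g (gammaP A y) * gammaPD y
def cM (B : ℝ) (g : ℂ → ℂ) : ℂ := ∫ y, g (gammaM B y) * gammaMD y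

lemma csqrt2 : (((Real.sqrt 2 : ℝ) : ℂ)) ^ 2 = 2 := by
  rw [← Complex.ofReal_pow, Real.sq_sqrt (by norm_num)]; norm_num

lemma csqrt2_ne : ((Real.sqrt 2 : ℝ) : ℂ) ≠ 0 := by
  exact_mod_cast (by positivity : Real.sqrt 2 ≠ 0)

lemma e_pi4 : cexp ((Real.pi / 4 : ℝ) * I) = (1 + I) / ((Real.sqrt 2 : ℝ) : ℂ) := by
  rw [Complex.exp_mul_I, ← Complex.ofReal_cos, ← Complex.ofReal_sin, Real.cos_pi_div_four, Real.sin_pi_div_four]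
  push_cast
  have := csqrt2; have := csqrt2_ne
  field_simp
  rw [csqrt2]
  try ring
lemma e_mpi4 : cexp ((-(Real.pi / 4) : ℝ) * I) = (1 - I) / ((Real.sqrt 2 : ℝ) : ℂ) := by
  rw [Complex.exp_mul_I, ← Complex.ofReal_cos, ← Complex.ofReal_sin, Real.cos_neg, Real.sin_neg, Real.cos_pi_div_four, Real.sin_pi_div_four]
  push_cast
  have := csqrt2; have := csqrt2_ne
  field_simp
  rw [csqrt2]
  try ring
lemma e_3pi4 : cexp ((Real.pi - Real.pi / 4 : ℝ) * I) = (-1 + I) / ((Real.sqrt 2 : ℝ) : ℂ) := by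
  rw [Complex.exp_mul_I, ← Complex.ofReal_cos, ← Complex.ofReal_sin, Real.cos_pi_sub, Real.sin_pi_sub, Real.cos_pi_div_four, Real.sin_pi_div_four]
  push_cast
  have := csqrt2; have := csqrt2_ne
  field_simp
  rw [csqrt2]
  try ring
lemma e_5pi4 : cexp ((Real.pi / 4 + Real.pi : ℝ) * I) = (-1 - I) / ((Real.sqrt 2 : ℝ) : ℂ) := by
  rw [Complex.exp_mul_I, ← Complex.ofReal_cos, ← Complex.ofReal_sin, Real.cos_add_pi, Real.sin_add_pi, Real.cos_pi_div_four, Real.sin_pi_div_four]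
  push_cast
  have := csqrt2; have := csqrt2_ne
  field_simp
  rw [csqrt2]
  try ring

lemma gP_pos (A r : ℝ) (hr : 0 < r) : gammaP A r = A + r * cexp ((Real.pi / 4 : ℝ) * I) := by
  rw [e_pi4, gammaP, abs_of_pos hr]; ring
lemma gP_neg (A r : ℝ) (hr : 0 < r) : gammaP A (-r) = A + r * cexp ((-(Real.pi / 4) : ℝ) * I) := by
  rw [e_mpi4, gammaP, abs_neg, abs_of_pos hr]; push_cast; ring
lemma gM_pos (A r : ℝ) (hr : 0 < r) : gammaM A r = A + r * cexp ((Real.pi - Real.pi / 4 : ℝ) * I) := by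
  rw [e_3pi4, gammaM, abs_of_pos hr]; ring
lemma gM_neg (A r : ℝ) (hr : 0 < r) : gammaM A (-r) = A + r * cexp ((Real.pi / 4 + Real.pi : ℝ) * I) := by
  rw [e_5pi4, gammaM, abs_neg, abs_of_pos hr]; push_cast; ring
lemma gPD_pos (r : ℝ) (hr : 0 < r) : gammaPD r = cexp ((Real.pi / 4 : ℝ) * I) := by
  rw [e_pi4, gammaPD, Real.sign_of_pos hr]; push_cast; ring
lemma gPD_neg (r : ℝ) (hr : 0 < r) : gammaPD (-r) = - cexp ((-(Real.pi / 4) : ℝ) * I) := by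
  rw [e_mpi4, gammaPD, Real.sign_of_neg (by linarith)]; push_cast; ring
lemma gMD_pos (r : ℝ) (hr : 0 < r) : gammaMD r = cexp ((Real.pi - Real.pi / 4 : ℝ) * I) := by
  rw [e_3pi4, gammaMD, Real.sign_of_pos hr]; push_cast; ring
lemma gMD_neg (r : ℝ) (hr : 0 < r) : gammaMD (-r) = - cexp ((Real.pi / 4 + Real.pi : ℝ) * I) := by
  rw [e_5pi4, gammaMD, Real.sign_of_neg (by linarith)]; push_cast; ring

lemma cP_rays (A : ℝ) (g : ℂ → ℂ)
    (h1 : IntegrableOn (fun r : ℝ => g (A + r * cexp ((Real.pi / 4 : ℝ) * I)) * cexp ((Real.pi / 4 : ℝ) * I)) (Set.Ioi 0))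
    (h2 : IntegrableOn (fun r : ℝ => g (A + r * cexp ((-(Real.pi / 4) : ℝ) * I)) * cexp ((-(Real.pi / 4) : ℝ) * I)) (Set.Ioi 0)) :
    Integrable (fun y => g (gammaP A y) * gammaPD y) ∧
    cP A g = (∫ r in Set.Ioi (0:ℝ), g (A + r * cexp ((Real.pi / 4 : ℝ) * I)) * cexp ((Real.pi / 4 : ℝ) * I)) -
      ∫ r in Set.Ioi (0:ℝ), g (A + r * cexp ((-(Real.pi / 4) : ℝ) * I)) * cexp ((-(Real.pi / 4) : ℝ) * I) := by
  have e1 : Set.EqOn (fun r : ℝ => g (A + r * cexp ((Real.pi / 4 : ℝ) * I)) * cexp ((Real.pi / 4 : ℝ) * I)) (fun y => g (gammaP A y) * gammaPD y) (Set.Ioi 0) := by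
    intro r hr
    simp only
    rw [gP_pos A r hr, gPD_pos r hr]
  have e2 : Set.EqOn (fun r : ℝ => - (g (A + r * cexp ((-(Real.pi / 4) : ℝ) * I)) * cexp ((-(Real.pi / 4) : ℝ) * I))) (fun y => g (gammaP A (-y)) * gammaPD (-y)) (Set.Ioi 0) := by
    intro r hr
    simp only
    rw [gP_neg A r hr, gPD_neg r hr, mul_neg]
  obtain ⟨h3, h4⟩ := int_half _ (h1.congr_fun e1 measurableSet_Ioi) (IntegrableOn.congr_fun h2.neg e2 measurableSet_Ioi)
  refine ⟨h3, ?_⟩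
  rw [cP, h4, ← setIntegral_congr_fun measurableSet_Ioi e1, ← setIntegral_congr_fun measurableSet_Ioi e2, MeasureTheory.integral_neg, sub_eq_add_neg]

lemma cM_rays (A : ℝ) (g : ℂ → ℂ)
    (h1 : IntegrableOn (fun r : ℝ => g (A + r * cexp ((Real.pi - Real.pi / 4 : ℝ) * I)) * cexp ((Real.pi - Real.pi / 4 : ℝ) * I)) (Set.Ioi 0))
    (h2 : IntegrableOn (fun r : ℝ => g (A + r * cexp ((Real.pi / 4 + Real.pi : ℝ) * I)) * cexp ((Real.pi / 4 + Real.pi : ℝ) * I)) (Set.Ioi 0)) :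
    Integrable (fun y => g (gammaM A y) * gammaMD y) ∧
    cM A g = (∫ r in Set.Ioi (0:ℝ), g (A + r * cexp ((Real.pi - Real.pi / 4 : ℝ) * I)) * cexp ((Real.pi - Real.pi / 4 : ℝ) * I)) -
      ∫ r in Set.Ioi (0:ℝ), g (A + r * cexp ((Real.pi / 4 + Real.pi : ℝ) * I)) * cexp ((Real.pi / 4 + Real.pi : ℝ) * I) := by
  have e1 : Set.EqOn (fun r : ℝ => g (A + r * cexp ((Real.pi - Real.pi / 4 : ℝ) * I)) * cexp ((Real.pi - Real.pi / 4 : ℝ) * I)) (fun y => g (gammaM A y) * gammaMD y) (Set.Ioi 0) := by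
    intro r hr
    simp only
    rw [gM_pos A r hr, gMD_pos r hr]
  have e2 : Set.EqOn (fun r : ℝ => - (g (A + r * cexp ((Real.pi / 4 + Real.pi : ℝ) * I)) * cexp ((Real.pi / 4 + Real.pi : ℝ) * I))) (fun y => g (gammaM A (-y)) * gammaMD (-y)) (Set.Ioi 0) := by
    intro r hr
    simp only
    rw [gM_neg A r hr, gMD_neg r hr, mul_neg]
  obtain ⟨h3, h4⟩ := int_half _ (h1.congr_fun e1 measurableSet_Ioi) (IntegrableOn.congr_fun h2.neg e2 measurableSet_Ioi)
  refine ⟨h3, ?_⟩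
  rw [cM, h4, ← setIntegral_congr_fun measurableSet_Ioi e1, ← setIntegral_congr_fun measurableSet_Ioi e2, MeasureTheory.integral_neg]
  exact (sub_eq_add_neg _ _).symm

lemma polar_re (c r θ : ℝ) : ((c : ℂ) + r * cexp (θ * I)).re = c + r * Real.cos θ := by
  rw [add_re, ofReal_re, Complex.re_ofReal_mul, Complex.exp_ofReal_mul_I_re]
lemma polar_im (c r θ : ℝ) : ((c : ℂ) + r * cexp (θ * I)).im = r * Real.sin θ := by
  rw [add_im, ofReal_im, Complex.im_ofReal_mul, Complex.exp_ofReal_mul_I_im, zero_add]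

lemma exp_le_sq (m r : ℝ) (hm : 0 < m) (hr : 0 < r) : Real.exp (-(m * r)) ≤ (2 / m ^ 2) / r ^ 2 := by
  have h := Real.quadratic_le_exp_of_nonneg (x := m * r) (by positivity)
  rw [Real.exp_neg, div_div, ← mul_pow, inv_eq_one_div, div_le_div_iff₀ (Real.exp_pos _) (by positivity)]
  nlinarith [mul_pos hm hr]

lemma sectorM (θ : ℝ) (h : θ ∈ Set.Icc (Real.pi - Real.pi / 4) (Real.pi / 4 + Real.pi)) :
    Real.cos θ ≤ -(Real.sqrt 2 / 2) ∧ |Real.sin θ| ≤ - Real.cos θ := by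
  have hpi := Real.pi_pos
  have h1 : Real.cos θ = - Real.cos |θ - Real.pi| := by rw [Real.cos_abs, Real.cos_sub_pi, neg_neg]
  have h2 : |θ - Real.pi| ≤ Real.pi / 4 := by rw [abs_le]; constructor <;> linarith [h.1, h.2]
  have h3 : Real.cos (Real.pi / 4) ≤ Real.cos |θ - Real.pi| :=
    Real.cos_le_cos_of_nonneg_of_le_pi (abs_nonneg _) (by linarith) h2
  rw [Real.cos_pi_div_four] at h3
  have h4 : Real.cos θ ≤ -(Real.sqrt 2 / 2) := by rw [h1]; linarith
  refine ⟨h4, ?_⟩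
  have hs : (Real.sqrt 2) ^ 2 = 2 := Real.sq_sqrt (by norm_num)
  have hs0 : 0 < Real.sqrt 2 := by positivity
  refine abs_le_of_sq_le_sq ?_ (by linarith)
  have := Real.sin_sq_add_cos_sq θ
  nlinarith

lemma decayM (s y B r θ : ℝ) (hs : 0 ≤ s) (hy : 2 * s * B ≤ y) (hr : 0 ≤ r)
    (h : θ ∈ Set.Icc (Real.pi - Real.pi / 4) (Real.pi / 4 + Real.pi)) :
    ‖cexp (-s * ((B : ℂ) + r * cexp (θ * I)) ^ 2 + y * ((B : ℂ) + r * cexp (θ * I)))‖ ≤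
      Real.exp (-s * B ^ 2 + y * B) * Real.exp (-(((y - 2 * s * B) * (Real.sqrt 2 / 2)) * r)) := by
  rw [Complex.norm_exp, ← Real.exp_add, Real.exp_le_exp]
  have e : (-s * ((B : ℂ) + r * cexp (θ * I)) ^ 2 + y * ((B : ℂ) + r * cexp (θ * I))).re =
      -s * ((B + r * Real.cos θ) ^ 2 - (r * Real.sin θ) ^ 2) + y * (B + r * Real.cos θ) := by
    rw [← polar_re B r θ, ← polar_im B r θ]
    simp [pow_two, mul_re]
  rw [e]
  obtain ⟨h1, h2⟩ := sectorM θ h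
  have h3 : Real.sin θ ^ 2 ≤ Real.cos θ ^ 2 := by
    rw [← sq_abs (Real.sin θ), ← neg_sq (Real.cos θ)]; gcongr
  have h4 : 0 ≤ s * r ^ 2 * (Real.cos θ ^ 2 - Real.sin θ ^ 2) := mul_nonneg (by positivity) (by linarith)
  have h5 : (y - 2 * s * B) * r * Real.cos θ ≤ (y - 2 * s * B) * r * (-(Real.sqrt 2 / 2)) :=
    mul_le_mul_of_nonneg_left h1 (mul_nonneg (by linarith) hr)
  nlinarith

lemma cM_zero (B : ℝ) (G : ℂ → ℂ)
    (hd : ∀ r : ℝ, 0 ≤ r → ∀ θ ∈ Set.Icc (Real.pi - Real.pi / 4) (Real.pi / 4 + Real.pi), DifferentiableAt ℂ G (B + r * cexp (θ * I)))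
    (C R : ℝ) (hR : 0 < R) (hb : ∀ r : ℝ, R ≤ r → ∀ θ ∈ Set.Icc (Real.pi - Real.pi / 4) (Real.pi / 4 + Real.pi), ‖G (B + r * cexp (θ * I))‖ ≤ C / r ^ 2) :
    Integrable (fun y => G (gammaM B y) * gammaMD y) ∧ cM B G = 0 := by
  have hpi := Real.pi_pos
  have m1 : (Real.pi - Real.pi / 4) ∈ Set.Icc (Real.pi - Real.pi / 4) (Real.pi / 4 + Real.pi) := ⟨le_rfl, by linarith⟩
  have m2 : (Real.pi / 4 + Real.pi) ∈ Set.Icc (Real.pi - Real.pi / 4) (Real.pi / 4 + Real.pi) := ⟨by linarith, le_rfl⟩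
  obtain ⟨h1, h2⟩ := cM_rays B G (ray_int G B _ (fun r hr => hd r hr _ m1) C R hR (fun r hr => hb r hr _ m1))
    (ray_int G B _ (fun r hr => hd r hr _ m2) C R hR (fun r hr => hb r hr _ m2))
  refine ⟨h1, ?_⟩
  rw [h2, rot G B _ _ m1.2 hd C R hR hb, sub_self]

lemma sector_mem (B r θ : ℝ) (hr : 0 ≤ r) (h : θ ∈ Set.Icc (Real.pi - Real.pi / 4) (Real.pi / 4 + Real.pi)) :
    |((B : ℂ) + r * cexp (θ * I)).im| ≤ B - ((B : ℂ) + r * cexp (θ * I)).re := by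
  rw [polar_re, polar_im, abs_mul, abs_of_nonneg hr]
  nlinarith [mul_le_mul_of_nonneg_left (sectorM θ h).2 hr]

lemma polar_far (B r θ : ℝ) (q : ℂ) (hr : 0 ≤ r) (h : 2 * ‖(B : ℂ) - q‖ ≤ r) : r / 2 ≤ ‖(B : ℂ) + r * cexp (θ * I) - q‖ := by
  have h1 : ‖(r : ℂ) * cexp (θ * I)‖ = r := by
    rw [norm_mul, Complex.norm_exp_ofReal_mul_I, mul_one, Complex.norm_real, Real.norm_of_nonneg hr]
  have h2 : (r : ℂ) * cexp (θ * I) = ((B : ℂ) + r * cexp (θ * I) - q) - ((B : ℂ) - q) := by ring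
  have h3 := norm_sub_le ((B : ℂ) + r * cexp (θ * I) - q) ((B : ℂ) - q)
  rw [← h2, h1] at h3
  linarith

/-- Cauchy formula, pole on the right of the contour -/
lemma cM_right (s y B : ℝ) (q : ℂ) (hs : 0 ≤ s) (hy : 2 * s * B < y) (hq : ¬ |q.im| ≤ B - q.re) :
    Integrable (fun r => cexp (-s * (gammaM B r) ^ 2 + y * gammaM B r) / (gammaM B r - q) * gammaMD r) ∧
    cM B (fun u => cexp (-s * u ^ 2 + y * u) / (u - q)) = 0 := by
  have hne : ∀ r : ℝ, 0 ≤ r → ∀ θ ∈ Set.Icc (Real.pi - Real.pi / 4) (Real.pi / 4 + Real.pi), (B : ℂ) + r * cexp (θ * I) - q ≠ 0 := by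
    intro r hr θ h h0
    have := sector_mem B r θ hr h
    rw [sub_eq_zero.mp h0] at this
    exact hq this
  set m := (y - 2 * s * B) * (Real.sqrt 2 / 2)
  have hm : 0 < m := mul_pos (by linarith) (by positivity)
  refine cM_zero B (fun u => cexp (-s * u ^ 2 + y * u) / (u - q)) ?_ (Real.exp (-s * B ^ 2 + y * B) * (2 / m ^ 2)) (2 * ‖(B : ℂ) - q‖ + 2) (by positivity) ?_
  · intro r hr θ h
    have := hne r hr θ h
    exact DifferentiableAt.div (by fun_prop) (by fun_prop) this
  · intro r hr θ h
    have hr0 : 0 < r := lt_of_lt_of_le (by positivity) hr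
    have h1 := polar_far B r θ q hr0.le (by linarith)
    have h2 : 1 ≤ r / 2 := by linarith [norm_nonneg ((B : ℂ) - q)]
    rw [norm_div]
    refine (div_le_self (norm_nonneg _) (h2.trans h1)).trans ?_
    refine (decayM s y B r θ hs hy.le hr0.le h).trans ?_
    rw [mul_div_assoc]
    exact mul_le_mul_of_nonneg_left (exp_le_sq m r hm hr0) (Real.exp_pos _).le

lemma wlog_im (q u : ℂ) (d : ℝ) (hu : (d : ℂ) + q - u ≠ 0) :
    ((u - q) / ((d : ℂ) + q - u)).im = (u.im - q.im) * d / normSq ((d : ℂ) + q - u) ∧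
    ((u - q) / ((d : ℂ) + q - u)).re = ((u.re - q.re) * (d - (u.re - q.re)) - (u.im - q.im) ^ 2) / normSq ((d : ℂ) + q - u) := by
  have h : normSq ((d : ℂ) + q - u) ≠ 0 := by simpa [normSq_eq_zero] using hu
  rw [Complex.div_im, Complex.div_re]
  constructor
  · rw [← sub_div]; congr 1
    simp; ring
  · rw [← add_div]; congr 1
    simp; ring

/-- one ray of the log computation -/
lemma ray_log (B d : ℝ) (q : ℂ) (hq : |q.im| < B - q.re) (hd : B - q.re < d) (θ : ℝ)
    (hθ : θ ∈ Set.Icc (Real.pi - Real.pi / 4) (Real.pi / 4 + Real.pi))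
    (hθ2 : |Real.sin θ| = - Real.cos θ) (l : ℂ)
    (hl : Tendsto (fun r : ℝ => Complex.log ((B + r * cexp (θ * I) - q) / ((d : ℂ) + q - (B + r * cexp (θ * I))))) atTop (𝓝 l)) :
    IntegrableOn (fun r : ℝ => ((d:ℂ) / (((d:ℂ) + q - (B + r * cexp (θ * I))) * ((B + r * cexp (θ * I)) - q))) * cexp (θ * I)) (Set.Ioi 0) ∧
    ∫ r in Set.Ioi (0:ℝ), ((d:ℂ) / (((d:ℂ) + q - (B + r * cexp (θ * I))) * ((B + r * cexp (θ * I)) - q))) * cexp (θ * I)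
      = l - Complex.log ((B - q) / ((d : ℂ) + q - B)) := by
  have hd0 : 0 < d := lt_of_le_of_lt (abs_nonneg _) (hq.trans hd)
  have hm := sectorM θ hθ
  have hs0 : 0 < Real.sqrt 2 := by positivity
  have hre : ∀ r : ℝ, 0 ≤ r → ((B:ℂ) + r * cexp (θ * I)).re ≤ B := by
    intro r hr
    have := abs_nonneg (Real.sin θ)
    rw [polar_re]; nlinarith [mul_nonneg hr (by linarith : 0 ≤ - Real.cos θ)]
  have hn1 : ∀ r : ℝ, 0 ≤ r → (d : ℂ) + q - (B + r * cexp (θ * I)) ≠ 0 := by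
    intro r hr h0
    have := congrArg Complex.re h0
    have h2 := hre r hr
    rw [sub_re] at this
    simp only [add_re, ofReal_re, Complex.zero_re] at this h2
    linarith
  have hsl : ∀ r : ℝ, 0 ≤ r → (B + r * cexp (θ * I) - q) / ((d : ℂ) + q - (B + r * cexp (θ * I))) ∈ slitPlane := by
    intro r hr
    obtain ⟨e1, e2⟩ := wlog_im q (B + r * cexp (θ * I)) d (hn1 r hr)
    have hp : 0 < normSq ((d : ℂ) + q - (B + r * cexp (θ * I))) := by rw [normSq_pos]; exact hn1 r hr
    rw [mem_slitPlane_iff, e1, e2]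
    by_cases hY : ((B:ℂ) + r * cexp (θ * I)).im - q.im = 0
    · left
      rw [hY]
      have h1 : ((B:ℂ) + r * cexp (θ * I)).re - q.re < d := by linarith [hre r hr]
      have h2 : 0 < ((B:ℂ) + r * cexp (θ * I)).re - q.re := by
        have h3 : |q.im| = r * |Real.sin θ| := by
          rw [← sub_eq_zero.mp hY, polar_im, abs_mul, abs_of_nonneg hr]
        rw [polar_re]
        rw [h3, hθ2] at hq
        linarith
      apply div_pos _ hp
      nlinarith
    · right
      exact div_ne_zero (mul_ne_zero hY hd0.ne') hp.ne'
  have hn2 : ∀ r : ℝ, 0 ≤ r → (B + r * cexp (θ * I)) - q ≠ 0 := by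
    intro r hr h0
    have := slitPlane_ne_zero (hsl r hr)
    rw [h0, zero_div] at this
    exact this rfl
  have hiv := ray_int (fun u => (d:ℂ) / (((d:ℂ) + q - u) * (u - q))) B θ
    (fun r hr => DifferentiableAt.div (by fun_prop) (by fun_prop) (mul_ne_zero (hn1 r hr) (hn2 r hr)))
    (4 * d) (2 * ‖(B:ℂ) - q‖ + 2 * ‖(B : ℂ) - (d + q)‖ + 1) (by positivity) (by
      intro r hr
      have hr0 : 0 < r := lt_of_lt_of_le (by positivity) hr
      have h1 := polar_far B r θ q hr0.le (by linarith [norm_nonneg ((B : ℂ) - (d + q))])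
      have h2 := polar_far B r θ (d + q) hr0.le (by linarith [norm_nonneg ((B : ℂ) - q)])
      rw [norm_sub_rev] at h2
      rw [norm_div, norm_mul, Complex.norm_real, Real.norm_of_nonneg hd0.le]
      rw [div_le_div_iff₀ (mul_pos (by linarith) (by linarith)) (by positivity)]
      have := mul_le_mul h1 h2 (by positivity) (norm_nonneg _)
      nlinarith)
  refine ⟨hiv, ?_⟩
  have key := integral_Ioi_of_hasDerivAt_of_tendsto' (a := (0:ℝ))
    (f := fun r : ℝ => Complex.log ((B + r * cexp (θ * I) - q) / ((d : ℂ) + q - (B + r * cexp (θ * I)))))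
    (f' := fun r : ℝ => ((d:ℂ) / (((d:ℂ) + q - (B + r * cexp (θ * I))) * ((B + r * cexp (θ * I)) - q))) * cexp (θ * I)) ?_ hiv hl
  · rw [key]; simp
  · intro r hr
    have hr : (0:ℝ) ≤ r := hr
    have hu : HasDerivAt (fun r : ℝ => (B:ℂ) + r * cexp (θ * I)) (cexp (θ * I)) r := by
      have := ((Complex.ofRealCLM.hasDerivAt (x := r)).mul_const (cexp (θ * I))).const_add (B:ℂ)
      simpa using this
    have h1 := ((hu.sub_const q).div (hu.const_sub ((d:ℂ) + q)) (hn1 r hr)).clog_real (hsl r hr)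
    refine h1.congr_deriv ?_
    have a1 := hn1 r hr
    have a2 := hn2 r hr
    rw [Pi.div_apply]
    field_simp
    ring

lemma w_tendsto (B d : ℝ) (q : ℂ) (θ : ℝ) :
    Tendsto (fun r : ℝ => (B + r * cexp (θ * I) - q) / ((d : ℂ) + q - (B + r * cexp (θ * I)))) atTop (𝓝 (-1)) := by
  have h1 : Tendsto (fun r : ℝ => -1 + (d:ℂ) / ((d : ℂ) + q - (B + r * cexp (θ * I)))) atTop (𝓝 (-1 + 0)) := by
    refine tendsto_const_nhds.add ?_
    rw [tendsto_zero_iff_norm_tendsto_zero]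
    refine squeeze_zero' (g := fun r : ℝ => ‖(d:ℂ)‖ * (2 / r)) (Eventually.of_forall fun _ => norm_nonneg _) ?_ ?_
    · filter_upwards [eventually_ge_atTop (2 * ‖(B : ℂ) - (d + q)‖ + 1)] with r hr
      have hr0 : 0 < r := lt_of_lt_of_le (by positivity) hr
      have h2 := polar_far B r θ (d + q) hr0.le (by linarith)
      rw [norm_sub_rev] at h2
      rw [norm_div, div_eq_mul_inv]
      gcongr
      rw [← inv_div]
      exact inv_anti₀ (by positivity) h2
    · have : Tendsto (fun r : ℝ => ‖(d:ℂ)‖ * (2 / r)) atTop (𝓝 (‖(d:ℂ)‖ * 0)) :=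
        (tendsto_const_nhds.div_atTop tendsto_id).const_mul _
      simpa using this
  rw [add_zero] at h1
  refine h1.congr' ?_
  filter_upwards [eventually_ge_atTop (2 * ‖(B : ℂ) - (d + q)‖ + 1)] with r hr
  have hr0 : 0 < r := lt_of_lt_of_le (by positivity) hr
  have h2 := polar_far B r θ (d + q) hr0.le (by linarith)
  have h3 : (d : ℂ) + q - (B + r * cexp (θ * I)) ≠ 0 := by
    rw [← norm_pos_iff, norm_sub_rev]; linarith [half_pos hr0]
  field_simp
  ring

lemma cM_two_pi (B d : ℝ) (q : ℂ) (hq : |q.im| < B - q.re) (hd : B - q.re < d) :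
    Integrable (fun r => (d:ℂ) / (((d:ℂ) + q - gammaM B r) * (gammaM B r - q)) * gammaMD r) ∧
    cM B (fun u => (d:ℂ) / (((d:ℂ) + q - u) * (u - q))) = 2 * Real.pi * I := by
  have hd0 : 0 < d := lt_of_le_of_lt (abs_nonneg _) (hq.trans hd)
  have hpi := Real.pi_pos
  have hs0 : 0 < Real.sqrt 2 := by positivity
  have m1 : (Real.pi - Real.pi / 4) ∈ Set.Icc (Real.pi - Real.pi / 4) (Real.pi / 4 + Real.pi) := ⟨le_rfl, by linarith⟩
  have m2 : (Real.pi / 4 + Real.pi) ∈ Set.Icc (Real.pi - Real.pi / 4) (Real.pi / 4 + Real.pi) := ⟨by linarith, le_rfl⟩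
  have t1 : |Real.sin (Real.pi - Real.pi / 4)| = - Real.cos (Real.pi - Real.pi / 4) := by
    rw [Real.sin_pi_sub, Real.cos_pi_sub, Real.sin_pi_div_four, Real.cos_pi_div_four, neg_neg, abs_of_pos (by positivity)]
  have t2 : |Real.sin (Real.pi / 4 + Real.pi)| = - Real.cos (Real.pi / 4 + Real.pi) := by
    rw [Real.sin_add_pi, Real.cos_add_pi, Real.sin_pi_div_four, Real.cos_pi_div_four, neg_neg, abs_neg, abs_of_pos (by positivity)]
  have far : ∀ θ r : ℝ, 2 * ‖(B : ℂ) - (d + q)‖ + 1 ≤ r → (d : ℂ) + q - (B + r * cexp (θ * I)) ≠ 0 := by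
    intro θ r hr
    have hr0 : 0 < r := lt_of_lt_of_le (by positivity) hr
    have h2 := polar_far B r θ (d + q) hr0.le (by linarith)
    rw [← norm_pos_iff, norm_sub_rev]; linarith [half_pos hr0]
  have l1 := (tendsto_log_nhdsWithin_im_nonneg_of_re_neg_of_im_zero (z := -1) (by simp) (by simp)).comp
    (tendsto_nhdsWithin_iff.mpr ⟨w_tendsto B d q (Real.pi - Real.pi / 4), by
      filter_upwards [eventually_ge_atTop (2 * ‖(B : ℂ) - (d + q)‖ + 1), eventually_ge_atTop (|q.im| * Real.sqrt 2)] with r hr hr2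
      have h3 := far (Real.pi - Real.pi / 4) r hr
      have hp : 0 < normSq ((d : ℂ) + q - (B + r * cexp ((Real.pi - Real.pi / 4 : ℝ) * I))) := by rw [normSq_pos]; exact h3
      show 0 ≤ _
      rw [(wlog_im q _ d h3).1, polar_im, Real.sin_pi_sub, Real.sin_pi_div_four]
      refine div_nonneg (mul_nonneg ?_ hd0.le) hp.le
      have := le_abs_self q.im
      have h5 : (Real.sqrt 2) ^ 2 = 2 := Real.sq_sqrt (by norm_num)
      have := mul_le_mul_of_nonneg_right hr2 hs0.le
      nlinarith⟩)
  have l2 := (tendsto_log_nhdsWithin_im_neg_of_re_neg_of_im_zero (z := -1) (by simp) (by simp)).comp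
    (tendsto_nhdsWithin_iff.mpr ⟨w_tendsto B d q (Real.pi / 4 + Real.pi), by
      filter_upwards [eventually_ge_atTop (2 * ‖(B : ℂ) - (d + q)‖ + 1), eventually_gt_atTop (|q.im| * Real.sqrt 2)] with r hr hr2
      have h3 := far (Real.pi / 4 + Real.pi) r hr
      have hp : 0 < normSq ((d : ℂ) + q - (B + r * cexp ((Real.pi / 4 + Real.pi : ℝ) * I))) := by rw [normSq_pos]; exact h3
      show _ < 0
      rw [(wlog_im q _ d h3).1, polar_im, Real.sin_add_pi, Real.sin_pi_div_four]
      refine div_neg_of_neg_of_pos (mul_neg_of_neg_of_pos ?_ hd0) hp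
      have := neg_abs_le q.im
      have h5 : (Real.sqrt 2) ^ 2 = 2 := Real.sq_sqrt (by norm_num)
      have := mul_lt_mul_of_pos_right hr2 hs0
      nlinarith⟩)
  obtain ⟨i1, e1⟩ := ray_log B d q hq hd _ m1 t1 _ l1
  obtain ⟨i2, e2⟩ := ray_log B d q hq hd _ m2 t2 _ l2
  obtain ⟨h1, h2⟩ := cM_rays B (fun u => (d:ℂ) / (((d:ℂ) + q - u) * (u - q))) i1 i2
  refine ⟨h1, ?_⟩
  rw [h2, e1, e2]
  ring

/-- Cauchy formula, pole on the left of the contour -/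
lemma cM_left (s y B : ℝ) (q : ℂ) (hs : 0 ≤ s) (hy : 2 * s * B < y) (hq : |q.im| < B - q.re) :
    Integrable (fun r => cexp (-s * (gammaM B r) ^ 2 + y * gammaM B r) / (gammaM B r - q) * gammaMD r) ∧
    cM B (fun u => cexp (-s * u ^ 2 + y * u) / (u - q)) = 2 * Real.pi * I * cexp (-s * q ^ 2 + y * q) := by
  obtain ⟨d, hd⟩ := exists_gt (B - q.re)
  have hd0 : 0 < d := lt_of_le_of_lt (abs_nonneg _) (hq.trans hd)
  obtain ⟨i1, e1⟩ := cM_two_pi B d q hq hd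
  set m := (y - 2 * s * B) * (Real.sqrt 2 / 2)
  have hm : 0 < m := mul_pos (by linarith) (by positivity)
  set f : ℂ → ℂ := fun u => cexp (-s * u ^ 2 + y * u) with hf
  set g : ℂ → ℂ := fun u => f u - f q * d / (d + q - u) with hg
  have hgq : g q = 0 := by
    have : (d:ℂ) ≠ 0 := by exact_mod_cast hd0.ne'
    simp only [hg]
    rw [add_sub_cancel_right]; field_simp; ring
  have hgd : DifferentiableOn ℂ g {(d:ℂ) + q}ᶜ := by
    intro u hu
    have : (d:ℂ) + q - u ≠ 0 := fun h => hu (sub_eq_zero.mp h).symm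
    refine DifferentiableAt.differentiableWithinAt ?_
    exact DifferentiableAt.sub (by fun_prop) (DifferentiableAt.div (by fun_prop) (by fun_prop) this)
  have ho : IsOpen ({(d:ℂ) + q}ᶜ : Set ℂ) := isOpen_compl_singleton
  have hqm : q ∈ ({(d:ℂ) + q}ᶜ : Set ℂ) := by
    simpa using hd0.ne'
  have hG := (Complex.differentiableOn_dslope (ho.mem_nhds hqm)).mpr hgd
  have hGv : ∀ u, u ≠ q → dslope g q u = f u / (u - q) - f q * ((d:ℂ) / (((d:ℂ) + q - u) * (u - q))) := by
    intro u hu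
    have : u - q ≠ 0 := sub_ne_zero.mpr hu
    rw [dslope_of_ne _ hu, slope_def_field, hgq, sub_zero]
    simp only [hg]
    rw [sub_div]; congr 1
    rw [div_div, mul_div_assoc]
  obtain ⟨i2, e2⟩ := cM_zero B (dslope g q) (fun r hr θ h => by
      refine hG.differentiableAt (ho.mem_nhds ?_)
      intro h0
      have h0 : (B + r * cexp (θ * I)) = (d:ℂ) + q := h0
      have h1 := sector_mem B r θ hr h
      rw [h0] at h1
      have := abs_nonneg ((d:ℂ) + q).im
      simp only [add_re, ofReal_re] at h1
      linarith)
    (Real.exp (-s * B ^ 2 + y * B) * (2 / m ^ 2) + ‖f q‖ * (4 * d)) (2 * ‖(B:ℂ) - q‖ + 2 * ‖(B : ℂ) - (d + q)‖ + 2) (by positivity) (by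
      intro r hr θ h
      have hr0 : 0 < r := lt_of_lt_of_le (by positivity) hr
      have h1 := polar_far B r θ q hr0.le (by linarith [norm_nonneg ((B : ℂ) - (d + q))])
      have h2 := polar_far B r θ (d + q) hr0.le (by linarith [norm_nonneg ((B : ℂ) - q)])
      rw [norm_sub_rev] at h2
      have h3 : 1 ≤ r / 2 := by linarith [norm_nonneg ((B : ℂ) - q), norm_nonneg ((B : ℂ) - (d + q))]
      rw [hGv _ (sub_ne_zero.mp (norm_pos_iff.mp (by linarith)))]
      refine (norm_sub_le _ _).trans ?_
      rw [add_div]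
      gcongr
      · rw [norm_div]
        refine (div_le_self (norm_nonneg _) (h3.trans h1)).trans ?_
        refine (decayM s y B r θ hs hy.le hr0.le h).trans ?_
        rw [mul_div_assoc]
        exact mul_le_mul_of_nonneg_left (exp_le_sq m r hm hr0) (Real.exp_pos _).le
      · rw [norm_mul, mul_div_assoc]
        gcongr
        rw [norm_div, norm_mul, Complex.norm_real, Real.norm_of_nonneg hd0.le]
        rw [div_le_div_iff₀ (mul_pos (by linarith) (by linarith)) (by positivity)]
        have := mul_le_mul h1 h2 (by positivity) (norm_nonneg _)
        nlinarith)
  have hne : ∀ r, gammaM B r ≠ q := by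
    intro r h
    have h1 : |(gammaM B r).im| = B - (gammaM B r).re := by
      simp [gammaM, abs_div, abs_of_nonneg (Real.sqrt_nonneg 2)]
    rw [h] at h1
    linarith
  have hE : (fun r => f (gammaM B r) / (gammaM B r - q) * gammaMD r) = fun r =>
      dslope g q (gammaM B r) * gammaMD r + f q * ((d:ℂ) / (((d:ℂ) + q - gammaM B r) * (gammaM B r - q)) * gammaMD r) := by
    funext r
    rw [hGv _ (hne r)]; ring
  constructor
  · show Integrable (fun r => f (gammaM B r) / (gammaM B r - q) * gammaMD r)
    rw [hE]
    exact i2.add (i1.const_mul _)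
  · show (∫ r, f (gammaM B r) / (gammaM B r - q) * gammaMD r) = _
    rw [hE, MeasureTheory.integral_add i2 (i1.const_mul _), MeasureTheory.integral_const_mul]
    unfold cM at e1 e2
    rw [e1, e2]
    ring

lemma gauss_line (s A Y : ℝ) (hs : 0 < s) :
    ∫ σ : ℝ, cexp (s * ((A : ℂ) + σ * I) ^ 2 - Y * ((A : ℂ) + σ * I)) = 2 * Real.pi * (gp s Y : ℝ) := by
  have h := integral_cexp_quadratic (b := (-s : ℂ)) (by simpa using hs) ((2 * s * A - Y) * I) (s * A ^ 2 - Y * A)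
  have e : ∀ σ : ℝ, (-s : ℂ) * (σ : ℂ) ^ 2 + (2 * s * A - Y) * I * σ + (s * A ^ 2 - Y * A) =
      s * ((A : ℂ) + σ * I) ^ 2 - Y * ((A : ℂ) + σ * I) := by
    intro σ
    linear_combination (-(s:ℂ) * σ ^ 2) * I_sq
  simp_rw [e] at h
  rw [h]
  have h2 : ((Real.pi : ℂ) / -(-s : ℂ)) ^ (1 / 2 : ℂ) = 2 * Real.pi * ((Real.sqrt (4 * Real.pi * s))⁻¹ : ℝ) := by
    have : ((Real.pi : ℂ) / -(-s : ℂ)) = ((Real.pi / s : ℝ) : ℂ) := by push_cast; rw [neg_neg]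
    rw [this, show (1 / 2 : ℂ) = ((1 / 2 : ℝ) : ℂ) by push_cast; rfl, ← Complex.ofReal_cpow (by positivity), ← Real.sqrt_eq_rpow]
    have : Real.sqrt (Real.pi / s) = 2 * Real.pi * (Real.sqrt (4 * Real.pi * s))⁻¹ := by
      rw [Real.sqrt_eq_iff_mul_self_eq (by positivity) (by positivity)]
      have h4 : (Real.sqrt (4 * Real.pi * s)) ^ 2 = 4 * Real.pi * s := Real.sq_sqrt (by positivity)
      have hp := Real.pi_pos
      rw [← pow_two, mul_pow, inv_pow, h4]
      field_simp
      norm_num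
    rw [this]; push_cast; ring
  rw [h2, gp]
  have e3 : ((s:ℂ) * A ^ 2 - Y * A) - ((2 * s * A - Y) * I) ^ 2 / (4 * (-s : ℂ)) = ((-Y ^ 2 / (4 * s) : ℝ) : ℂ) := by
    have : (s : ℂ) ≠ 0 := by exact_mod_cast hs.ne'
    push_cast
    rw [mul_pow, I_sq]
    field_simp
    ring
  rw [e3]
  push_cast
  ring

lemma norm_line (s A y σ : ℝ) : ‖cexp (s * ((A : ℂ) + σ * I) ^ 2 - y * ((A : ℂ) + σ * I))‖ = Real.exp (s * A ^ 2 - y * A) * Real.exp (-s * σ ^ 2) := by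
  rw [Complex.norm_exp, ← Real.exp_add]
  congr 1
  simp [pow_two]
  ring

lemma Eal_line (α s y A : ℝ) (hs : 0 < s) (hA : A < α) :
    ∫ σ : ℝ, cexp (s * ((A : ℂ) + σ * I) ^ 2 - y * ((A : ℂ) + σ * I)) / (α - (A + σ * I)) = 2 * Real.pi * (Eal α s y : ℝ) := by
  have e1 : ∀ σ : ℝ, cexp (s * ((A : ℂ) + σ * I) ^ 2 - y * ((A : ℂ) + σ * I)) / (α - (A + σ * I)) =
      ∫ η in Set.Ioi (0:ℝ), cexp (s * ((A : ℂ) + σ * I) ^ 2 - y * ((A : ℂ) + σ * I)) * cexp ((-(α - (A + σ * I))) * η) := by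
    intro σ
    rw [MeasureTheory.integral_const_mul, integral_exp_mul_complex_Ioi (by simpa using hA)]
    rw [Complex.ofReal_zero, mul_zero, Complex.exp_zero, neg_div_neg_eq, div_eq_mul_inv, one_div]
  simp_rw [e1]
  rw [MeasureTheory.integral_integral_swap]
  · have e2 : ∀ η : ℝ, ∫ σ : ℝ, cexp (s * ((A : ℂ) + σ * I) ^ 2 - y * ((A : ℂ) + σ * I)) * cexp ((-(α - (A + σ * I))) * η) =
        2 * Real.pi * ((gp s (y - η) * Real.exp (-α * η) : ℝ) : ℂ) := by
      intro η
      have : ∀ σ : ℝ, cexp (s * ((A : ℂ) + σ * I) ^ 2 - y * ((A : ℂ) + σ * I)) * cexp ((-(α - (A + σ * I))) * η) =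
          cexp (s * ((A : ℂ) + σ * I) ^ 2 - (y - η : ℝ) * ((A : ℂ) + σ * I)) * cexp (-α * η) := by
        intro σ
        rw [← Complex.exp_add, ← Complex.exp_add]
        congr 1
        push_cast
        ring
      simp_rw [this]
      rw [MeasureTheory.integral_mul_const, gauss_line s A _ hs]
      push_cast
      ring
    simp_rw [e2]
    rw [MeasureTheory.integral_const_mul, integral_complex_ofReal, Eal]
  · have hi : Integrable (fun p : ℝ × ℝ => (Real.exp (s * A ^ 2 - y * A) * Real.exp (-s * p.1 ^ 2)) * Real.exp (-(α - A) * p.2)) (volume.prod (volume.restrict (Set.Ioi 0))) := by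
      refine Integrable.mul_prod (f := fun σ : ℝ => Real.exp (s * A ^ 2 - y * A) * Real.exp (-s * σ ^ 2)) (g := fun η : ℝ => Real.exp (-(α - A) * η)) ?_ ?_
      · exact (integrable_exp_neg_mul_sq hs).const_mul _
      · exact exp_neg_integrableOn_Ioi 0 (by linarith)
    refine hi.mono' (by
      apply Continuous.aestronglyMeasurable
      simp only [Function.uncurry_def]
      fun_prop) (Eventually.of_forall ?_)
    rintro ⟨σ, η⟩
    simp only [Function.uncurry_def]
    rw [norm_mul, norm_line, Complex.norm_exp]
    refine le_of_eq ?_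
    congr 2
    simp

lemma decayP (s y A r θ : ℝ) (hs : 0 < s) (hy : 2 * s * A < y) (hr : 0 ≤ r) (h0 : 0 ≤ Real.cos θ) (h1 : Real.cos θ ≤ Real.sqrt 2 / 2) :
    ‖cexp (s * ((A : ℂ) + r * cexp (θ * I)) ^ 2 - y * ((A : ℂ) + r * cexp (θ * I)))‖ ≤
      Real.exp (s * A ^ 2 - y * A + ((y - 2 * s * A) * (Real.sqrt 2 / 2)) ^ 2 / (4 * s)) * Real.exp (-(((y - 2 * s * A) * (Real.sqrt 2 / 2)) * r)) := by
  rw [Complex.norm_exp, ← Real.exp_add, Real.exp_le_exp]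
  have e : (s * ((A : ℂ) + r * cexp (θ * I)) ^ 2 - y * ((A : ℂ) + r * cexp (θ * I))).re =
      s * ((A + r * Real.cos θ) ^ 2 - (r * Real.sin θ) ^ 2) - y * (A + r * Real.cos θ) := by
    rw [← polar_re A r θ, ← polar_im A r θ]
    simp [pow_two, mul_re]
  rw [e]
  have hs2 : (Real.sqrt 2) ^ 2 = 2 := Real.sq_sqrt (by norm_num)
  have hs0 : 0 < Real.sqrt 2 := by positivity
  have hsc := Real.sin_sq_add_cos_sq θ
  set c := Real.cos θ
  set k := Real.sqrt 2 * c with hk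
  set m := (y - 2 * s * A) * (Real.sqrt 2 / 2) with hm
  have hk1 : k ≤ 1 := by nlinarith
  have hk0 : 0 ≤ k := by positivity
  have hmk : (y - 2 * s * A) * c = m * k := by rw [hm, hk]; linear_combination (-(y - 2 * s * A) * c / 2) * hs2
  have hk2 : 2 * c ^ 2 = k ^ 2 := by rw [hk, mul_pow, hs2]
  have h5 : m * r - m ^ 2 / (4 * s) ≤ s * r ^ 2 := by
    have : s * r ^ 2 - m * r + m ^ 2 / (4 * s) = s * (r - m / (2 * s)) ^ 2 := by field_simp; ring
    nlinarith [mul_nonneg hs.le (sq_nonneg (r - m / (2 * s)))]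
  have h6 : (1 - k) * (m * r - m ^ 2 / (4 * s)) ≤ (1 - k) * (s * r ^ 2) := mul_le_mul_of_nonneg_left h5 (by linarith)
  have h7 : (1 - k) * (s * r ^ 2) ≤ (1 - k ^ 2) * (s * r ^ 2) := mul_le_mul_of_nonneg_right (by nlinarith) (by positivity)
  have h8 : 0 ≤ k * (m ^ 2 / (4 * s)) := by positivity
  have e2 : s * ((A + r * c) ^ 2 - (r * Real.sin θ) ^ 2) - y * (A + r * c) = s * A ^ 2 - y * A - r * (m * k) - (1 - k ^ 2) * (s * r ^ 2) := by
    rw [← hmk, ← hk2]; linear_combination (-s * r ^ 2) * hsc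
  rw [e2]
  nlinarith

lemma cP_Eal (α s y A : ℝ) (hs : 0 < s) (hA : A < α) (hy : 2 * s * A < y) :
    cP A (fun v => cexp (s * v ^ 2 - y * v) / (α - v)) = 2 * Real.pi * I * (Eal α s y : ℝ) := by
  have hpi := Real.pi_pos
  set G : ℂ → ℂ := fun v => cexp (s * v ^ 2 - y * v) / (α - v) with hG
  set m := (y - 2 * s * A) * (Real.sqrt 2 / 2) with hm
  have hm0 : 0 < m := mul_pos (by linarith) (by positivity)
  have hc : ∀ θ : ℝ, Real.pi / 4 ≤ |θ| → |θ| ≤ Real.pi / 2 → 0 ≤ Real.cos θ ∧ Real.cos θ ≤ Real.sqrt 2 / 2 ∧ Real.sin θ ≠ 0 := by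
    intro θ h1 h2
    rw [← Real.cos_abs]
    refine ⟨Real.cos_nonneg_of_mem_Icc ⟨by linarith, h2⟩, ?_, ?_⟩
    · rw [← Real.cos_pi_div_four]
      exact Real.cos_le_cos_of_nonneg_of_le_pi (by linarith) (by linarith) h1
    · rcases abs_cases θ with ⟨h3, h4⟩ | ⟨h3, h4⟩
      · exact (Real.sin_pos_of_pos_of_lt_pi (by linarith) (by linarith)).ne'
      · exact (Real.sin_neg_of_neg_of_neg_pi_lt (by linarith) (by linarith)).ne
  have hd : ∀ θ : ℝ, Real.pi / 4 ≤ |θ| → |θ| ≤ Real.pi / 2 → ∀ r : ℝ, 0 ≤ r → DifferentiableAt ℂ G (A + r * cexp (θ * I)) := by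
    intro θ h1 h2 r hr
    refine DifferentiableAt.div (by fun_prop) (by fun_prop) ?_
    intro h0
    have h0 := (sub_eq_zero.mp h0).symm
    have him := congrArg Complex.im h0
    have hre := congrArg Complex.re h0
    rw [polar_im, ofReal_im] at him
    rw [polar_re, ofReal_re] at hre
    have : r = 0 := (mul_eq_zero.mp him).resolve_right (hc θ h1 h2).2.2
    rw [this, zero_mul, add_zero] at hre
    linarith
  have hb : ∀ θ : ℝ, Real.pi / 4 ≤ |θ| → |θ| ≤ Real.pi / 2 → ∀ r : ℝ, 2 * ‖(A : ℂ) - α‖ + 2 ≤ r →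
      ‖G (A + r * cexp (θ * I))‖ ≤ Real.exp (s * A ^ 2 - y * A + m ^ 2 / (4 * s)) * (2 / m ^ 2) / r ^ 2 := by
    intro θ h1 h2 r hr
    have hr0 : 0 < r := lt_of_lt_of_le (by positivity) hr
    have h3 := polar_far A r θ α hr0.le (by linarith)
    have h4 : 1 ≤ r / 2 := by linarith [norm_nonneg ((A : ℂ) - α)]
    rw [norm_sub_rev] at h3
    simp only [hG]
    rw [norm_div]
    refine (div_le_self (norm_nonneg _) (h4.trans h3)).trans ?_
    refine (decayP s y A r θ hs hy hr0.le (hc θ h1 h2).1 (hc θ h1 h2).2.1).trans ?_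
    rw [mul_div_assoc]
    exact mul_le_mul_of_nonneg_left (exp_le_sq m r hm0 hr0) (Real.exp_pos _).le
  set C := Real.exp (s * A ^ 2 - y * A + m ^ 2 / (4 * s)) * (2 / m ^ 2)
  set R := 2 * ‖(A : ℂ) - α‖ + 2
  have hR : 0 < R := by positivity
  have q1 : Real.pi / 4 ≤ |Real.pi / 4| := le_abs_self _
  have q2 : |Real.pi / 4| ≤ Real.pi / 2 := by rw [abs_of_pos (by positivity)]; linarith
  have q3 : Real.pi / 4 ≤ |-(Real.pi / 4)| := by rw [abs_neg]; exact q1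
  have q4 : |-(Real.pi / 4)| ≤ Real.pi / 2 := by rw [abs_neg]; exact q2
  have q5 : Real.pi / 4 ≤ |Real.pi / 2| := by rw [abs_of_pos (by positivity)]; linarith
  have q6 : |Real.pi / 2| ≤ Real.pi / 2 := by rw [abs_of_pos (by positivity)]
  have q7 : Real.pi / 4 ≤ |-(Real.pi / 2)| := by rw [abs_neg]; exact q5
  have q8 : |-(Real.pi / 2)| ≤ Real.pi / 2 := by rw [abs_neg]; exact q6
  obtain ⟨-, h2⟩ := cP_rays A G (ray_int G A _ (hd _ q1 q2) C R hR (hb _ q1 q2)) (ray_int G A _ (hd _ q3 q4) C R hR (hb _ q3 q4))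
  have r1 : ∀ θ ∈ Set.Icc (Real.pi / 4) (Real.pi / 2), Real.pi / 4 ≤ |θ| ∧ |θ| ≤ Real.pi / 2 := by
    intro θ h
    rw [abs_of_pos (by linarith [h.1])]; exact h
  have r2 : ∀ θ ∈ Set.Icc (-(Real.pi / 2)) (-(Real.pi / 4)), Real.pi / 4 ≤ |θ| ∧ |θ| ≤ Real.pi / 2 := by
    intro θ h
    rw [abs_of_neg (by linarith [h.2])]; exact ⟨by linarith [h.2], by linarith [h.1]⟩
  have h3 := rot G A (Real.pi / 4) (Real.pi / 2) (by linarith) (fun r hr θ h => hd θ (r1 θ h).1 (r1 θ h).2 r hr) C R hR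
    (fun r hr θ h => hb θ (r1 θ h).1 (r1 θ h).2 r hr)
  have h4 := rot G A (-(Real.pi / 2)) (-(Real.pi / 4)) (by linarith) (fun r hr θ h => hd θ (r2 θ h).1 (r2 θ h).2 r hr) C R hR
    (fun r hr θ h => hb θ (r2 θ h).1 (r2 θ h).2 r hr)
  have i5 := ray_int G A _ (hd _ q5 q6) C R hR (hb _ q5 q6)
  have i6 := ray_int G A _ (hd _ q7 q8) C R hR (hb _ q7 q8)
  have eI : cexp ((Real.pi / 2 : ℝ) * I) = I := by push_cast; exact Complex.exp_pi_div_two_mul_I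
  have eI' : cexp ((-(Real.pi / 2) : ℝ) * I) = -I := by
    rw [Complex.ofReal_neg, neg_mul, Complex.exp_neg, eI, Complex.inv_I]
  rw [h2, h3, ← h4]
  rw [eI] at i5 ⊢
  rw [eI'] at i6 ⊢
  obtain ⟨-, h7⟩ := int_half (fun σ : ℝ => G (A + σ * I) * I) i5 (by
    refine (IntegrableOn.congr_fun i6.neg (fun r _ => ?_) measurableSet_Ioi)
    simp)
  have h8 := Eal_line α s y A hs hA
  have h9 : ∫ σ : ℝ, G (A + σ * I) * I = 2 * Real.pi * I * (Eal α s y : ℝ) := by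
    rw [MeasureTheory.integral_mul_const]
    simp only [hG]
    rw [h8]; ring
  rw [← h9, h7, sub_eq_add_neg, ← MeasureTheory.integral_neg]
  congr 1
  refine integral_congr_ae (Eventually.of_forall fun r => ?_)
  simp

/-- distance of the arc coordinate to the crossing -/
def rr (p y : ℝ) : ℝ := |y| / Real.sqrt 2 - p

def wt (p ε y : ℝ) : ℝ := (Real.sqrt |rr p y|)⁻¹ * Real.exp (-(ε * |y|))

lemma wt_nonneg (p ε y : ℝ) : 0 ≤ wt p ε y := by unfold wt; positivity

lemma w0_int (c : ℝ) (hc : 0 < c) : Integrable fun x : ℝ => (Real.sqrt |x|)⁻¹ * Real.exp (-(c * |x|)) := by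
  have h := integrableOn_rpow_mul_exp_neg_mul_rpow (s := -(1/2)) (p := 1) (b := c) (by norm_num) (by norm_num) hc
  have h1 : IntegrableOn (fun x : ℝ => (Real.sqrt |x|)⁻¹ * Real.exp (-(c * |x|))) (Set.Ioi 0) := by
    refine h.congr_fun (fun x hx => ?_) measurableSet_Ioi
    have hx : 0 < x := hx
    simp only [Real.rpow_one, abs_of_pos hx]
    rw [Real.rpow_neg hx.le, Real.sqrt_eq_rpow, neg_mul]
  refine (int_half _ h1 ?_).1
  simpa only [abs_neg] using h1

lemma wt_int (p ε : ℝ) (hε : 0 < ε) : Integrable (wt p ε) := by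
  have hs : 0 < Real.sqrt 2 := by positivity
  set c := ε * Real.sqrt 2 with hc
  have hc0 : 0 < c := by positivity
  have h0 := w0_int c hc0
  have h1 := (h0.comp_sub_right p).comp_div hs.ne'
  have h2 := h1.comp_neg
  refine ((h1.add h2).const_mul (Real.exp (c * |p|))).mono' ?_ (Eventually.of_forall fun y => ?_)
  · unfold wt rr
    exact Measurable.aestronglyMeasurable (by fun_prop)
  rw [Real.norm_of_nonneg (wt_nonneg _ _ _)]
  have key : wt p ε y ≤ Real.exp (c * |p|) * ((Real.sqrt |(|y| / Real.sqrt 2 - p)|)⁻¹ * Real.exp (-(c * |(|y| / Real.sqrt 2 - p)|))) := by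
    unfold wt rr
    rw [mul_left_comm, ← Real.exp_add]
    gcongr
    have h3 := abs_sub (|y| / Real.sqrt 2) p
    rw [abs_of_nonneg (by positivity : 0 ≤ |y| / Real.sqrt 2)] at h3
    have h4 : ε * |y| = c * (|y| / Real.sqrt 2) := by rw [hc]; field_simp
    rw [h4]
    nlinarith
  refine key.trans ?_
  simp only [Pi.add_apply]
  gcongr
  rcases abs_cases y with ⟨h3, h4⟩ | ⟨h3, h4⟩
  · rw [h3]
    exact le_add_of_nonneg_right (by positivity)
  · rw [h3]
    exact le_add_of_nonneg_left (by positivity)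

lemma gammaP_re (A y : ℝ) : (gammaP A y).re = A + |y| / Real.sqrt 2 := by simp [gammaP]
lemma gammaP_im (A y : ℝ) : (gammaP A y).im = y / Real.sqrt 2 := by simp [gammaP]
lemma gammaM_re (A y : ℝ) : (gammaM A y).re = A - |y| / Real.sqrt 2 := by simp [gammaM]
lemma gammaM_im (A y : ℝ) : (gammaM A y).im = y / Real.sqrt 2 := by simp [gammaM]

lemma gap_sq (A B y₁ y₂ : ℝ) :
    4 * (|rr ((B - A) / 2) y₁| * |rr ((B - A) / 2) y₂|) ≤ ‖gammaP A y₁ - gammaM B y₂‖ ^ 2 := by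
  rw [Complex.sq_norm, Complex.normSq_apply, sub_re, sub_im, gammaP_re, gammaP_im, gammaM_re, gammaM_im]
  unfold rr
  set ρ₁ := |y₁| / Real.sqrt 2 with h1
  set ρ₂ := |y₂| / Real.sqrt 2 with h2
  have h3 : (ρ₁ - ρ₂) ^ 2 ≤ (y₁ / Real.sqrt 2 - y₂ / Real.sqrt 2) ^ 2 := by
    have e1 : ρ₁ = |y₁ / Real.sqrt 2| := by rw [abs_div, abs_of_pos (by positivity : 0 < Real.sqrt 2)]
    have e2 : ρ₂ = |y₂ / Real.sqrt 2| := by rw [abs_div, abs_of_pos (by positivity : 0 < Real.sqrt 2)]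
    rw [e1, e2]
    exact sq_le_sq.mpr (abs_abs_sub_abs_le _ _)
  set p := (B - A) / 2 with hp
  have h4 : 2 * (|ρ₁ - p| * |ρ₂ - p|) ≤ |ρ₁ - p| ^ 2 + |ρ₂ - p| ^ 2 := by nlinarith [sq_nonneg (|ρ₁ - p| - |ρ₂ - p|)]
  rw [sq_abs, sq_abs] at h4
  have hBA : B = A + 2 * p := by rw [hp]; ring
  rw [hBA]
  nlinarith

lemma gap_inv (A B y₁ y₂ : ℝ) (h₁ : rr ((B - A) / 2) y₁ ≠ 0) (h₂ : rr ((B - A) / 2) y₂ ≠ 0) :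
    gammaP A y₁ - gammaM B y₂ ≠ 0 ∧
    ‖(gammaP A y₁ - gammaM B y₂)⁻¹‖ ≤ (Real.sqrt |rr ((B - A) / 2) y₁|)⁻¹ * (Real.sqrt |rr ((B - A) / 2) y₂|)⁻¹ := by
  have h := gap_sq A B y₁ y₂
  have a1 := abs_pos.mpr h₁
  have a2 := abs_pos.mpr h₂
  set a := |rr ((B - A) / 2) y₁|
  set b := |rr ((B - A) / 2) y₂|
  have h3 : Real.sqrt a * Real.sqrt b ≤ ‖gammaP A y₁ - gammaM B y₂‖ := by
    rw [← Real.sqrt_mul a1.le]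
    apply Real.sqrt_le_iff.mpr ⟨norm_nonneg _, by nlinarith [mul_pos a1 a2]⟩
  have h4 : 0 < Real.sqrt a * Real.sqrt b := by positivity
  refine ⟨norm_pos_iff.mp (by linarith), ?_⟩
  rw [norm_inv, ← mul_inv]
  exact inv_anti₀ h4 h3

lemma rr_ae (p : ℝ) : ∀ᵐ y : ℝ, rr p y ≠ 0 := by
  have : ({Real.sqrt 2 * p, -(Real.sqrt 2 * p)} : Set ℝ).Finite := Set.toFinite _
  filter_upwards [this.countable.ae_notMem volume] with y hy h
  apply hy
  have hs : Real.sqrt 2 ≠ 0 := by positivity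
  have : |y| = Real.sqrt 2 * p := by
    unfold rr at h; field_simp at h; linarith
  rcases abs_cases y with ⟨h3, h4⟩ | ⟨h3, h4⟩
  · left; linarith
  · right; show y = _; linarith

lemma norm_gPD (y : ℝ) : ‖gammaPD y‖ ≤ 1 := by
  rcases lt_trichotomy y 0 with h | h | h
  · have := gPD_neg (-y) (by linarith)
    rw [neg_neg] at this
    rw [this, norm_neg, Complex.norm_exp_ofReal_mul_I]
  · subst h
    simp [gammaPD]
    rw [abs_of_nonneg (Real.sqrt_nonneg 2)]
    exact inv_le_one_of_one_le₀ (by rw [Real.one_le_sqrt]; norm_num)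
  · rw [gPD_pos y h, Complex.norm_exp_ofReal_mul_I]

lemma norm_gMD (y : ℝ) : ‖gammaMD y‖ ≤ 1 := by
  rcases lt_trichotomy y 0 with h | h | h
  · have := gMD_neg (-y) (by linarith)
    rw [neg_neg] at this
    rw [this, norm_neg, Complex.norm_exp_ofReal_mul_I]
  · subst h
    simp [gammaMD]
    rw [abs_of_nonneg (Real.sqrt_nonneg 2)]
    exact inv_le_one_of_one_le₀ (by rw [Real.one_le_sqrt]; norm_num)
  · rw [gMD_pos y h, Complex.norm_exp_ofReal_mul_I]

lemma sign_meas : Measurable Real.sign := by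
  unfold Real.sign
  exact Measurable.ite measurableSet_Iio measurable_const (Measurable.ite measurableSet_Ioi measurable_const measurable_const)

lemma gP_cont (A : ℝ) : Continuous (gammaP A) := by unfold gammaP; fun_prop
lemma gM_cont (A : ℝ) : Continuous (gammaM A) := by unfold gammaM; fun_prop
lemma gPD_meas : Measurable gammaPD := by
  have := sign_meas
  unfold gammaPD; fun_prop
lemma gMD_meas : Measurable gammaMD := by
  have := sign_meas
  unfold gammaMD; fun_prop

/-- integrand of the double contour integral -/
def IIf (A B : ℝ) (f g : ℂ → ℂ) (p : ℝ × ℝ) : ℂ :=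
  f (gammaP A p.1) * g (gammaM B p.2) / (gammaP A p.1 - gammaM B p.2) * gammaPD p.1 * gammaMD p.2

def II (A B : ℝ) (f g : ℂ → ℂ) : ℂ := (1 / (2 * (Real.pi : ℂ) * I)) ^ 2 * ∫ p : ℝ × ℝ, IIf A B f g p

lemma IIf_meas (A B : ℝ) (f g : ℂ → ℂ) (hf : Measurable fun y => f (gammaP A y)) (hg : Measurable fun y => g (gammaM B y)) :
    Measurable (IIf A B f g) := by
  have h1 := (gP_cont A).measurable
  have h2 := (gM_cont B).measurable
  have h3 := gPD_meas
  have h4 := gMD_meas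
  exact ((((hf.comp measurable_fst).mul (hg.comp measurable_snd)).div
    ((h1.comp measurable_fst).sub (h2.comp measurable_snd))).mul (h3.comp measurable_fst)).mul (h4.comp measurable_snd)

lemma prod_ae (q : ℝ → Prop) (hq : ∀ᵐ y : ℝ, q y) : ∀ᵐ z : ℝ × ℝ, q z.1 ∧ q z.2 := by
  have h1 : ∀ᵐ z : ℝ × ℝ, q z.1 := Measure.quasiMeasurePreserving_fst.ae hq
  have h2 : ∀ᵐ z : ℝ × ℝ, q z.2 := Measure.quasiMeasurePreserving_snd.ae hq
  filter_upwards [h1, h2] with z a b using ⟨a, b⟩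

lemma IIf_bound (A B ε C₁ C₂ : ℝ) (f g : ℂ → ℂ)
    (hf : ∀ y, ‖f (gammaP A y)‖ ≤ C₁ * Real.exp (-(ε * |y|))) (hg : ∀ y, ‖g (gammaM B y)‖ ≤ C₂ * Real.exp (-(ε * |y|))) :
    ∀ᵐ z : ℝ × ℝ, ‖IIf A B f g z‖ ≤ C₁ * C₂ * (wt ((B - A) / 2) ε z.1 * wt ((B - A) / 2) ε z.2) := by
  filter_upwards [prod_ae _ (rr_ae ((B - A) / 2))] with z hz
  have h := (gap_inv A B z.1 z.2 hz.1 hz.2).2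
  unfold IIf
  rw [norm_mul, norm_mul, div_eq_mul_inv, norm_mul, norm_mul]
  have hf1 := hf z.1
  have hg1 := hg z.2
  have c1 : 0 ≤ C₁ * Real.exp (-(ε * |z.1|)) := (norm_nonneg _).trans hf1
  have c2 : 0 ≤ C₂ * Real.exp (-(ε * |z.2|)) := (norm_nonneg _).trans hg1
  calc _ ≤ (C₁ * Real.exp (-(ε * |z.1|))) * (C₂ * Real.exp (-(ε * |z.2|))) * ((Real.sqrt |rr ((B - A) / 2) z.1|)⁻¹ * (Real.sqrt |rr ((B - A) / 2) z.2|)⁻¹) * 1 * 1 := by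
        gcongr
        · exact norm_gPD _
        · exact norm_gMD _
    _ = _ := by unfold wt; ring

lemma IIf_int (A B ε C₁ C₂ : ℝ) (hε : 0 < ε) (f g : ℂ → ℂ) (mf : Measurable fun y => f (gammaP A y)) (mg : Measurable fun y => g (gammaM B y))
    (hf : ∀ y, ‖f (gammaP A y)‖ ≤ C₁ * Real.exp (-(ε * |y|))) (hg : ∀ y, ‖g (gammaM B y)‖ ≤ C₂ * Real.exp (-(ε * |y|))) :
    Integrable (IIf A B f g) := by
  have hi : Integrable (fun z : ℝ × ℝ => wt ((B - A) / 2) ε z.1 * wt ((B - A) / 2) ε z.2) :=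
    (wt_int _ ε hε).mul_prod (wt_int _ ε hε)
  exact (hi.const_mul (C₁ * C₂)).mono' (IIf_meas A B f g mf mg).aestronglyMeasurable (IIf_bound A B ε C₁ C₂ f g hf hg)

lemma II_bound (A B ε C₁ C₂ : ℝ) (hε : 0 < ε) (f g : ℂ → ℂ)
    (hf : ∀ y, ‖f (gammaP A y)‖ ≤ C₁ * Real.exp (-(ε * |y|))) (hg : ∀ y, ‖g (gammaM B y)‖ ≤ C₂ * Real.exp (-(ε * |y|))) :
    ‖II A B f g‖ ≤ C₁ * C₂ * (∫ y, wt ((B - A) / 2) ε y) ^ 2 := by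
  have hi : Integrable (fun z : ℝ × ℝ => wt ((B - A) / 2) ε z.1 * wt ((B - A) / 2) ε z.2) :=
    (wt_int _ ε hε).mul_prod (wt_int _ ε hε)
  unfold II
  rw [norm_mul]
  have h1 : ‖(1 / (2 * (Real.pi : ℂ) * I)) ^ 2‖ ≤ 1 := by
    rw [norm_pow]
    apply pow_le_one₀ (norm_nonneg _)
    have := Real.pi_gt_three
    rw [norm_div, norm_one, norm_mul, norm_mul, Complex.norm_I, Complex.norm_real, Real.norm_of_nonneg Real.pi_pos.le, Complex.norm_ofNat]
    rw [div_le_one (by positivity)]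
    linarith
  have h2 : ‖∫ p : ℝ × ℝ, IIf A B f g p‖ ≤ C₁ * C₂ * (∫ y, wt ((B - A) / 2) ε y) ^ 2 := by
    refine (norm_integral_le_of_norm_le (hi.const_mul (C₁ * C₂)) (IIf_bound A B ε C₁ C₂ f g hf hg)).trans (le_of_eq ?_)
    rw [MeasureTheory.integral_const_mul, pow_two]
    congr 1
    exact integral_prod_mul (wt ((B - A) / 2) ε) (wt ((B - A) / 2) ε)
  calc _ ≤ 1 * ‖∫ p : ℝ × ℝ, IIf A B f g p‖ := by gcongr
    _ ≤ _ := by rw [one_mul]; exact h2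

lemma II_tendsto (A B ε C₁ C₂ : ℝ) (hε : 0 < ε) {ι : Type*} {l : Filter ι} [l.IsCountablyGenerated] (f g : ι → ℂ → ℂ) (f₀ g₀ : ℂ → ℂ)
    (mf : ∀ i, Measurable fun y => f i (gammaP A y)) (mg : ∀ i, Measurable fun y => g i (gammaM B y))
    (hf : ∀ᶠ i in l, ∀ y, ‖f i (gammaP A y)‖ ≤ C₁ * Real.exp (-(ε * |y|))) (hg : ∀ᶠ i in l, ∀ y, ‖g i (gammaM B y)‖ ≤ C₂ * Real.exp (-(ε * |y|)))
    (tf : ∀ y, Tendsto (fun i => f i (gammaP A y)) l (𝓝 (f₀ (gammaP A y))))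
    (tg : ∀ y, Tendsto (fun i => g i (gammaM B y)) l (𝓝 (g₀ (gammaM B y)))) :
    Tendsto (fun i => II A B (f i) (g i)) l (𝓝 (II A B f₀ g₀)) := by
  have hi : Integrable (fun z : ℝ × ℝ => wt ((B - A) / 2) ε z.1 * wt ((B - A) / 2) ε z.2) :=
    (wt_int _ ε hε).mul_prod (wt_int _ ε hε)
  refine Tendsto.const_mul _ ?_
  refine tendsto_integral_filter_of_dominated_convergence _ (Eventually.of_forall fun i => (IIf_meas A B _ _ (mf i) (mg i)).aestronglyMeasurable) ?_ (hi.const_mul (C₁ * C₂)) ?_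
  · filter_upwards [hf, hg] with i h1 h2
    exact IIf_bound A B ε C₁ C₂ _ _ h1 h2
  · refine Eventually.of_forall fun z => ?_
    unfold IIf
    exact ((((tf z.1).mul (tg z.2)).div_const _).mul_const _).mul_const _

def segw (A B s : ℝ) : ℂ := (((A + B) / 2 : ℝ) : ℂ) + (s : ℂ) * I

def seg (A B a b : ℝ) : ℂ :=
  if A < B then (1 / (2 * (Real.pi : ℂ) * I)) *
    ∫ s in (-((B - A) / 2))..((B - A) / 2), cexp (a * segw A B s ^ 2 + b * segw A B s) * I
  else 0

lemma ray_prim (h H : ℂ → ℂ) (hh : Continuous h) (hH : ∀ z, HasDerivAt H (h z) z) (c e : ℂ) (R : ℝ) :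
    ∫ r in (0:ℝ)..R, h (c + r * e) * e = H (c + R * e) - H c := by
  have := intervalIntegral.integral_eq_sub_of_hasDerivAt (a := 0) (b := R) (f := fun r : ℝ => H (c + r * e)) (f' := fun r : ℝ => h (c + r * e) * e) ?_ ?_
  · rw [this]; simp
  · intro r _
    have hu : HasDerivAt (fun r : ℝ => c + r * e) e r := by
      have := ((Complex.ofRealCLM.hasDerivAt (x := r)).mul_const e).const_add c
      simpa using this
    exact (hH _).comp r hu
  · exact Continuous.intervalIntegrable (by fun_prop) _ _

lemma seg_arc (A B : ℝ) (hAB : A < B) (h : ℂ → ℂ) (hd : Differentiable ℂ h) :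
    ∫ y, (if rr ((B - A) / 2) y < 0 then h (gammaP A y) * gammaPD y else 0) =
      ∫ s in (-((B - A) / 2))..((B - A) / 2), h (segw A B s) * I := by
  obtain ⟨H, hH⟩ := (IsConservativeOn.isExactOn_univ hd.continuous hd.differentiableOn.isConservativeOn)
  replace hH : ∀ z, HasDerivAt H (h z) z := fun z => hH z trivial
  have hc := hd.continuous
  set p := (B - A) / 2 with hp
  have hp0 : 0 < p := by rw [hp]; linarith
  have hs : 0 < Real.sqrt 2 := by positivity
  set R := Real.sqrt 2 * p with hR
  have hR0 : 0 < R := by positivity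
  have hrr : ∀ r : ℝ, 0 < r → (rr p r < 0 ↔ r < R) := by
    intro r hr
    unfold rr
    rw [abs_of_pos hr, sub_neg, div_lt_iff₀ hs, mul_comm p]
  have half : ∀ e : ℂ, (IntegrableOn (fun r : ℝ => if rr p r < 0 then h (A + r * e) * e else 0) (Set.Ioi 0)) ∧
      ∫ r in Set.Ioi (0:ℝ), (if rr p r < 0 then h (A + r * e) * e else 0) = H (A + R * e) - H A := by
    intro e
    have e1 : Set.EqOn (Set.indicator (Set.Iio R) (fun r : ℝ => h (A + r * e) * e)) (fun r : ℝ => if rr p r < 0 then h (A + r * e) * e else 0) (Set.Ioi 0) := by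
      intro r hr
      simp only [Set.indicator_apply, Set.mem_Iio]
      exact if_congr (hrr r hr).symm rfl rfl
    have i1 : IntegrableOn (Set.indicator (Set.Iio R) (fun r : ℝ => h (A + r * e) * e)) (Set.Ioi 0) := by
      rw [IntegrableOn, integrable_indicator_iff measurableSet_Iio, IntegrableOn, Measure.restrict_restrict measurableSet_Iio]
      have : ContinuousOn (fun r : ℝ => h (A + r * e) * e) (Set.Icc 0 R) := by fun_prop
      refine (this.integrableOn_Icc).mono_set ?_
      rintro x ⟨h1, h2⟩
      exact ⟨le_of_lt h2, le_of_lt h1⟩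
    refine ⟨i1.congr_fun e1 measurableSet_Ioi, ?_⟩
    rw [← setIntegral_congr_fun measurableSet_Ioi e1, setIntegral_indicator measurableSet_Iio, Set.Ioi_inter_Iio, ← integral_Ioc_eq_integral_Ioo, ← intervalIntegral.integral_of_le hR0.le,
      ray_prim h H hc hH]
  obtain ⟨i1, e1⟩ := half (cexp ((Real.pi / 4 : ℝ) * I))
  obtain ⟨i2, e2⟩ := half (cexp ((-(Real.pi / 4) : ℝ) * I))
  have E1 : Set.EqOn (fun r : ℝ => if rr p r < 0 then h (A + r * cexp ((Real.pi / 4 : ℝ) * I)) * cexp ((Real.pi / 4 : ℝ) * I) else 0)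
      (fun y => if rr p y < 0 then h (gammaP A y) * gammaPD y else 0) (Set.Ioi 0) := by
    intro r hr
    simp only [gP_pos A r hr, gPD_pos r hr]
  have E2 : Set.EqOn (fun r : ℝ => - (if rr p r < 0 then h (A + r * cexp ((-(Real.pi / 4) : ℝ) * I)) * cexp ((-(Real.pi / 4) : ℝ) * I) else 0))
      (fun y => if rr p (-y) < 0 then h (gammaP A (-y)) * gammaPD (-y) else 0) (Set.Ioi 0) := by
    intro r hr
    have : rr p (-r) = rr p r := by unfold rr; rw [abs_neg]
    simp only [gP_neg A r hr, gPD_neg r hr, this]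
    split_ifs <;> simp
  obtain ⟨-, h4⟩ := int_half (fun y => if rr p y < 0 then h (gammaP A y) * gammaPD y else 0) (i1.congr_fun E1 measurableSet_Ioi) (IntegrableOn.congr_fun i2.neg E2 measurableSet_Ioi)
  rw [h4, ← setIntegral_congr_fun measurableSet_Ioi E1, ← setIntegral_congr_fun measurableSet_Ioi E2, MeasureTheory.integral_neg, e1, e2]
  have h5 := intervalIntegral.integral_eq_sub_of_hasDerivAt (a := -p) (b := p) (f := fun s : ℝ => H (segw A B s)) (f' := fun s : ℝ => h (segw A B s) * I) ?_ ?_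
  · rw [h5]
    have w1 : (A : ℂ) + R * cexp ((Real.pi / 4 : ℝ) * I) = segw A B p := by
      rw [e_pi4, segw, hR, hp]; push_cast
      have := csqrt2_ne
      field_simp; ring
    have w2 : (A : ℂ) + R * cexp ((-(Real.pi / 4) : ℝ) * I) = segw A B (-p) := by
      rw [e_mpi4, segw, hR, hp]; push_cast
      have := csqrt2_ne
      field_simp; ring
    rw [w1, w2]; ring
  · intro r _
    have hu : HasDerivAt (fun r : ℝ => segw A B r) I r := by
      have := ((Complex.ofRealCLM.hasDerivAt (x := r)).mul_const I).const_add (((A + B) / 2 : ℝ) : ℂ)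
      simpa [segw] using this
    exact (hH _).comp r hu
  · unfold segw
    exact Continuous.intervalIntegrable (by fun_prop) _ _

lemma normP (s y A σ : ℝ) : ‖cexp (s * gammaP A σ ^ 2 - y * gammaP A σ)‖ =
    Real.exp (s * A ^ 2 - y * A) * Real.exp (-((y - 2 * s * A) / Real.sqrt 2 * |σ|)) := by
  rw [Complex.norm_exp, ← Real.exp_add]
  congr 1
  have e : (s * gammaP A σ ^ 2 - y * gammaP A σ).re = s * ((gammaP A σ).re ^ 2 - (gammaP A σ).im ^ 2) - y * (gammaP A σ).re := by
    simp [pow_two]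
  rw [e, gammaP_re, gammaP_im, div_pow, ← sq_abs σ]
  field_simp; ring

lemma normM (s y B σ : ℝ) : ‖cexp (-s * gammaM B σ ^ 2 + y * gammaM B σ)‖ =
    Real.exp (-s * B ^ 2 + y * B) * Real.exp (-((y - 2 * s * B) / Real.sqrt 2 * |σ|)) := by
  rw [Complex.norm_exp, ← Real.exp_add]
  congr 1
  have e : (-s * gammaM B σ ^ 2 + y * gammaM B σ).re = -s * ((gammaM B σ).re ^ 2 - (gammaM B σ).im ^ 2) + y * (gammaM B σ).re := by
    simp [pow_two]
  rw [e, gammaM_re, gammaM_im, div_pow, ← sq_abs σ]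
  field_simp; ring

/-- distance from a real point to the contours -/
lemma distP (A α σ : ℝ) (h : A < α) : (α - A) / 2 ≤ ‖(α : ℂ) - gammaP A σ‖ := by
  have hs : 0 < Real.sqrt 2 := by positivity
  set ρ := |σ| / Real.sqrt 2 with hρ
  have h1 := Complex.abs_re_le_norm ((α : ℂ) - gammaP A σ)
  have h2 := Complex.abs_im_le_norm ((α : ℂ) - gammaP A σ)
  rw [sub_re, gammaP_re, ofReal_re] at h1
  rw [sub_im, gammaP_im, ofReal_im, zero_sub, abs_neg, abs_div, abs_of_pos hs] at h2
  have h3 := le_abs_self (α - (A + |σ| / Real.sqrt 2))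
  linarith

variable {N : ℕ}

def FF (α β : Fin N → ℝ) (v : ℂ) : ℂ := (∏ i, (v - β i)) / (∏ i, ((α i : ℂ) - v))

end AW

namespace AW

variable {N : ℕ}

lemma expP_meas (s y A : ℝ) : Measurable fun σ => cexp (s * gammaP A σ ^ 2 - y * gammaP A σ) := by
  have := (gP_cont A).measurable
  fun_prop

lemma expM_meas (s y A : ℝ) : Measurable fun σ => cexp (-s * gammaM A σ ^ 2 + y * gammaM A σ) := by
  have := (gM_cont A).measurable
  fun_prop

lemma cP_int (α s y A : ℝ) (hA : A < α) (hy : 2 * s * A < y) :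
    Integrable fun σ => cexp (s * gammaP A σ ^ 2 - y * gammaP A σ) / (α - gammaP A σ) * gammaPD σ := by
  have hs : 0 < Real.sqrt 2 := by positivity
  have hε : 0 < (y - 2 * s * A) / Real.sqrt 2 := div_pos (by linarith) hs
  refine ((int_exp_abs' _ hε).const_mul (Real.exp (s * A ^ 2 - y * A) * (2 / (α - A)))).mono'
    (((expP_meas s y A).div (measurable_const.sub (gP_cont A).measurable)).mul gPD_meas).aestronglyMeasurable (Eventually.of_forall fun σ => ?_)
  have h1 := distP A α σ hA
  have h0 : 0 < (α - A) / 2 := by linarith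
  rw [norm_mul, norm_div, normP]
  calc _ ≤ Real.exp (s * A ^ 2 - y * A) * Real.exp (-((y - 2 * s * A) / Real.sqrt 2 * |σ|)) / ((α - A) / 2) * 1 := by
        gcongr
        exact norm_gPD _
    _ = _ := by field_simp

lemma nonreal_ae : ∀ᵐ y : ℝ, y ≠ 0 := by
  have := (measure_singleton (μ := (volume : Measure ℝ)) (0:ℝ))
  rw [ae_iff]; simpa using this

lemma inner_u (s B A y₂ σ : ℝ) (hs : 0 ≤ s) (hy : 2 * s * B < y₂) (hσ : rr ((B - A) / 2) σ ≠ 0) :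
    cM B (fun u => cexp (-s * u ^ 2 + y₂ * u) / (u - gammaP A σ)) =
      if rr ((B - A) / 2) σ < 0 then 2 * Real.pi * I * cexp (-s * gammaP A σ ^ 2 + y₂ * gammaP A σ) else 0 := by
  have hs2 : 0 < Real.sqrt 2 := by positivity
  have key : |(gammaP A σ).im| < B - (gammaP A σ).re ↔ rr ((B - A) / 2) σ < 0 := by
    rw [gammaP_im, gammaP_re, abs_div, abs_of_pos hs2]; unfold rr
    constructor <;> intro h <;> linarith
  have key2 : |(gammaP A σ).im| ≤ B - (gammaP A σ).re ↔ rr ((B - A) / 2) σ ≤ 0 := by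
    rw [gammaP_im, gammaP_re, abs_div, abs_of_pos hs2]; unfold rr
    constructor <;> intro h <;> linarith
  split_ifs with h
  · exact (cM_left s y₂ B _ hs hy (key.2 h)).2
  · refine (cM_right s y₂ B _ hs hy ?_).2
    rw [key2]
    intro h'
    exact hσ (le_antisymm h' (not_lt.1 h))

lemma IIf_EE (A B s₁ s₂ y₁ y₂ : ℝ) (hs₂ : 0 < s₂) (h₁ : 2 * s₁ * A < y₁) (h₂ : 2 * s₂ * B < y₂) :
    Integrable (IIf A B (fun v => cexp (s₁ * v ^ 2 - y₁ * v)) (fun u => cexp (-s₂ * u ^ 2 + y₂ * u))) ∧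
    (1 / (2 * (Real.pi : ℂ) * I)) ^ 2 * ∫ p, IIf A B (fun v => cexp (s₁ * v ^ 2 - y₁ * v)) (fun u => cexp (-s₂ * u ^ 2 + y₂ * u)) p = - seg A B (s₁ - s₂) (y₂ - y₁) := by
  have hs : 0 < Real.sqrt 2 := by positivity
  have hε : 0 < min ((y₁ - 2 * s₁ * A) / Real.sqrt 2) ((y₂ - 2 * s₂ * B) / Real.sqrt 2) :=
    lt_min (div_pos (by linarith) hs) (div_pos (by linarith) hs)
  have hi : Integrable (IIf A B (fun v => cexp (s₁ * v ^ 2 - y₁ * v)) (fun u => cexp (-s₂ * u ^ 2 + y₂ * u))) := by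
    refine IIf_int A B _ (Real.exp (s₁ * A ^ 2 - y₁ * A)) (Real.exp (-s₂ * B ^ 2 + y₂ * B)) hε _ _ (expP_meas _ _ _) (expM_meas _ _ _) ?_ ?_
    · intro y
      rw [normP]
      gcongr
      exact min_le_left _ _
    · intro y
      rw [normM]
      gcongr
      exact min_le_right _ _
  refine ⟨hi, ?_⟩
  rw [Measure.volume_eq_prod, integral_prod _ (by rwa [Measure.volume_eq_prod] at hi)]
  have e1 : ∀ᵐ σ : ℝ, (∫ y, IIf A B (fun v => cexp (s₁ * v ^ 2 - y₁ * v)) (fun u => cexp (-s₂ * u ^ 2 + y₂ * u)) (σ, y)) =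
      (-(2 * Real.pi * I)) * (if rr ((B - A) / 2) σ < 0 then (fun w => cexp ((s₁ - s₂ : ℝ) * w ^ 2 + (y₂ - y₁ : ℝ) * w)) (gammaP A σ) * gammaPD σ else 0) := by
    filter_upwards [rr_ae ((B - A) / 2)] with σ hσ
    have := inner_u s₂ B A y₂ σ hs₂.le h₂ hσ
    unfold cM at this
    have e2 : ∀ y, IIf A B (fun v => cexp (s₁ * v ^ 2 - y₁ * v)) (fun u => cexp (-s₂ * u ^ 2 + y₂ * u)) (σ, y) =
        (-(cexp (s₁ * gammaP A σ ^ 2 - y₁ * gammaP A σ) * gammaPD σ)) * (cexp (-s₂ * gammaM B y ^ 2 + y₂ * gammaM B y) / (gammaM B y - gammaP A σ) * gammaMD y) := by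
      intro y
      unfold IIf
      rw [← neg_sub (gammaM B y) (gammaP A σ), div_neg]
      ring
    simp_rw [e2]
    rw [MeasureTheory.integral_const_mul, this]
    split_ifs
    · have : cexp ((s₁ - s₂ : ℝ) * gammaP A σ ^ 2 + (y₂ - y₁ : ℝ) * gammaP A σ) = cexp (s₁ * gammaP A σ ^ 2 - y₁ * gammaP A σ) * cexp (-s₂ * gammaP A σ ^ 2 + y₂ * gammaP A σ) := by
        rw [← Complex.exp_add]; push_cast; ring_nf
      simp only [this]; ring
    · simp
  rw [integral_congr_ae e1, MeasureTheory.integral_const_mul]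
  have hpi : (2 * (Real.pi : ℂ) * I) ≠ 0 := by simp [Real.pi_ne_zero]
  unfold seg
  split_ifs with hAB
  · have hsa := seg_arc A B hAB (fun w => cexp ((s₁ - s₂ : ℝ) * w ^ 2 + (y₂ - y₁ : ℝ) * w)) (by fun_prop)
    rw [hsa]
    field_simp
  · have : ∀ σ, ¬ rr ((B - A) / 2) σ < 0 := by
      intro σ; unfold rr
      have : 0 ≤ |σ| / Real.sqrt 2 := by positivity
      linarith
    simp [this]

lemma pre_contour (α β : Fin N → ℝ) (hα : Function.Injective α) (hβ : Function.Injective β)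
    (A B s₁ s₂ y₁ y₂ : ℝ) (hs₁ : 0 < s₁) (hs₂ : 0 < s₂) (hA : ∀ k, A < α k) (hB : ∀ k, β k < B)
    (h₁ : 2 * s₁ * A < y₁) (h₂ : 2 * s₂ * B < y₂) :
    ((∑ j, (∑ k, Cco α β j k * Eal (α k) s₁ y₁) * Real.exp (β j * y₂ - s₂ * β j ^ 2) : ℝ) : ℂ) =
      II A B (fun v => cexp (s₁ * v ^ 2 - y₁ * v) * FF α β v) (fun u => cexp (-s₂ * u ^ 2 + y₂ * u) / FF α β u)
      + seg A B (s₁ - s₂) (y₂ - y₁) := by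
  have hpi : (2 * (Real.pi : ℂ) * I) ≠ 0 := by simp [Real.pi_ne_zero]
  have hs : 0 < Real.sqrt 2 := by positivity
  obtain ⟨iE, eE⟩ := IIf_EE A B s₁ s₂ y₁ y₂ hs₂ h₁ h₂
  have hψ : ∀ j, Integrable (fun r => cexp (-s₂ * gammaM B r ^ 2 + y₂ * gammaM B r) / (gammaM B r - β j) * gammaMD r) ∧
      cM B (fun u => cexp (-s₂ * u ^ 2 + y₂ * u) / (u - β j)) = 2 * Real.pi * I * cexp (-s₂ * (β j:ℂ) ^ 2 + y₂ * β j) := by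
    intro j
    exact cM_left s₂ y₂ B (β j) hs₂.le h₂ (by simpa using hB j)
  have hφ := fun k => cP_Eal (α k) s₁ y₁ A hs₁ (hA k) h₁
  have iφ := fun k => cP_int (α k) s₁ y₁ A (hA k) h₁
  -- the double integral
  set T : Fin N → Fin N → ℝ × ℝ → ℂ := fun j k p => (cexp (s₁ * gammaP A p.1 ^ 2 - y₁ * gammaP A p.1) / (α k - gammaP A p.1) * gammaPD p.1) *
    (cexp (-s₂ * gammaM B p.2 ^ 2 + y₂ * gammaM B p.2) / (gammaM B p.2 - β j) * gammaMD p.2) with hT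
  have iT : ∀ j k, Integrable (T j k) := fun j k => (iφ k).mul_prod (hψ j).1
  have eT : ∀ j k, ∫ p, T j k p = (2 * Real.pi * I * (Eal (α k) s₁ y₁ : ℝ)) * (2 * Real.pi * I * cexp (-s₂ * (β j:ℂ) ^ 2 + y₂ * β j)) := by
    intro j k
    rw [← hφ k, ← (hψ j).2]
    unfold cP cM
    exact integral_prod_mul (μ := volume) (ν := volume) (fun σ => cexp (s₁ * gammaP A σ ^ 2 - y₁ * gammaP A σ) / (α k - gammaP A σ) * gammaPD σ) (fun r => cexp (-s₂ * gammaM B r ^ 2 + y₂ * gammaM B r) / (gammaM B r - β j) * gammaMD r)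
  have e0 : ((∑ j, (∑ k, Cco α β j k * Eal (α k) s₁ y₁) * Real.exp (β j * y₂ - s₂ * β j ^ 2) : ℝ) : ℂ) =
      (1 / (2 * (Real.pi : ℂ) * I)) ^ 2 * ∫ p, ∑ j, ∑ k, (Cco α β j k : ℂ) * T j k p := by
    rw [integral_finsetSum _ (fun j _ => integrable_finsetSum _ fun k _ => (iT j k).const_mul _), Finset.mul_sum]
    push_cast
    refine Finset.sum_congr rfl fun j _ => ?_
    rw [integral_finsetSum _ (fun k _ => (iT j k).const_mul _), Finset.mul_sum, Finset.sum_mul]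
    refine Finset.sum_congr rfl fun k _ => ?_
    rw [MeasureTheory.integral_const_mul, eT]
    have : cexp ((β j:ℂ) * y₂ - s₂ * (β j:ℂ) ^ 2) = cexp (-s₂ * (β j:ℂ) ^ 2 + y₂ * β j) := by
      congr 1; ring
    rw [this]
    field_simp
  have e1 : (fun p => ∑ j, ∑ k, (Cco α β j k : ℂ) * T j k p) =ᵐ[volume] fun p =>
      IIf A B (fun v => cexp (s₁ * v ^ 2 - y₁ * v) * FF α β v) (fun u => cexp (-s₂ * u ^ 2 + y₂ * u) / FF α β u) p
       - IIf A B (fun v => cexp (s₁ * v ^ 2 - y₁ * v)) (fun u => cexp (-s₂ * u ^ 2 + y₂ * u)) p := by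
    filter_upwards [prod_ae _ (rr_ae ((B - A) / 2)), prod_ae _ nonreal_ae] with p hp hp0
    have hg := (gap_inv A B p.1 p.2 hp.1 hp.2).1
    have nrv : ∀ x : ℝ, gammaP A p.1 ≠ x := by
      intro x hx
      have := congrArg Complex.im hx
      rw [gammaP_im, ofReal_im, div_eq_zero_iff] at this
      rcases this with h | h
      · exact hp0.1 h
      · exact hs.ne' h
    have nru : ∀ x : ℝ, gammaM B p.2 ≠ x := by
      intro x hx
      have := congrArg Complex.im hx
      rw [gammaM_im, ofReal_im, div_eq_zero_iff] at this
      rcases this with h | h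
      · exact hp0.2 h
      · exact hs.ne' h
    have hres := resolvent α β hα hβ (gammaP A p.1) (gammaM B p.2) (fun i => nrv _) (fun i => nrv _) (fun i => nru _) (fun i => nru _) (by
      intro h; apply hg; rw [h, sub_self])
    have e3 : ∑ j, ∑ k, (Cco α β j k : ℂ) * T j k p = (∑ j, (∑ k, (Cco α β j k:ℂ)/((α k:ℂ)-gammaP A p.1)) * (1/(gammaM B p.2-β j))) *
        (cexp (s₁ * gammaP A p.1 ^ 2 - y₁ * gammaP A p.1) * cexp (-s₂ * gammaM B p.2 ^ 2 + y₂ * gammaM B p.2) * gammaPD p.1 * gammaMD p.2) := by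
      rw [Finset.sum_mul]
      refine Finset.sum_congr rfl fun j _ => ?_
      rw [Finset.sum_mul, Finset.sum_mul]
      refine Finset.sum_congr rfl fun k _ => ?_
      simp only [hT]
      ring
    rw [e3, hres]
    unfold IIf FF
    beta_reduce
    generalize cexp (s₁ * gammaP A p.1 ^ 2 - y₁ * gammaP A p.1) = E1
    generalize cexp (-s₂ * gammaM B p.2 ^ 2 + y₂ * gammaM B p.2) = E2
    generalize (∏ i, (gammaP A p.1 - (β i:ℂ))) / (∏ i, ((α i:ℂ) - gammaP A p.1)) = F1
    generalize (∏ i, (gammaM B p.2 - (β i:ℂ))) / (∏ i, ((α i:ℂ) - gammaM B p.2)) = F2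
    ring
  have iF : Integrable (IIf A B (fun v => cexp (s₁ * v ^ 2 - y₁ * v) * FF α β v) (fun u => cexp (-s₂ * u ^ 2 + y₂ * u) / FF α β u)) := by
    have h3 : Integrable (fun p => ∑ j, ∑ k, (Cco α β j k : ℂ) * T j k p) := integrable_finsetSum _ fun j _ => integrable_finsetSum _ fun k _ => (iT j k).const_mul _
    have := (h3.congr e1).add iE
    refine this.congr (Eventually.of_forall fun p => ?_)
    simp
  rw [e0, integral_congr_ae e1, MeasureTheory.integral_sub iF iE, mul_sub, eE]
  unfold II
  ring

end AW

namespace AW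

lemma hlog (ε x : ℝ) (hε : ε = 1 ∨ ε = -1) (hx : 0 ≤ x) :
    ε / 2 * Real.log (1 + 2 * ε * x + 2 * x ^ 2) - x ≤ -(2 / 9) * (x ^ 3 / (1 + x ^ 2)) := by
  have hε2 : ε ^ 2 = 1 := by rcases hε with h | h <;> rw [h] <;> norm_num
  have hq : ∀ x : ℝ, 0 < 1 + 2 * ε * x + 2 * x ^ 2 := fun x => by
    nlinarith [sq_nonneg (1 + 2 * ε * x), sq_nonneg x, sq_nonneg (ε * x), sq_nonneg (1 + ε * x)]
  set F : ℝ → ℝ := fun x => ε / 2 * Real.log (1 + 2 * ε * x + 2 * x ^ 2) - x + (2 / 9) * (x ^ 3 / (1 + x ^ 2)) with hF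
  have hd : ∀ x, HasDerivAt F (ε / 2 * ((2 * ε + 4 * x) / (1 + 2 * ε * x + 2 * x ^ 2)) - 1 + (2 / 9) * ((3 * x ^ 2 * (1 + x ^ 2) - x ^ 3 * (2 * x)) / (1 + x ^ 2) ^ 2)) x := by
    intro x
    have h1 : HasDerivAt (fun x : ℝ => 1 + 2 * ε * x + 2 * x ^ 2) (2 * ε + 4 * x) x := by
      have := (((hasDerivAt_id x).const_mul (2 * ε)).const_add 1).add ((hasDerivAt_pow 2 x).const_mul 2)
      refine this.congr_deriv ?_
      norm_num; ring
    have h2 : HasDerivAt (fun x : ℝ => 1 + x ^ 2) (2 * x) x := by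
      have := (hasDerivAt_pow 2 x).const_add 1
      refine this.congr_deriv ?_
      norm_num
    have h3 : HasDerivAt (fun x : ℝ => x ^ 3) (3 * x ^ 2) x := by
      have := (hasDerivAt_pow 3 x)
      refine this.congr_deriv ?_
      norm_num
    exact (((h1.log (hq x).ne').const_mul (ε / 2)).sub (hasDerivAt_id x)).add ((h3.fun_div h2 (by positivity)).const_mul (2 / 9))
  have ha : AntitoneOn F (Set.Ici 0) := by
    apply antitoneOn_of_deriv_nonpos (convex_Ici 0)
    · exact fun x _ => (hd x).continuousAt.continuousWithinAt
    · exact fun x _ => (hd x).differentiableAt.differentiableWithinAt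
    · intro x _
      rw [(hd x).deriv]
      have q := hq x
      have p : 0 < 1 + x ^ 2 := by positivity
      have e1 : ε / 2 * ((2 * ε + 4 * x) / (1 + 2 * ε * x + 2 * x ^ 2)) - 1 = -(2 * x ^ 2 / (1 + 2 * ε * x + 2 * x ^ 2)) := by
        have hnum : ε * (2 * ε + 4 * x) / 2 = (1 + 2 * ε * x + 2 * x ^ 2) - 2 * x ^ 2 := by linear_combination hε2
        rw [← mul_div_assoc, div_mul_eq_mul_div, hnum, sub_div, div_self q.ne']; ring
      rw [e1]
      have e2 : (2 / 3) * (x ^ 2 / (1 + x ^ 2)) ≤ 2 * x ^ 2 / (1 + 2 * ε * x + 2 * x ^ 2) := by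
        rw [← mul_div_assoc, div_le_div_iff₀ p q]
        have : 1 + 2 * ε * x + 2 * x ^ 2 ≤ 3 * (1 + x ^ 2) := by nlinarith [sq_nonneg (ε - x)]
        nlinarith [sq_nonneg x]
      have e3 : (3 * x ^ 2 * (1 + x ^ 2) - x ^ 3 * (2 * x)) / (1 + x ^ 2) ^ 2 ≤ 3 * (x ^ 2 / (1 + x ^ 2)) := by
        rw [← mul_div_assoc, div_le_div_iff₀ (by positivity) p]
        have h0 : 0 ≤ x ^ 3 * (2 * x) := by nlinarith [sq_nonneg (x ^ 2)]
        nlinarith [mul_nonneg h0 p.le]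
      linarith
  have := ha (Set.mem_Ici.2 le_rfl) (Set.mem_Ici.2 hx) hx
  simp only [hF] at this
  norm_num at this
  linarith

lemma log3 (s : ℝ) (hs : |s| ≤ 1 / 2) : |Real.log (1 + s) - s + s ^ 2 / 2| ≤ 2 * |s| ^ 3 := by
  have := Real.abs_log_sub_add_sum_range_le (x := -s) (by rw [abs_neg]; linarith) 2
  rw [Finset.sum_range_succ, Finset.sum_range_one, abs_neg] at this
  norm_num at this
  have h2 : |s| ^ 3 / (1 - |s|) ≤ 2 * |s| ^ 3 := by
    rw [div_le_iff₀ (by linarith)]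
    nlinarith [pow_nonneg (abs_nonneg s) 3]
  refine le_trans (le_of_eq ?_) (this.trans h2)
  congr 1; ring

lemma fac (ε d A ρ : ℝ) (v : ℂ) (hε : ε = 1 ∨ ε = -1) (hd : 0 < d) (hA : |d * A| ≤ 1 / 2) (hρ : 0 ≤ ρ)
    (h1 : v.re = A + ε * ρ) (h2 : v.im ^ 2 = ρ ^ 2) :
    0 < ‖1 + d * v‖ ∧ ε * (Real.log ‖1 + d * v‖ - d * v.re + d ^ 2 * (v.re ^ 2 - v.im ^ 2) / 2) ≤
      d ^ 3 * (2 * |A| ^ 3 + 2 * A ^ 2 * ρ - (1 / 16) * (ρ ^ 3 / (1 + 4 * d ^ 2 * ρ ^ 2))) := by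
  have hε2 : ε ^ 2 = 1 := by rcases hε with h | h <;> rw [h] <;> norm_num
  have hεa : |ε| = 1 := by rcases hε with h | h <;> rw [h] <;> norm_num
  have hl := abs_le.1 hA
  have hp : 0 < 1 + d * A := by linarith
  set x := d * ρ / (1 + d * A) with hx
  have hx0 : 0 ≤ x := by positivity
  have hxe : d * ρ = x * (1 + d * A) := by rw [hx]; field_simp
  have hq : 0 < 1 + 2 * ε * x + 2 * x ^ 2 := by
    nlinarith [sq_nonneg (1 + 2 * ε * x), sq_nonneg x, sq_nonneg (ε * x), sq_nonneg (1 + ε * x)]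
  have hn : ‖1 + d * v‖ ^ 2 = (1 + d * A) ^ 2 * (1 + 2 * ε * x + 2 * x ^ 2) := by
    rw [← Complex.normSq_eq_norm_sq, Complex.normSq_apply]
    have a1 : (1 + d * v).re = 1 + d * v.re := by simp
    have a2 : (1 + d * v).im = d * v.im := by simp
    rw [a1, a2, h1]
    have : d * v.im * (d * v.im) = (d * ρ) ^ 2 := by rw [mul_pow, ← h2]; ring
    rw [this]
    have : 1 + d * (A + ε * ρ) = (1 + d * A) + ε * (d * ρ) := by ring
    rw [this, hxe]
    linear_combination (x ^ 2 * (1 + d * A) ^ 2) * hε2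
  have hpos : 0 < ‖1 + d * v‖ := by
    have h0 : 0 < ‖1 + d * v‖ ^ 2 := by rw [hn]; positivity
    exact lt_of_le_of_ne (norm_nonneg _) (fun h => by rw [← h] at h0; norm_num at h0)
  refine ⟨hpos, ?_⟩
  have hlogn : Real.log ‖1 + d * v‖ = Real.log (1 + d * A) + Real.log (1 + 2 * ε * x + 2 * x ^ 2) / 2 := by
    have := congrArg Real.log hn
    rw [Real.log_pow, Real.log_mul (by positivity) hq.ne', Real.log_pow] at this
    push_cast at this
    linarith
  have b1 := log3 (d * A) hA
  have b1' : ε * (Real.log (1 + d * A) - d * A + (d * A) ^ 2 / 2) ≤ 2 * |d * A| ^ 3 := by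
    refine (le_abs_self _).trans ?_
    rw [abs_mul, hεa, one_mul]; exact b1
  have b2 := hlog ε x hε hx0
  have b3 : d ^ 3 * (1 / 16) * (ρ ^ 3 / (1 + 4 * d ^ 2 * ρ ^ 2)) ≤ (2 / 9) * (x ^ 3 / (1 + x ^ 2)) := by
    have l1 : (2 / 3) * (d * ρ) ≤ x := by rw [hxe]; nlinarith
    have l2 : x ≤ 2 * (d * ρ) := by rw [hxe]; nlinarith
    have z : 0 ≤ d * ρ := by positivity
    have l3 : (8 / 27) * (d * ρ) ^ 3 ≤ x ^ 3 := by
      have := pow_le_pow_left₀ (by positivity) l1 3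
      refine le_trans (le_of_eq ?_) this
      ring
    have l4 : x ^ 2 ≤ 4 * d ^ 2 * ρ ^ 2 := by
      have := pow_le_pow_left₀ hx0 l2 2
      refine this.trans (le_of_eq ?_)
      ring
    calc _ = (1 / 16) * (d * ρ) ^ 3 / (1 + 4 * d ^ 2 * ρ ^ 2) := by ring
      _ ≤ ((2 / 9) * x ^ 3) / (1 + x ^ 2) := by
        have := pow_nonneg z 3
        exact div_le_div₀ (by positivity) (by linarith) (by positivity) (by linarith)
      _ = _ := by ring
  have b4 : d * A * (x * d * A) ≤ d ^ 3 * 2 * A ^ 2 * ρ := by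
    have l2 : x ≤ 2 * (d * ρ) := by rw [hxe]; nlinarith
    calc _ = (d * A) ^ 2 * x := by ring
      _ ≤ (d * A) ^ 2 * (2 * (d * ρ)) := by gcongr
      _ = _ := by ring
  have e : ε * (Real.log ‖1 + d * v‖ - d * v.re + d ^ 2 * (v.re ^ 2 - v.im ^ 2) / 2) =
      ε * (Real.log (1 + d * A) - d * A + (d * A) ^ 2 / 2) + (ε / 2 * Real.log (1 + 2 * ε * x + 2 * x ^ 2) - x) + d * A * (x * d * A) := by
    rw [hlogn, h1, h2]
    have hz : d * A * (x * d * A) = d * A * (d * ρ) + x - d * ρ := by rw [hxe]; ring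
    rw [hz]
    linear_combination (d * ρ * (d * A) - d * ρ + ε * d ^ 2 * ρ ^ 2 / 2) * hε2
  rw [e]
  have : |d * A| ^ 3 = d ^ 3 * |A| ^ 3 := by rw [abs_mul, abs_of_pos hd, mul_pow]
  rw [this] at b1'
  linarith

lemma cub (M δ ρ : ℝ) (hM : 1 ≤ M) (hδ : 8 * δ ^ 2 * M ≤ 1) (hρ : 0 ≤ ρ) :
    M * ρ - 2 * M ^ 2 ≤ ρ ^ 3 / (1 + 4 * δ ^ 2 * ρ ^ 2) := by
  have hp : 0 < 1 + 4 * δ ^ 2 * ρ ^ 2 := by positivity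
  by_cases h : 2 * M ≤ ρ ^ 2
  · rw [le_div_iff₀ hp]
    have h1 : M * (1 + 4 * δ ^ 2 * ρ ^ 2) ≤ ρ ^ 2 := by nlinarith [sq_nonneg ρ]
    nlinarith [mul_le_mul_of_nonneg_left h1 hρ, sq_nonneg M]
  · have h0 : 0 ≤ ρ ^ 3 / (1 + 4 * δ ^ 2 * ρ ^ 2) := by positivity
    have : ρ ≤ 2 * M := by nlinarith
    nlinarith

def Hb {n : ℕ} (d : Fin n → ℝ) (v : ℂ) : ℂ := ∏ i, ((1 + d i * v) * cexp (-(d i * v) + (d i) ^ 2 * v ^ 2 / 2))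

lemma Hb_bound_aux (A K : ℝ) : ∃ C δ : ℝ, 0 < δ ∧ ∀ (ε : ℝ), (ε = 1 ∨ ε = -1) → ∀ (n : ℕ) (d : Fin n → ℝ), (∀ i, 0 < d i) → (∀ i, d i ≤ δ) →
    1 ≤ ∑ i, d i ^ 3 → ∑ i, d i ^ 3 ≤ 2 → ∀ (ρ : ℝ) (v : ℂ), 0 ≤ ρ → v.re = A + ε * ρ → v.im ^ 2 = ρ ^ 2 →
      0 < ‖Hb d v‖ ∧ ε * Real.log ‖Hb d v‖ ≤ C - K * ρ := by
  set M := max 1 (16 * (4 * A ^ 2 + K)) with hM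
  have hM1 : 1 ≤ M := le_max_left _ _
  have hM2 : 16 * (4 * A ^ 2 + K) ≤ M := le_max_right _ _
  refine ⟨4 * |A| ^ 3 + M ^ 2, min (1 / (2 * (|A| + 1))) (1 / (4 * M)), by positivity, ?_⟩
  intro ε hε n d hd0 hd hS1 hS2 ρ v hρ h1 h2
  set δ := min (1 / (2 * (|A| + 1))) (1 / (4 * M)) with hδ
  have hδ0 : 0 < δ := by positivity
  have hδA : δ * |A| ≤ 1 / 2 := by
    have : δ ≤ 1 / (2 * (|A| + 1)) := min_le_left _ _
    rw [le_div_iff₀ (by positivity)] at this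
    linarith
  have hδM : 8 * δ ^ 2 * M ≤ 1 := by
    have : δ ≤ 1 / (4 * M) := min_le_right _ _
    rw [le_div_iff₀ (by positivity)] at this
    have h4 : δ ≤ 1 / 4 := by nlinarith
    nlinarith
  have hf := fun i => fac ε (d i) A ρ v hε (hd0 i) (by
    rw [abs_mul, abs_of_pos (hd0 i)]
    exact (mul_le_mul_of_nonneg_right (hd i) (abs_nonneg _)).trans hδA) hρ h1 h2
  have hfp : ∀ i, 0 < ‖(1 + d i * v) * cexp (-(d i * v) + (d i) ^ 2 * v ^ 2 / 2)‖ := by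
    intro i
    rw [norm_mul, Complex.norm_exp]
    exact mul_pos (hf i).1 (Real.exp_pos _)
  have hfl : ∀ i, Real.log ‖(1 + d i * v) * cexp (-(d i * v) + (d i) ^ 2 * v ^ 2 / 2)‖ = Real.log ‖1 + d i * v‖ - d i * v.re + (d i) ^ 2 * (v.re ^ 2 - v.im ^ 2) / 2 := by
    intro i
    rw [norm_mul, Complex.norm_exp, Real.log_mul (hf i).1.ne' (Real.exp_ne_zero _), Real.log_exp]
    have : (-(d i * v) + (d i) ^ 2 * v ^ 2 / 2 : ℂ).re = - (d i * v.re) + (d i) ^ 2 * (v.re ^ 2 - v.im ^ 2) / 2 := by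
      have e : (-(d i * v) + (d i) ^ 2 * v ^ 2 / 2 : ℂ) = -((d i : ℝ) * v) + ((d i ^ 2 / 2 : ℝ) : ℂ) * v ^ 2 := by push_cast; ring
      rw [e, add_re, neg_re, Complex.re_ofReal_mul, Complex.re_ofReal_mul, pow_two v, mul_re]
      ring
    rw [this]; ring
  unfold Hb
  rw [norm_prod]
  refine ⟨Finset.prod_pos fun i _ => hfp i, ?_⟩
  rw [Real.log_prod (fun i _ => (hfp i).ne'), Finset.mul_sum]
  have hc := cub M δ ρ hM1 hδM hρ
  calc _ ≤ ∑ i, d i ^ 3 * (2 * |A| ^ 3 + 2 * A ^ 2 * ρ - (1 / 16) * (ρ ^ 3 / (1 + 4 * δ ^ 2 * ρ ^ 2))) := by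
        refine Finset.sum_le_sum fun i _ => ?_
        rw [hfl i]
        refine (hf i).2.trans ?_
        have := (hd0 i).le
        have := hd i
        gcongr
    _ = (∑ i, d i ^ 3) * (2 * |A| ^ 3 + 2 * A ^ 2 * ρ) - (∑ i, d i ^ 3) * ((1 / 16) * (ρ ^ 3 / (1 + 4 * δ ^ 2 * ρ ^ 2))) := by
        rw [← Finset.sum_mul]; ring
    _ ≤ 2 * (2 * |A| ^ 3 + 2 * A ^ 2 * ρ) - 1 * ((1 / 16) * (ρ ^ 3 / (1 + 4 * δ ^ 2 * ρ ^ 2))) := by gcongr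
    _ ≤ _ := by nlinarith

lemma Hb_P (A K : ℝ) : ∃ C δ : ℝ, 0 < δ ∧ ∀ (n : ℕ) (d : Fin n → ℝ), (∀ i, 0 < d i) → (∀ i, d i ≤ δ) →
    1 ≤ ∑ i, d i ^ 3 → ∑ i, d i ^ 3 ≤ 2 → ∀ y, ‖Hb d (gammaP A y)‖ ≤ C * Real.exp (-(K * |y|)) := by
  have hs : 0 < Real.sqrt 2 := by positivity
  obtain ⟨C, δ, hδ, h⟩ := Hb_bound_aux A (K * Real.sqrt 2)
  refine ⟨Real.exp C, δ, hδ, fun n d h0 h1 h2 h3 y => ?_⟩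
  obtain ⟨hp, hb⟩ := h 1 (Or.inl rfl) n d h0 h1 h2 h3 (|y| / Real.sqrt 2) (gammaP A y) (by positivity) (by rw [gammaP_re]; ring) (by rw [gammaP_im, div_pow, div_pow, sq_abs])
  rw [one_mul] at hb
  rw [← Real.exp_add]
  refine (Real.le_exp_log _).trans (Real.exp_le_exp.2 (hb.trans (le_of_eq ?_)))
  field_simp; ring

lemma Hb_M (B K : ℝ) : ∃ C δ : ℝ, 0 < δ ∧ ∀ (n : ℕ) (d : Fin n → ℝ), (∀ i, 0 < d i) → (∀ i, d i ≤ δ) →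
    1 ≤ ∑ i, d i ^ 3 → ∑ i, d i ^ 3 ≤ 2 → ∀ y, ‖Hb d (gammaM B y)‖⁻¹ ≤ C * Real.exp (-(K * |y|)) := by
  have hs : 0 < Real.sqrt 2 := by positivity
  obtain ⟨C, δ, hδ, h⟩ := Hb_bound_aux B (K * Real.sqrt 2)
  refine ⟨Real.exp C, δ, hδ, fun n d h0 h1 h2 h3 y => ?_⟩
  obtain ⟨hp, hb⟩ := h (-1) (Or.inr rfl) n d h0 h1 h2 h3 (|y| / Real.sqrt 2) (gammaM B y) (by positivity) (by rw [gammaM_re]; ring) (by rw [gammaM_im, div_pow, div_pow, sq_abs])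
  rw [← Real.exp_add]
  refine (Real.le_exp_log _).trans (Real.exp_le_exp.2 ?_)
  rw [Real.log_inv]
  refine le_trans (le_of_eq ?_) (hb.trans (le_of_eq ?_))
  · ring
  field_simp; ring

/-- pointwise convergence of the bulk product -/
lemma Hb_tendsto (n : ℕ → ℕ) (d : ∀ k, Fin (n k) → ℝ) (hd0 : ∀ k i, 0 < d k i) (δ : ℕ → ℝ) (hδ : Tendsto δ atTop (𝓝 0))
    (hd : ∀ k i, d k i ≤ δ k) (hS : Tendsto (fun k => ∑ i, d k i ^ 3) atTop (𝓝 1)) (v : ℂ) :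
    Tendsto (fun k => Hb (d k) v) atTop (𝓝 (cexp (v ^ 3 / 3))) := by
  have hev : ∀ᶠ k in atTop, δ k * ‖v‖ < 1 / 2 := by
    have : Tendsto (fun k => δ k * ‖v‖) atTop (𝓝 (0 * ‖v‖)) := hδ.mul_const _
    rw [zero_mul] at this
    exact this.eventually_lt_const (by norm_num)
  have hsm : ∀ k, δ k * ‖v‖ < 1 / 2 → ∀ i, ‖(d k i : ℂ) * v‖ < 1 / 2 := by
    intro k hk i
    rw [norm_mul, Complex.norm_real, Real.norm_of_nonneg (hd0 k i).le]
    exact (mul_le_mul_of_nonneg_right (hd k i) (norm_nonneg _)).trans_lt hk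
  set L : ℕ → ℂ := fun k => ∑ i, (Complex.log (1 + d k i * v) + (-(d k i * v) + (d k i) ^ 2 * v ^ 2 / 2)) with hL
  have e1 : ∀ᶠ k in atTop, cexp (L k) = Hb (d k) v := by
    filter_upwards [hev] with k hk
    simp only [hL]
    unfold Hb
    rw [Complex.exp_sum]
    refine Finset.prod_congr rfl fun i _ => ?_
    rw [Complex.exp_add, Complex.exp_log]
    intro h0
    have h1 : (d k i : ℂ) * v = -1 := by linear_combination h0
    have := hsm k hk i
    rw [h1] at this
    norm_num at this
  refine Tendsto.congr' e1 ?_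
  refine (Complex.continuous_exp.tendsto _).comp ?_
  have h2 : Tendsto (fun k => L k - ((∑ i, d k i ^ 3 : ℝ) : ℂ) * (v ^ 3 / 3)) atTop (𝓝 0) := by
    rw [tendsto_zero_iff_norm_tendsto_zero]
    have hup : Tendsto (fun k => (δ k * ∑ i, d k i ^ 3) * ‖v‖ ^ 4) atTop (𝓝 ((0 * 1) * ‖v‖ ^ 4)) := (hδ.mul hS).mul_const _
    rw [zero_mul, zero_mul] at hup
    refine squeeze_zero' (Eventually.of_forall fun k => norm_nonneg _) ?_ hup
    filter_upwards [hev] with k hk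
    have : L k - ((∑ i, d k i ^ 3 : ℝ) : ℂ) * (v ^ 3 / 3) = ∑ i, (Complex.log (1 + d k i * v) - Complex.logTaylor 4 (d k i * v)) := by
      simp only [hL]
      push_cast
      rw [Finset.sum_mul, ← Finset.sum_sub_distrib]
      refine Finset.sum_congr rfl fun i _ => ?_
      simp only [Complex.logTaylor_succ, Complex.logTaylor_zero]
      simp
      ring
    rw [this, Finset.mul_sum, Finset.sum_mul]
    refine (norm_sum_le _ _).trans (Finset.sum_le_sum fun i _ => ?_)
    have h3 := hsm k hk i
    have h4 := Complex.norm_log_sub_logTaylor_le 3 (z := d k i * v) (by linarith)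
    refine h4.trans ?_
    have h5 : (1 - ‖(d k i : ℂ) * v‖)⁻¹ ≤ 2 := by
      rw [inv_le_comm₀ (by linarith) (by norm_num)]; linarith
    have h6 : ‖(d k i : ℂ) * v‖ ^ 4 = d k i * d k i ^ 3 * ‖v‖ ^ 4 := by
      rw [norm_mul, Complex.norm_real, Real.norm_of_nonneg (hd0 k i).le]; ring
    rw [show ((3 : ℕ) : ℝ) + 1 = 4 by norm_num, show 3 + 1 = 4 from rfl]
    have h7 : 0 < d k i := hd0 k i
    calc _ ≤ ‖(d k i : ℂ) * v‖ ^ 4 * 2 / 4 := by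
          gcongr
      _ ≤ ‖(d k i : ℂ) * v‖ ^ 4 := by nlinarith [pow_nonneg (norm_nonneg ((d k i : ℂ) * v)) 4]
      _ ≤ _ := by
        rw [h6]
        have := hd k i
        gcongr
  have h3 : Tendsto (fun k => ((∑ i, d k i ^ 3 : ℝ) : ℂ) * (v ^ 3 / 3)) atTop (𝓝 (((1:ℝ) : ℂ) * (v ^ 3 / 3))) :=
    ((Complex.continuous_ofReal.tendsto _).comp hS).mul_const _
  have := h2.add h3
  simpa using this

lemma exists_pert {N : ℕ} (f : Fin N → ℝ) (η : ℝ) (hη : 0 < η) :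
    ∃ f' : Fin N → ℝ, Function.Injective f' ∧ ∀ i, f i < f' i ∧ f' i ≤ f i + η := by
  set bad : Set ℝ := ⋃ p : Fin N × Fin N, {x | p.1 ≠ p.2 ∧ f p.1 + x * (p.1 + 1) = f p.2 + x * (p.2 + 1)} with hbad
  have hfin : bad.Finite := by
    refine Set.finite_iUnion fun p => ?_
    refine Set.Subsingleton.finite ?_
    rintro x ⟨h1, h2⟩ y ⟨-, h3⟩
    have h4 : (x - y) * ((p.1 : ℕ) - (p.2 : ℕ) : ℝ) = 0 := by linear_combination h2 - h3
    rcases mul_eq_zero.1 h4 with h | h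
    · linarith
    · exfalso; apply h1
      have : ((p.1 : ℕ) : ℝ) = ((p.2 : ℕ) : ℝ) := by linarith
      exact Fin.ext (by exact_mod_cast this)
  have hpos : 0 < η / (N + 1) := by positivity
  obtain ⟨x, hx, hxb⟩ := ((Set.Ioo_infinite hpos).sdiff hfin).nonempty
  refine ⟨fun i => f i + x * (i + 1), ?_, fun i => ⟨?_, ?_⟩⟩
  · intro i j hij
    by_contra hne
    exact hxb (Set.mem_iUnion.2 ⟨(i, j), hne, hij⟩)
  · have := hx.1
    have : 0 < x * ((i : ℕ) + 1) := by positivity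
    linarith
  · have h1 := hx.2.le
    have h2 : ((i : ℕ) : ℝ) + 1 ≤ N + 1 := by
      have : (i : ℕ) + 1 ≤ N + 1 := by omega
      exact_mod_cast this
    have h3 := hx.1.le
    have : x * ((i : ℕ) + 1) ≤ η / (N + 1) * (N + 1) := by gcongr
    rw [div_mul_cancel₀ _ (by positivity)] at this
    linarith

lemma num_bound {n : ℕ} (e : Fin n → ℝ) (v : ℂ) : ‖∏ i, (1 + e i * v)‖ ≤ Real.exp ((∑ i, |e i|) * ‖v‖) := by
  rw [norm_prod, Finset.sum_mul, Real.exp_sum]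
  refine Finset.prod_le_prod (fun _ _ => norm_nonneg _) fun i _ => ?_
  refine (norm_add_le _ _).trans ?_
  rw [norm_one, norm_mul, Complex.norm_real, Real.norm_eq_abs, add_comm]
  exact Real.add_one_le_exp _

lemma den_one (e A y : ℝ) (he : 0 ≤ e) (hA : A * e ≤ 1 / 2) :
    0 < ‖1 - e * gammaP A y‖ ∧ ‖1 - e * gammaP A y‖⁻¹ ≤ Real.exp (e * (2 * (|A| + |y|))) := by
  have hs : 0 < Real.sqrt 2 := by positivity
  set ρ := |y| / Real.sqrt 2 with hρ
  have hρ0 : 0 ≤ ρ := by positivity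
  have hρy : ρ ≤ |y| := by
    rw [hρ, div_le_iff₀ hs]
    have : 1 ≤ Real.sqrt 2 := by rw [Real.one_le_sqrt]; norm_num
    nlinarith [abs_nonneg y]
  have hp : 1 / 2 ≤ 1 - e * A := by nlinarith
  set x := e * ρ / (1 - e * A) with hx
  have hx0 : 0 ≤ x := div_nonneg (by positivity) (by linarith)
  have hxe : e * ρ = x * (1 - e * A) := by rw [hx]; field_simp
  have hq : 0 < 1 + 2 * (-1) * x + 2 * x ^ 2 := by nlinarith [sq_nonneg (1 - x), sq_nonneg x, sq_nonneg (1 - 2 * x)]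
  have hn : ‖1 - e * gammaP A y‖ ^ 2 = (1 - e * A) ^ 2 * (1 + 2 * (-1) * x + 2 * x ^ 2) := by
    rw [← Complex.normSq_eq_norm_sq, Complex.normSq_apply]
    have a1 : (1 - e * gammaP A y).re = (1 - e * A) - e * ρ := by simp [gammaP_re]; ring
    have a2 : (1 - e * gammaP A y).im = - (e * (y / Real.sqrt 2)) := by simp [gammaP_im]
    have a3 : (- (e * (y / Real.sqrt 2))) * (- (e * (y / Real.sqrt 2))) = (e * ρ) ^ 2 := by
      rw [hρ, mul_pow, div_pow, sq_abs]; ring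
    rw [a1, a2, a3, hxe]; ring
  have hpos : 0 < ‖1 - e * gammaP A y‖ := by
    have h0 : 0 < ‖1 - e * gammaP A y‖ ^ 2 := by rw [hn]; exact mul_pos (pow_pos (by linarith) 2) hq
    exact lt_of_le_of_ne (norm_nonneg _) (fun h => by rw [← h] at h0; norm_num at h0)
  refine ⟨hpos, ?_⟩
  have hl : Real.log ‖1 - e * gammaP A y‖ = Real.log (1 - e * A) + Real.log (1 + 2 * (-1) * x + 2 * x ^ 2) / 2 := by
    have := congrArg Real.log hn
    rw [Real.log_pow, Real.log_mul (pow_pos (by linarith) 2).ne' hq.ne', Real.log_pow] at this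
    push_cast at this
    linear_combination this / 2
  have b := hlog (-1) x (Or.inr rfl) hx0
  have b0 : 0 ≤ x ^ 3 / (1 + x ^ 2) := by positivity
  have b1 : - Real.log (1 - e * A) ≤ 2 * (e * |A|) := by
    have h1 := Real.one_sub_inv_le_log_of_pos (show 0 < 1 - e * A by linarith)
    have h2 : (1 - e * A)⁻¹ - 1 ≤ 2 * (e * |A|) := by
      have h3 : (1 - e * A)⁻¹ - 1 = e * A * (1 - e * A)⁻¹ := by field_simp; ring
      rw [h3]
      have h4 : (1 - e * A)⁻¹ ≤ 2 := by rw [inv_le_comm₀ (by linarith) (by norm_num)]; linarith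
      have h5 : 0 ≤ (1 - e * A)⁻¹ := inv_nonneg.2 (by linarith)
      have h6 := le_abs_self A
      have h7 : e * A ≤ e * |A| := by gcongr
      have h8 : 0 ≤ e * |A| := by positivity
      nlinarith
    linarith
  have b2 : x ≤ 2 * (e * |y|) := by
    have : e * ρ ≤ e * |y| := by gcongr
    nlinarith
  refine (Real.le_exp_log _).trans (Real.exp_le_exp.2 ?_)
  rw [Real.log_inv, hl]
  linarith

lemma den_bound {n : ℕ} (e : Fin n → ℝ) (A y : ℝ) (he : ∀ i, 0 ≤ e i) (hA : ∀ i, A * e i ≤ 1 / 2) :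
    ‖∏ i, (1 - e i * gammaP A y)‖⁻¹ ≤ Real.exp ((∑ i, e i) * (2 * (|A| + |y|))) := by
  rw [norm_prod, ← Finset.prod_inv_distrib, Finset.sum_mul, Real.exp_sum]
  exact Finset.prod_le_prod (fun _ _ => by positivity) fun i _ => (den_one (e i) A y (he i) (hA i)).2

lemma gM_negP (B y : ℝ) : gammaM B y = - gammaP (-B) (-y) := by
  apply Complex.ext
  · rw [neg_re, gammaM_re, gammaP_re, abs_neg]; ring
  · rw [neg_im, gammaM_im, gammaP_im]; ring

lemma den_boundM {n : ℕ} (e : Fin n → ℝ) (B y : ℝ) (he : ∀ i, 0 ≤ e i) (hB : ∀ i, -B * e i ≤ 1 / 2) :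
    ‖∏ i, (1 + e i * gammaM B y)‖⁻¹ ≤ Real.exp ((∑ i, e i) * (2 * (|B| + |y|))) := by
  have := den_bound e (-B) (-y) he hB
  rw [abs_neg, abs_neg] at this
  refine le_trans (le_of_eq ?_) this
  congr 2
  refine Finset.prod_congr rfl fun i _ => ?_
  rw [gM_negP]; ring

lemma gP_norm (A y : ℝ) : ‖gammaP A y‖ ≤ |A| + 2 * |y| := by
  have h := Complex.norm_le_abs_re_add_abs_im (gammaP A y)
  have hs : 0 < Real.sqrt 2 := by positivity
  have : |y| / Real.sqrt 2 ≤ |y| := by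
    rw [div_le_iff₀ hs]
    have : 1 ≤ Real.sqrt 2 := by rw [Real.one_le_sqrt]; norm_num
    nlinarith [abs_nonneg y]
  rw [gammaP_re, gammaP_im, abs_div, abs_of_pos hs] at h
  have h2 := abs_add_le A (|y| / Real.sqrt 2)
  rw [abs_of_nonneg (show 0 ≤ |y| / Real.sqrt 2 by positivity)] at h2
  linarith

lemma gM_norm (A y : ℝ) : ‖gammaM A y‖ ≤ |A| + 2 * |y| := by
  rw [gM_negP, norm_neg]
  have := gP_norm (-A) (-y)
  rwa [abs_neg, abs_neg] at this

lemma prod_tendsto (b : ℕ → ℝ) (hb0 : ∀ i, 0 ≤ b i) (hb : Summable b) (m : ℕ → ℕ) (hm : Tendsto m atTop atTop) (b' : ∀ k, Fin (m k) → ℝ)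
    (h1 : ∀ k (i : Fin (m k)), b i < b' k i) (h2 : ∀ k (i : Fin (m k)), b' k i ≤ b i + (1 / 2) ^ (m k)) (v : ℂ) :
    Tendsto (fun k => ∏ i, (1 + b' k i * v)) atTop (𝓝 (∏' i, (1 + b i * v))) := by
  set f : ℕ → ℕ → ℂ := fun k i => if h : i < m k then b' k ⟨i, h⟩ * v else 0 with hf
  have hbd : Summable fun i => (b i + (1 / 2) ^ i) * ‖v‖ := (hb.add (summable_geometric_two)).mul_right _
  have key := tendsto_tprod_one_add_of_dominated_convergence (𝓕 := atTop) (f := f) (g := fun i => (b i : ℂ) * v) hbd ?_ (Eventually.of_forall ?_)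
  · refine key.congr fun k => ?_
    rw [tprod_eq_prod (s := Finset.range (m k)), ← Fin.prod_univ_eq_prod_range (fun i => 1 + f k i)]
    · refine Finset.prod_congr rfl fun i _ => ?_
      simp [hf]
    · intro i hi
      simp only [Finset.mem_range] at hi
      simp [hf, hi]
  · intro i
    have e : Tendsto (fun k => ((b i + (1 / 2) ^ (m k) : ℝ) : ℂ) * v) atTop (𝓝 (((b i + 0 : ℝ) : ℂ) * v)) :=
      ((Complex.continuous_ofReal.tendsto _).comp (tendsto_const_nhds.add ((tendsto_pow_atTop_nhds_zero_of_lt_one (by norm_num) (by norm_num)).comp hm))).mul_const _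
    refine Metric.tendsto_atTop.2 fun ε hε => ?_
    have h3 : Tendsto (fun k => (1 / 2 : ℝ) ^ (m k) * ‖v‖) atTop (𝓝 (0 * ‖v‖)) := ((tendsto_pow_atTop_nhds_zero_of_lt_one (by norm_num) (by norm_num)).comp hm).mul_const _
    rw [zero_mul] at h3
    obtain ⟨K, hK⟩ := eventually_atTop.1 ((h3.eventually_lt_const hε).and (hm.eventually_gt_atTop i))
    refine ⟨K, fun k hk => ?_⟩
    obtain ⟨h4, h5⟩ := hK k hk
    simp only [hf, h5, dif_pos]
    rw [dist_eq_norm, ← sub_mul, norm_mul, ← Complex.ofReal_sub, Complex.norm_real, Real.norm_eq_abs]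
    refine lt_of_le_of_lt ?_ h4
    gcongr
    have h6 := h1 k ⟨i, h5⟩
    have h7 := h2 k ⟨i, h5⟩
    simp only at h6 h7
    have h8 : (0:ℝ) ≤ (1 / 2) ^ m k := by positivity
    rw [abs_le]; constructor <;> linarith
  · intro k i
    simp only [hf]
    split_ifs with h
    · rw [norm_mul, Complex.norm_real, Real.norm_eq_abs]
      gcongr
      have h3 := h1 k ⟨i, h⟩
      have h4 := h2 k ⟨i, h⟩
      have h5 := hb0 i
      have h6 : (1 / 2 : ℝ) ^ m k ≤ (1 / 2) ^ i := pow_le_pow_of_le_one (by norm_num) (by norm_num) h.le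
      simp only at h3 h4
      rw [abs_le]; constructor <;> linarith
    · rw [norm_zero]
      have := hb0 i
      positivity

lemma sum_le_of (b : ℕ → ℝ) (hb0 : ∀ i, 0 ≤ b i) (hb : Summable b) (n m : ℕ) (hnm : n ≤ m) (b' : Fin n → ℝ) (h2 : ∀ i : Fin n, b' i ≤ b i + (1 / 2) ^ m) :
    ∑ i, b' i ≤ ∑' i, b i + 2 := by
  calc _ ≤ ∑ i : Fin n, (b i + (1 / 2) ^ (i : ℕ)) := by
        refine Finset.sum_le_sum fun i _ => (h2 i).trans ?_
        gcongr 1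
        exact pow_le_pow_of_le_one (by norm_num) (by norm_num) (i.2.le.trans hnm)
    _ = ∑ i ∈ Finset.range n, (b i + (1 / 2) ^ i) := Fin.sum_univ_eq_sum_range (fun i => b i + (1 / 2) ^ i) n
    _ ≤ ∑' i, (b i + (1 / 2) ^ i) := (hb.add summable_geometric_two).sum_le_tsum _ fun i _ => by
        have := hb0 i; positivity
    _ = _ := by rw [hb.tsum_add summable_geometric_two, tsum_geometric_two]

structure PP where
  a : ℕ → ℝ
  b : ℕ → ℝ
  c : ℝ
  ha : ∀ i, 0 ≤ a i
  hb : ∀ i, 0 ≤ b i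
  sa : Summable a
  sb : Summable b

namespace PP

variable (P : PP)

abbrev nB (k : ℕ) : ℕ := (k + 1) ^ 3
abbrev nN (k : ℕ) : ℕ := (k + 1) ^ 3 + (k + 1)

def tgt (k : ℕ) : Fin (nN k) → ℝ := Fin.append (fun _ : Fin (nB k) => 1 / ((k : ℝ) + 1)) (fun i : Fin (k + 1) => P.b i)

def bL (k : ℕ) : Fin (nN k) → ℝ := (exists_pert (P.tgt k) ((1 / 2) ^ nN k) (by positivity)).choose
def aL (k : ℕ) : Fin (nN k) → ℝ := (exists_pert (fun i : Fin (nN k) => P.a i) ((1 / 2) ^ nN k) (by positivity)).choose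

lemma bL_inj (k : ℕ) : Function.Injective (P.bL k) := (exists_pert (P.tgt k) ((1 / 2) ^ nN k) (by positivity)).choose_spec.1
lemma aL_inj (k : ℕ) : Function.Injective (P.aL k) := (exists_pert (fun i : Fin (nN k) => P.a i) ((1 / 2) ^ nN k) (by positivity)).choose_spec.1
lemma bL_spec (k : ℕ) (i : Fin (nN k)) : P.tgt k i < P.bL k i ∧ P.bL k i ≤ P.tgt k i + (1 / 2) ^ nN k := (exists_pert (P.tgt k) ((1 / 2) ^ nN k) (by positivity)).choose_spec.2 i
lemma aL_spec (k : ℕ) (i : Fin (nN k)) : P.a i < P.aL k i ∧ P.aL k i ≤ P.a i + (1 / 2) ^ nN k := (exists_pert (fun i : Fin (nN k) => P.a i) ((1 / 2) ^ nN k) (by positivity)).choose_spec.2 i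

def dL (k : ℕ) (i : Fin (nB k)) : ℝ := P.bL k (Fin.castAdd _ i)
def cL (k : ℕ) (i : Fin (k + 1)) : ℝ := P.bL k (Fin.natAdd _ i)

lemma dL_spec (k : ℕ) (i : Fin (nB k)) : 1 / ((k : ℝ) + 1) < P.dL k i ∧ P.dL k i ≤ 1 / ((k : ℝ) + 1) + (1 / 2) ^ nN k := by
  have := P.bL_spec k (Fin.castAdd _ i)
  rwa [tgt, Fin.append_left] at this
lemma cL_spec (k : ℕ) (i : Fin (k + 1)) : P.b i < P.cL k i ∧ P.cL k i ≤ P.b i + (1 / 2) ^ nN k := by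
  have := P.bL_spec k (Fin.natAdd _ i)
  rwa [tgt, Fin.append_right] at this

lemma dL_pos (k : ℕ) (i : Fin (nB k)) : 0 < P.dL k i := lt_trans (by positivity) (P.dL_spec k i).1
lemma cL_pos (k : ℕ) (i : Fin (k + 1)) : 0 < P.cL k i := lt_of_le_of_lt (P.hb i) (P.cL_spec k i).1
lemma aL_pos (k : ℕ) (i : Fin (nN k)) : 0 < P.aL k i := lt_of_le_of_lt (P.ha i) (P.aL_spec k i).1
lemma bL_pos (k : ℕ) (i : Fin (nN k)) : 0 < P.bL k i := by
  induction i using Fin.addCases with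
  | left i => exact P.dL_pos k i
  | right i => exact P.cL_pos k i

lemma bL_prod (k : ℕ) (g : ℝ → ℂ) : ∏ i, g (P.bL k i) = (∏ i, g (P.dL k i)) * ∏ i, g (P.cL k i) := by
  rw [Fin.prod_univ_add]; rfl

def al (k : ℕ) (i : Fin (nN k)) : ℝ := 1 / P.aL k i
def be (k : ℕ) (i : Fin (nN k)) : ℝ := -(1 / P.bL k i)

lemma al_inj (k : ℕ) : Function.Injective (P.al k) := by
  intro i j h
  unfold al at h
  rw [one_div, one_div, inv_inj] at h
  exact P.aL_inj k h
lemma be_inj (k : ℕ) : Function.Injective (P.be k) := by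
  intro i j h
  unfold be at h
  rw [neg_inj, one_div, one_div, inv_inj] at h
  exact P.bL_inj k h
lemma be_lt_al (k : ℕ) (i j : Fin (nN k)) : P.be k j < P.al k i := by
  have h1 := one_div_pos.2 (P.aL_pos k i)
  have h2 := one_div_pos.2 (P.bL_pos k j)
  unfold al be; linarith

def ga (k : ℕ) : ℝ := ∑ i, P.dL k i
def TT (k : ℕ) : ℝ := (∑ i, P.dL k i ^ 2) / 2

def PhiN (k : ℕ) (v : ℂ) : ℂ := (∏ i, (1 + P.cL k i * v)) / ∏ i, (1 - P.aL k i * v)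
def GN (k : ℕ) (v : ℂ) : ℂ := cexp (P.c * v) * P.PhiN k v * Hb (P.dL k) v

def kap (k : ℕ) : ℂ := (∏ i, (P.aL k i : ℂ)) / ∏ i, (P.bL k i : ℂ)
lemma kap_ne (k : ℕ) : P.kap k ≠ 0 := by
  unfold kap
  refine div_ne_zero (Finset.prod_ne_zero_iff.2 fun i _ => ?_) (Finset.prod_ne_zero_iff.2 fun i _ => ?_)
  · exact_mod_cast (P.aL_pos k i).ne'
  · exact_mod_cast (P.bL_pos k i).ne'

lemma FF_eq (k : ℕ) (v : ℂ) : FF (P.al k) (P.be k) v = P.kap k * ((∏ i, (1 + P.bL k i * v)) / ∏ i, (1 - P.aL k i * v)) := by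
  unfold FF kap
  have h1 : ∀ i, v - (P.be k i : ℂ) = (1 + P.bL k i * v) / P.bL k i := by
    intro i
    have : (P.bL k i : ℂ) ≠ 0 := by exact_mod_cast (P.bL_pos k i).ne'
    unfold be; push_cast; field_simp; ring
  have h2 : ∀ i, (P.al k i : ℂ) - v = (1 - P.aL k i * v) / P.aL k i := by
    intro i
    have : (P.aL k i : ℂ) ≠ 0 := by exact_mod_cast (P.aL_pos k i).ne'
    unfold al; push_cast; field_simp
  simp_rw [h1, h2, Finset.prod_div_distrib]
  have := P.kap_ne k
  rw [div_div_div_eq, mul_comm (∏ i, (P.bL k i : ℂ)), mul_comm, mul_comm (∏ i, (1 - (P.aL k i : ℂ) * v)), div_mul_div_comm]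

lemma Hb_eq (k : ℕ) (v : ℂ) : Hb (P.dL k) v = (∏ i, (1 + P.dL k i * v)) * cexp (P.TT k * v ^ 2 - P.ga k * v) := by
  unfold Hb
  rw [Finset.prod_mul_distrib, ← Complex.exp_sum]
  congr 2
  have e1 : ((P.TT k : ℝ) : ℂ) * v ^ 2 = ∑ i, ((P.dL k i : ℂ)) ^ 2 * v ^ 2 / 2 := by
    unfold TT
    push_cast
    rw [div_mul_eq_mul_div, Finset.sum_mul, Finset.sum_div]
  have e2 : ((P.ga k : ℝ) : ℂ) * v = ∑ i, (P.dL k i : ℂ) * v := by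
    unfold ga
    push_cast
    rw [Finset.sum_mul]
  rw [e1, e2, ← Finset.sum_sub_distrib]
  exact Finset.sum_congr rfl fun i _ => by ring

lemma pre_eq (k : ℕ) (v : ℂ) (t ξ : ℝ) : cexp ((P.TT k - t : ℝ) * v ^ 2 - (ξ + P.ga k - P.c : ℝ) * v) * FF (P.al k) (P.be k) v =
    P.kap k * (cexp (-t * v ^ 2 - ξ * v) * P.GN k v) := by
  rw [FF_eq, P.bL_prod k (fun x => 1 + x * v)]
  unfold GN PhiN
  rw [Hb_eq]
  have : cexp ((P.TT k - t : ℝ) * v ^ 2 - (ξ + P.ga k - P.c : ℝ) * v) = cexp (-t * v ^ 2 - ξ * v) * cexp (P.c * v) * cexp (P.TT k * v ^ 2 - P.ga k * v) := by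
    rw [← Complex.exp_add, ← Complex.exp_add]; push_cast; ring_nf
  rw [this]; ring

lemma pre_eq' (k : ℕ) (v : ℂ) (t ξ : ℝ) : cexp (-(P.TT k - t : ℝ) * v ^ 2 + (ξ + P.ga k - P.c : ℝ) * v) / FF (P.al k) (P.be k) v =
    (cexp (t * v ^ 2 + ξ * v) / P.GN k v) / P.kap k := by
  have h := P.pre_eq k v t ξ
  have e1 : cexp (-(P.TT k - t : ℝ) * v ^ 2 + (ξ + P.ga k - P.c : ℝ) * v) = (cexp ((P.TT k - t : ℝ) * v ^ 2 - (ξ + P.ga k - P.c : ℝ) * v))⁻¹ := by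
    rw [← Complex.exp_neg]; congr 1; ring
  have e2 : cexp (t * v ^ 2 + ξ * v) = (cexp (-t * v ^ 2 - ξ * v))⁻¹ := by
    rw [← Complex.exp_neg]; congr 1; ring
  rw [e1, e2, div_eq_mul_inv, ← mul_inv, h, mul_inv, mul_inv]
  ring

def Psi (v : ℂ) : ℂ := cexp (P.c * v) * ((∏' i, (1 + P.b i * v)) / (∏' i, (1 - P.a i * v)))

def adm (A B : ℝ) : Prop := (∀ i, A * P.a i ≤ 1 / 4) ∧ (∀ i, -B * P.b i ≤ 1 / 4)

lemma half_pow_small (k : ℕ) : (1 / 2 : ℝ) ^ nN k ≤ 1 / ((k : ℝ) + 1) ^ 3 := by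
  have h : ((nN k : ℕ) : ℝ) ≤ 2 ^ nN k := by exact_mod_cast (Nat.lt_two_pow_self).le
  rw [one_div_pow, one_div_le_one_div (by positivity) (by positivity)]
  refine le_trans ?_ h
  push_cast
  have : (0:ℝ) ≤ (k : ℝ) + 1 := by positivity
  linarith

lemma dL_le (k : ℕ) (i : Fin (nB k)) : P.dL k i ≤ 2 / ((k : ℝ) + 1) := by
  have h1 := (P.dL_spec k i).2
  have h2 := half_pow_small k
  have h3 : 1 / ((k : ℝ) + 1) ^ 3 ≤ 1 / ((k : ℝ) + 1) := by
    rw [one_div_le_one_div (by positivity) (by positivity)]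
    have : (1:ℝ) ≤ (k : ℝ) + 1 := by
      have : (0:ℝ) ≤ (k : ℝ) := by positivity
      linarith
    nlinarith [sq_nonneg ((k:ℝ))]
  have : 2 / ((k : ℝ) + 1) = 1 / ((k : ℝ) + 1) + 1 / ((k : ℝ) + 1) := by ring
  linarith

lemma tend_inv (x : ℝ) : Tendsto (fun k : ℕ => x / ((k : ℝ) + 1)) atTop (𝓝 0) :=
  tendsto_const_nhds.div_atTop (tendsto_atTop_add_const_right _ _ tendsto_natCast_atTop_atTop)

lemma S3_bounds (k : ℕ) : 1 ≤ ∑ i, P.dL k i ^ 3 ∧ ∑ i, P.dL k i ^ 3 ≤ (1 + 1 / ((k : ℝ) + 1)) ^ 3 := by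
  have hk : (0:ℝ) < (k : ℝ) + 1 := by positivity
  constructor
  · calc (1:ℝ) = ∑ i : Fin (nB k), (1 / ((k : ℝ) + 1)) ^ 3 := by
          rw [Finset.sum_const, Finset.card_univ, Fintype.card_fin, nsmul_eq_mul]; push_cast; field_simp
      _ ≤ _ := Finset.sum_le_sum fun i _ => pow_le_pow_left₀ (by positivity) (P.dL_spec k i).1.le 3
  · calc _ ≤ ∑ i : Fin (nB k), ((1 + 1 / ((k : ℝ) + 1)) / ((k : ℝ) + 1)) ^ 3 := by
          refine Finset.sum_le_sum fun i _ => pow_le_pow_left₀ (P.dL_pos k i).le ?_ 3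
          have h1 := (P.dL_spec k i).2
          have h2 := half_pow_small k
          have h3 : 1 / ((k : ℝ) + 1) ^ 3 ≤ (1 / ((k : ℝ) + 1)) / ((k : ℝ) + 1) := by
            rw [div_div, one_div_le_one_div (by positivity) (by positivity)]
            have : (0:ℝ) ≤ (k : ℝ) := by positivity
            nlinarith [mul_nonneg this (sq_nonneg ((k:ℝ)+1))]
          rw [add_div]; linarith
      _ = _ := by
          rw [Finset.sum_const, Finset.card_univ, Fintype.card_fin, nsmul_eq_mul]; push_cast; field_simp

lemma S3_tendsto : Tendsto (fun k => ∑ i, P.dL k i ^ 3) atTop (𝓝 1) := by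
  have h : Tendsto (fun k : ℕ => (1 + 1 / ((k : ℝ) + 1)) ^ 3) atTop (𝓝 ((1 + 0) ^ 3)) := (tendsto_const_nhds.add (tend_inv 1)).pow 3
  norm_num at h
  refine tendsto_of_tendsto_of_tendsto_of_le_of_le tendsto_const_nhds h (fun k => (P.S3_bounds k).1) (fun k => ?_)
  have := (P.S3_bounds k).2
  simpa using this

lemma TT_ge (k : ℕ) : ((k : ℝ) + 1) / 2 ≤ P.TT k := by
  have hk : (0:ℝ) < (k : ℝ) + 1 := by positivity
  unfold TT
  gcongr
  calc _ = ∑ i : Fin (nB k), (1 / ((k : ℝ) + 1)) ^ 2 := by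
        rw [Finset.sum_const, Finset.card_univ, Fintype.card_fin, nsmul_eq_mul]; push_cast; field_simp
    _ ≤ _ := Finset.sum_le_sum fun i _ => pow_le_pow_left₀ (by positivity) (P.dL_spec k i).1.le 2

lemma TT_le (k : ℕ) : P.TT k ≤ 2 * ((k : ℝ) + 1) := by
  have hk : (0:ℝ) < (k : ℝ) + 1 := by positivity
  unfold TT
  rw [div_le_iff₀ (by norm_num)]
  calc _ ≤ ∑ i : Fin (nB k), (2 / ((k : ℝ) + 1)) ^ 2 := Finset.sum_le_sum fun i _ => pow_le_pow_left₀ (P.dL_pos k i).le (P.dL_le k i) 2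
    _ = _ := by
        rw [Finset.sum_const, Finset.card_univ, Fintype.card_fin, nsmul_eq_mul]; push_cast; field_simp

lemma ga_ge (k : ℕ) : ((k : ℝ) + 1) ^ 2 ≤ P.ga k := by
  have hk : (0:ℝ) < (k : ℝ) + 1 := by positivity
  unfold ga
  calc _ = ∑ i : Fin (nB k), (1 / ((k : ℝ) + 1)) := by
        rw [Finset.sum_const, Finset.card_univ, Fintype.card_fin, nsmul_eq_mul]; push_cast; field_simp
    _ ≤ _ := Finset.sum_le_sum fun i _ => (P.dL_spec k i).1.le

lemma ev_admiss (A τ R : ℝ) (hτ : 0 ≤ τ) : ∀ᶠ k in atTop, τ < P.TT k ∧ ∀ t ξ : ℝ, |t| ≤ τ → -R ≤ ξ → 2 * (P.TT k - t) * A < ξ + P.ga k - P.c := by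
  have h1 : Tendsto (fun k : ℕ => ((k : ℝ) + 1)) atTop atTop := tendsto_atTop_add_const_right _ _ tendsto_natCast_atTop_atTop
  filter_upwards [h1.eventually_gt_atTop (2 * τ), h1.eventually_gt_atTop (4 * |A| + 1), h1.eventually_gt_atTop (2 * τ * |A| + R + P.c)] with k h2 h3 h4
  have h5 := P.TT_ge k
  have h6 := P.TT_le k
  have h7 := P.ga_ge k
  refine ⟨by linarith, fun t ξ ht hξ => ?_⟩
  have ht' := abs_le.1 ht
  have h8 : 2 * (P.TT k - t) * A ≤ 2 * (2 * ((k : ℝ) + 1) + τ) * |A| := by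
    have : 0 ≤ P.TT k - t := by linarith
    calc _ ≤ 2 * (P.TT k - t) * |A| := by gcongr; exact le_abs_self A
      _ ≤ _ := by gcongr; linarith
  have h9 : (0:ℝ) < (k : ℝ) + 1 := by positivity
  nlinarith [mul_lt_mul_of_pos_left h3 h9]

end PP

end AW

namespace AW

lemma II_scale (A B : ℝ) (f g : ℂ → ℂ) (κ : ℂ) (hκ : κ ≠ 0) : II A B (fun v => κ * f v) (fun u => g u / κ) = II A B f g := by
  unfold II
  congr 2
  funext p
  unfold IIf
  field_simp

lemma expP_bound (A τ R t ξ y : ℝ) (hτ : |t| ≤ τ) (hR : 0 ≤ R) (hξ : -R ≤ ξ) :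
    ‖cexp (-t * gammaP A y ^ 2 - ξ * gammaP A y)‖ ≤ Real.exp (τ * A ^ 2) * Real.exp (-(ξ * A)) * Real.exp ((2 * τ * |A| + R) * |y|) := by
  have hs : 0 < Real.sqrt 2 := by positivity
  have hρy : |y| / Real.sqrt 2 ≤ |y| := by
    rw [div_le_iff₀ hs]
    have : 1 ≤ Real.sqrt 2 := by rw [Real.one_le_sqrt]; norm_num
    nlinarith [abs_nonneg y]
  have hρ0 : 0 ≤ |y| / Real.sqrt 2 := by positivity
  have him : (y / Real.sqrt 2) ^ 2 = (|y| / Real.sqrt 2) ^ 2 := by rw [div_pow, div_pow, sq_abs]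
  rw [Complex.norm_exp, ← Real.exp_add, ← Real.exp_add]
  apply Real.exp_le_exp.2
  have e : (-t * gammaP A y ^ 2 - ξ * gammaP A y : ℂ).re = -t * (A ^ 2 + 2 * A * (|y| / Real.sqrt 2)) - ξ * (A + |y| / Real.sqrt 2) := by
    simp only [pow_two, sub_re, mul_re, neg_re, neg_im, ofReal_re, ofReal_im, mul_im, gammaP_re, gammaP_im]
    linear_combination t * him
  rw [e]
  set ρ := |y| / Real.sqrt 2
  have h1 : -t * (A ^ 2 + 2 * A * ρ) ≤ τ * (A ^ 2 + 2 * |A| * ρ) := by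
    calc _ ≤ |t| * |A ^ 2 + 2 * A * ρ| := by rw [← abs_neg t, ← abs_mul]; exact le_abs_self _
      _ ≤ τ * (A ^ 2 + 2 * |A| * ρ) := by
        refine mul_le_mul hτ ?_ (abs_nonneg _) ((abs_nonneg _).trans hτ)
        refine (abs_add_le _ _).trans ?_
        rw [abs_mul, abs_mul, abs_of_nonneg hρ0, abs_two, abs_of_nonneg (sq_nonneg A)]
  have h2 : -(ξ * ρ) ≤ R * |y| := by nlinarith
  have h3 : τ * (2 * |A| * ρ) ≤ τ * (2 * |A| * |y|) := by
    have := (abs_nonneg _).trans hτ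
    gcongr
  nlinarith

lemma expM_bound (B τ R t ξ y : ℝ) (hτ : |t| ≤ τ) (hR : 0 ≤ R) (hξ : -R ≤ ξ) :
    ‖cexp (t * gammaM B y ^ 2 + ξ * gammaM B y)‖ ≤ Real.exp (τ * B ^ 2) * Real.exp (ξ * B) * Real.exp ((2 * τ * |B| + R) * |y|) := by
  have h := expP_bound (-B) τ R (-t) ξ (-y) (by rwa [abs_neg]) hR hξ
  rw [gM_negP]
  simp only [abs_neg, neg_sq, Complex.ofReal_neg, neg_neg, mul_neg] at h ⊢
  rw [← sub_eq_add_neg]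
  exact h

lemma norm_cexp_mul (c : ℝ) (v : ℂ) : ‖cexp (c * v)‖ ≤ Real.exp (|c| * ‖v‖) := by
  rw [Complex.norm_exp]
  apply Real.exp_le_exp.2
  refine (Complex.re_le_norm _).trans ?_
  rw [norm_mul, Complex.norm_real, Real.norm_eq_abs]

namespace PP

variable (P : PP)

lemma ev_small (x : ℝ) (η : ℝ) (hη : 0 < η) : ∀ᶠ k : ℕ in atTop, x / ((k : ℝ) + 1) < η :=
  (tend_inv x).eventually_lt_const hη

lemma half_pow_le (k : ℕ) : (1 / 2 : ℝ) ^ nN k ≤ 1 / ((k : ℝ) + 1) := by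
  refine (half_pow_small k).trans ?_
  rw [one_div_le_one_div (by positivity) (by positivity)]
  have : (0:ℝ) ≤ (k : ℝ) := by positivity
  nlinarith [sq_nonneg ((k:ℝ))]

lemma ev_good (A B : ℝ) (h : P.adm A B) : ∀ᶠ k in atTop, (∀ i, A * P.aL k i ≤ 1 / 2) ∧ (∀ i, -B * P.cL k i ≤ 1 / 2) ∧ (∀ i, -B * P.dL k i ≤ 1 / 2) := by
  filter_upwards [ev_small |A| (1 / 4) (by norm_num), ev_small |B| (1 / 4) (by norm_num)] with k h1 h2
  have aux : ∀ x y z w : ℝ, x * y ≤ 1 / 4 → y < z → z ≤ y + w → w ≤ 1 / ((k : ℝ) + 1) → |x| / ((k : ℝ) + 1) < 1 / 4 → x * z ≤ 1 / 2 := by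
    intro x y z w e1 e2 e3 e4 e5
    have : x * (z - y) ≤ |x| * (1 / ((k : ℝ) + 1)) := by
      calc _ ≤ |x| * (z - y) := mul_le_mul_of_nonneg_right (le_abs_self x) (by linarith)
        _ ≤ _ := by gcongr; linarith
    rw [mul_one_div] at this
    linarith
  refine ⟨fun i => ?_, fun i => ?_, fun i => ?_⟩
  · exact aux _ _ _ _ (h.1 i) (P.aL_spec k i).1 (P.aL_spec k i).2 (half_pow_le k) h1
  · exact aux _ _ _ _ (h.2 i) (P.cL_spec k i).1 (P.cL_spec k i).2 (half_pow_le k) (by rwa [abs_neg])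
  · calc _ ≤ |B| * P.dL k i := by gcongr; exact (P.dL_pos k i).le; exact neg_le_abs B
      _ ≤ |B| * (2 / ((k : ℝ) + 1)) := by gcongr; exact P.dL_le k i
      _ = 2 * (|B| / ((k : ℝ) + 1)) := by ring
      _ ≤ _ := by linarith

lemma ev_d (δ : ℝ) (hδ : 0 < δ) : ∀ᶠ k in atTop, (∀ i, P.dL k i ≤ δ) ∧ ∑ i, P.dL k i ^ 3 ≤ 2 := by
  filter_upwards [ev_small 2 δ hδ, P.S3_tendsto.eventually_le_const (by norm_num : (1:ℝ) < 2)] with k h1 h2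
  exact ⟨fun i => (P.dL_le k i).trans h1.le, h2⟩

lemma sum_aL (k : ℕ) : ∑ i, P.aL k i ≤ ∑' i, P.a i + 2 := sum_le_of P.a P.ha P.sa _ (nN k) le_rfl _ fun i => (P.aL_spec k i).2
lemma sum_cL (k : ℕ) : ∑ i, P.cL k i ≤ ∑' i, P.b i + 2 := sum_le_of P.b P.hb P.sb _ (nN k) (Nat.le_add_left _ _) _ fun i => (P.cL_spec k i).2

lemma GN_P (A B K : ℝ) (h : P.adm A B) : ∃ C, ∀ᶠ k in atTop, ∀ y, ‖P.GN k (gammaP A y)‖ ≤ C * Real.exp (-(K * |y|)) := by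
  set Sa := ∑' i, P.a i + 2
  set Sb := ∑' i, P.b i + 2
  obtain ⟨C, δ, hδ, hC⟩ := Hb_P A (K + 2 * |P.c| + 2 * Sb + 2 * Sa)
  refine ⟨Real.exp (|P.c| * |A|) * (Real.exp (Sb * |A|) * Real.exp (2 * Sa * |A|)) * C, ?_⟩
  filter_upwards [P.ev_good A B h, P.ev_d δ hδ] with k hg hd y
  have h1 := hC _ (P.dL k) (P.dL_pos k) hd.1 (P.S3_bounds k).1 hd.2 y
  have h2 := den_bound (P.aL k) A y (fun i => (P.aL_pos k i).le) hg.1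
  have h3 := num_bound (P.cL k) (gammaP A y)
  have h4 := norm_cexp_mul P.c (gammaP A y)
  have h5 := gP_norm A y
  have e3 : ∑ i, |P.cL k i| ≤ Sb := by
    rw [Finset.sum_congr rfl fun i _ => abs_of_pos (P.cL_pos k i)]; exact P.sum_cL k
  have hSb : 0 ≤ Sb := (Finset.sum_nonneg fun i _ => abs_nonneg _).trans e3
  have e2 := P.sum_aL k
  unfold GN PhiN
  rw [norm_mul, norm_mul, norm_div, div_eq_mul_inv]
  calc _ ≤ Real.exp (|P.c| * (|A| + 2 * |y|)) * (Real.exp (Sb * (|A| + 2 * |y|)) * Real.exp (Sa * (2 * (|A| + |y|)))) * (C * Real.exp (-((K + 2 * |P.c| + 2 * Sb + 2 * Sa) * |y|))) := by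
        refine mul_le_mul (mul_le_mul (h4.trans ?_) (mul_le_mul (h3.trans ?_) (h2.trans ?_) (by positivity) (by positivity)) (by positivity) (by positivity)) h1 (by positivity) (by positivity)
        · gcongr
        · exact Real.exp_le_exp.2 (mul_le_mul e3 h5 (norm_nonneg _) hSb)
        · exact Real.exp_le_exp.2 (mul_le_mul_of_nonneg_right e2 (by positivity))
    _ = (Real.exp (|P.c| * (|A| + 2 * |y|)) * (Real.exp (Sb * (|A| + 2 * |y|)) * Real.exp (Sa * (2 * (|A| + |y|)))) * (Real.exp (-((K + 2 * |P.c| + 2 * Sb + 2 * Sa) * |y|)))) * C := by ring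
    _ = (Real.exp (|P.c| * |A|) * (Real.exp (Sb * |A|) * Real.exp (2 * Sa * |A|)) * Real.exp (-(K * |y|))) * C := by
        simp only [← Real.exp_add]; congr 2; ring
    _ = _ := by ring

lemma GN_M (A B K : ℝ) (h : P.adm A B) : ∃ C, ∀ᶠ k in atTop, ∀ y, ‖P.GN k (gammaM B y)‖⁻¹ ≤ C * Real.exp (-(K * |y|)) := by
  set Sa := ∑' i, P.a i + 2
  set Sb := ∑' i, P.b i + 2
  obtain ⟨C, δ, hδ, hC⟩ := Hb_M B (K + 2 * |P.c| + 2 * Sb + 2 * Sa)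
  refine ⟨Real.exp (|P.c| * |B|) * (Real.exp (2 * Sb * |B|) * Real.exp (Sa * |B|)) * C, ?_⟩
  filter_upwards [P.ev_good A B h, P.ev_d δ hδ] with k hg hd y
  have h1 := hC _ (P.dL k) (P.dL_pos k) hd.1 (P.S3_bounds k).1 hd.2 y
  have h2 := den_boundM (P.cL k) B y (fun i => (P.cL_pos k i).le) hg.2.1
  have h3 := num_bound (fun i => -P.aL k i) (gammaM B y)
  have h4 := norm_cexp_mul (-P.c) (gammaM B y)
  have h5 := gM_norm B y
  have e3 : ∑ i, |-P.aL k i| ≤ Sa := by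
    simp_rw [abs_neg]
    rw [Finset.sum_congr rfl fun i _ => abs_of_pos (P.aL_pos k i)]; exact P.sum_aL k
  have hSa : 0 ≤ Sa := (Finset.sum_nonneg fun i _ => abs_nonneg _).trans e3
  have e2 := P.sum_cL k
  have e4 : ‖cexp (P.c * gammaM B y)‖⁻¹ = ‖cexp ((-P.c : ℝ) * gammaM B y)‖ := by
    rw [← norm_inv, ← Complex.exp_neg]; push_cast; rw [neg_mul]
  have e5 : ‖∏ i, (1 - (P.aL k i : ℂ) * gammaM B y)‖ = ‖∏ i, (1 + ((-P.aL k i : ℝ) : ℂ) * gammaM B y)‖ := by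
    push_cast; simp_rw [neg_mul, ← sub_eq_add_neg]
  rw [abs_neg] at h4
  unfold GN PhiN
  rw [norm_mul, norm_mul, norm_div, mul_inv, mul_inv, inv_div, div_eq_mul_inv, e4, e5]
  calc _ ≤ Real.exp (|P.c| * (|B| + 2 * |y|)) * (Real.exp (Sa * (|B| + 2 * |y|)) * Real.exp (Sb * (2 * (|B| + |y|)))) * (C * Real.exp (-((K + 2 * |P.c| + 2 * Sb + 2 * Sa) * |y|))) := by
        refine mul_le_mul (mul_le_mul (h4.trans ?_) (mul_le_mul (h3.trans ?_) (h2.trans ?_) (by positivity) (by positivity)) (by positivity) (by positivity)) h1 (by positivity) (by positivity)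
        · gcongr
        · exact Real.exp_le_exp.2 (mul_le_mul e3 h5 (norm_nonneg _) hSa)
        · exact Real.exp_le_exp.2 (mul_le_mul_of_nonneg_right e2 (by positivity))
    _ = (Real.exp (|P.c| * (|B| + 2 * |y|)) * (Real.exp (Sa * (|B| + 2 * |y|)) * Real.exp (Sb * (2 * (|B| + |y|)))) * (Real.exp (-((K + 2 * |P.c| + 2 * Sb + 2 * Sa) * |y|)))) * C := by ring
    _ = (Real.exp (|P.c| * |B|) * (Real.exp (2 * Sb * |B|) * Real.exp (Sa * |B|)) * Real.exp (-(K * |y|))) * C := by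
        simp only [← Real.exp_add]; congr 2; ring
    _ = _ := by ring

lemma nN_tend : Tendsto nN atTop atTop :=
  tendsto_atTop_mono (fun k => by simp only [id, nN]; have := Nat.zero_le ((k+1)^3); omega) tendsto_id

lemma lim_num (v : ℂ) : Tendsto (fun k => ∏ i, (1 + P.cL k i * v)) atTop (𝓝 (∏' i, (1 + P.b i * v))) := by
  refine prod_tendsto P.b P.hb P.sb (fun k => k + 1) (tendsto_add_atTop_nat 1) P.cL (fun k i => (P.cL_spec k i).1) (fun k i => ?_) v
  refine (P.cL_spec k i).2.trans ?_
  gcongr 1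
  exact pow_le_pow_of_le_one (by norm_num) (by norm_num) (Nat.le_add_left _ _)

lemma lim_den (v : ℂ) : Tendsto (fun k => ∏ i, (1 - P.aL k i * v)) atTop (𝓝 (∏' i, (1 - P.a i * v))) := by
  have := prod_tendsto P.a P.ha P.sa nN nN_tend P.aL (fun k i => (P.aL_spec k i).1) (fun k i => (P.aL_spec k i).2) (-v)
  simpa only [mul_neg, ← sub_eq_add_neg] using this

lemma lim_Hb (v : ℂ) : Tendsto (fun k => Hb (P.dL k) v) atTop (𝓝 (cexp (v ^ 3 / 3))) :=
  Hb_tendsto nB P.dL P.dL_pos (fun k => 2 / ((k : ℝ) + 1)) (tend_inv 2) P.dL_le P.S3_tendsto v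

lemma tp_ne (e : ℕ → ℝ) (s : Summable e) (h0 : ∀ i, 0 ≤ e i) (v : ℂ) (h : ∀ i, 1 + (e i : ℂ) * v ≠ 0) : ∏' i, (1 + (e i : ℂ) * v) ≠ 0 := by
  refine tprod_one_add_ne_zero_of_summable h ?_
  have : ∀ i, ‖(e i : ℂ) * v‖ = e i * ‖v‖ := fun i => by rw [norm_mul, Complex.norm_real, Real.norm_of_nonneg (h0 i)]
  simp_rw [this]
  exact s.mul_right _

lemma GN_lim_P (A B y : ℝ) (h : P.adm A B) : Tendsto (fun k => P.GN k (gammaP A y)) atTop (𝓝 (cexp (gammaP A y ^ 3 / 3) * P.Psi (gammaP A y))) := by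
  have hne : ∏' i, (1 - (P.a i : ℂ) * gammaP A y) ≠ 0 := by
    have := tp_ne P.a P.sa P.ha (-gammaP A y) fun i => by
      rw [mul_neg, ← sub_eq_add_neg]
      exact norm_pos_iff.1 (den_one (P.a i) A y (P.ha i) ((h.1 i).trans (by norm_num))).1
    simpa only [mul_neg, ← sub_eq_add_neg] using this
  have := (((P.lim_num (gammaP A y)).div (P.lim_den _) hne).const_mul (cexp (P.c * gammaP A y))).mul (P.lim_Hb (gammaP A y))
  rw [mul_comm (cexp (gammaP A y ^ 3 / 3))]
  exact this

lemma GN_lim_M (A B y : ℝ) (h : P.adm A B) : Tendsto (fun k => (P.GN k (gammaM B y))⁻¹) atTop (𝓝 (cexp (gammaM B y ^ 3 / 3) * P.Psi (gammaM B y))⁻¹) := by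
  have hne : ∏' i, (1 + (P.b i : ℂ) * gammaM B y) ≠ 0 := by
    refine tp_ne P.b P.sb P.hb _ fun i => ?_
    have := (den_one (P.b i) (-B) (-y) (P.hb i) ((h.2 i).trans (by norm_num))).1
    rw [gM_negP, mul_neg, ← sub_eq_add_neg]
    exact norm_pos_iff.1 this
  have h1 := (P.lim_den (gammaM B y)).div (P.lim_num (gammaM B y)) hne
  have h2 := ((P.lim_Hb (gammaM B y)).inv₀ (Complex.exp_ne_zero _)).mul (h1.mul_const (cexp (P.c * gammaM B y))⁻¹)
  have e : ∀ k, (P.GN k (gammaM B y))⁻¹ = (Hb (P.dL k) (gammaM B y))⁻¹ * ((∏ i, (1 - P.aL k i * gammaM B y)) / (∏ i, (1 + P.cL k i * gammaM B y)) * (cexp (P.c * gammaM B y))⁻¹) := by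
    intro k
    unfold GN PhiN
    rw [mul_inv, mul_inv, inv_div]; ring
  simp_rw [e]
  have e' : (cexp (gammaM B y ^ 3 / 3) * P.Psi (gammaM B y))⁻¹ = (cexp (gammaM B y ^ 3 / 3))⁻¹ * ((∏' i, (1 - P.a i * gammaM B y)) / (∏' i, (1 + P.b i * gammaM B y)) * (cexp (P.c * gammaM B y))⁻¹) := by
    unfold Psi
    rw [mul_inv, mul_inv, inv_div]; ring
  rw [e']
  exact h2

def f₀ (t ξ : ℝ) (v : ℂ) : ℂ := cexp (-t * v ^ 2 - ξ * v) * (cexp (v ^ 3 / 3) * P.Psi v)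
def g₀ (t ξ : ℝ) (u : ℂ) : ℂ := cexp (t * u ^ 2 + ξ * u) / (cexp (u ^ 3 / 3) * P.Psi u)

def SN (k : ℕ) (t₁ ξ₁ t₂ ξ₂ : ℝ) : ℝ := ∑ j, (∑ i, Cco (P.al k) (P.be k) j i * Eal (P.al k i) (P.TT k - t₁) (ξ₁ + (P.ga k - P.c))) *
  Real.exp (P.be k j * (ξ₂ + (P.ga k - P.c)) - (P.TT k - t₂) * P.be k j ^ 2)

lemma SN_eq (A B τ R : ℝ) (hτ : 0 ≤ τ) (h : P.adm A B) : ∀ᶠ k in atTop, ∀ t₁ ξ₁ t₂ ξ₂ : ℝ, |t₁| ≤ τ → |t₂| ≤ τ → -R ≤ ξ₁ → -R ≤ ξ₂ →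
    (P.SN k t₁ ξ₁ t₂ ξ₂ : ℂ) = II A B (fun v => cexp (-t₁ * v ^ 2 - ξ₁ * v) * P.GN k v) (fun u => cexp (t₂ * u ^ 2 + ξ₂ * u) / P.GN k u) + seg A B (t₂ - t₁) (ξ₂ - ξ₁) := by
  filter_upwards [P.ev_good A B h, P.ev_admiss A τ R hτ, P.ev_admiss B τ R hτ] with k hg h1 h2 t₁ ξ₁ t₂ ξ₂ ht₁ ht₂ hξ₁ hξ₂
  have hA : ∀ i, A < P.al k i := fun i => by
    unfold al; rw [lt_div_iff₀ (P.aL_pos k i)]; linarith [hg.1 i]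
  have hB : ∀ i, P.be k i < B := by
    have : ∀ i, -B * P.bL k i ≤ 1 / 2 := by
      intro i
      induction i using Fin.addCases with
      | left i => exact hg.2.2 i
      | right i => exact hg.2.1 i
    intro i
    unfold be
    rw [neg_lt, lt_div_iff₀ (P.bL_pos k i)]; linarith [this i]
  have q1 := h1.2 t₁ ξ₁ ht₁ hξ₁
  have q2 := h2.2 t₂ ξ₂ ht₂ hξ₂
  have := pre_contour (P.al k) (P.be k) (P.al_inj k) (P.be_inj k) A B (P.TT k - t₁) (P.TT k - t₂) (ξ₁ + P.ga k - P.c) (ξ₂ + P.ga k - P.c)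
    (by linarith [(abs_le.1 ht₁).2, h1.1]) (by linarith [(abs_le.1 ht₂).2, h1.1]) hA hB q1 q2
  unfold SN
  simp only [← add_sub_assoc]
  rw [this]
  simp_rw [P.pre_eq, P.pre_eq']
  rw [II_scale _ _ _ _ _ (P.kap_ne k)]
  congr 2 <;> ring

lemma GN_meas (k : ℕ) : Measurable (P.GN k) := by
  unfold GN PhiN Hb; fun_prop

lemma comb_bound (x y z w C q : ℝ) (u g : ℂ) (h1 : ‖u‖ ≤ x * z * Real.exp (w * q)) (h2 : ‖g‖ ≤ C * Real.exp (-(y * q))) (hx : 0 ≤ x * z) (hy : y = w + 1) : ‖u * g‖ ≤ (x * C * z) * Real.exp (-(1 * q)) := by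
  rw [norm_mul]
  refine (mul_le_mul h1 h2 (norm_nonneg _) (by positivity)).trans (le_of_eq ?_)
  rw [hy, show -((w + 1) * q) = -(w * q) + -(1 * q) by ring, Real.exp_add, Real.exp_neg (w * q)]
  field_simp

lemma fb (A B τ R : ℝ) (hR : 0 ≤ R) (h : P.adm A B) : ∃ C, ∀ᶠ k in atTop, ∀ t ξ : ℝ, |t| ≤ τ → -R ≤ ξ → ∀ y,
    ‖cexp (-t * gammaP A y ^ 2 - ξ * gammaP A y) * P.GN k (gammaP A y)‖ ≤ (C * Real.exp (-(ξ * A))) * Real.exp (-(1 * |y|)) ∧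
    ‖cexp (t * gammaM B y ^ 2 + ξ * gammaM B y) / P.GN k (gammaM B y)‖ ≤ (C * Real.exp (ξ * B)) * Real.exp (-(1 * |y|)) := by
  obtain ⟨C₁, h₁⟩ := P.GN_P A B (2 * τ * |A| + R + 1) h
  obtain ⟨C₂, h₂⟩ := P.GN_M A B (2 * τ * |B| + R + 1) h
  refine ⟨max (Real.exp (τ * A ^ 2) * C₁) (Real.exp (τ * B ^ 2) * C₂), ?_⟩
  filter_upwards [h₁, h₂] with k h₁ h₂ t ξ ht hξ y
  constructor
  · refine (comb_bound _ _ _ _ _ _ _ _ (expP_bound A τ R t ξ y ht hR hξ) (h₁ y) (by positivity) (by ring)).trans ?_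
    gcongr
    exact le_max_left _ _
  · rw [div_eq_mul_inv]
    refine (comb_bound _ _ _ _ _ _ _ _ (expM_bound B τ R t ξ y ht hR hξ) ((norm_inv _).le.trans (h₂ y)) (by positivity) (by ring)).trans ?_
    gcongr
    exact le_max_right _ _

lemma SN_lim (A B : ℝ) (h : P.adm A B) (t₁ ξ₁ t₂ ξ₂ : ℝ) : Tendsto (fun k => (P.SN k t₁ ξ₁ t₂ ξ₂ : ℂ)) atTop
    (𝓝 (II A B (P.f₀ t₁ ξ₁) (P.g₀ t₂ ξ₂) + seg A B (t₂ - t₁) (ξ₂ - ξ₁))) := by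
  set τ := max |t₁| |t₂|
  set R := max |ξ₁| |ξ₂|
  have hR : 0 ≤ R := (abs_nonneg _).trans (le_max_left _ _)
  have k1 : |t₁| ≤ τ := le_max_left _ _
  have k2 : |t₂| ≤ τ := le_max_right _ _
  have k3 : -R ≤ ξ₁ := (abs_le.1 (le_max_left |ξ₁| |ξ₂|)).1
  have k4 : -R ≤ ξ₂ := (abs_le.1 (le_max_right |ξ₁| |ξ₂|)).1
  have he := P.SN_eq A B τ R ((abs_nonneg _).trans k1) h
  obtain ⟨C, hC⟩ := P.fb A B τ R hR h
  refine Tendsto.congr' (he.mono fun k hk => (hk t₁ ξ₁ t₂ ξ₂ k1 k2 k3 k4).symm) ?_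
  refine Tendsto.add_const _ ?_
  have mG := P.GN_meas
  have m1 := (gP_cont A).measurable
  have m2 := (gM_cont B).measurable
  refine II_tendsto A B 1 (C * Real.exp (-(ξ₁ * A))) (C * Real.exp (ξ₂ * B)) one_pos _ _ _ _ (fun k => ?_) (fun k => ?_) ?_ ?_ ?_ ?_
  · exact Measurable.mul (by fun_prop) ((mG k).comp m1)
  · exact Measurable.div (by fun_prop) ((mG k).comp m2)
  · filter_upwards [hC] with k hk y using (hk t₁ ξ₁ k1 k3 y).1
  · filter_upwards [hC] with k hk y using (hk t₂ ξ₂ k2 k4 y).2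
  · intro y
    exact (P.GN_lim_P A B y h).const_mul _
  · intro y
    simp_rw [div_eq_mul_inv]
    unfold g₀
    rw [div_eq_mul_inv]
    exact (P.GN_lim_M A B y h).const_mul _

lemma SN_bound (δ τ R : ℝ) (hδ : 0 < δ) (h : P.adm δ (-δ)) (hτ : 0 ≤ τ) (hR : 0 ≤ R) : ∃ C, 0 ≤ C ∧ ∀ᶠ k in atTop, ∀ t₁ ξ₁ t₂ ξ₂ : ℝ, |t₁| ≤ τ → |t₂| ≤ τ → -R ≤ ξ₁ → -R ≤ ξ₂ →
    |P.SN k t₁ ξ₁ t₂ ξ₂| ≤ C * Real.exp (-(δ * ξ₁)) * Real.exp (-(δ * ξ₂)) := by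
  obtain ⟨C, hC⟩ := P.fb δ (-δ) τ R hR h
  refine ⟨C ^ 2 * (∫ y, wt ((-δ - δ) / 2) 1 y) ^ 2, by positivity, ?_⟩
  filter_upwards [hC, P.SN_eq δ (-δ) τ R hτ h] with k h1 h2 t₁ ξ₁ t₂ ξ₂ k1 k2 k3 k4
  have e := h2 t₁ ξ₁ t₂ ξ₂ k1 k2 k3 k4
  have hs : seg δ (-δ) (t₂ - t₁) (ξ₂ - ξ₁) = 0 := by
    unfold seg; rw [if_neg (by linarith)]
  rw [hs, add_zero] at e
  have := II_bound δ (-δ) 1 (C * Real.exp (-(ξ₁ * δ))) (C * Real.exp (ξ₂ * (-δ))) one_pos (fun v => cexp (-t₁ * v ^ 2 - ξ₁ * v) * P.GN k v) (fun u => cexp (t₂ * u ^ 2 + ξ₂ * u) / P.GN k u) (fun y => (h1 t₁ ξ₁ k1 k3 y).1) (fun y => (h1 t₂ ξ₂ k2 k4 y).2)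
  rw [← e, Complex.norm_real, Real.norm_eq_abs] at this
  refine this.trans (le_of_eq ?_)
  rw [mul_neg, mul_comm ξ₁, mul_comm ξ₂]; ring

end PP

end AW

namespace AW

lemma gp_le (s y : ℝ) : gp s y ≤ (Real.sqrt (4 * Real.pi * s))⁻¹ := by
  unfold gp
  by_cases hs : 0 ≤ s
  · refine mul_le_of_le_one_right (by positivity) (Real.exp_le_one_iff.2 ?_)
    rw [neg_div]
    exact neg_nonpos.2 (by positivity)
  · rw [Real.sqrt_eq_zero_of_nonpos (by push Not at hs; nlinarith [Real.pi_pos])]; simp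

lemma gp_tail (s y δ : ℝ) (hs : 0 < s) : gp s y ≤ (Real.sqrt (4 * Real.pi * s))⁻¹ * Real.exp (δ ^ 2 * s) * Real.exp (-(δ * y)) := by
  unfold gp
  rw [mul_assoc (_⁻¹ : ℝ) (Real.exp _), ← Real.exp_add]
  gcongr
  rw [neg_div, neg_le_iff_add_nonneg]
  have : δ ^ 2 * s + -(δ * y) + y ^ 2 / (4 * s) = (2 * s * δ - y) ^ 2 / (4 * s) := by field_simp; ring
  rw [this]; positivity

lemma det_row_bound {α : Type*} [Fintype α] [DecidableEq α] (M : Matrix α α ℝ) (p : α) (w C : ℝ) (hw : 0 < w)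
    (h1 : ∀ i j, |M i j| ≤ C) (h2 : ∀ j, |M p j| ≤ C * w) : |M.det| ≤ (Nat.factorial (Fintype.card α)) * C ^ Fintype.card α * w := by
  have e := Matrix.det_mul_column (Function.update (fun _ : α => (1:ℝ)) p w⁻¹) M
  have hb := Matrix.det_le (A := Matrix.of fun i j => Function.update (fun _ : α => (1:ℝ)) p w⁻¹ i * M i j) (abv := AbsoluteValue.abs) (x := C) (by
    intro i j
    rw [AbsoluteValue.abs_apply, Matrix.of_apply, abs_mul]
    by_cases h : i = p
    · subst h
      rw [Function.update_self, abs_of_pos (inv_pos.2 hw), inv_mul_le_iff₀ hw, mul_comm]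
      exact h2 j
    · rw [Function.update_of_ne h, abs_one, one_mul]; exact h1 i j)
  rw [e, AbsoluteValue.abs_apply, abs_mul, Finset.prod_update_of_mem (Finset.mem_univ p)] at hb
  simp only [Finset.prod_const_one, mul_one] at hb
  rw [abs_of_pos (inv_pos.2 hw), inv_mul_le_iff₀ hw] at hb
  refine hb.trans (le_of_eq ?_)
  rw [nsmul_eq_mul]; ring

namespace PP

variable (P : PP)

lemma adm_neg (A B : ℝ) (hA : A ≤ 0) (hB : 0 ≤ B) : P.adm A B :=
  ⟨fun i => by nlinarith [P.ha i], fun i => by nlinarith [P.hb i]⟩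

lemma exists_adm : ∃ δ, 0 < δ ∧ P.adm δ (-δ) := by
  have h1 : ∀ i, P.a i ≤ ∑' i, P.a i := fun i => P.sa.le_tsum i fun j _ => P.ha j
  have h2 : ∀ i, P.b i ≤ ∑' i, P.b i := fun i => P.sb.le_tsum i fun j _ => P.hb j
  have h3 : 0 ≤ ∑' i, P.a i := tsum_nonneg P.ha
  have h4 : 0 ≤ ∑' i, P.b i := tsum_nonneg P.hb
  have h5 : 0 < 4 * (∑' i, P.a i + ∑' i, P.b i + 1) := by positivity
  refine ⟨1 / (4 * (∑' i, P.a i + ∑' i, P.b i + 1)), by positivity, fun i => ?_, fun i => ?_⟩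
  · rw [div_mul_eq_mul_div, div_le_iff₀ h5]; linarith [h1 i]
  · rw [neg_neg, div_mul_eq_mul_div, div_le_iff₀ h5]; linarith [h2 i]

/-- smooth part of the limit kernel -/
def Sl (t₁ ξ₁ t₂ ξ₂ : ℝ) : ℝ := (II (-1) 1 (P.f₀ t₁ ξ₁) (P.g₀ t₂ ξ₂) + seg (-1) 1 (t₂ - t₁) (ξ₂ - ξ₁)).re

lemma SN_Sl (t₁ ξ₁ t₂ ξ₂ : ℝ) : Tendsto (fun k => P.SN k t₁ ξ₁ t₂ ξ₂) atTop (𝓝 (P.Sl t₁ ξ₁ t₂ ξ₂)) :=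
  (Complex.continuous_re.tendsto _).comp (P.SN_lim (-1) 1 (P.adm_neg _ _ (by norm_num) (by norm_num)) t₁ ξ₁ t₂ ξ₂)

lemma Sl_eq (A B : ℝ) (h : P.adm A B) (t₁ ξ₁ t₂ ξ₂ : ℝ) : (P.Sl t₁ ξ₁ t₂ ξ₂ : ℂ) = II A B (P.f₀ t₁ ξ₁) (P.g₀ t₂ ξ₂) + seg A B (t₂ - t₁) (ξ₂ - ξ₁) :=
  tendsto_nhds_unique ((Complex.continuous_ofReal.tendsto _).comp (P.SN_Sl t₁ ξ₁ t₂ ξ₂)) (P.SN_lim A B h t₁ ξ₁ t₂ ξ₂)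

def gt (a b : ℝ × ℝ) : ℝ := if a.1 < b.1 then gp (b.1 - a.1) (a.2 - b.2) else 0

def KN (k : ℕ) (a b : ℝ × ℝ) : ℝ := P.SN k a.1 a.2 b.1 b.2 - gt a b
def KL (a b : ℝ × ℝ) : ℝ := P.Sl a.1 a.2 b.1 b.2 - gt a b

section
variable {α : Type*} [Fintype α] [DecidableEq α]

def DN (k : ℕ) (τ z : α → ℝ) : ℝ := (Matrix.of fun p q => P.KN k (τ p, z p) (τ q, z q)).det
def DL (τ z : α → ℝ) : ℝ := (Matrix.of fun p q => P.KL (τ p, z p) (τ q, z q)).det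

lemma DN_DL (τ z : α → ℝ) : Tendsto (fun k => P.DN k τ z) atTop (𝓝 (P.DL τ z)) := by
  unfold DN DL
  have hc : Continuous fun M : Matrix α α ℝ => M.det := continuous_id.matrix_det
  refine (hc.tendsto _).comp ?_
  refine tendsto_pi_nhds.2 fun p => tendsto_pi_nhds.2 fun q => ?_
  exact (P.SN_Sl _ _ _ _).sub_const _

lemma DN_bound (δ : ℝ) (hδ : 0 < δ) (h : P.adm δ (-δ)) (τ : α → ℝ) (p : α) (R : ℝ) (hR : 0 ≤ R) : ∃ C : ℝ, 0 ≤ C ∧ ∀ᶠ k in atTop, ∀ z : α → ℝ, -R ≤ z p → (∀ q, q ≠ p → |z q| ≤ R) →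
    |P.DN k τ z| ≤ C * Real.exp (-(δ * z p)) := by
  set T := ∑ q, |τ q| with hT
  have hτ : ∀ q, |τ q| ≤ T := fun q => Finset.single_le_sum (f := fun q => |τ q|) (fun _ _ => abs_nonneg _) (Finset.mem_univ q)
  obtain ⟨C, hC0, hC⟩ := P.SN_bound δ T R hδ h (Finset.sum_nonneg fun _ _ => abs_nonneg _) hR
  set G := ∑ q, ∑ r, (Real.sqrt (4 * Real.pi * (τ r - τ q)))⁻¹ * Real.exp (δ ^ 2 * (τ r - τ q)) with hG
  set G' := ∑ q, ∑ r, (Real.sqrt (4 * Real.pi * (τ r - τ q)))⁻¹ with hG'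
  have hG1 : ∀ q r, (Real.sqrt (4 * Real.pi * (τ r - τ q)))⁻¹ * Real.exp (δ ^ 2 * (τ r - τ q)) ≤ G := fun q r =>
    (Finset.single_le_sum (f := fun r => (Real.sqrt (4 * Real.pi * (τ r - τ q)))⁻¹ * Real.exp (δ ^ 2 * (τ r - τ q))) (fun _ _ => by positivity) (Finset.mem_univ r)).trans
      (Finset.single_le_sum (f := fun q => ∑ r, (Real.sqrt (4 * Real.pi * (τ r - τ q)))⁻¹ * Real.exp (δ ^ 2 * (τ r - τ q))) (fun _ _ => Finset.sum_nonneg fun _ _ => by positivity) (Finset.mem_univ q))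
  have hG1' : ∀ q r, (Real.sqrt (4 * Real.pi * (τ r - τ q)))⁻¹ ≤ G' := fun q r =>
    (Finset.single_le_sum (f := fun r => (Real.sqrt (4 * Real.pi * (τ r - τ q)))⁻¹) (fun _ _ => by positivity) (Finset.mem_univ r)).trans
      (Finset.single_le_sum (f := fun q => ∑ r, (Real.sqrt (4 * Real.pi * (τ r - τ q)))⁻¹) (fun _ _ => Finset.sum_nonneg fun _ _ => by positivity) (Finset.mem_univ q))
  have hGp : 0 ≤ G := Finset.sum_nonneg fun _ _ => Finset.sum_nonneg fun _ _ => by positivity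
  have hGp' : 0 ≤ G' := Finset.sum_nonneg fun _ _ => Finset.sum_nonneg fun _ _ => by positivity
  set Q := C * Real.exp (δ * R) * Real.exp (δ * R) + C * Real.exp (δ * R) + G' + G * Real.exp (δ * R) with hQ
  have hQ0 : 0 ≤ Q := by positivity
  refine ⟨(Nat.factorial (Fintype.card α)) * Q ^ Fintype.card α, by positivity, ?_⟩
  filter_upwards [hC] with k hk z hzp hz
  have hz' : ∀ q, -R ≤ z q := fun q => by
    by_cases hq : q = p
    · rw [hq]; exact hzp
    · exact (abs_le.1 (hz q hq)).1
  have hS : ∀ q r, |P.SN k (τ q) (z q) (τ r) (z r)| ≤ C * Real.exp (-(δ * z q)) * Real.exp (δ * R) := fun q r => by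
    refine (hk _ _ _ _ (hτ q) (hτ r) (hz' q) (hz' r)).trans ?_
    gcongr
    nlinarith [hz' r]
  refine det_row_bound _ p _ Q (Real.exp_pos _) (fun q r => ?_) (fun r => ?_)
  · have h1 : |P.SN k (τ q) (z q) (τ r) (z r)| ≤ C * Real.exp (δ * R) * Real.exp (δ * R) := (hS q r).trans (by
      gcongr
      nlinarith [hz' q])
    have h2 : |gt (τ q, z q) (τ r, z r)| ≤ G' := by
      unfold gt
      split_ifs
      · rw [abs_of_nonneg (gp_nonneg _ _)]
        exact (gp_le _ _).trans (hG1' q r)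
      · simpa using hGp'
    have h3 : 0 ≤ C * Real.exp (δ * R) := by positivity
    have h4 : 0 ≤ G * Real.exp (δ * R) := by positivity
    refine (abs_sub _ _).trans ?_
    simp only
    linarith
  · have h1 := hS p r
    have h2 : |gt (τ p, z p) (τ r, z r)| ≤ G * Real.exp (δ * R) * Real.exp (-(δ * z p)) := by
      unfold gt
      simp only
      split_ifs with hlt
      · rw [abs_of_nonneg (gp_nonneg _ _)]
        have hrp : r ≠ p := fun e => by rw [e] at hlt; exact lt_irrefl _ hlt
        refine (gp_tail _ _ δ (by linarith)).trans ?_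
        rw [mul_assoc G, ← Real.exp_add]
        gcongr
        · exact hG1 p r
        · nlinarith [(abs_le.1 (hz r hrp)).2]
      · rw [abs_zero]; positivity
    have h3 : 0 ≤ C * Real.exp (δ * R) * Real.exp (δ * R) * Real.exp (-(δ * z p)) := by positivity
    have h4 : 0 ≤ G' * Real.exp (-(δ * z p)) := by positivity
    refine (abs_sub _ _).trans ?_
    rw [hQ]
    simp only
    nlinarith

end

def sys (A : Finset ℝ) (k : ℕ) (h : ∀ t ∈ A, t < P.TT k) : EMSys A (Fin (nN k)) :=
  emG (P.al k) (P.be k) (P.al_inj k) (P.be_inj k) (P.be_lt_al k) (fun l : A => P.TT k - l) (fun _ => P.ga k - P.c)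
    (fun a b hab => by have : (a:ℝ) < b := hab; simp only; linarith) (fun l => by have := h l l.2; linarith)

lemma sys_pos (A : Finset ℝ) (k : ℕ) (h : ∀ t ∈ A, t < P.TT k) (x : A × Fin (nN k) → ℝ) : 0 ≤ (P.sys A k h).D Finset.univ x := emG_pos _ _ _ _ _ _ _ _ _ _

lemma sys_K (A : Finset ℝ) (k : ℕ) (h : ∀ t ∈ A, t < P.TT k) (a b : A × ℝ) : (P.sys A k h).K a b = P.KN k (a.1, a.2) (b.1, b.2) := by
  unfold EMSys.K KN gt SN sys emG
  simp only
  congr 2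
  congr 1 <;> ring

lemma sys_Dt {α : Type*} [Fintype α] [DecidableEq α] (A : Finset ℝ) (k : ℕ) (h : ∀ t ∈ A, t < P.TT k) (τ : α → A) (z : α → ℝ) :
    (P.sys A k h).Dt τ z = P.DN k (fun p => (τ p : ℝ)) z := by
  unfold EMSys.Dt DN
  simp_rw [sys_K]

lemma ev_TT {α : Type*} [Fintype α] (τ : α → ℝ) : ∀ᶠ k in atTop, (∀ t ∈ Finset.univ.image τ, t < P.TT k) ∧ Fintype.card α ≤ nN k := by
  have h1 : Tendsto (fun k : ℕ => ((k : ℝ) + 1)) atTop atTop := tendsto_atTop_add_const_right _ _ tendsto_natCast_atTop_atTop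
  filter_upwards [h1.eventually_gt_atTop (2 * ∑ q, |τ q|), nN_tend.eventually_ge_atTop (Fintype.card α)] with k hk hk'
  refine ⟨fun t ht => ?_, hk'⟩
  obtain ⟨q, _, rfl⟩ := Finset.mem_image.1 ht
  have := Finset.single_le_sum (f := fun q => |τ q|) (fun _ _ => abs_nonneg _) (Finset.mem_univ q)
  have := le_abs_self (τ q)
  have := P.TT_ge k
  linarith

lemma DN_props {α : Type*} [Fintype α] [DecidableEq α] (τ : α → ℝ) : ∀ᶠ k in atTop, Measurable (P.DN k τ) ∧ ∀ z, 0 ≤ P.DN k τ z := by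
  filter_upwards [P.ev_TT τ] with k hk
  set τ' : α → (Finset.univ.image τ : Finset ℝ) := fun p => ⟨τ p, Finset.mem_image_of_mem _ (Finset.mem_univ p)⟩ with hτ'
  have e : ∀ z, P.DN k τ z = (P.sys _ k hk.1).Dt τ' z := fun z => by rw [P.sys_Dt _ k hk.1 τ' z]
  constructor
  · rw [funext e]; exact EMSys.mDt _ τ'
  · intro z
    rw [e]
    exact EMSys.Dt_nonneg _ (P.sys_pos _ _ _) _ (by simpa using hk.2) _

lemma DL_meas {α : Type*} [Fintype α] [DecidableEq α] (τ : α → ℝ) : Measurable (P.DL τ) := by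
  obtain ⟨k₀, hk₀⟩ := eventually_atTop.1 (P.DN_props τ)
  refine measurable_of_tendsto_metrizable (f := fun k => P.DN (k + k₀) τ) (fun k => (hk₀ _ (Nat.le_add_left _ _)).1) ?_
  rw [tendsto_pi_nhds]
  exact fun z => (tendsto_add_atTop_iff_nat k₀).2 (P.DN_DL τ z)

lemma DL_nonneg {α : Type*} [Fintype α] [DecidableEq α] (τ z : α → ℝ) : 0 ≤ P.DL τ z :=
  ge_of_tendsto (P.DN_DL τ z) ((P.DN_props τ).mono fun _ h => h.2 z)

end PP

end AW

namespace AW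

/-- Compact space of ordered line ensembles with values in the extended reals. -/
def XX : Type := {y : ℕ × ℝ → EReal // ∀ i t, y (i + 1, t) ≤ y (i, t)}

instance : TopologicalSpace XX := inferInstanceAs (TopologicalSpace {y : ℕ × ℝ → EReal // ∀ i t, y (i + 1, t) ≤ y (i, t)})
instance : T2Space XX := inferInstanceAs (T2Space {y : ℕ × ℝ → EReal // ∀ i t, y (i + 1, t) ≤ y (i, t)})
instance : CompactSpace XX := by
  have hc : IsClosed {y : ℕ × ℝ → EReal | ∀ i t, y (i + 1, t) ≤ y (i, t)} := by
    simp only [Set.ofPred_forall]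
    refine isClosed_iInter fun i => isClosed_iInter fun t => isClosed_le (continuous_apply _) (continuous_apply _)
  exact isCompact_iff_compactSpace.1 hc.isCompact
instance : MeasurableSpace XX := borel XX
instance : BorelSpace XX := ⟨rfl⟩

def ev (q : ℕ × ℝ) (y : XX) : EReal := y.1 q

lemma ev_cont (q : ℕ × ℝ) : Continuous (ev q) := (continuous_apply q).comp continuous_subtype_val
lemma ev_meas (q : ℕ × ℝ) : Measurable (ev q) := (ev_cont q).measurable
lemma ev_anti (t : ℝ) (y : XX) : Antitone fun i => ev (i, t) y := antitone_nat_of_succ_le fun i => y.2 i t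

def srt {N : ℕ} (x : Fin N → ℝ) (i : Fin N) : ℝ := x (Tuple.sort (fun j => -x j) i)

lemma srt_anti {N : ℕ} (x : Fin N → ℝ) : Antitone (srt x) := fun i j h => by
  have := Tuple.monotone_sort (fun j => -x j) h
  simp only [Function.comp_apply, neg_le_neg_iff] at this
  exact this

lemma srt_meas {N : ℕ} (i : Fin N) : Measurable fun x : Fin N → ℝ => srt x i := by
  letI : MeasurableSpace (Equiv.Perm (Fin N)) := ⊤
  have h1 : Measurable fun x : Fin N → ℝ => Tuple.sort (fun j => -x j) := by
    refine measurable_to_countable' fun σ => ?_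
    have : (fun x : Fin N → ℝ => Tuple.sort (fun j => -x j)) ⁻¹' {σ} = {x | (∀ i j, i ≤ j → -x (σ i) ≤ -x (σ j)) ∧ ∀ i j, i < j → -x (σ i) = -x (σ j) → σ i < σ j} := by
      ext x
      simp only [Set.mem_preimage, Set.mem_singleton_iff, Set.mem_ofPred_eq]
      rw [eq_comm, Tuple.eq_sort_iff]; rfl
    rw [this]
    refine measurableSet_setOfPred.2 ((Measurable.forall fun i => Measurable.forall fun j => ?_).and (Measurable.forall fun i => Measurable.forall fun j => ?_))
    · by_cases h : i ≤ j
      · simp only [h, true_imp_iff]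
        exact measurableSet_setOfPred.1 (measurableSet_le (by fun_prop) (by fun_prop))
      · simp only [h, false_imp_iff]; exact measurable_const
    · refine Measurable.imp measurable_const (Measurable.imp ?_ measurable_const)
      exact measurableSet_setOfPred.1 (measurableSet_eq_fun (by fun_prop) (by fun_prop))
  have h2 : Measurable fun q : (Fin N → ℝ) × Equiv.Perm (Fin N) => q.1 (q.2 i) :=
    measurable_from_prod_countable_left fun σ => measurable_pi_apply (σ i)
  exact h2.comp (measurable_id.prodMk h1)

section
variable {A : Finset ℝ} {N : ℕ}

open Classical in
def iotaF (w : A × Fin N → ℝ) (q : ℕ × ℝ) : EReal := if h : q.2 ∈ A ∧ q.1 < N then (w (⟨q.2, h.1⟩, ⟨q.1, h.2⟩) : EReal) else ⊥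

lemma iotaF_mem (w : {w : A × Fin N → ℝ // ∀ l, Antitone fun i => w (l, i)}) (i : ℕ) (t : ℝ) : iotaF w.1 (i + 1, t) ≤ iotaF w.1 (i, t) := by
  unfold iotaF
  by_cases h : t ∈ A ∧ i + 1 < N
  · rw [dif_pos h, dif_pos ⟨h.1, by omega⟩]
    exact EReal.coe_le_coe_iff.2 (w.2 ⟨t, h.1⟩ (by rw [Fin.le_def]; simp))
  · rw [dif_neg h]; exact bot_le

def iota (w : {w : A × Fin N → ℝ // ∀ l, Antitone fun i => w (l, i)}) : XX := ⟨iotaF w.1, iotaF_mem w⟩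

lemma iota_cont : Continuous (iota (A := A) (N := N)) := by
  refine Continuous.subtype_mk ?_ _
  refine continuous_pi fun q => ?_
  unfold iotaF
  split_ifs with h
  · exact continuous_coe_real_ereal.comp ((continuous_apply _).comp continuous_subtype_val)
  · exact continuous_const

def emb (ω : A × Fin N → ℝ) : XX := iota ⟨fun q => srt (fun j => ω (q.1, j)) q.2, fun l => srt_anti fun j => ω (l, j)⟩

lemma emb_meas : Measurable (emb (A := A) (N := N)) := by
  refine (iota_cont (A := A) (N := N)).measurable.comp (Measurable.subtype_mk ?_)
  refine measurable_pi_lambda _ fun q => ?_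
  exact (srt_meas q.2).comp (show Measurable fun (ω : A × Fin N → ℝ) (j : Fin N) => ω (q.1, j) from measurable_pi_lambda _ fun j => measurable_pi_apply (q.1, j))

lemma ev_emb (ω : A × Fin N → ℝ) (t : A) (i : Fin N) : ev ((i : ℕ), (t : ℝ)) (emb ω) = (srt (fun j => ω (t, j)) i : ℝ) := by
  unfold ev emb iota iotaF
  simp only
  rw [dif_pos ⟨t.2, i.2⟩]

lemma ev_emb_bot (ω : A × Fin N → ℝ) (t : ℝ) (i : ℕ) (h : ¬ i < N) : ev (i, t) (emb ω) = ⊥ := by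
  unfold ev emb iota iotaF
  simp only
  rw [dif_neg (fun h' => h h'.2)]

variable {α : Type} [Fintype α] [DecidableEq α]

open Classical in
/-- factorial moment sums -/
def cs (τ : α → ℝ) (w : α → EReal → ℝ≥0∞) (y : XX) : ℝ≥0∞ :=
  ∑' i : α → ℕ, if Function.Injective (fun p => (τ p, i p)) then ∏ p, w p (ev (i p, τ p) y) else 0

open Classical in
lemma cs_meas (τ : α → ℝ) (w : α → EReal → ℝ≥0∞) (hw : ∀ p, Measurable (w p)) : Measurable (cs τ w) := by
  unfold cs
  refine Measurable.tsum fun i => ?_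
  split_ifs
  · exact Finset.measurable_prod _ fun p _ => (hw p).comp (ev_meas _)
  · exact measurable_const

open Classical in
lemma cs_emb (τ : α → A) (w : α → EReal → ℝ≥0∞) (hw : ∀ p, w p ⊥ = 0) (ω : A × Fin N → ℝ) :
    cs (fun p => (τ p : ℝ)) w (emb ω) = ∑ ι : {ι : α → Fin N // Function.Injective fun p => (τ p, ι p)}, ∏ p, w p (ω (τ p, ι.1 p) : ℝ) := by
  set g : {ι : α → Fin N // Function.Injective fun p => (τ p, ι p)} → (α → ℕ) := fun ι p => (ι.1 p : ℕ) with hg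
  have hginj : Function.Injective g := fun ι ι' h => Subtype.ext (funext fun p => Fin.ext (congrFun h p))
  have hinj : ∀ i : α → Fin N, Function.Injective (fun p => ((τ p : ℝ), ((i p : ℕ)))) ↔ Function.Injective (fun p => (τ p, i p)) := by
    intro i
    have : (fun p => ((τ p : ℝ), ((i p : ℕ)))) = (Prod.map (Subtype.val : A → ℝ) (Fin.val : Fin N → ℕ)) ∘ (fun p => (τ p, i p)) := rfl
    rw [this]
    exact (Subtype.val_injective.prodMap Fin.val_injective).of_comp_iff _
  unfold cs
  rw [← hginj.tsum_eq, tsum_fintype]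
  · have hσ : ∀ ι : α → Fin N, Function.Injective (fun p => (τ p, ι p)) ↔ Function.Injective (fun p => (τ p, (Equiv.piCongrRight fun p => Tuple.sort (fun j => -ω (τ p, j))) ι p)) := by
      intro ι
      constructor
      · intro h p q e
        simp only [Equiv.piCongrRight_apply, Pi.map_apply, Prod.mk.injEq] at e
        obtain ⟨e1, e2⟩ := e
        rw [e1] at e2
        exact h (Prod.ext e1 ((Tuple.sort _).injective e2))
      · intro h p q e
        simp only [Prod.mk.injEq] at e
        refine h ?_
        simp only [Equiv.piCongrRight_apply, Pi.map_apply, Prod.mk.injEq]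
        exact ⟨e.1, by rw [e.1, e.2]⟩
    refine Fintype.sum_equiv ((Equiv.piCongrRight fun p => Tuple.sort (fun j => -ω (τ p, j))).subtypeEquiv hσ) _ _ fun ι => ?_
    rw [if_pos ((hinj ι.1).2 ι.2)]
    refine Finset.prod_congr rfl fun p _ => ?_
    rw [hg, ev_emb]; rfl
  · intro i hi
    rw [Function.mem_support] at hi
    have h1 : Function.Injective (fun p => ((τ p : ℝ), i p)) := by
      by_contra h; rw [if_neg h] at hi; exact hi rfl
    rw [if_pos h1] at hi
    have h2 : ∀ p, i p < N := by
      intro p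
      by_contra h
      refine hi (Finset.prod_eq_zero (Finset.mem_univ p) ?_)
      rw [ev_emb_bot ω _ _ h, hw]
    exact ⟨⟨fun p => ⟨i p, h2 p⟩, (hinj _).1 h1⟩, rfl⟩

end

namespace PP
variable (P : PP)

lemma exists_k (A : Finset ℝ) : ∃ k, A.card ≤ k ∧ ∀ t ∈ A, t < P.TT k := by
  have h1 := P.ev_TT (fun t : A => (t : ℝ))
  obtain ⟨k, hk, hk'⟩ := (h1.and (eventually_ge_atTop A.card)).exists
  exact ⟨k, hk', fun t ht => hk.1 t (Finset.mem_image.2 ⟨⟨t, ht⟩, Finset.mem_univ _, rfl⟩)⟩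

def kk (A : Finset ℝ) : ℕ := (P.exists_k A).choose

lemma kk_spec (A : Finset ℝ) : A.card ≤ P.kk A ∧ ∀ t ∈ A, t < P.TT (P.kk A) := (P.exists_k A).choose_spec

lemma kk_tend : Tendsto P.kk atTop atTop := by
  refine tendsto_atTop.2 fun n => ?_
  obtain ⟨A₀, hA₀⟩ := Infinite.exists_subset_card_eq ℝ n
  filter_upwards [eventually_ge_atTop A₀] with A hA
  exact (hA₀ ▸ Finset.card_le_card hA).trans (P.kk_spec A).1

/-- prelimit measure on the space of ensembles -/
def PX (A : Finset ℝ) : Measure XX := (P.sys A (P.kk A) (P.kk_spec A).2).ℙ.map emb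

instance (A : Finset ℝ) : IsProbabilityMeasure (P.PX A) := by
  have := EMSys.isProb _ (P.sys_pos A (P.kk A) (P.kk_spec A).2)
  exact Measure.isProbabilityMeasure_map emb_meas.aemeasurable

variable {α : Type} [Fintype α] [DecidableEq α]

lemma PX_cs (τ : α → ℝ) : ∀ᶠ A in atTop, ∀ w : α → EReal → ℝ≥0∞, (∀ p, Measurable (w p)) → (∀ p, w p ⊥ = 0) →
    ∫⁻ y, cs τ w y ∂P.PX A = ∫⁻ z : α → ℝ, ENNReal.ofReal (P.DN (P.kk A) τ z) * ∏ p, w p (z p) := by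
  classical
  filter_upwards [eventually_ge_atTop (Finset.univ.image τ), P.kk_tend.eventually (P.ev_TT τ)] with A hA hk w hw hw0
  set τ' : α → A := fun p => ⟨τ p, hA (Finset.mem_image_of_mem _ (Finset.mem_univ p))⟩ with hτ'
  unfold PX
  rw [lintegral_map (cs_meas τ w hw) emb_meas]
  have h1 : ∀ ω, cs τ w (emb ω) = _ := fun ω => cs_emb (A := A) (N := nN (P.kk A)) τ' w hw0 ω
  simp_rw [h1]
  have := EMSys.correl _ (P.sys_pos A (P.kk A) (P.kk_spec A).2) τ' (by simpa using hk.2) (fun z => ∏ p, w p (z p : ℝ))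
    (Finset.measurable_prod _ fun p _ => (hw p).comp (measurable_coe_real_ereal.comp (measurable_pi_apply p)))
  refine Eq.trans ?_ (this.trans ?_)
  · congr!
  · simp_rw [P.sys_Dt]; rfl

end PP

end AW

namespace AW

open scoped NNReal

section
variable {α : Type} [Fintype α] [DecidableEq α]

open Classical in
/-- truncated factorial moment sums -/
def csF (s : Finset (α → ℕ)) (τ : α → ℝ) (w : α → EReal → ℝ≥0) (y : XX) : ℝ≥0 :=
  ∑ i ∈ s, if Function.Injective (fun p => (τ p, i p)) then ∏ p, w p (ev (i p, τ p) y) else 0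

lemma csF_cont (s : Finset (α → ℕ)) (τ : α → ℝ) (w : α → EReal → ℝ≥0) (hw : ∀ p, Continuous (w p)) : Continuous (csF s τ w) := by
  unfold csF
  refine continuous_finsetSum _ fun i _ => ?_
  split_ifs
  · exact continuous_finsetProd _ fun p _ => (hw p).comp (ev_cont _)
  · exact continuous_const

open Classical in
lemma csF_coe (s : Finset (α → ℕ)) (τ : α → ℝ) (w : α → EReal → ℝ≥0) (y : XX) :
    (csF s τ w y : ℝ≥0∞) = ∑ i ∈ s, if Function.Injective (fun p => (τ p, i p)) then ∏ p, ((w p (ev (i p, τ p) y) : ℝ≥0) : ℝ≥0∞) else 0 := by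
  unfold csF
  push_cast
  refine Finset.sum_congr rfl fun i _ => ?_
  split_ifs <;> simp

lemma csF_le (s : Finset (α → ℕ)) (τ : α → ℝ) (w : α → EReal → ℝ≥0) (y : XX) :
    (csF s τ w y : ℝ≥0∞) ≤ cs τ (fun p x => (w p x : ℝ≥0∞)) y := by
  rw [csF_coe]; exact ENNReal.sum_le_tsum s

lemma cs_lint (τ : α → ℝ) (w : α → EReal → ℝ≥0) (hw : ∀ p, Continuous (w p)) (μ : Measure XX) (F : ℝ≥0∞)
    (h : ∀ s, ∫⁻ y, (csF s τ w y : ℝ≥0∞) ∂μ ≤ F) : ∫⁻ y, cs τ (fun p x => (w p x : ℝ≥0∞)) y ∂μ ≤ F := by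
  classical
  unfold cs
  have hm : ∀ i : α → ℕ, Measurable fun y => (if Function.Injective (fun p => (τ p, i p)) then ∏ p, ((w p (ev (i p, τ p) y) : ℝ≥0) : ℝ≥0∞) else 0) := by
    intro i
    split_ifs
    · exact Finset.measurable_prod _ fun p _ => measurable_coe_nnreal_ennreal.comp ((hw p).measurable.comp (ev_meas _))
    · exact measurable_const
  rw [lintegral_tsum fun i => (hm i).aemeasurable, ENNReal.tsum_eq_iSup_sum]
  refine iSup_le fun s => ?_
  rw [← lintegral_finsetSum _ fun i _ => hm i]
  simp_rw [csF_coe] at h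
  exact h s

/-- adding one more point at the level of `p` -/
def optT (τ : α → ℝ) (p : α) : Option α → ℝ := fun o => o.elim (τ p) τ
def optW {β : Type} (w : α → β) (v : β) : Option α → β := fun o => o.elim v w

open Classical in
lemma tail_one (τ : α → ℝ) (w : α → EReal → ℝ≥0∞) (v : EReal → ℝ≥0∞) (R : EReal) (p : α) (hw : ∀ x, w p x ≠ 0 → R ≤ x) (hv : ∀ x, R ≤ x → v x = 1)
    (L : ℕ) (y : XX) :
    ((L - Fintype.card α : ℕ) : ℝ≥0∞) * (∑' i : α → ℕ, if L ≤ i p then (if Function.Injective (fun p => (τ p, i p)) then ∏ p, w p (ev (i p, τ p) y) else 0) else 0)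
      ≤ cs (optT τ p) (optW w v) y := by
  unfold cs
  rw [← (Equiv.piOptionEquivProd (β := fun _ => ℕ)).symm.tsum_eq, ENNReal.tsum_prod', ENNReal.tsum_comm, ← ENNReal.tsum_mul_left]
  refine ENNReal.tsum_le_tsum fun i => ?_
  by_cases hL : L ≤ i p
  swap
  · simp [hL]
  rw [if_pos hL]
  by_cases hi : Function.Injective (fun p => (τ p, i p))
  swap
  · simp [hi]
  rw [if_pos hi]
  by_cases h0 : ∏ p, w p (ev (i p, τ p) y) = 0
  · rw [h0]; simp
  have hev : R ≤ ev (i p, τ p) y := hw _ fun h => h0 (Finset.prod_eq_zero (Finset.mem_univ p) h)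
  refine le_trans ?_ (ENNReal.sum_le_tsum (Finset.range L \ Finset.univ.image i))
  have h1 : ∀ j ∈ Finset.range L \ Finset.univ.image i,
      (if Function.Injective (fun o : Option α => (optT τ p o, (Equiv.piOptionEquivProd (β := fun _ => ℕ)).symm (j, i) o)) then ∏ o : Option α, optW w v o (ev ((Equiv.piOptionEquivProd (β := fun _ => ℕ)).symm (j, i) o, optT τ p o) y) else 0)
       = ∏ p, w p (ev (i p, τ p) y) := by
    intro j hj
    rw [Finset.mem_sdiff, Finset.mem_range, Finset.mem_image] at hj
    have hne : ∀ q, i q ≠ j := fun q h => hj.2 ⟨q, Finset.mem_univ _, h⟩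
    rw [if_pos, Fintype.prod_option]
    · have : v (ev (j, τ p) y) = 1 := hv _ (hev.trans (ev_anti (τ p) y (by omega)))
      simp only [optW, optT, Equiv.piOptionEquivProd, Equiv.coe_fn_symm_mk, Option.elim_none, Option.elim_some]
      rw [this, one_mul]
    · intro o o' h
      simp only [Prod.mk.injEq] at h
      rcases o with _ | q <;> rcases o' with _ | q'
      · rfl
      · exact absurd h.2.symm (hne q')
      · exact absurd h.2 (hne q)
      · exact congrArg some (hi (Prod.ext h.1 h.2))
  rw [Finset.sum_congr rfl h1, Finset.sum_const, nsmul_eq_mul]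
  gcongr
  have := Finset.le_card_sdiff (Finset.univ.image i) (Finset.range L)
  rw [Finset.card_range] at this
  have h3 : (Finset.univ.image i).card ≤ Fintype.card α := Finset.card_image_le
  omega

lemma tail_pt (τ : α → ℝ) (w : α → EReal → ℝ≥0) (v : EReal → ℝ≥0∞) (R : EReal) (hw : ∀ p x, w p x ≠ 0 → R ≤ x) (hv : ∀ x, R ≤ x → v x = 1)
    (L : ℕ) (y : XX) :
    cs τ (fun p x => (w p x : ℝ≥0∞)) y ≤ csF (Fintype.piFinset fun _ => Finset.range (L + 1 + Fintype.card α)) τ w y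
      + ((L + 1 : ℕ) : ℝ≥0∞)⁻¹ * ∑ p, cs (optT τ p) (optW (fun p x => (w p x : ℝ≥0∞)) v) y := by
  classical
  set n := Fintype.card α
  have h1 : ∀ p, (∑' i : α → ℕ, if L + 1 + n ≤ i p then (if Function.Injective (fun p => (τ p, i p)) then ∏ p, ((w p (ev (i p, τ p) y) : ℝ≥0) : ℝ≥0∞) else 0) else 0)
      ≤ ((L + 1 : ℕ) : ℝ≥0∞)⁻¹ * cs (optT τ p) (optW (fun p x => (w p x : ℝ≥0∞)) v) y := by
    intro p
    have := tail_one τ (fun p x => (w p x : ℝ≥0∞)) v R p (fun x hx => hw p x (by simpa using hx)) hv (L + 1 + n) y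
    have e : L + 1 + n - Fintype.card α = L + 1 := by omega
    rw [e] at this
    rw [← ENNReal.mul_le_iff_le_inv (by simp) (by simp)]
    exact this
  rw [Finset.mul_sum]
  refine le_trans ?_ (add_le_add_right (Finset.sum_le_sum fun p _ => h1 p) _)
  rw [csF_coe]
  unfold cs
  have h2 : ∀ s : Finset (α → ℕ), ∀ f : (α → ℕ) → ℝ≥0∞, ∑ i ∈ s, f i = ∑' i, if i ∈ s then f i else 0 := by
    intro s f
    rw [tsum_eq_sum (s := s) (fun i hi => if_neg hi)]
    exact Finset.sum_congr rfl fun i hi => (if_pos hi).symm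
  rw [h2, ← Summable.tsum_finsetSum (fun _ _ => ENNReal.summable), ← ENNReal.tsum_add]
  refine ENNReal.tsum_le_tsum fun i => ?_
  by_cases hi : i ∈ Fintype.piFinset fun _ : α => Finset.range (L + 1 + n)
  · rw [if_pos hi]; exact le_self_add
  · rw [Fintype.mem_piFinset] at hi
    push Not at hi
    obtain ⟨p, hp⟩ := hi
    rw [Finset.mem_range, not_lt] at hp
    refine le_trans ?_ le_add_self
    refine le_trans ?_ (Finset.single_le_sum (fun _ _ => zero_le) (Finset.mem_univ p))
    rw [if_pos hp]

/-- an integrable box majorant -/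
def hbx (δ R : ℝ) (p₀ q : α) (x : ℝ) : ℝ := if q = p₀ then (Set.Ici (-R)).indicator (fun x => Real.exp (-(δ * x))) x else (Set.Icc (-R) R).indicator 1 x

lemma hb_lt (δ R : ℝ) (hδ : 0 < δ) (p₀ : α) : ∫⁻ z : α → ℝ, ENNReal.ofReal (∏ q, hbx δ R p₀ q (z q)) ≠ ⊤ := by
  refine (Integrable.lintegral_lt_top ?_).ne
  refine Integrable.fintype_prod_dep fun q => ?_
  unfold hbx
  split_ifs
  · rw [integrable_indicator_iff measurableSet_Ici, integrableOn_Ici_iff_integrableOn_Ioi]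
    simpa [neg_mul] using exp_neg_integrableOn_Ioi (-R) hδ
  · rw [integrable_indicator_iff measurableSet_Icc]
    exact integrableOn_const (by simp)

end

namespace PP
variable (P : PP) {α : Type} [Fintype α] [DecidableEq α]

lemma DN_hb (τ : α → ℝ) (p₀ : α) (R : ℝ) (hR : 0 ≤ R) (M : ℝ≥0) : ∃ δ > 0, ∃ C : ℝ, 0 ≤ C ∧ ∀ᶠ k in atTop, ∀ w : α → EReal → ℝ≥0,
    (∀ p x, w p x ≠ 0 → ((-R : ℝ) : EReal) ≤ x) → (∀ p x, p ≠ p₀ → w p x ≠ 0 → x ≤ (R : EReal)) → (∀ p x, w p x ≤ M) →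
    ∀ z, ENNReal.ofReal (P.DN k τ z) * ∏ q, (w q (z q) : ℝ≥0∞) ≤ ENNReal.ofReal C * ENNReal.ofReal (∏ q, hbx δ R p₀ q (z q)) := by
  obtain ⟨δ, hδ, had⟩ := P.exists_adm
  obtain ⟨C, hC, hk⟩ := P.DN_bound δ hδ had τ p₀ R hR
  refine ⟨δ, hδ, C * M ^ Fintype.card α, by positivity, ?_⟩
  filter_upwards [hk] with k hk w h1 h2 h3 z
  by_cases h0 : ∏ q, (w q (z q) : ℝ≥0∞) = 0
  · rw [h0, mul_zero]; exact zero_le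
  have hne : ∀ q, w q (z q) ≠ 0 := fun q h => h0 (Finset.prod_eq_zero (Finset.mem_univ q) (by simp [h]))
  have ha : ∀ q, -R ≤ z q := fun q => EReal.coe_le_coe_iff.1 (h1 q _ (hne q))
  have hbx' : ∀ q, q ≠ p₀ → z q ≤ R := fun q hq => EReal.coe_le_coe_iff.1 (h2 q _ hq (hne q))
  have e : ∏ q, hbx δ R p₀ q (z q) = Real.exp (-(δ * z p₀)) := by
    rw [Finset.prod_eq_single p₀]
    · unfold hbx; rw [if_pos rfl, Set.indicator_of_mem (Set.mem_Ici.2 (ha p₀))]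
    · intro q _ hq
      unfold hbx; rw [if_neg hq, Set.indicator_of_mem (Set.mem_Icc.2 ⟨ha q, hbx' q hq⟩)]; rfl
    · simp
  rw [e, ← ENNReal.ofReal_mul (by positivity)]
  have h4 : ∏ q, (w q (z q) : ℝ≥0∞) ≤ ENNReal.ofReal ((M : ℝ) ^ Fintype.card α) := by
    rw [ENNReal.ofReal_pow (by positivity), ENNReal.ofReal_coe_nnreal, ← Finset.card_univ, ← Finset.prod_const]
    exact Finset.prod_le_prod' fun q _ => by exact_mod_cast h3 q _
  refine (mul_le_mul' (ENNReal.ofReal_le_ofReal ((le_abs_self _).trans (hk z (ha p₀) fun q hq => abs_le.2 ⟨ha q, hbx' q hq⟩))) h4).trans ?_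
  rw [← ENNReal.ofReal_mul (by positivity)]
  exact ENNReal.ofReal_le_ofReal (by linarith)

def UU : Ultrafilter (Finset ℝ) := Ultrafilter.of atTop

lemma UU_le : (UU : Filter (Finset ℝ)) ≤ atTop := Ultrafilter.of_le _

def PXp (A : Finset ℝ) : ProbabilityMeasure XX := ⟨P.PX A, inferInstance⟩

lemma exists_mu : ∃ μ : ProbabilityMeasure XX, Tendsto P.PXp UU (𝓝 μ) := by
  obtain ⟨μ, -, h⟩ := isCompact_univ.ultrafilter_le_nhds (UU.map P.PXp) (by simp)
  exact ⟨μ, h⟩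

/-- the limiting law -/
def mu : Measure XX := (P.exists_mu.choose : Measure XX)

instance : IsProbabilityMeasure P.mu := by unfold mu; infer_instance

lemma lim_csF (s : Finset (α → ℕ)) (τ : α → ℝ) (w : α → EReal → ℝ≥0) (hw : ∀ p, Continuous (w p)) :
    Tendsto (fun A => ∫⁻ y, (csF s τ w y : ℝ≥0∞) ∂P.PX A) UU (𝓝 (∫⁻ y, (csF s τ w y : ℝ≥0∞) ∂P.mu)) :=
  (ProbabilityMeasure.tendsto_iff_forall_lintegral_tendsto.1 P.exists_mu.choose_spec) (BoundedContinuousFunction.mkOfCompact ⟨csF s τ w, csF_cont s τ w hw⟩)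

lemma cs_mu_le (τ : α → ℝ) (w : α → EReal → ℝ≥0) (hw : ∀ p, Continuous (w p)) (F : ℝ≥0∞)
    (h : ∀ᶠ A in atTop, ∫⁻ y, cs τ (fun p x => (w p x : ℝ≥0∞)) y ∂P.PX A ≤ F) : ∫⁻ y, cs τ (fun p x => (w p x : ℝ≥0∞)) y ∂P.mu ≤ F := by
  refine cs_lint τ w hw _ _ fun s => ?_
  refine le_of_tendsto (P.lim_csF s τ w hw) ?_
  filter_upwards [UU_le h] with A hA
  exact (lintegral_mono fun y => csF_le s τ w y).trans hA

end PP

end AW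

namespace AW

open scoped NNReal

/-- clamp to a bounded interval -/
def cl (R : ℝ) (x : EReal) : ℝ := (max ((-R : ℝ) : EReal) (min (R : EReal) x)).toReal

lemma cl_cont (R : ℝ) : Continuous (cl R) := by
  unfold cl
  refine EReal.continuousOn_toReal.comp_continuous (continuous_const.max (continuous_const.min continuous_id)) fun x => ?_
  have h1 : max ((-R : ℝ) : EReal) (min (R : EReal) x) ≤ ((max (-R) R : ℝ) : EReal) :=
    max_le (EReal.coe_le_coe_iff.2 (le_max_left _ _)) ((min_le_left _ _).trans (EReal.coe_le_coe_iff.2 (le_max_right _ _)))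
  have h2 : ((-R : ℝ) : EReal) ≤ max ((-R : ℝ) : EReal) (min (R : EReal) x) := le_max_left _ _
  simp only [Set.mem_compl_iff, Set.mem_insert_iff, Set.mem_singleton_iff, not_or]
  exact ⟨fun h => by rw [h] at h2; exact absurd (le_bot_iff.1 h2) (EReal.coe_ne_bot _), fun h => by rw [h] at h1; exact absurd (top_le_iff.1 h1) (EReal.coe_ne_top _)⟩

lemma cl_coe (R x : ℝ) : cl R (x : EReal) = max (-R) (min R x) := by
  unfold cl
  have h : Monotone (fun r : ℝ => (r : EReal)) := fun a b h => EReal.coe_le_coe_iff.2 h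
  rw [← h.map_min, ← h.map_max, EReal.toReal_coe]

lemma cl_top (R : ℝ) (hR : 0 ≤ R) : cl R ⊤ = R := by
  unfold cl
  rw [min_eq_left le_top, max_eq_right (EReal.coe_le_coe_iff.2 (by linarith)), EReal.toReal_coe]

lemma cl_bot (R : ℝ) : cl R ⊥ = -R := by
  unfold cl
  rw [min_eq_right bot_le, max_eq_left bot_le, EReal.toReal_coe]

def u0 (R : ℝ) (x : EReal) : ℝ≥0 := min 1 (Real.toNNReal (R + 1 - |cl (R + 1) x|))

lemma u0_cont (R : ℝ) : Continuous (u0 R) :=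
  continuous_const.min (continuous_real_toNNReal.comp (continuous_const.sub (cl_cont _).abs))

lemma u0_one (R x : ℝ) (h : |x| ≤ R) : u0 R x = 1 := by
  unfold u0
  rw [abs_le] at h
  have e : max (-(R + 1)) (min (R + 1) x) = x := by rw [min_eq_right (by linarith), max_eq_right (by linarith)]
  rw [cl_coe, e, min_eq_left]
  rw [← Real.toNNReal_one]
  refine Real.toNNReal_le_toNNReal ?_
  have : |x| ≤ R := abs_le.2 h
  linarith

lemma u0_supp (R : ℝ) (hR : 0 ≤ R) (x : EReal) (h : u0 R x ≠ 0) : ∃ r : ℝ, x = r ∧ |r| ≤ R + 1 := by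
  induction x with
  | bot => exfalso; apply h; unfold u0; rw [cl_bot, abs_neg, abs_of_nonneg (by linarith)]; simp
  | top => exfalso; apply h; unfold u0; rw [cl_top _ (by linarith), abs_of_nonneg (by linarith)]; simp
  | coe r =>
    refine ⟨r, rfl, ?_⟩
    by_contra hr
    apply h
    unfold u0
    rw [cl_coe]
    rcases lt_abs.1 (not_le.1 hr) with h1 | h1
    · rw [min_eq_left h1.le, max_eq_right (by linarith), abs_of_nonneg (by linarith)]; simp
    · have e : max (-(R + 1)) (min (R + 1) r) = -(R + 1) := by rw [min_eq_right (by linarith), max_eq_left (by linarith)]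
      rw [e, abs_neg, abs_of_nonneg (by linarith)]; simp

def vv (r : ℝ) (x : EReal) : ℝ≥0 := min 1 (Real.toNNReal (cl (|r| + 1) x - r))

lemma vv_cont (r : ℝ) : Continuous (vv r) :=
  continuous_const.min (continuous_real_toNNReal.comp ((cl_cont _).sub continuous_const))

lemma vv_le (R : ℝ) (x : EReal) : vv R x ≤ 1 := min_le_left _ _

lemma vv_one (r : ℝ) (x : EReal) (h : ((r + 1 : ℝ) : EReal) ≤ x) : vv r x = 1 := by
  unfold vv
  rw [min_eq_left]
  rw [← Real.toNNReal_one]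
  refine Real.toNNReal_le_toNNReal ?_
  have h3 := le_abs_self r
  induction x with
  | bot => exact absurd (le_bot_iff.1 h) (EReal.coe_ne_bot _)
  | top => rw [cl_top _ (by positivity)]; linarith
  | coe s =>
    have := EReal.coe_le_coe_iff.1 h
    rw [cl_coe, le_sub_iff_add_le]
    refine le_max_of_le_right (le_min (by linarith) (by linarith))

lemma vv_supp (r : ℝ) (x : EReal) (h : vv r x ≠ 0) : (r : EReal) ≤ x := by
  have h3 := neg_abs_le r
  induction x with
  | bot => exfalso; apply h; unfold vv; rw [cl_bot, Real.toNNReal_of_nonpos (by linarith)]; simp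
  | top => exact le_top
  | coe s =>
    rw [EReal.coe_le_coe_iff]
    by_contra hs
    apply h
    unfold vv
    rw [cl_coe, Real.toNNReal_of_nonpos]
    · simp
    · rw [sub_nonpos]; exact max_le (by linarith) ((min_le_right _ _).trans (by linarith))

namespace PP
variable (P : PP) {α : Type} [Fintype α] [DecidableEq α]

lemma exists_M (w : α → EReal → ℝ≥0) (hw : ∀ p, Continuous (w p)) : ∃ M : ℝ≥0, 1 ≤ M ∧ ∀ p x, w p x ≤ M := by
  have : ∀ p, ∃ M : ℝ≥0, ∀ x, w p x ≤ M := fun p => by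
    obtain ⟨M, hM⟩ := (isCompact_range (hw p)).bddAbove
    exact ⟨M, fun x => hM ⟨x, rfl⟩⟩
  choose M hM using this
  refine ⟨1 + ∑ p, M p, le_self_add, fun p x => (hM p x).trans ?_⟩
  exact (Finset.single_le_sum (fun _ _ => zero_le) (Finset.mem_univ p)).trans le_add_self

lemma PX_le (τ : α → ℝ) (p₀ : α) (R : ℝ) (hR : 0 ≤ R) (M : ℝ≥0) : ∃ δ > 0, ∃ C : ℝ, 0 ≤ C ∧ ∀ᶠ A in atTop, ∀ w : α → EReal → ℝ≥0, (∀ p, Continuous (w p)) →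
    (∀ p x, w p x ≠ 0 → ((-R : ℝ) : EReal) ≤ x) → (∀ p x, p ≠ p₀ → w p x ≠ 0 → x ≤ (R : EReal)) → (∀ p x, w p x ≤ M) →
    ∫⁻ y, cs τ (fun p x => (w p x : ℝ≥0∞)) y ∂P.PX A ≤ ENNReal.ofReal C * ∫⁻ z : α → ℝ, ENNReal.ofReal (∏ q, hbx δ R p₀ q (z q)) := by
  obtain ⟨δ, hδ, C, hC, hk⟩ := P.DN_hb τ p₀ R hR M
  refine ⟨δ, hδ, C, hC, ?_⟩
  filter_upwards [P.PX_cs τ, P.kk_tend.eventually hk] with A hA hk w hw h1 h2 h3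
  rw [hA (fun p x => (w p x : ℝ≥0∞)) (fun p => measurable_coe_nnreal_ennreal.comp (hw p).measurable) (fun p => ?_), ← lintegral_const_mul' _ _ ENNReal.ofReal_ne_top]
  · exact lintegral_mono fun z => hk w h1 h2 h3 z
  · have : w p ⊥ = 0 := by
      by_contra h
      exact absurd (le_bot_iff.1 (h1 p _ h)) (EReal.coe_ne_bot _)
    simp [this]

lemma opt_le (τ : α → ℝ) (p : α) (R : ℝ) (hR : 0 ≤ R) (w : α → EReal → ℝ≥0) (hw : ∀ p, Continuous (w p))
    (h1 : ∀ p x, w p x ≠ 0 → ((-R : ℝ) : EReal) ≤ x ∧ x ≤ (R : EReal)) : ∃ C : ℝ≥0∞, C ≠ ⊤ ∧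
    ∀ᶠ A in atTop, ∫⁻ y, cs (optT τ p) (optW (fun p x => (w p x : ℝ≥0∞)) (fun x => (vv (-R - 1) x : ℝ≥0∞))) y ∂P.PX A ≤ C := by
  obtain ⟨M, hM1, hM⟩ := exists_M w hw
  obtain ⟨δ, hδ, C, hC, h⟩ := P.PX_le (optT τ p) (none : Option α) (R + 1) (by linarith) M
  refine ⟨_, ENNReal.mul_ne_top (ENNReal.ofReal_ne_top (r := C)) (hb_lt δ (R + 1) hδ (none : Option α)), ?_⟩
  filter_upwards [h] with A hA
  have e : optW (fun p x => (w p x : ℝ≥0∞)) (fun x => (vv (-R - 1) x : ℝ≥0∞)) = fun o x => (optW w (vv (-R - 1)) o x : ℝ≥0∞) := by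
    funext o x; cases o <;> rfl
  rw [e]
  refine hA _ ?_ ?_ ?_ ?_
  · rintro (_ | p)
    · exact vv_cont _
    · exact hw p
  · rintro (_ | p) x hx
    · have := vv_supp _ _ hx
      rwa [show -R - 1 = -(R + 1) by ring] at this
    · exact (EReal.coe_le_coe_iff.2 (by linarith)).trans (h1 p x hx).1
  · rintro (_ | p) x hp hx
    · exact absurd rfl hp
    · exact (h1 p x hx).2.trans (EReal.coe_le_coe_iff.2 (by linarith))
  · rintro (_ | p) x
    · exact (vv_le _ _).trans hM1
    · exact hM p x

lemma mu_cont [Nonempty α] (τ : α → ℝ) (R : ℝ) (hR : 0 ≤ R) (w : α → EReal → ℝ≥0) (hw : ∀ p, Continuous (w p))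
    (h1 : ∀ p x, w p x ≠ 0 → ((-R : ℝ) : EReal) ≤ x ∧ x ≤ (R : EReal)) :
    ∫⁻ y, cs τ (fun p x => (w p x : ℝ≥0∞)) y ∂P.mu = ∫⁻ z : α → ℝ, ENNReal.ofReal (P.DL τ z) * ∏ q, (w q (z q) : ℝ≥0∞) ∧
      ∫⁻ z : α → ℝ, ENNReal.ofReal (P.DL τ z) * ∏ q, (w q (z q) : ℝ≥0∞) ≠ ⊤ := by
  obtain ⟨M, hM1, hM⟩ := exists_M w hw
  obtain ⟨p₀⟩ := ‹Nonempty α›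
  obtain ⟨δ, hδ, C, hC, hk⟩ := P.DN_hb τ p₀ R hR M
  have hk' : ∀ᶠ k in atTop, ∀ z, ENNReal.ofReal (P.DN k τ z) * ∏ q, (w q (z q) : ℝ≥0∞) ≤ ENNReal.ofReal C * ENNReal.ofReal (∏ q, hbx δ R p₀ q (z q)) := by
    filter_upwards [hk] with k hk
    exact hk w (fun p x h => (h1 p x h).1) (fun p x _ h => (h1 p x h).2) hM
  have hfin : ∫⁻ z : α → ℝ, ENNReal.ofReal C * ENNReal.ofReal (∏ q, hbx δ R p₀ q (z q)) ≠ ⊤ := by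
    rw [lintegral_const_mul' _ _ ENNReal.ofReal_ne_top]
    exact ENNReal.mul_ne_top ENNReal.ofReal_ne_top (hb_lt δ R hδ p₀)
  have hpt : ∀ z, Tendsto (fun k => ENNReal.ofReal (P.DN k τ z) * ∏ q, (w q (z q) : ℝ≥0∞)) atTop (𝓝 (ENNReal.ofReal (P.DL τ z) * ∏ q, (w q (z q) : ℝ≥0∞))) := by
    intro z
    refine ENNReal.Tendsto.mul_const (ENNReal.tendsto_ofReal (P.DN_DL τ z)) (Or.inr ?_)
    exact ENNReal.prod_ne_top fun _ _ => ENNReal.coe_ne_top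
  have hmw : Measurable fun z : α → ℝ => ∏ q, (w q (z q) : ℝ≥0∞) :=
    Finset.measurable_prod _ fun q _ => measurable_coe_nnreal_ennreal.comp ((hw q).measurable.comp (measurable_coe_real_ereal.comp (measurable_pi_apply q)))
  set F := ∫⁻ z : α → ℝ, ENNReal.ofReal (P.DL τ z) * ∏ q, (w q (z q) : ℝ≥0∞) with hF
  have hFtop : F ≠ ⊤ := by
    refine ne_top_of_le_ne_top hfin (lintegral_mono fun z => ?_)
    exact le_of_tendsto (hpt z) (hk'.mono fun k h => h z)
  refine ⟨?_, hFtop⟩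
  have hlim : Tendsto (fun k => ∫⁻ z : α → ℝ, ENNReal.ofReal (P.DN k τ z) * ∏ q, (w q (z q) : ℝ≥0∞)) atTop (𝓝 F) := by
    refine tendsto_lintegral_filter_of_dominated_convergence _ ?_ ?_ hfin (ae_of_all _ hpt)
    · filter_upwards [P.DN_props τ] with k hk
      exact hk.1.ennreal_ofReal.mul hmw
    · filter_upwards [hk'] with k hk
      exact ae_of_all _ hk
  have hw0 : ∀ p, ((w p ⊥ : ℝ≥0) : ℝ≥0∞) = 0 := by
    intro p
    have : w p ⊥ = 0 := by
      by_contra h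
      exact absurd (le_bot_iff.1 (h1 p _ h).1) (EReal.coe_ne_bot _)
    simp [this]
  have hFA : Tendsto (fun A => ∫⁻ y, cs τ (fun p x => (w p x : ℝ≥0∞)) y ∂P.PX A) UU (𝓝 F) := by
    refine ((hlim.comp P.kk_tend).mono_left UU_le).congr' ?_
    filter_upwards [UU_le (P.PX_cs τ)] with A hA
    exact (hA _ (fun p => measurable_coe_nnreal_ennreal.comp (hw p).measurable) hw0).symm
  refine le_antisymm ?_ ?_
  · refine cs_lint τ w hw _ _ fun s => le_of_tendsto_of_tendsto' (P.lim_csF s τ w hw) hFA fun A => lintegral_mono fun y => csF_le s τ w y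
  · choose Cp hCp hCp' using fun p => P.opt_le τ p R hR w hw h1
    have key : ∀ L : ℕ, F ≤ ∫⁻ y, cs τ (fun p x => (w p x : ℝ≥0∞)) y ∂P.mu + ((L + 1 : ℕ) : ℝ≥0∞)⁻¹ * ∑ p, Cp p := by
      intro L
      set s : Finset (α → ℕ) := Fintype.piFinset fun _ => Finset.range (L + 1 + Fintype.card α)
      refine le_trans ?_ (add_le_add_left (lintegral_mono fun y => csF_le s τ w y) _)
      refine le_of_tendsto_of_tendsto hFA ((P.lim_csF s τ w hw).add_const _) ?_
      filter_upwards [UU_le (eventually_all.2 hCp')] with A hA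
      refine (lintegral_mono fun y => tail_pt τ w (fun x => (vv (-R - 1) x : ℝ≥0∞)) ((-R : ℝ) : EReal) (fun p x h => (h1 p x h).1) (fun x hx => ?_) L y).trans ?_
      · rw [vv_one _ _ (by rwa [show -R - 1 + 1 = -R by ring])]; simp
      · have hmo : ∀ p, Measurable (cs (optT τ p) (optW (fun p x => (w p x : ℝ≥0∞)) (fun x => (vv (-R - 1) x : ℝ≥0∞)))) := by
          intro p
          refine cs_meas _ _ ?_
          rintro (_ | q)
          · exact measurable_coe_nnreal_ennreal.comp (vv_cont _).measurable
          · exact measurable_coe_nnreal_ennreal.comp (hw q).measurable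
        rw [lintegral_add_left (show Measurable fun y => (csF s τ w y : ℝ≥0∞) from measurable_coe_nnreal_ennreal.comp (csF_cont s τ w hw).measurable),
          lintegral_const_mul _ (Finset.measurable_sum _ fun p _ => hmo p), lintegral_finsetSum _ fun p _ => hmo p]
        gcongr with p _
        exact hA p
    have hz : Tendsto (fun L : ℕ => ∫⁻ y, cs τ (fun p x => (w p x : ℝ≥0∞)) y ∂P.mu + ((L + 1 : ℕ) : ℝ≥0∞)⁻¹ * ∑ p, Cp p) atTop (𝓝 (∫⁻ y, cs τ (fun p x => (w p x : ℝ≥0∞)) y ∂P.mu + 0 * ∑ p, Cp p)) := by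
      refine Tendsto.const_add _ (ENNReal.Tendsto.mul_const ?_ (Or.inr ?_))
      · exact ENNReal.tendsto_inv_nat_nhds_zero.comp (tendsto_add_atTop_nat 1)
      · exact ENNReal.sum_ne_top.2 fun p _ => hCp p
    rw [zero_mul, add_zero] at hz
    exact ge_of_tendsto' hz key

/-- one-point tail estimate -/
lemma mu_tail (t r : ℝ) : ∫⁻ y, cs (fun _ : Unit => t) (fun _ x => (vv r x : ℝ≥0∞)) y ∂P.mu ≠ ⊤ := by
  obtain ⟨δ, hδ, C, hC, h⟩ := P.PX_le (fun _ : Unit => t) () |r| (abs_nonneg r) 1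
  refine ne_top_of_le_ne_top (ENNReal.mul_ne_top (ENNReal.ofReal_ne_top (r := C)) (hb_lt δ |r| hδ ())) (P.cs_mu_le _ (fun _ => vv r) (fun _ => vv_cont r) _ ?_)
  filter_upwards [h] with A hA
  refine hA _ (fun _ => vv_cont r) (fun _ x hx => ?_) (fun p x hp => absurd rfl hp) (fun _ x => vv_le _ _)
  exact (EReal.coe_le_coe_iff.2 (neg_abs_le r)).trans (vv_supp _ _ hx)

/-- decay of the one-point tail -/
lemma mu_tail' (t : ℝ) : ∃ c > 0, ∃ H : ℝ≥0∞, H ≠ ⊤ ∧ ∀ r : ℝ, 0 ≤ r → ∫⁻ y, cs (fun _ : Unit => t) (fun _ x => (vv r x : ℝ≥0∞)) y ∂P.mu ≤ ENNReal.ofReal (Real.exp (-(c * r))) * H := by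
  obtain ⟨δ, hδ, C, hC, hk⟩ := P.DN_hb (fun _ : Unit => t) () 0 le_rfl 1
  refine ⟨δ / 2, by linarith, ENNReal.ofReal C * ∫⁻ z : Unit → ℝ, ENNReal.ofReal (∏ q, hbx (δ / 2) 0 () q (z q)),
    ENNReal.mul_ne_top ENNReal.ofReal_ne_top (hb_lt (δ / 2) 0 (by linarith) ()), fun r hr => ?_⟩
  refine P.cs_mu_le _ (fun _ => vv r) (fun _ => vv_cont r) _ ?_
  filter_upwards [P.PX_cs (fun _ : Unit => t), P.kk_tend.eventually hk] with A hA hk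
  rw [hA (fun _ x => (vv r x : ℝ≥0∞)) (fun p => measurable_coe_nnreal_ennreal.comp (vv_cont r).measurable) (fun p => ?_), ← mul_assoc,
    ← lintegral_const_mul' _ _ (ENNReal.mul_ne_top ENNReal.ofReal_ne_top ENNReal.ofReal_ne_top)]
  · refine lintegral_mono fun z => ?_
    by_cases h0 : vv r (z ()) = 0
    · simp [h0]
    have hz : r ≤ z () := EReal.coe_le_coe_iff.1 (vv_supp _ _ h0)
    refine (hk (fun _ => vv r) (fun _ x hx => ?_) (fun p x hp => absurd rfl hp) (fun _ x => vv_le _ _) z).trans ?_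
    · exact (EReal.coe_le_coe_iff.2 (by linarith)).trans (vv_supp _ _ hx)
    · rw [mul_comm (ENNReal.ofReal (Real.exp _)), mul_assoc, ← ENNReal.ofReal_mul (Real.exp_pos _).le]
      gcongr
      simp only [Finset.univ_unique, Finset.prod_singleton, hbx, if_true]
      rw [Set.indicator_of_mem, Set.indicator_of_mem, ← Real.exp_add]
      · refine Real.exp_le_exp.2 ?_
        have : δ * r ≤ δ * z () := by gcongr
        have e : z default = z () := rfl
        rw [e]; linarith
      · rw [Set.mem_Ici]; exact (by linarith : -(0:ℝ) ≤ r).trans hz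
      · rw [Set.mem_Ici]; exact (by linarith : -(0:ℝ) ≤ r).trans hz
  · have : vv r ⊥ = 0 := by
      by_contra h
      exact absurd (le_bot_iff.1 (vv_supp _ _ h)) (EReal.coe_ne_bot _)
    simp [this]

end PP

end AW

namespace AW

open scoped NNReal

section
variable {α : Type} [Fintype α] [DecidableEq α]

lemma ext_pi (μ ν : Measure (α → ℝ)) [IsFiniteMeasure μ]
    (h : ∀ f : α → BoundedContinuousFunction ℝ ℝ≥0, ∫⁻ z, ∏ p, (f p (z p) : ℝ≥0∞) ∂μ = ∫⁻ z, ∏ p, (f p (z p) : ℝ≥0∞) ∂ν) : μ = ν := by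
  have hι : Measurable fun z : α → ℝ => (z, fun _ : Empty => (0 : ℝ)) := measurable_id.prodMk measurable_const
  have key : μ.map (fun z : α → ℝ => (z, fun _ : Empty => (0 : ℝ))) = ν.map (fun z : α → ℝ => (z, fun _ : Empty => (0 : ℝ))) := by
    have := Measure.isFiniteMeasure_map μ (fun z : α → ℝ => (z, fun _ : Empty => (0 : ℝ)))
    refine Measure.ext_of_lintegral_prod_mul_prod_boundedContinuousFunction fun f g => ?_
    have hm : Measurable fun p : (α → ℝ) × (Empty → ℝ) => ∏ i, (f i (p.1 i) : ℝ≥0∞) :=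
      Finset.measurable_prod _ fun i _ => measurable_coe_nnreal_ennreal.comp ((f i).continuous.measurable.comp ((measurable_pi_apply i).comp measurable_fst))
    simp only [ENNReal.ofNNReal_finsetProd, Finset.univ_eq_empty, Finset.prod_empty, ENNReal.coe_one, mul_one]
    rw [lintegral_map hm hι, lintegral_map hm hι]
    exact h f
  have h2 := congrArg (fun ρ => ρ.map Prod.fst) key
  simp only [Measure.map_map measurable_fst hι] at h2
  have e : (Prod.fst ∘ fun z : α → ℝ => (z, fun _ : Empty => (0 : ℝ))) = id := rfl
  rwa [e, Measure.map_id, Measure.map_id] at h2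

/-- indicator of a set of reals as a function on the extended reals -/
def wC (C : Set ℝ) (x : EReal) : ℝ≥0∞ := ((fun r : ℝ => (r : EReal)) '' C).indicator 1 x

lemma wC_coe (C : Set ℝ) (r : ℝ) : wC C r = C.indicator 1 r := by
  unfold wC
  by_cases h : r ∈ C
  · rw [Set.indicator_of_mem h, Set.indicator_of_mem (show ((r : ℝ) : EReal) ∈ (fun r : ℝ => (r : EReal)) '' C from ⟨r, h, rfl⟩)]; rfl
  · rw [Set.indicator_of_notMem h, Set.indicator_of_notMem]
    rintro ⟨s, hs, e⟩
    exact h (EReal.coe_injective e ▸ hs)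

lemma wC_eq (R : ℝ) (hR : 0 ≤ R) (C : Set ℝ) (hC : ∀ x ∈ C, |x| ≤ R) (x : EReal) :
    wC C x = (u0 R x : ℝ≥0∞) * C.indicator 1 (cl (R + 1) x) := by
  by_cases h : u0 R x = 0
  · rw [h]
    simp only [ENNReal.coe_zero, zero_mul]
    unfold wC
    refine Set.indicator_of_notMem ?_ _
    rintro ⟨s, hs, e⟩
    simp only at e
    rw [← e, u0_one R s (hC s hs)] at h
    exact one_ne_zero h
  · obtain ⟨r, rfl, hr⟩ := u0_supp R hR x h
    have hr' := abs_le.1 hr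
    rw [wC_coe, cl_coe, min_eq_right hr'.2, max_eq_right hr'.1]
    by_cases hC' : r ∈ C
    · rw [u0_one R r (hC r hC')]; simp
    · rw [Set.indicator_of_notMem hC', mul_zero]

lemma wC_meas (R : ℝ) (hR : 0 ≤ R) (C : Set ℝ) (hC : ∀ x ∈ C, |x| ≤ R) (hm : MeasurableSet C) : Measurable (wC C) := by
  have : wC C = fun x => (u0 R x : ℝ≥0∞) * C.indicator 1 (cl (R + 1) x) := funext fun x => wC_eq R hR C hC x
  rw [this]
  exact (measurable_coe_nnreal_ennreal.comp (u0_cont R).measurable).mul ((measurable_one.indicator hm).comp (cl_cont _).measurable)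

end

namespace PP
variable (P : PP) {α : Type} [Fintype α] [DecidableEq α]

lemma cl_pi_meas (R : ℝ) (τ : α → ℝ) (i : α → ℕ) : Measurable fun (y : XX) (p : α) => cl R (ev (i p, τ p) y) :=
  measurable_pi_lambda _ fun p => (cl_cont R).measurable.comp (ev_meas _)

open Classical in
def rho1 (R : ℝ) (τ : α → ℝ) : Measure (α → ℝ) := Measure.sum fun i : α → ℕ =>
  if Function.Injective (fun p => (τ p, i p)) then (P.mu.withDensity fun y => ∏ p, (u0 R (ev (i p, τ p) y) : ℝ≥0∞)).map (fun y p => cl (R + 1) (ev (i p, τ p) y)) else 0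

def rho2 (R : ℝ) (τ : α → ℝ) : Measure (α → ℝ) :=
  (volume.withDensity fun z : α → ℝ => ENNReal.ofReal (P.DL τ z) * ∏ p, (u0 R (z p) : ℝ≥0∞)).map (fun z p => cl (R + 1) (z p))

lemma rho1_int (R : ℝ) (τ : α → ℝ) (g : α → ℝ → ℝ≥0∞) (hg : ∀ p, Measurable (g p)) :
    ∫⁻ z, ∏ p, g p (z p) ∂P.rho1 R τ = ∫⁻ y, cs τ (fun p x => (u0 R x : ℝ≥0∞) * g p (cl (R + 1) x)) y ∂P.mu := by
  classical
  have hgm : Measurable fun z : α → ℝ => ∏ p, g p (z p) := Finset.measurable_prod _ fun p _ => (hg p).comp (measurable_pi_apply p)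
  have hum : ∀ i : α → ℕ, Measurable fun y => ∏ p, (u0 R (ev (i p, τ p) y) : ℝ≥0∞) := fun i =>
    Finset.measurable_prod _ fun p _ => measurable_coe_nnreal_ennreal.comp ((u0_cont R).measurable.comp (ev_meas _))
  unfold rho1 cs
  rw [lintegral_sum_measure, lintegral_tsum]
  · refine tsum_congr fun i => ?_
    split_ifs
    · rw [lintegral_map hgm (cl_pi_meas _ τ i), lintegral_withDensity_eq_lintegral_mul _ (hum i) (show Measurable fun y => ∏ p, g p (cl (R + 1) (ev (i p, τ p) y)) from hgm.comp (cl_pi_meas _ τ i))]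
      refine lintegral_congr fun y => ?_
      simp only [Pi.mul_apply, Function.comp_apply, Finset.prod_mul_distrib]
    · simp
  · intro i
    split_ifs
    · simp_rw [Finset.prod_mul_distrib]
      exact ((hum i).mul (hgm.comp (cl_pi_meas _ τ i))).aemeasurable
    · exact aemeasurable_const

lemma rho2_int (R : ℝ) (τ : α → ℝ) (g : α → ℝ → ℝ≥0∞) (hg : ∀ p, Measurable (g p)) :
    ∫⁻ z, ∏ p, g p (z p) ∂P.rho2 R τ = ∫⁻ z : α → ℝ, ENNReal.ofReal (P.DL τ z) * ∏ p, ((u0 R (z p) : ℝ≥0∞) * g p (cl (R + 1) (z p))) := by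
  have hgm : Measurable fun z : α → ℝ => ∏ p, g p (z p) := Finset.measurable_prod _ fun p _ => (hg p).comp (measurable_pi_apply p)
  have hc : Measurable fun (z : α → ℝ) (p : α) => cl (R + 1) (z p) :=
    measurable_pi_lambda _ fun p => (cl_cont (R + 1)).measurable.comp (measurable_coe_real_ereal.comp (measurable_pi_apply p))
  have hum : Measurable fun z : α → ℝ => ENNReal.ofReal (P.DL τ z) * ∏ p, (u0 R (z p) : ℝ≥0∞) :=
    (P.DL_meas τ).ennreal_ofReal.mul (Finset.measurable_prod _ fun p _ => measurable_coe_nnreal_ennreal.comp ((u0_cont R).measurable.comp (measurable_coe_real_ereal.comp (measurable_pi_apply p))))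
  unfold rho2
  rw [lintegral_map hgm hc, lintegral_withDensity_eq_lintegral_mul _ hum (show Measurable fun z : α → ℝ => ∏ p, g p (cl (R + 1) (z p)) from hgm.comp hc)]
  refine lintegral_congr fun y => ?_
  simp only [Pi.mul_apply, Function.comp_apply, Finset.prod_mul_distrib, mul_assoc]

lemma mu_bcf [Nonempty α] (τ : α → ℝ) (R : ℝ) (hR : 0 ≤ R) (f : α → BoundedContinuousFunction ℝ ℝ≥0) :
    ∫⁻ z, ∏ p, (f p (z p) : ℝ≥0∞) ∂P.rho2 R τ = ∫⁻ z, ∏ p, (f p (z p) : ℝ≥0∞) ∂P.rho1 R τ ∧ ∫⁻ z, ∏ p, (f p (z p) : ℝ≥0∞) ∂P.rho2 R τ ≠ ⊤ := by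
  have h := P.mu_cont τ (R + 1) (by linarith) (fun p x => u0 R x * f p (cl (R + 1) x)) (fun p => (u0_cont R).mul ((f p).continuous.comp (cl_cont _)))
    (fun p x hx => by
      obtain ⟨r, rfl, hr⟩ := u0_supp R hR x (left_ne_zero_of_mul hx)
      exact ⟨EReal.coe_le_coe_iff.2 (abs_le.1 hr).1, EReal.coe_le_coe_iff.2 (abs_le.1 hr).2⟩)
  have hm : ∀ p, Measurable fun x => (f p x : ℝ≥0∞) := fun p => measurable_coe_nnreal_ennreal.comp (f p).continuous.measurable
  rw [P.rho1_int R τ (fun p x => (f p x : ℝ≥0∞)) hm, P.rho2_int R τ (fun p x => (f p x : ℝ≥0∞)) hm]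
  simp only [ENNReal.coe_mul] at h
  exact ⟨h.1.symm, h.2⟩

lemma rho_eq [Nonempty α] (τ : α → ℝ) (R : ℝ) (hR : 0 ≤ R) : P.rho2 R τ = P.rho1 R τ ∧ IsFiniteMeasure (P.rho2 R τ) := by
  have hf : IsFiniteMeasure (P.rho2 R τ) := by
    constructor
    have := (P.mu_bcf τ R hR fun _ => 1).2
    simp only [BoundedContinuousFunction.coe_one, Pi.one_apply, ENNReal.coe_one, Finset.prod_const_one, lintegral_one] at this
    exact lt_top_iff_ne_top.2 this
  exact ⟨ext_pi _ _ fun f => (P.mu_bcf τ R hR f).1, hf⟩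

lemma mu_corr [Nonempty α] (τ : α → ℝ) (C : α → Set ℝ) (hm : ∀ p, MeasurableSet (C p)) (hb : ∀ p, Bornology.IsBounded (C p)) :
    ∫⁻ y, cs τ (fun p => wC (C p)) y ∂P.mu = ∫⁻ z : α → ℝ, ENNReal.ofReal (P.DL τ z) * ∏ p, (C p).indicator 1 (z p) ∧
    ∫⁻ z : α → ℝ, ENNReal.ofReal (P.DL τ z) * ∏ p, (C p).indicator 1 (z p) ≠ ⊤ := by
  have : ∃ R, 0 ≤ R ∧ ∀ p, ∀ x ∈ C p, |x| ≤ R := by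
    choose R hR using fun p => (hb p).exists_norm_le
    refine ⟨∑ p, |R p|, Finset.sum_nonneg fun _ _ => abs_nonneg _, fun p x hx => ((hR p x hx).trans (le_abs_self _)).trans ?_⟩
    exact Finset.single_le_sum (f := fun p => |R p|) (fun _ _ => abs_nonneg _) (Finset.mem_univ p)
  obtain ⟨R, hR, hC⟩ := this
  obtain ⟨he, hf⟩ := P.rho_eq τ R hR
  have hgm : ∀ p, Measurable ((C p).indicator (1 : ℝ → ℝ≥0∞)) := fun p => measurable_one.indicator (hm p)
  have h1 := P.rho1_int R τ _ hgm
  have h2 := P.rho2_int R τ _ hgm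
  have e1 : (fun p x => (u0 R x : ℝ≥0∞) * (C p).indicator 1 (cl (R + 1) x)) = fun p => wC (C p) := by
    funext p x; exact (wC_eq R hR (C p) (hC p) x).symm
  rw [e1] at h1
  have e2 : ∀ (z : α → ℝ) p, (u0 R (z p) : ℝ≥0∞) * (C p).indicator 1 (cl (R + 1) (z p)) = (C p).indicator 1 (z p) := by
    intro z p
    rw [← wC_eq R hR (C p) (hC p), wC_coe]
  simp_rw [e2] at h2
  rw [← h1, ← h2, he]
  refine ⟨rfl, ?_⟩
  rw [← he]
  refine ne_top_of_le_ne_top (measure_ne_top (P.rho2 R τ) Set.univ) ?_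
  rw [← lintegral_one]
  refine lintegral_mono fun z => Finset.prod_le_one' fun p _ => Set.indicator_le_self' (fun _ _ => zero_le) _

/-- almost surely all points are below infinity and locally finite from above -/
lemma ae_top (t : ℝ) : ∀ᵐ y ∂P.mu, ev (0, t) y ≠ ⊤ := by
  obtain ⟨c, hc, H, hH, h⟩ := P.mu_tail' t
  rw [ae_iff]
  have hms : MeasurableSet {y : XX | ¬ ev (0, t) y ≠ ⊤} := by
    have : {y : XX | ¬ ev (0, t) y ≠ ⊤} = ev (0, t) ⁻¹' {⊤} := by ext; simp
    rw [this]; exact ev_meas _ (measurableSet_singleton _)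
  have hb : ∀ r : ℝ, 0 ≤ r → P.mu {y : XX | ¬ ev (0, t) y ≠ ⊤} ≤ ENNReal.ofReal (Real.exp (-(c * r))) * H := by
    intro r hr
    refine le_trans ?_ (h r hr)
    rw [← lintegral_indicator_one hms]
    refine lintegral_mono fun y => ?_
    refine Set.indicator_le (fun y hy => ?_) y
    rw [Set.mem_ofPred_eq, not_not] at hy
    unfold cs
    refine le_trans ?_ (ENNReal.le_tsum (fun _ : Unit => 0))
    rw [if_pos (Function.injective_of_subsingleton _)]
    simp [hy, vv_one r ⊤ le_top]
  refine le_antisymm ?_ zero_le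
  refine ge_of_tendsto (f := fun r : ℝ => ENNReal.ofReal (Real.exp (-(c * r))) * H) (x := atTop) ?_ ((eventually_ge_atTop 0).mono hb)
  rw [← zero_mul H]
  refine ENNReal.Tendsto.mul_const ?_ (Or.inr hH)
  rw [← ENNReal.ofReal_zero]
  refine ENNReal.tendsto_ofReal (Real.tendsto_exp_neg_atTop_nhds_zero.comp (tendsto_id.const_mul_atTop hc))

lemma ae_fin (t : ℝ) : ∀ᵐ y ∂P.mu, ∀ N : ℕ, ∃ L : ℕ, ∀ i, L ≤ i → ev (i, t) y < ((-(N : ℝ) : ℝ) : EReal) := by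
  rw [ae_all_iff]
  intro N
  have h := P.mu_tail t (-N - 1)
  have hm : Measurable (cs (fun _ : Unit => t) (fun _ x => (vv (-N - 1) x : ℝ≥0∞))) := cs_meas _ _ fun _ => measurable_coe_nnreal_ennreal.comp (vv_cont _).measurable
  filter_upwards [ae_lt_top hm h] with y hy
  by_contra hcon
  push Not at hcon
  have hall : ∀ i, ((-(N : ℝ) : ℝ) : EReal) ≤ ev (i, t) y := by
    intro i
    obtain ⟨j, hj, hj'⟩ := hcon i
    exact hj'.trans (ev_anti t y hj)
  refine hy.ne ?_
  unfold cs
  have : ∀ i : Unit → ℕ, (if Function.Injective (fun p : Unit => (t, i p)) then ∏ p, ((vv (-N - 1) (ev (i p, t) y) : ℝ≥0) : ℝ≥0∞) else 0) = 1 := by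
    intro i
    rw [if_pos (Function.injective_of_subsingleton _)]
    refine Finset.prod_eq_one fun p _ => ?_
    rw [vv_one _ _ (by rw [show -(N : ℝ) - 1 + 1 = -N by ring]; exact hall _)]; rfl
  refine (tsum_congr this).trans ?_
  exact ENNReal.tsum_const_eq_top_of_ne_zero one_ne_zero

end PP

end AW

namespace AW

lemma mul_one_add (e : ℕ → ℝ) (h0 : ∀ i, 0 ≤ e i) (s : Summable e) (v : ℂ) : Multipliable fun i => 1 + (e i : ℂ) * v := by
  refine multipliable_one_add_of_summable ?_
  have : ∀ i, ‖(e i : ℂ) * v‖ = e i * ‖v‖ := fun i => by rw [norm_mul, Complex.norm_real, Real.norm_of_nonneg (h0 i)]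
  simp_rw [this]
  exact s.mul_right _

lemma ratio_bound (e : ℕ → ℝ) (h0 : ∀ i, 0 ≤ e i) (s : Summable e) (v w : ℂ) (hw : ∀ i, 1 ≤ 2 * ‖1 + (e i : ℂ) * w‖) :
    ‖∏' i, (1 + (e i : ℂ) * v)‖ ≤ Real.exp (2 * (∑' i, e i) * ‖v - w‖) * ‖∏' i, (1 + (e i : ℂ) * w)‖ := by
  have t1 := (continuous_norm.tendsto _).comp (mul_one_add e h0 s v).hasProd
  have t2 := ((continuous_norm.tendsto _).comp (mul_one_add e h0 s w).hasProd).const_mul (Real.exp (2 * (∑' i, e i) * ‖v - w‖))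
  refine le_of_tendsto_of_tendsto' t1 t2 fun F => ?_
  simp only [Function.comp_apply, norm_prod]
  have : Real.exp (∑ i ∈ F, 2 * e i * ‖v - w‖) ≤ Real.exp (2 * (∑' i, e i) * ‖v - w‖) := by
    rw [← Finset.sum_mul, ← Finset.mul_sum]
    have := s.sum_le_tsum F fun i _ => h0 i
    gcongr
  refine le_trans ?_ (mul_le_mul_of_nonneg_right this (Finset.prod_nonneg fun _ _ => norm_nonneg _))
  rw [Real.exp_sum, ← Finset.prod_mul_distrib]
  refine Finset.prod_le_prod (fun _ _ => norm_nonneg _) fun i _ => ?_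
  have h1 : ‖1 + (e i : ℂ) * v‖ ≤ ‖1 + (e i : ℂ) * w‖ + e i * ‖v - w‖ := by
    have : 1 + (e i : ℂ) * v = (1 + (e i : ℂ) * w) + e i * (v - w) := by ring
    rw [this]
    refine (norm_add_le _ _).trans (le_of_eq ?_)
    rw [norm_mul (e i : ℂ), Complex.norm_real, Real.norm_of_nonneg (h0 i)]
  have h2 := Real.add_one_le_exp (2 * e i * ‖v - w‖)
  have h3 : 0 ≤ e i * ‖v - w‖ := mul_nonneg (h0 i) (norm_nonneg _)
  nlinarith [hw i, norm_nonneg (1 + (e i : ℂ) * w)]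

lemma low (e : ℝ) (he : 0 ≤ e) (w : ℂ) (h : w.re ≤ |w.im|) : 1 ≤ 2 * ‖1 - (e : ℂ) * w‖ := by
  have h1 : (1 - e * w.re) ^ 2 + (e * w.im) ^ 2 = ‖1 - (e : ℂ) * w‖ ^ 2 := by
    rw [Complex.sq_norm, Complex.normSq_apply]
    simp
    ring
  have h2 : 1 / 4 ≤ (1 - e * w.re) ^ 2 + (e * w.im) ^ 2 := by
    have : (e * w.im) ^ 2 = (e * |w.im|) ^ 2 := by rw [mul_pow, mul_pow, sq_abs]
    rw [this]
    have h3 : e * w.re ≤ e * |w.im| := mul_le_mul_of_nonneg_left h he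
    by_cases h4 : e * w.re ≤ 1 / 2
    · nlinarith [sq_nonneg (e * |w.im|)]
    · nlinarith [sq_nonneg (1 - e * w.re)]
  nlinarith [norm_nonneg (1 - (e : ℂ) * w)]

lemma low' (e : ℝ) (he : 0 ≤ e) (w : ℂ) (h : -w.re ≤ |w.im|) : 1 ≤ 2 * ‖1 + (e : ℂ) * w‖ := by
  have := low e he (-w) (by simpa using h)
  rwa [mul_neg, sub_neg_eq_add] at this

namespace PP
variable (P : PP)

def DD : ℝ := |P.c| + 2 * ∑' i, P.b i + 2 * ∑' i, P.a i

lemma DD_nonneg : 0 ≤ P.DD := by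
  have : 0 ≤ ∑' i, P.b i := tsum_nonneg P.hb
  have : 0 ≤ ∑' i, P.a i := tsum_nonneg P.ha
  unfold DD; positivity

lemma den_ne (v : ℂ) (hv : v.re ≤ |v.im|) : ∏' i, (1 - (P.a i : ℂ) * v) ≠ 0 := by
  have := tp_ne P.a P.sa P.ha (-v) fun i h => by
    have := low (P.a i) (P.ha i) v hv
    rw [mul_neg, ← sub_eq_add_neg] at h
    rw [h, norm_zero] at this
    norm_num at this
  simpa only [mul_neg, ← sub_eq_add_neg] using this

lemma num_ne (v : ℂ) (hv : -v.re ≤ |v.im|) : ∏' i, (1 + (P.b i : ℂ) * v) ≠ 0 :=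
  tp_ne P.b P.sb P.hb v fun i h => by
    have := low' (P.b i) (P.hb i) v hv
    rw [h, norm_zero] at this
    norm_num at this

lemma Psi_ne (v : ℂ) (hv : v.re ≤ |v.im|) (hv' : -v.re ≤ |v.im|) : P.Psi v ≠ 0 :=
  mul_ne_zero (Complex.exp_ne_zero _) (div_ne_zero (P.num_ne v hv') (P.den_ne v hv))

lemma Psi_ratio (v w : ℂ) (hv : v.re ≤ |v.im|) (hw : -w.re ≤ |w.im|) (hw2 : P.Psi w ≠ 0) : ‖P.Psi v‖ ≤ Real.exp (P.DD * ‖v - w‖) * ‖P.Psi w‖ := by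
  have h1 := ratio_bound P.b P.hb P.sb v w fun i => low' _ (P.hb i) w hw
  have h2 := ratio_bound P.a P.ha P.sa (-w) (-v) fun i => by
    rw [mul_neg, ← sub_eq_add_neg]; exact low _ (P.ha i) v hv
  simp only [mul_neg, ← sub_eq_add_neg] at h2
  rw [show -w - -v = v - w by ring] at h2
  have h3 : ‖cexp (P.c * v)‖ ≤ Real.exp (|P.c| * ‖v - w‖) * ‖cexp (P.c * w)‖ := by
    rw [show (P.c : ℂ) * v = P.c * (v - w) + P.c * w by ring, Complex.exp_add, norm_mul]
    exact mul_le_mul_of_nonneg_right (norm_cexp_mul _ _) (norm_nonneg _)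
  have hv0 : 0 < ‖∏' i, (1 - (P.a i : ℂ) * v)‖ := norm_pos_iff.2 (P.den_ne v hv)
  have hw0 : 0 < ‖∏' i, (1 - (P.a i : ℂ) * w)‖ := norm_pos_iff.2 fun h => hw2 (by unfold Psi; rw [h, div_zero, mul_zero])
  unfold Psi
  rw [norm_mul, norm_mul, norm_div, norm_div]
  have h4 : ‖∏' i, (1 - (P.a i : ℂ) * v)‖⁻¹ ≤ Real.exp (2 * (∑' i, P.a i) * ‖v - w‖) * ‖∏' i, (1 - (P.a i : ℂ) * w)‖⁻¹ := by
    rw [← div_eq_mul_inv, le_div_iff₀ hw0, inv_mul_le_iff₀ hv0]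
    linarith
  have e : Real.exp (P.DD * ‖v - w‖) = Real.exp (|P.c| * ‖v - w‖) * Real.exp (2 * (∑' i, P.b i) * ‖v - w‖) * Real.exp (2 * (∑' i, P.a i) * ‖v - w‖) := by
    rw [← Real.exp_add, ← Real.exp_add]; congr 1; unfold DD; ring
  rw [e, div_eq_mul_inv, div_eq_mul_inv]
  calc _ ≤ (Real.exp (|P.c| * ‖v - w‖) * ‖cexp (P.c * w)‖) * ((Real.exp (2 * (∑' i, P.b i) * ‖v - w‖) * ‖∏' i, (1 + (P.b i : ℂ) * w)‖) * (Real.exp (2 * (∑' i, P.a i) * ‖v - w‖) * ‖∏' i, (1 - (P.a i : ℂ) * w)‖⁻¹)) := by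
        gcongr
    _ = _ := by ring

lemma tp_conj (e : ℕ → ℝ) (h0 : ∀ i, 0 ≤ e i) (s : Summable e) (w : ℂ) : ‖∏' i, (1 + (e i : ℂ) * (starRingEnd ℂ) w)‖ = ‖∏' i, (1 + (e i : ℂ) * w)‖ := by
  have t1 := (continuous_norm.tendsto _).comp (mul_one_add e h0 s ((starRingEnd ℂ) w)).hasProd
  have t2 := ((continuous_norm.tendsto _).comp (mul_one_add e h0 s w).hasProd)
  refine tendsto_nhds_unique t1 (t2.congr fun F => ?_)
  simp only [Function.comp_apply, norm_prod]
  refine Finset.prod_congr rfl fun i _ => ?_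
  rw [← Complex.norm_conj]
  simp

lemma Psi_conj (w : ℂ) : ‖P.Psi ((starRingEnd ℂ) w)‖ = ‖P.Psi w‖ := by
  unfold Psi
  have h2 := tp_conj P.a P.ha P.sa (-w)
  simp only [map_neg, mul_neg, ← sub_eq_add_neg] at h2
  rw [norm_mul, norm_mul, norm_div, norm_div, tp_conj P.b P.hb P.sb, h2]
  congr 1
  rw [Complex.norm_exp, Complex.norm_exp]
  simp

def wst (t p y : ℝ) : ℂ := (t : ℂ) + (if 0 ≤ y then p else -p : ℝ) * I

lemma wst_re (t p y : ℝ) : (wst t p y).re = t := by simp [wst]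
lemma wst_im (t p y : ℝ) : (wst t p y).im = if 0 ≤ y then p else -p := by simp [wst]
lemma wst_abs (t p y : ℝ) (hp : 0 ≤ p) : |(wst t p y).im| = p := by
  rw [wst_im]; split_ifs
  · exact abs_of_nonneg hp
  · rw [abs_neg, abs_of_nonneg hp]

lemma Psi_wst (t p y : ℝ) : ‖P.Psi (wst t p y)‖ = ‖P.Psi (wst t p 1)‖ := by
  by_cases h : 0 ≤ y
  · simp [wst, h]
  · rw [← P.Psi_conj (wst t p 1)]
    simp [wst, h]

lemma gP_wst (t p y : ℝ) : ‖gammaP (t - p) y - wst t p y‖ ≤ 2 * |rr p y| := by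
  refine (Complex.norm_le_abs_re_add_abs_im _).trans ?_
  rw [sub_re, sub_im, wst_re, wst_im, gammaP_re, gammaP_im]
  have e1 : t - p + |y| / Real.sqrt 2 - t = rr p y := by unfold rr; ring
  rw [e1]
  have e2 : |y / Real.sqrt 2 - (if 0 ≤ y then p else -p)| = |rr p y| := by
    split_ifs with h
    · unfold rr; rw [abs_of_nonneg h]
    · unfold rr; rw [abs_of_neg (not_le.1 h), ← abs_neg]; congr 1; ring
  rw [e2]; linarith

lemma gM_wst (t p y : ℝ) : ‖gammaM (t + p) y - wst t p y‖ ≤ 2 * |rr p y| := by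
  refine (Complex.norm_le_abs_re_add_abs_im _).trans ?_
  rw [sub_re, sub_im, wst_re, wst_im, gammaM_re, gammaM_im]
  have e1 : t + p - |y| / Real.sqrt 2 - t = -rr p y := by unfold rr; ring
  rw [e1, abs_neg]
  have e2 : |y / Real.sqrt 2 - (if 0 ≤ y then p else -p)| = |rr p y| := by
    split_ifs with h
    · unfold rr; rw [abs_of_nonneg h]
    · unfold rr; rw [abs_of_neg (not_le.1 h), ← abs_neg]; congr 1; ring
  rw [e2]; linarith

lemma expo_re (t ξ p r σ : ℝ) (v : ℂ) (hσ : σ ^ 2 = 1) (h1 : v.re = t + σ * r) (h2 : v.im ^ 2 = (p + r) ^ 2) :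
    (v ^ 3 / 3 - t * v ^ 2 - ξ * v).re = -(2 * t ^ 3 / 3) - ξ * t + σ * (-(2 / 3) * r ^ 3 - 2 * p * r ^ 2 + (-(ξ + t ^ 2) - p ^ 2) * r) := by
  have e : (v ^ 3 / 3 - t * v ^ 2 - ξ * v).re = (v.re ^ 3 - 3 * v.re * v.im ^ 2) / 3 - t * (v.re ^ 2 - v.im ^ 2) - ξ * v.re := by
    have : v ^ 3 / 3 = ((1 / 3 : ℝ) : ℂ) * v ^ 3 := by push_cast; ring
    rw [this, sub_re, sub_re, Complex.re_ofReal_mul, Complex.re_ofReal_mul, Complex.re_ofReal_mul]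
    simp only [pow_succ, pow_zero, one_mul, mul_re, mul_im]
    ring
  rw [e, h1, h2]
  linear_combination (t * r ^ 2 - t * r ^ 2 + σ * r ^ 3 / 3 ) * hσ

lemma poly_bound (D p r q : ℝ) (hD : 0 ≤ D) (hp : 1 ≤ p) (hr : -p ≤ r) (hq : p ^ 2 ≤ q) (hq' : q ≤ p ^ 2 + 1) :
    -(2 / 3) * r ^ 3 - 2 * p * r ^ 2 + (q - p ^ 2) * r + D * (2 * |r|) ≤ (2 * D + 2) ^ 2 - |r| := by
  have h1 : -(2 / 3) * r ^ 3 ≤ (2 / 3) * p * r ^ 2 := by nlinarith [sq_nonneg r]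
  have h2 : (q - p ^ 2) * r ≤ |r| := by
    have := le_abs_self r
    nlinarith [abs_nonneg r]
  have h3 : r ^ 2 ≤ p * r ^ 2 := by nlinarith [sq_nonneg r]
  have h4 : r ^ 2 = |r| ^ 2 := (sq_abs r).symm
  nlinarith [sq_nonneg (|r| - (D + 1)), abs_nonneg r]

lemma wst_ne (t p y : ℝ) (ht : |t| ≤ p) : P.Psi (wst t p y) ≠ 0 := by
  have habs := abs_le.1 ht
  have h0 := (abs_nonneg t).trans ht
  exact P.Psi_ne _ (by rw [wst_abs _ _ _ h0, wst_re]; linarith) (by rw [wst_abs _ _ _ h0, wst_re]; linarith)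

lemma f_bound (t p ξ : ℝ) (ht : |t| ≤ p) (hp : 1 ≤ p) (hq : p ^ 2 ≤ -(ξ + t ^ 2)) (hq' : -(ξ + t ^ 2) ≤ p ^ 2 + 1) (y : ℝ) : ‖P.f₀ t ξ (gammaP (t - p) y)‖ ≤
    Real.exp (-(2 * t ^ 3 / 3) - ξ * t) * ‖P.Psi (wst t p 1)‖ * Real.exp ((2 * P.DD + 2) ^ 2) * Real.exp (-|rr p y|) := by
  have hr : -p ≤ rr p y := by unfold rr; have : 0 ≤ |y| / Real.sqrt 2 := by positivity
                              linarith
  have hR := poly_bound P.DD p (rr p y) _ P.DD_nonneg hp hr hq hq'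
  have hE := expo_re t ξ p (rr p y) 1 (gammaP (t - p) y) (by norm_num) (by rw [gammaP_re]; unfold rr; ring)
    (by rw [gammaP_im]; unfold rr; rw [div_pow, ← sq_abs y]; ring)
  have habs := abs_le.1 ht
  have hPs := P.Psi_ratio (gammaP (t - p) y) (wst t p y)
    (by rw [gammaP_re, gammaP_im, abs_div, abs_of_pos (by positivity : (0 : ℝ) < Real.sqrt 2)]; linarith)
    (by rw [wst_abs _ _ _ (by linarith), wst_re]; linarith) (P.wst_ne t p y ht)
  rw [P.Psi_wst] at hPs
  have e : P.f₀ t ξ (gammaP (t - p) y) = cexp (gammaP (t - p) y ^ 3 / 3 - t * gammaP (t - p) y ^ 2 - ξ * gammaP (t - p) y) * P.Psi (gammaP (t - p) y) := by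
    unfold f₀; rw [← mul_assoc, ← Complex.exp_add]; congr 2; ring
  rw [e, norm_mul, Complex.norm_exp, hE]
  have h5 : Real.exp (P.DD * ‖gammaP (t - p) y - wst t p y‖) ≤ Real.exp (P.DD * (2 * |rr p y|)) := by
    have := P.DD_nonneg
    have := gP_wst t p y
    gcongr
  calc _ ≤ Real.exp (-(2 * t ^ 3 / 3) - ξ * t + 1 * (-(2 / 3) * rr p y ^ 3 - 2 * p * rr p y ^ 2 + (-(ξ + t ^ 2) - p ^ 2) * rr p y)) *
        (Real.exp (P.DD * (2 * |rr p y|)) * ‖P.Psi (wst t p 1)‖) := by gcongr; exact hPs.trans (by gcongr)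
    _ = Real.exp (-(2 * t ^ 3 / 3) - ξ * t) * ‖P.Psi (wst t p 1)‖ * Real.exp (-(2 / 3) * rr p y ^ 3 - 2 * p * rr p y ^ 2 + (-(ξ + t ^ 2) - p ^ 2) * rr p y + P.DD * (2 * |rr p y|)) := by
        rw [Real.exp_add, Real.exp_add, one_mul]; ring
    _ ≤ _ := by
        rw [mul_assoc _ _ (Real.exp (-|rr p y|)), ← Real.exp_add]
        refine mul_le_mul_of_nonneg_left (Real.exp_le_exp.2 ?_) (by positivity)
        linarith

lemma g_bound (t p ξ : ℝ) (ht : |t| ≤ p) (hp : 1 ≤ p) (hq : p ^ 2 ≤ -(ξ + t ^ 2)) (hq' : -(ξ + t ^ 2) ≤ p ^ 2 + 1) (y : ℝ) : ‖P.g₀ t ξ (gammaM (t + p) y)‖ ≤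
    Real.exp (2 * t ^ 3 / 3 + ξ * t) * ‖P.Psi (wst t p 1)‖⁻¹ * Real.exp ((2 * P.DD + 2) ^ 2) * Real.exp (-|rr p y|) := by
  have hr : -p ≤ rr p y := by unfold rr; have : 0 ≤ |y| / Real.sqrt 2 := by positivity
                              linarith
  have hR := poly_bound P.DD p (rr p y) _ P.DD_nonneg hp hr hq hq'
  have hE := expo_re t ξ p (rr p y) (-1) (gammaM (t + p) y) (by norm_num) (by rw [gammaM_re]; unfold rr; ring)
    (by rw [gammaM_im]; unfold rr; rw [div_pow, ← sq_abs y]; ring)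
  have habs := abs_le.1 ht
  have hw1 : (wst t p y).re ≤ |(wst t p y).im| := by rw [wst_abs _ _ _ (by linarith), wst_re]; linarith
  have hu2 : -(gammaM (t + p) y).re ≤ |(gammaM (t + p) y).im| := by
    rw [gammaM_re, gammaM_im, abs_div, abs_of_pos (by positivity : (0 : ℝ) < Real.sqrt 2)]; linarith
  by_cases h0 : P.Psi (gammaM (t + p) y) = 0
  · unfold g₀; rw [h0, mul_zero, div_zero, norm_zero]; positivity
  have hPs := P.Psi_ratio (wst t p y) (gammaM (t + p) y) hw1 hu2 h0
  rw [P.Psi_wst, norm_sub_rev] at hPs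
  have hN : 0 < ‖P.Psi (wst t p 1)‖ := norm_pos_iff.2 (P.wst_ne t p 1 ht)
  have e : P.g₀ t ξ (gammaM (t + p) y) = cexp (-(gammaM (t + p) y ^ 3 / 3 - t * gammaM (t + p) y ^ 2 - ξ * gammaM (t + p) y)) * (P.Psi (gammaM (t + p) y))⁻¹ := by
    unfold g₀; rw [div_eq_mul_inv, mul_inv, ← mul_assoc, ← Complex.exp_neg, ← Complex.exp_add]; congr 2; ring
  rw [e, norm_mul, Complex.norm_exp, neg_re, hE, norm_inv]
  have h5 : Real.exp (P.DD * ‖gammaM (t + p) y - wst t p y‖) ≤ Real.exp (P.DD * (2 * |rr p y|)) := by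
    have := P.DD_nonneg
    have := gM_wst t p y
    gcongr
  have h6 : ‖P.Psi (gammaM (t + p) y)‖⁻¹ ≤ Real.exp (P.DD * (2 * |rr p y|)) * ‖P.Psi (wst t p 1)‖⁻¹ := by
    rw [← div_eq_mul_inv, le_div_iff₀ hN, inv_mul_le_iff₀ (norm_pos_iff.2 h0), mul_comm]
    exact hPs.trans (by gcongr)
  calc _ ≤ Real.exp (-(-(2 * t ^ 3 / 3) - ξ * t + -1 * (-(2 / 3) * rr p y ^ 3 - 2 * p * rr p y ^ 2 + (-(ξ + t ^ 2) - p ^ 2) * rr p y))) *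
        (Real.exp (P.DD * (2 * |rr p y|)) * ‖P.Psi (wst t p 1)‖⁻¹) := by gcongr
    _ = Real.exp (2 * t ^ 3 / 3 + ξ * t) * ‖P.Psi (wst t p 1)‖⁻¹ * Real.exp (-(2 / 3) * rr p y ^ 3 - 2 * p * rr p y ^ 2 + (-(ξ + t ^ 2) - p ^ 2) * rr p y + P.DD * (2 * |rr p y|)) := by
        rw [← mul_assoc, ← Real.exp_add, mul_right_comm _ _ (Real.exp _), ← Real.exp_add]; congr 2; ring
    _ ≤ _ := by
        rw [mul_assoc _ _ (Real.exp (-|rr p y|)), ← Real.exp_add]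
        refine mul_le_mul_of_nonneg_left (Real.exp_le_exp.2 ?_) (by positivity)
        linarith

end PP

/-- double contour bound with weights measured from the crossing points -/
lemma w1_int (p : ℝ) : Integrable (fun y => (Real.sqrt |rr p y|)⁻¹ * Real.exp (-|rr p y|)) ∧
    ∫ y, (Real.sqrt |rr p y|)⁻¹ * Real.exp (-|rr p y|) ≤ 4 * ∫ x : ℝ, (Real.sqrt |x|)⁻¹ * Real.exp (-(1 * |x|)) := by
  have hs : 0 < Real.sqrt 2 := by positivity
  have h0 := w0_int 1 one_pos
  set w : ℝ → ℝ := fun x => (Real.sqrt |x|)⁻¹ * Real.exp (-(1 * |x|)) with hw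
  have hw0 : ∀ x, 0 ≤ w x := fun x => by simp only [hw]; positivity
  have i1 : Integrable fun y => w (y * (Real.sqrt 2)⁻¹ - p) := (h0.comp_sub_right p).comp_mul_right' (by positivity)
  have i2 : Integrable fun y => w (y * (-(Real.sqrt 2)⁻¹) - p) := (h0.comp_sub_right p).comp_mul_right' (neg_ne_zero.2 (by positivity))
  have hle : ∀ y, w (rr p y) ≤ w (y * (Real.sqrt 2)⁻¹ - p) + w (y * (-(Real.sqrt 2)⁻¹) - p) := by
    intro y
    rcases le_total 0 y with h | h
    · rw [rr, abs_of_nonneg h, div_eq_mul_inv]; linarith [hw0 (y * (-(Real.sqrt 2)⁻¹) - p)]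
    · rw [rr, abs_of_nonpos h, div_eq_mul_inv, neg_mul, ← mul_neg]; linarith [hw0 (y * (Real.sqrt 2)⁻¹ - p)]
  have e : (fun y => (Real.sqrt |rr p y|)⁻¹ * Real.exp (-|rr p y|)) = fun y => w (rr p y) := by
    funext y; simp only [hw, one_mul]
  rw [e]
  have hm : Measurable fun y => w (rr p y) := by simp only [hw, rr]; fun_prop
  refine ⟨(i1.add i2).mono' hm.aestronglyMeasurable (Eventually.of_forall fun y => ?_), ?_⟩
  · rw [Real.norm_of_nonneg (hw0 _)]; exact hle y
  · refine (integral_mono_of_nonneg (Eventually.of_forall fun y => hw0 _) (i1.add i2) (Eventually.of_forall hle)).trans ?_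
    rw [integral_add' i1 i2]
    have h1 := Measure.integral_comp_mul_right (fun x => w (x - p)) (Real.sqrt 2)⁻¹
    have h2 := Measure.integral_comp_mul_right (fun x => w (x - p)) (-(Real.sqrt 2)⁻¹)
    rw [h1, h2, integral_sub_right_eq_self w p]
    have hI : 0 ≤ ∫ x, w x := integral_nonneg hw0
    have : Real.sqrt 2 ≤ 2 := by rw [Real.sqrt_le_left (by norm_num)]; norm_num
    rw [inv_neg, abs_neg, inv_inv, abs_of_pos hs, smul_eq_mul]
    nlinarith

lemma II_bound2 (A B C₁ C₂ : ℝ) (f g : ℂ → ℂ)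
    (hf : ∀ y, ‖f (gammaP A y)‖ ≤ C₁ * Real.exp (-|rr ((B - A) / 2) y|)) (hg : ∀ y, ‖g (gammaM B y)‖ ≤ C₂ * Real.exp (-|rr ((B - A) / 2) y|)) :
    ‖II A B f g‖ ≤ C₁ * C₂ * (4 * ∫ x : ℝ, (Real.sqrt |x|)⁻¹ * Real.exp (-(1 * |x|))) ^ 2 := by
  obtain ⟨i1, i2⟩ := w1_int ((B - A) / 2)
  set w : ℝ → ℝ := fun y => (Real.sqrt |rr ((B - A) / 2) y|)⁻¹ * Real.exp (-|rr ((B - A) / 2) y|) with hw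
  have hw0 : ∀ x, 0 ≤ w x := fun x => by simp only [hw]; positivity
  have hC₁ : 0 ≤ C₁ := by
    have := (norm_nonneg _).trans (hf 0)
    exact nonneg_of_mul_nonneg_left this (Real.exp_pos _)
  have hC₂ : 0 ≤ C₂ := by
    have := (norm_nonneg _).trans (hg 0)
    exact nonneg_of_mul_nonneg_left this (Real.exp_pos _)
  have hb : ∀ᵐ z : ℝ × ℝ, ‖IIf A B f g z‖ ≤ C₁ * C₂ * (w z.1 * w z.2) := by
    filter_upwards [prod_ae _ (rr_ae ((B - A) / 2))] with z hz
    have h := (gap_inv A B z.1 z.2 hz.1 hz.2).2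
    unfold IIf
    rw [norm_mul, norm_mul, div_eq_mul_inv, norm_mul, norm_mul]
    calc _ ≤ (C₁ * Real.exp (-|rr ((B - A) / 2) z.1|)) * (C₂ * Real.exp (-|rr ((B - A) / 2) z.2|)) * ((Real.sqrt |rr ((B - A) / 2) z.1|)⁻¹ * (Real.sqrt |rr ((B - A) / 2) z.2|)⁻¹) * 1 * 1 := by
          gcongr
          · exact hf _
          · exact hg _
          · exact norm_gPD _
          · exact norm_gMD _
      _ = _ := by simp only [hw]; ring
  have hi : Integrable (fun z : ℝ × ℝ => w z.1 * w z.2) := i1.mul_prod i1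
  unfold II
  rw [norm_mul]
  have hk : ‖(1 / (2 * (Real.pi : ℂ) * I)) ^ 2‖ ≤ 1 := by
    rw [norm_pow, norm_div, norm_mul, norm_mul, Complex.norm_real, Real.norm_of_nonneg Real.pi_pos.le, norm_I, norm_one]
    refine pow_le_one₀ (by positivity) ?_
    rw [Complex.norm_ofNat, div_le_one (by positivity)]
    linarith [Real.pi_gt_three]
  have h2 : ‖∫ p : ℝ × ℝ, IIf A B f g p‖ ≤ C₁ * C₂ * (∫ y, w y) ^ 2 := by
    refine (norm_integral_le_of_norm_le (hi.const_mul (C₁ * C₂)) hb).trans (le_of_eq ?_)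
    rw [MeasureTheory.integral_const_mul, sq]
    congr 1
    exact integral_prod_mul w w
  have h3 : 0 ≤ ∫ y, w y := integral_nonneg hw0
  calc _ ≤ 1 * (C₁ * C₂ * (∫ y, w y) ^ 2) := by gcongr
    _ ≤ _ := by rw [one_mul]; gcongr

end AW

namespace AW

def sc (p d : ℝ) : ℝ := (2 * Real.pi)⁻¹ * ∫ s in (-p)..p, Real.cos (d * s)

lemma sc_zero (p : ℝ) : sc p 0 = p / Real.pi := by
  unfold sc
  have := Real.pi_pos.ne'
  simp
  field_simp
  ring

lemma sc_neg (p d : ℝ) : sc p (-d) = sc p d := by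
  unfold sc; simp only [neg_mul, Real.cos_neg]

lemma sc_abs (p d : ℝ) (hp : 0 ≤ p) : |sc p d| ≤ p / Real.pi := by
  have h : ‖∫ s in (-p)..p, Real.cos (d * s)‖ ≤ 1 * |p - -p| :=
    intervalIntegral.norm_integral_le_of_norm_le_const fun s _ => Real.abs_cos_le_one _
  rw [Real.norm_eq_abs, abs_of_nonneg (by linarith : 0 ≤ p - -p)] at h
  have := Real.pi_pos
  unfold sc
  rw [abs_mul, abs_of_pos (by positivity), ← div_eq_inv_mul, div_le_div_iff₀ (by positivity) (by positivity)]
  nlinarith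

lemma seg_sc (t p d : ℝ) (hp : 0 < p) : seg (t - p) (t + p) 0 d = ((Real.exp (d * t) * sc p d : ℝ) : ℂ) := by
  unfold seg
  rw [if_pos (by linarith)]
  have e1 : ((t + p) - (t - p)) / 2 = p := by ring
  have e2 : ∀ s : ℝ, segw (t - p) (t + p) s = t + s * I := fun s => by
    unfold segw; push_cast; ring
  rw [e1]
  simp only [e2]
  have e3 : ∀ s : ℝ, cexp (((0 : ℝ) : ℂ) * ((t : ℂ) + s * I) ^ 2 + d * (t + s * I)) * I = (cexp (d * t) * I) * cexp (d * s * I) := fun s => by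
    rw [show ((0 : ℝ) : ℂ) * ((t : ℂ) + s * I) ^ 2 + d * (t + s * I) = d * t + d * s * I by push_cast; ring, Complex.exp_add]; ring
  simp only [e3]
  rw [intervalIntegral.integral_const_mul]
  set T := ∫ s in (-p)..p, cexp (d * s * I) with hT
  have hT2 : T = ∫ s in (-p)..p, cexp (-(d * s) * I) := by
    have := intervalIntegral.integral_comp_neg (a := -p) (b := p) (fun s : ℝ => cexp (d * s * I))
    rw [neg_neg] at this
    rw [hT, ← this]
    congr 1; funext s; congr 1; push_cast; ring
  have hI : ∀ c : ℂ, IntervalIntegrable (fun s : ℝ => cexp (c * s * I)) volume (-p) p := fun c =>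
    Continuous.intervalIntegrable (by fun_prop) _ _
  have hT3 : 2 * T = ((2 * ∫ s in (-p)..p, Real.cos (d * s) : ℝ) : ℂ) := by
    have h2 := hI (-d)
    simp only [neg_mul] at h2
    rw [two_mul]
    nth_rewrite 2 [hT2]
    rw [hT]
    simp only [neg_mul]
    rw [← intervalIntegral.integral_add (hI d) h2, ← intervalIntegral.integral_const_mul, ← intervalIntegral.integral_ofReal]
    congr 1; funext s
    push_cast
    rw [Complex.cos]
    ring_nf
  have hT4 : T = ((∫ s in (-p)..p, Real.cos (d * s) : ℝ) : ℂ) := by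
    push_cast at hT3 ⊢
    exact mul_left_cancel₀ two_ne_zero hT3
  rw [hT4]
  unfold sc
  push_cast
  have := Real.pi_pos.ne'
  field_simp

namespace PP
variable (P : PP)

def CC (t : ℝ) : ℝ := Real.exp (|t|) * Real.exp ((2 * P.DD + 2) ^ 2) ^ 2 * (4 * ∫ x : ℝ, (Real.sqrt |x|)⁻¹ * Real.exp (-(1 * |x|))) ^ 2

lemma CC_nonneg (t : ℝ) : 0 ≤ P.CC t := by unfold CC; positivity

lemma Sl_near (t p ξ η : ℝ) (ht : |t| ≤ p) (hp : 1 ≤ p) (hq : p ^ 2 ≤ -(ξ + t ^ 2)) (hq' : -(ξ + t ^ 2) ≤ p ^ 2 + 1)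
    (hη : p ^ 2 ≤ -(η + t ^ 2)) (hη' : -(η + t ^ 2) ≤ p ^ 2 + 1) :
    |P.Sl t ξ t η - Real.exp ((η - ξ) * t) * sc p (η - ξ)| ≤ P.CC t := by
  have hab := abs_le.1 ht
  have h := P.Sl_eq (t - p) (t + p) (P.adm_neg _ _ (by linarith) (by linarith)) t ξ t η
  rw [sub_self, seg_sc t p _ (by linarith)] at h
  have e : ((P.Sl t ξ t η - Real.exp ((η - ξ) * t) * sc p (η - ξ) : ℝ) : ℂ) = II (t - p) (t + p) (P.f₀ t ξ) (P.g₀ t η) := by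
    rw [Complex.ofReal_sub, h]; ring
  rw [← Real.norm_eq_abs, ← Complex.norm_real, e]
  have ep : ((t + p) - (t - p)) / 2 = p := by ring
  have hb := II_bound2 (t - p) (t + p) _ _ (P.f₀ t ξ) (P.g₀ t η) (by rw [ep]; exact P.f_bound t p ξ ht hp hq hq') (by rw [ep]; exact P.g_bound t p η ht hp hη hη')
  refine hb.trans ?_
  unfold CC
  have hN : ‖P.Psi (wst t p 1)‖ ≠ 0 := norm_ne_zero_iff.2 (P.wst_ne t p 1 ht)
  have he : Real.exp (-(2 * t ^ 3 / 3) - ξ * t) * Real.exp (2 * t ^ 3 / 3 + η * t) ≤ Real.exp |t| := by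
    rw [← Real.exp_add, Real.exp_le_exp]
    have h1 : (η - ξ) * t ≤ |η - ξ| * |t| := by rw [← abs_mul]; exact le_abs_self _
    have h2 : |η - ξ| ≤ 1 := abs_le.2 ⟨by linarith, by linarith⟩
    nlinarith [abs_nonneg t]
  refine mul_le_mul_of_nonneg_right ?_ (by positivity)
  calc _ = Real.exp (-(2 * t ^ 3 / 3) - ξ * t) * Real.exp (2 * t ^ 3 / 3 + η * t) * Real.exp ((2 * P.DD + 2) ^ 2) ^ 2 * (‖P.Psi (wst t p 1)‖ * ‖P.Psi (wst t p 1)‖⁻¹) := by ring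
    _ ≤ _ := by rw [mul_inv_cancel₀ hN, mul_one]; gcongr

lemma KL_self (t ξ η : ℝ) : P.KL (t, ξ) (t, η) = P.Sl t ξ t η := by simp [KL, gt]

lemma KL_diag (t p ξ : ℝ) (ht : |t| ≤ p) (hp : 1 ≤ p) (hq : p ^ 2 ≤ -(ξ + t ^ 2)) (hq' : -(ξ + t ^ 2) ≤ p ^ 2 + 1) :
    p / Real.pi - P.CC t ≤ P.KL (t, ξ) (t, ξ) := by
  have := P.Sl_near t p ξ ξ ht hp hq hq' hq hq'
  rw [sub_self, zero_mul, Real.exp_zero, one_mul, sc_zero] at this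
  rw [KL_self]
  linarith [(abs_le.1 this).1]

lemma KL_off (t p ξ η : ℝ) (ht : |t| ≤ p) (hp : 1 ≤ p) (hq : p ^ 2 ≤ -(ξ + t ^ 2)) (hq' : -(ξ + t ^ 2) ≤ p ^ 2 + 1)
    (hη : p ^ 2 ≤ -(η + t ^ 2)) (hη' : -(η + t ^ 2) ≤ p ^ 2 + 1) :
    -(P.CC t * (2 * Real.exp |t| + P.CC t) * p) ≤ P.KL (t, ξ) (t, η) * P.KL (t, η) (t, ξ) := by
  rw [KL_self, KL_self]
  have h1 := P.Sl_near t p ξ η ht hp hq hq' hη hη'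
  have h2 := P.Sl_near t p η ξ ht hp hη hη' hq hq'
  rw [← neg_sub η ξ, sc_neg] at h2
  have hs := sc_abs p (η - ξ) (by linarith)
  have hE : ∀ σ : ℝ, |σ| ≤ 1 → Real.exp (σ * t) ≤ Real.exp |t| := fun σ hσ => by
    rw [Real.exp_le_exp]
    have h1 : σ * t ≤ |σ| * |t| := by rw [← abs_mul]; exact le_abs_self _
    nlinarith [abs_nonneg t]
  have hd : |η - ξ| ≤ 1 := abs_le.2 ⟨by linarith, by linarith⟩
  have hx1 := hE (η - ξ) hd
  have hx2 := hE (-(η - ξ)) (by rwa [abs_neg])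
  have hm : Real.exp ((η - ξ) * t) * Real.exp (-(η - ξ) * t) = 1 := by rw [← Real.exp_add, show (η - ξ) * t + -(η - ξ) * t = 0 by ring, Real.exp_zero]
  have hC := P.CC_nonneg t
  have hsp : |sc p (η - ξ)| ≤ p := hs.trans (div_le_self (by linarith) (by linarith [Real.pi_gt_three]))
  set S := sc p (η - ξ)
  set u := Real.exp ((η - ξ) * t)
  set v := Real.exp (-(η - ξ) * t)
  set C := P.CC t
  set E := Real.exp |t|
  set x := P.Sl t ξ t η - u * S with hx
  set y := P.Sl t η t ξ - v * S with hy
  have e : P.Sl t ξ t η * P.Sl t η t ξ = S ^ 2 * (u * v) + (u * S) * y + (v * S) * x + x * y := by rw [hx, hy]; ring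
  have hu0 : 0 < u := Real.exp_pos _
  have hv0 : 0 < v := Real.exp_pos _
  have b1 : |u * S * y| ≤ E * p * C := by
    rw [abs_mul, abs_mul, abs_of_pos hu0]; gcongr
  have b2 : |v * S * x| ≤ E * p * C := by
    rw [abs_mul, abs_mul, abs_of_pos hv0]; gcongr
  have b3 : |x * y| ≤ C * C := by rw [abs_mul]; gcongr
  rw [e, hm]
  nlinarith [(abs_le.1 b1).1, (abs_le.1 b2).1, (abs_le.1 b3).1, sq_nonneg S, mul_nonneg hC hC]

end PP
end AW

namespace AW

lemma en_two_mul (a b : ℝ≥0∞) : 2 * a * b ≤ a ^ 2 + b ^ 2 := by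
  rcases le_total a b with h | h
  · obtain ⟨c, rfl⟩ := exists_add_of_le h
    calc 2 * a * (a + c) ≤ 2 * a * (a + c) + c ^ 2 := le_self_add
      _ = _ := by ring
  · obtain ⟨c, rfl⟩ := exists_add_of_le h
    calc 2 * (b + c) * b ≤ 2 * (b + c) * b + c ^ 2 := le_self_add
      _ = _ := by ring

lemma wC_sq (C : Set ℝ) (x : EReal) : wC C x * wC C x = wC C x := by
  unfold wC Set.indicator; split_ifs <;> simp

lemma wC_le (C : Set ℝ) (x : EReal) : wC C x ≤ 1 := by
  unfold wC Set.indicator; split_ifs <;> simp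

lemma wC_bot (C : Set ℝ) : wC C ⊥ = 0 := by
  refine Set.indicator_of_notMem ?_ _
  rintro ⟨s, -, e⟩
  exact EReal.coe_ne_bot s e

lemma cs_unit (t : ℝ) (C : Set ℝ) (y : XX) : cs (fun _ : Unit => t) (fun _ => wC C) y = ∑' i : ℕ, wC C (ev (i, t) y) := by
  unfold cs
  rw [← (Equiv.funUnique Unit ℕ).tsum_eq fun i : ℕ => wC C (ev (i, t) y)]
  refine tsum_congr fun i => ?_
  rw [if_pos (Function.injective_of_subsingleton _)]
  simp

lemma cs_two (t : ℝ) (C : Set ℝ) (y : XX) :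
    (∑' i : ℕ, wC C (ev (i, t) y)) ^ 2 ≤ (∑' i : ℕ, wC C (ev (i, t) y)) + cs (fun _ : Fin 2 => t) (fun _ => wC C) y := by
  set w : ℕ → ℝ≥0∞ := fun i => wC C (ev (i, t) y) with hw
  have e1 : cs (fun _ : Fin 2 => t) (fun _ => wC C) y = ∑' q : ℕ × ℕ, if q.1 = q.2 then 0 else w q.1 * w q.2 := by
    unfold cs
    rw [← (finTwoArrowEquiv ℕ).tsum_eq]
    refine tsum_congr fun i => ?_
    rw [Fin.prod_univ_two]
    change (if _ then _ else 0) = if i 0 = i 1 then 0 else w (i 0) * w (i 1)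
    by_cases h : i 0 = i 1
    · rw [if_pos h, if_neg]
      intro hi
      have := hi (a₁ := 0) (a₂ := 1) (by simp [h])
      exact absurd this (by decide)
    · rw [if_neg h, if_pos]
      intro a b hab
      simp only [Prod.mk.injEq, true_and] at hab
      fin_cases a <;> fin_cases b <;> simp_all
  have e2 : ∑' i, w i = ∑' q : ℕ × ℕ, if q.1 = q.2 then w q.1 * w q.2 else 0 := by
    rw [ENNReal.tsum_prod (f := fun a b => if a = b then w a * w b else 0)]
    refine tsum_congr fun a => ?_
    rw [tsum_eq_single a fun b hb => if_neg fun h => hb h.symm, if_pos rfl]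
    exact (wC_sq _ _).symm
  have e3 : (∑' i, w i) ^ 2 = ∑' q : ℕ × ℕ, w q.1 * w q.2 := by
    rw [ENNReal.tsum_prod (f := fun a b => w a * w b), sq, ← ENNReal.tsum_mul_right]
    refine tsum_congr fun a => ?_
    rw [ENNReal.tsum_mul_left]
  rw [e3, e1, e2, ← ENNReal.tsum_add]
  refine ENNReal.tsum_le_tsum fun q => ?_
  split_ifs <;> simp

namespace PP
variable (P : PP)

def win (t p : ℝ) : Set ℝ := Set.Icc (-t ^ 2 - p ^ 2 - 1) (-t ^ 2 - p ^ 2)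

def m1 (t p : ℝ) : ℝ≥0∞ := ∫⁻ x : ℝ, ENNReal.ofReal (P.KL (t, x) (t, x)) * (win t p).indicator 1 x

lemma KL_nonneg (t x : ℝ) : 0 ≤ P.KL (t, x) (t, x) := by
  have := P.DL_nonneg (fun _ : Unit => t) (fun _ => x)
  simpa [DL] using this

lemma KL_meas (t : ℝ) : Measurable fun x => P.KL (t, x) (t, x) := by
  have := (P.DL_meas (fun _ : Unit => t)).comp (measurable_pi_lambda (fun (x : ℝ) (_ : Unit) => x) fun _ => measurable_id)
  simpa [DL, Function.comp_def] using this

lemma mom1 (t p : ℝ) : ∫⁻ y, ∑' i : ℕ, wC (win t p) (ev (i, t) y) ∂P.mu = P.m1 t p ∧ P.m1 t p ≠ ⊤ := by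
  have h := P.mu_corr (fun _ : Unit => t) (fun _ => win t p) (fun _ => measurableSet_Icc) (fun _ => Metric.isBounded_Icc _ _)
  simp only [cs_unit] at h
  have e : ∫⁻ z : Unit → ℝ, ENNReal.ofReal (P.DL (fun _ => t) z) * ∏ p_1 : Unit, (win t p).indicator 1 (z p_1) = P.m1 t p := by
    unfold m1
    rw [← (volume_preserving_funUnique Unit ℝ).lintegral_comp_emb (MeasurableEquiv.measurableEmbedding _)]
    refine lintegral_congr fun z => ?_
    simp [DL]
  rw [e] at h
  exact h

lemma m1_ge (t p : ℝ) (ht : |t| ≤ p) (hp : 1 ≤ p) : ENNReal.ofReal (p / Real.pi - P.CC t) ≤ P.m1 t p := by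
  have hwm : MeasurableSet (win t p) := measurableSet_Icc
  have : ENNReal.ofReal (p / Real.pi - P.CC t) = ∫⁻ x : ℝ, ENNReal.ofReal (p / Real.pi - P.CC t) * (win t p).indicator 1 x := by
    rw [lintegral_const_mul _ (measurable_one.indicator hwm), lintegral_indicator_one hwm, win, Real.volume_Icc]
    rw [show -t ^ 2 - p ^ 2 - (-t ^ 2 - p ^ 2 - 1) = 1 by ring, ENNReal.ofReal_one, mul_one]
  rw [this]
  refine lintegral_mono fun x => ?_
  by_cases hx : x ∈ win t p
  · gcongr
    exact P.KL_diag t p x ht hp (by linarith [hx.2]) (by linarith [hx.1])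
  · simp [Set.indicator_of_notMem hx]

lemma mom2 (t p : ℝ) (ht : |t| ≤ p) (hp : 1 ≤ p) : ∫⁻ y, cs (fun _ : Fin 2 => t) (fun _ => wC (win t p)) y ∂P.mu ≤
    P.m1 t p ^ 2 + ENNReal.ofReal (P.CC t * (2 * Real.exp |t| + P.CC t) * p) := by
  rw [(P.mu_corr (fun _ : Fin 2 => t) (fun _ => win t p) (fun _ => measurableSet_Icc) (fun _ => Metric.isBounded_Icc _ _)).1]
  set K := P.CC t * (2 * Real.exp |t| + P.CC t) * p with hK
  set J : ℝ → ℝ≥0∞ := (win t p).indicator 1 with hJ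
  have hJm : Measurable J := measurable_one.indicator measurableSet_Icc
  have hJ1 : ∫⁻ x, J x = 1 := by
    rw [hJ, lintegral_indicator_one (show MeasurableSet (win t p) from measurableSet_Icc), win, Real.volume_Icc]
    rw [show -t ^ 2 - p ^ 2 - (-t ^ 2 - p ^ 2 - 1) = 1 by ring, ENNReal.ofReal_one]
  set k : ℝ → ℝ≥0∞ := fun x => ENNReal.ofReal (P.KL (t, x) (t, x)) * J x with hk
  have hkm : Measurable k := (P.KL_meas t).ennreal_ofReal.mul hJm
  have hle : ∀ z : Fin 2 → ℝ, ENNReal.ofReal (P.DL (fun _ => t) z) * ∏ q, J (z q) ≤ (k (z 0) * k (z 1)) + ENNReal.ofReal K * (J (z 0) * J (z 1)) := by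
    intro z
    rw [Fin.prod_univ_two]
    by_cases h0 : z 0 ∈ win t p
    swap; · simp [hJ, Set.indicator_of_notMem h0]
    by_cases h1 : z 1 ∈ win t p
    swap; · simp [hJ, Set.indicator_of_notMem h1]
    have hoff := P.KL_off t p (z 0) (z 1) ht hp (by linarith [h0.2]) (by linarith [h0.1]) (by linarith [h1.2]) (by linarith [h1.1])
    have hD : P.DL (fun _ => t) z ≤ P.KL (t, z 0) (t, z 0) * P.KL (t, z 1) (t, z 1) + K := by
      unfold DL
      rw [Matrix.det_fin_two]
      simp only [Matrix.of_apply]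
      linarith
    simp only [hk, hJ, Set.indicator_of_mem h0, Set.indicator_of_mem h1, Pi.one_apply, mul_one]
    refine (ENNReal.ofReal_le_ofReal hD).trans (ENNReal.ofReal_add_le.trans ?_)
    rw [ENNReal.ofReal_mul (P.KL_nonneg t _)]
  refine (lintegral_mono hle).trans (le_of_eq ?_)
  have hpp := (volume_preserving_finTwoArrow ℝ).lintegral_comp_emb (MeasurableEquiv.measurableEmbedding _)
  have := hpp fun q => k q.1 * k q.2 + ENNReal.ofReal K * (J q.1 * J q.2)
  refine this.trans ?_
  have hv : (volume : Measure (ℝ × ℝ)) = (volume : Measure ℝ).prod volume := rfl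
  rw [lintegral_add_left (show Measurable fun q : ℝ × ℝ => k q.1 * k q.2 from (hkm.comp measurable_fst).mul (hkm.comp measurable_snd)), lintegral_const_mul _ (show Measurable fun q : ℝ × ℝ => J q.1 * J q.2 from (hJm.comp measurable_fst).mul (hJm.comp measurable_snd)), hv,
    lintegral_prod_mul hkm.aemeasurable hkm.aemeasurable, lintegral_prod_mul hJm.aemeasurable hJm.aemeasurable, hJ1, mul_one, mul_one, sq]
  rfl

/-- almost surely there are infinitely many points on every level -/
lemma ae_bot (t : ℝ) (k : ℕ) : ∀ᵐ y ∂P.mu, ev (k, t) y ≠ ⊥ := by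
  rw [ae_iff]
  set E := {y : XX | ¬ ev (k, t) y ≠ ⊥} with hE
  have hEm : MeasurableSet E := by
    have : E = ev (k, t) ⁻¹' {⊥} := by ext; simp [hE]
    rw [this]; exact ev_meas _ (measurableSet_singleton _)
  set C := P.CC t
  have hC : 0 ≤ C := P.CC_nonneg t
  set K := C * (2 * Real.exp |t| + C) with hK
  have hK0 : 0 ≤ K := by positivity
  have key : ∀ p, |t| ≤ p → 1 ≤ p → (P.mu E).toReal * (P.m1 t p).toReal ^ 2 ≤ (2 * k + 1) * (P.m1 t p).toReal + K * p := by
    intro p ht hp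
    set m := P.m1 t p with hm
    obtain ⟨hm1, hmt⟩ := P.mom1 t p
    set N : XX → ℝ≥0∞ := fun y => ∑' i : ℕ, wC (win t p) (ev (i, t) y) with hN
    have hwm : Measurable (wC (win t p)) := wC_meas (|-t ^ 2 - p ^ 2 - 1|) (abs_nonneg _) _ (fun x hx => by
      have h1 := hx.1; have h2 := hx.2
      have : -t ^ 2 - p ^ 2 - 1 ≤ 0 := by nlinarith [sq_nonneg t, sq_nonneg p]
      rw [abs_of_nonpos this, abs_le]; constructor <;> nlinarith [sq_nonneg t, sq_nonneg p]) measurableSet_Icc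
    have hNm : Measurable N := Measurable.tsum fun i => hwm.comp (ev_meas _)
    have hpt : ∀ y, 2 * m * N y ≤ 2 * m * k + N y + cs (fun _ : Fin 2 => t) (fun _ => wC (win t p)) y + m ^ 2 * Eᶜ.indicator 1 y := by
      intro y
      by_cases hy : y ∈ E
      · have hy' : ev (k, t) y = ⊥ := not_not.1 hy
        have : N y ≤ k := by
          have hz : ∀ i ∉ Finset.range k, wC (win t p) (ev (i, t) y) = 0 := by
            intro i hi
            have : ev (i, t) y = ⊥ := le_bot_iff.1 (hy' ▸ ev_anti t y (by simpa using hi))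
            rw [this, wC_bot]
          simp only [hN]
          rw [tsum_eq_sum hz]
          refine (Finset.sum_le_sum fun i _ => wC_le _ _).trans ?_
          simp
        calc 2 * m * N y ≤ 2 * m * k := by gcongr
          _ ≤ _ := by rw [add_assoc, add_assoc]; exact le_self_add
      · rw [Set.indicator_of_mem (show y ∈ Eᶜ from hy), Pi.one_apply, mul_one]
        calc 2 * m * N y ≤ m ^ 2 + N y ^ 2 := en_two_mul _ _
          _ ≤ m ^ 2 + (N y + cs (fun _ : Fin 2 => t) (fun _ => wC (win t p)) y) := by gcongr; exact cs_two t _ y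
          _ ≤ _ := by
            rw [add_comm (m ^ 2), add_assoc (2 * m * k)]
            exact add_le_add (le_add_self (a := (N y + cs (fun _ : Fin 2 => t) (fun _ => wC (win t p)) y)) (b := 2 * m * k)) le_rfl
    have hiv := lintegral_mono (μ := P.mu) hpt
    have hcm : Measurable fun y => cs (fun _ : Fin 2 => t) (fun _ => wC (win t p)) y := cs_meas _ _ fun _ => hwm
    rw [lintegral_const_mul _ hNm, lintegral_add_right _ ((measurable_one.indicator hEm.compl).const_mul _), lintegral_add_right _ hcm, lintegral_add_right _ hNm,
      lintegral_const, lintegral_const_mul _ (measurable_one.indicator hEm.compl), lintegral_indicator_one hEm.compl, measure_univ, mul_one, hm1] at hiv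
    have h2 := P.mom2 t p ht hp
    have hfin : 2 * m * k + m + (m ^ 2 + ENNReal.ofReal (K * p)) + m ^ 2 * P.mu Eᶜ ≠ ⊤ := by
      have := measure_ne_top P.mu Eᶜ
      finiteness
    have h3 := ENNReal.toReal_mono hfin (hiv.trans (by gcongr))
    have hKp : 0 ≤ K * p := by positivity
    have hc : (P.mu Eᶜ).toReal = 1 - (P.mu E).toReal := by
      have := probReal_compl_eq_one_sub (μ := P.mu) hEm
      exact this
    rw [ENNReal.toReal_add (by finiteness) (by finiteness), ENNReal.toReal_add (by finiteness) (by finiteness), ENNReal.toReal_add (by finiteness) (by finiteness), ENNReal.toReal_add (by finiteness) (by finiteness)] at h3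
    simp only [ENNReal.toReal_mul, ENNReal.toReal_pow, ENNReal.toReal_ofNat, ENNReal.toReal_natCast, ENNReal.toReal_ofReal hKp, hc] at h3
    nlinarith
  have hfin : ∀ X : ℝ, 1 ≤ X → (P.mu E).toReal * X ≤ (2 * k + 1) + K * (8 + 4 * C + 4 * |t|) := by
    intro X hX
    set p := 4 * (C + X) + |t| with hp
    have hp1 : 1 ≤ p := by linarith [abs_nonneg t]
    have hpt : |t| ≤ p := by linarith
    have h := key p hpt hp1
    have hm := P.m1_ge t p hpt hp1
    have hmt := (P.mom1 t p).2
    rw [ENNReal.ofReal_le_iff_le_toReal hmt] at hm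
    have hpi : p / 4 ≤ p / Real.pi := div_le_div_of_nonneg_left (by linarith) Real.pi_pos Real.pi_le_four
    set M := (P.m1 t p).toReal
    have hMX : X ≤ M := by linarith [abs_nonneg t]
    have hM1 : 1 ≤ M := hX.trans hMX
    have hpM : p ≤ (4 + 4 * C + |t|) * M := by
      nlinarith [abs_nonneg t]
    have hq : 0 ≤ (P.mu E).toReal := ENNReal.toReal_nonneg
    have h5 : (P.mu E).toReal * M ≤ (2 * k + 1) + K * (4 + 4 * C + |t|) := by
      have : (P.mu E).toReal * M * M ≤ ((2 * k + 1) + K * (4 + 4 * C + |t|)) * M := by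
        nlinarith [mul_le_mul_of_nonneg_left hpM hK0]
      exact le_of_mul_le_mul_right this (by linarith)
    nlinarith [mul_le_mul_of_nonneg_left hMX hq, mul_nonneg hK0 (abs_nonneg t)]
  have h0 : (P.mu E).toReal = 0 := by
    by_contra hne
    have hq : 0 < (P.mu E).toReal := lt_of_le_of_ne ENNReal.toReal_nonneg (Ne.symm hne)
    set L := (2 * k + 1) + K * (8 + 4 * C + 4 * |t|) with hL
    have hL0 : 0 ≤ L := by positivity
    have := hfin (L / (P.mu E).toReal + 1) (by have : 0 ≤ L / (P.mu E).toReal := by positivity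
                                               linarith)
    rw [mul_add, mul_div_cancel₀ _ hne] at this
    linarith
  exact ((ENNReal.toReal_eq_zero_iff _).1 h0).resolve_right (measure_ne_top _ _)

/-- almost surely there are no double points -/
lemma ae_ne (t : ℝ) (a b : ℕ) (hab : a ≠ b) : ∀ᵐ y ∂P.mu, ∀ r : ℝ, ev (a, t) y = r → ev (b, t) y ≠ r := by
  have hd : MeasurableSet {z : Fin 2 → ℝ | z 0 = z 1} := measurableSet_eq_fun (measurable_pi_apply 0) (measurable_pi_apply 1)
  have hnull : volume {z : Fin 2 → ℝ | z 0 = z 1} = 0 := by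
    have := (volume_preserving_finTwoArrow ℝ).measure_preimage (s := {q : ℝ × ℝ | q.1 = q.2}) (measurableSet_eq_fun measurable_fst measurable_snd).nullMeasurableSet
    refine (this.symm ▸ ?_ : volume (MeasurableEquiv.finTwoArrow ⁻¹' {q : ℝ × ℝ | q.1 = q.2}) = 0)
    have hv : (volume : Measure (ℝ × ℝ)) = (volume : Measure ℝ).prod volume := rfl
    rw [hv, Measure.prod_apply (measurableSet_eq_fun measurable_fst measurable_snd)]
    have : ∀ x : ℝ, Prod.mk x ⁻¹' {q : ℝ × ℝ | q.1 = q.2} = {x} := fun x => by ext y; simp [eq_comm]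
    simp [this]
  have hR : ∀ R : ℕ, ∀ᵐ y ∂P.mu, u0 R (ev (a, t) y) * u0 R (ev (b, t) y) = 0 ∨ cl (R + 1) (ev (a, t) y) ≠ cl (R + 1) (ev (b, t) y) := by
    intro R
    have he := (P.rho_eq (fun _ : Fin 2 => t) R (Nat.cast_nonneg R)).1
    have hum : Measurable fun x => (u0 R x : ℝ≥0∞) := measurable_coe_nnreal_ennreal.comp (u0_cont R).measurable
    have h2 : P.rho2 R (fun _ : Fin 2 => t) {z | z 0 = z 1} = 0 := by
      have hc : Measurable fun (z : Fin 2 → ℝ) (p : Fin 2) => cl (R + 1) (z p) :=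
        measurable_pi_lambda _ fun p => (cl_cont (R + 1)).measurable.comp (measurable_coe_real_ereal.comp (measurable_pi_apply p))
      unfold rho2
      rw [Measure.map_apply hc hd, withDensity_apply _ (hc hd), ← lintegral_indicator (hc hd)]
      refine (lintegral_congr_ae (g := fun _ => 0) ?_).trans lintegral_zero
      filter_upwards [compl_mem_ae_iff.2 hnull] with z hz
      refine Set.indicator_apply_eq_zero.2 fun hS => ?_
      rw [Fin.prod_univ_two]
      by_cases h0 : u0 R (z 0) = 0
      · simp [h0]
      by_cases h1 : u0 R (z 1) = 0
      · simp [h1]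
      obtain ⟨r, e, hr⟩ := u0_supp R (Nat.cast_nonneg R) _ h0
      obtain ⟨r', e', hr'⟩ := u0_supp R (Nat.cast_nonneg R) _ h1
      rw [← EReal.coe_injective e] at hr
      rw [← EReal.coe_injective e'] at hr'
      have hS' : cl (R + 1) (z 0) = cl (R + 1) (z 1) := hS
      rw [cl_coe, cl_coe, min_eq_right (abs_le.1 hr).2, max_eq_right (abs_le.1 hr).1, min_eq_right (abs_le.1 hr').2, max_eq_right (abs_le.1 hr').1] at hS'
      exact absurd hS' hz
    rw [he, rho1, Measure.sum_apply _ hd, ENNReal.tsum_eq_zero] at h2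
    have h3 := h2 ![a, b]
    have hm := cl_pi_meas (R + 1) (fun _ : Fin 2 => t) ![a, b]
    rw [if_pos (by
      intro p q hpq
      simp only [Prod.mk.injEq, true_and] at hpq
      fin_cases p <;> fin_cases q <;> simp_all), Measure.map_apply hm hd, withDensity_apply _ (hm hd), ← lintegral_indicator (hm hd), lintegral_eq_zero_iff (Measurable.indicator (show Measurable fun y => ∏ p, (u0 R (ev (![a, b] p, t) y) : ℝ≥0∞) from Finset.measurable_prod _ fun p _ => hum.comp (ev_meas _)) (hm hd))] at h3
    filter_upwards [h3] with y hy
    by_contra hcon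
    push Not at hcon
    rw [Set.indicator_of_mem (show y ∈ _ from hcon.2), Fin.prod_univ_two] at hy
    exact hcon.1 (ENNReal.coe_eq_zero.1 (by rw [ENNReal.coe_mul]; exact hy))
  filter_upwards [ae_all_iff.2 hR] with y hy r h1 h2
  obtain ⟨R, hRr⟩ := exists_nat_ge |r|
  rcases hy R with h | h
  · rw [h1, h2, u0_one _ _ hRr] at h
    simp at h
  · exact h (by rw [h1, h2])

end PP
end AW

namespace AW

/-- prepend finitely many parameters -/
def app (J : ℕ) (d e : ℕ → ℝ) (i : ℕ) : ℝ := if i < J then d i else e (i - J)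

lemma app_add (J : ℕ) (d e : ℕ → ℝ) (i : ℕ) : app J d e (i + J) = e i := by simp [app]

lemma app_nonneg (J : ℕ) (d e : ℕ → ℝ) (hd : ∀ i < J, 0 ≤ d i) (he : ∀ i, 0 ≤ e i) (i : ℕ) : 0 ≤ app J d e i := by
  unfold app; split_ifs with h
  · exact hd i h
  · exact he _

lemma app_sum (J : ℕ) (d e : ℕ → ℝ) (s : Summable e) : Summable (app J d e) := by
  rw [← summable_nat_add_iff J]; simpa only [app_add] using s

lemma app_tp (J : ℕ) (d e : ℕ → ℝ) (h0 : ∀ i, 0 ≤ e i) (s : Summable e) (v : ℂ) :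
    ∏' i, (1 + (app J d e i : ℂ) * v) = (∏ i ∈ Finset.range J, (1 + (d i : ℂ) * v)) * ∏' i, (1 + (e i : ℂ) * v) := by
  have := Multipliable.prod_mul_tprod_nat_mul' (k := J) (f := fun i => 1 + (app J d e i : ℂ) * v) (by
    simp only [app_add]; exact mul_one_add e h0 s v)
  rw [← this]
  simp only [app_add]
  congr 1
  exact Finset.prod_congr rfl fun i hi => by simp [app, Finset.mem_range.1 hi]

lemma sh_nonneg (e : ℕ → ℝ) (h0 : ∀ i, 0 ≤ e i) (g : ℝ) (hg : ∀ i, 1 / 2 ≤ 1 + e i * g) (i : ℕ) : 0 ≤ e i / (1 + e i * g) :=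
  div_nonneg (h0 i) (by linarith [hg i])

lemma sh_sum (e : ℕ → ℝ) (h0 : ∀ i, 0 ≤ e i) (s : Summable e) (g : ℝ) (hg : ∀ i, 1 / 2 ≤ 1 + e i * g) : Summable fun i => e i / (1 + e i * g) :=
  Summable.of_nonneg_of_le (sh_nonneg e h0 g hg) (fun i => by
    rw [div_le_iff₀ (by linarith [hg i])]; nlinarith [hg i, h0 i]) (s.mul_left 2)

lemma sh_tp (e : ℕ → ℝ) (h0 : ∀ i, 0 ≤ e i) (s : Summable e) (g : ℝ) (hg : ∀ i, 1 / 2 ≤ 1 + e i * g) (v : ℂ) :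
    ∏' i, (1 + (e i : ℂ) * (v + g)) = (∏' i, (1 + (e i : ℂ) * g)) * ∏' i, (1 + ((e i / (1 + e i * g) : ℝ) : ℂ) * v) := by
  rw [← Multipliable.tprod_mul (mul_one_add e h0 s g) (mul_one_add _ (sh_nonneg e h0 g hg) (sh_sum e h0 s g hg) v)]
  refine tprod_congr fun i => ?_
  have h : (1 + (e i : ℂ) * g) ≠ 0 := by
    have := hg i
    exact_mod_cast (by linarith : (1 + e i * g) ≠ 0)
  push_cast
  field_simp
  ring

lemma ne_im (e : ℝ) (z : ℂ) (hz : z.im ≠ 0) : 1 + (e : ℂ) * z ≠ 0 := by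
  intro h
  have h1 := congrArg Complex.im h
  have h2 := congrArg Complex.re h
  simp at h1 h2
  rcases h1 with h1 | h1
  · simp [h1] at h2
  · exact hz h1

lemma Phi_red (P : AWParams) (hcm : P.cm = 0) (hfin : ∃ J : ℕ, ∀ i, J ≤ i → P.am i = 0 ∧ P.bm i = 0) :
    ∃ (Q : PP) (g : ℝ) (k : ℂ), |g| < 1 ∧ k ≠ 0 ∧ ∀ v : ℂ, v.im ≠ 0 → P.Phi (v + g) = k * Q.Psi v := by
  have hg : ∃ (J : ℕ) (g : ℝ), |g| < 1 ∧ (∀ i, J ≤ i → P.am i = 0 ∧ P.bm i = 0) ∧ (∀ i < J, 0 < g + P.bm i ∧ 0 < P.am i - g) ∧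
      (∀ i, 1 / 2 ≤ 1 + P.bp i * g) ∧ (∀ i, 1 / 2 ≤ 1 + P.ap i * (-g)) := by
    classical
    have key : ∀ β : ℝ, 0 < β → ∃ ε, 0 < ε ∧ ε < 1 ∧ ε < β ∧ (∀ i, P.bp i * ε ≤ 1 / 2) ∧ (∀ i, P.ap i * ε ≤ 1 / 2) := by
      intro β hβ
      have h1 := P.bp_nonneg 0
      have h2 := P.ap_nonneg 0
      have hb : 0 < β⁻¹ := inv_pos.2 hβ
      set D := 2 + β⁻¹ + 2 * P.bp 0 + 2 * P.ap 0 with hD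
      have hD0 : 0 < D := by positivity
      refine ⟨D⁻¹, inv_pos.2 hD0, inv_lt_one_of_one_lt₀ (by linarith), (inv_lt_comm₀ hD0 hβ).2 (by linarith), fun i => ?_, fun i => ?_⟩
      · rw [← div_eq_mul_inv, div_le_iff₀ hD0]
        linarith [P.bp_anti (Nat.zero_le i)]
      · rw [← div_eq_mul_inv, div_le_iff₀ hD0]
        linarith [P.ap_anti (Nat.zero_le i)]
    rcases Nat.eq_zero_or_pos (Nat.find hfin) with h0 | h0
    · exact ⟨0, 0, by simp, fun i _ => Nat.find_spec hfin i (h0 ▸ Nat.zero_le i), by simp, by norm_num, by norm_num⟩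
    · have hmin := Nat.find_min hfin (Nat.sub_lt h0 one_pos)
      set J := Nat.find hfin with hJ
      have hsp : ∀ i, J ≤ i → P.am i = 0 ∧ P.bm i = 0 := Nat.find_spec hfin
      have hor : 0 < P.am (J - 1) ∨ 0 < P.bm (J - 1) := by
        by_contra hcon
        push Not at hcon
        refine hmin fun i hi => ?_
        exact ⟨le_antisymm ((P.am_anti hi).trans hcon.1) (P.am_nonneg i), le_antisymm ((P.bm_anti hi).trans hcon.2) (P.bm_nonneg i)⟩
      rcases hor with h | h
      · obtain ⟨ε, e0, e1, e2, e3, e4⟩ := key _ h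
        refine ⟨J, ε, by rwa [abs_of_pos e0], hsp, fun i hi => ⟨by linarith [P.bm_nonneg i], ?_⟩, fun i => ?_, fun i => ?_⟩
        · linarith [P.am_anti (Nat.le_sub_one_of_lt hi)]
        · nlinarith [P.bp_nonneg i]
        · linarith [e4 i]
      · obtain ⟨ε, e0, e1, e2, e3, e4⟩ := key _ h
        refine ⟨J, -ε, by rwa [abs_neg, abs_of_pos e0], hsp, fun i hi => ⟨?_, by linarith [P.am_nonneg i]⟩, fun i => ?_, fun i => ?_⟩
        · linarith [P.bm_anti (Nat.le_sub_one_of_lt hi)]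
        · linarith [e3 i]
        · nlinarith [P.ap_nonneg i]
  obtain ⟨J, g, hg1, hJ, hm, hb, ha⟩ := hg
  have sbp : Summable P.bp := Summable.of_nonneg_of_le P.bp_nonneg (fun i => by
    linarith [P.ap_nonneg i, P.am_nonneg i, P.bm_nonneg i]) P.sum_fin
  have sap : Summable P.ap := Summable.of_nonneg_of_le P.ap_nonneg (fun i => by
    linarith [P.bp_nonneg i, P.am_nonneg i, P.bm_nonneg i]) P.sum_fin
  let dB : ℕ → ℝ := fun i => (g + P.bm i)⁻¹
  let dA : ℕ → ℝ := fun i => (P.am i - g)⁻¹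
  let Q : PP := ⟨app J dA fun i => P.ap i / (1 + P.ap i * (-g)), app J dB fun i => P.bp i / (1 + P.bp i * g), P.cp,
    app_nonneg _ _ _ (fun i hi => (inv_pos.2 (hm i hi).2).le) (sh_nonneg _ P.ap_nonneg _ ha),
    app_nonneg _ _ _ (fun i hi => (inv_pos.2 (hm i hi).1).le) (sh_nonneg _ P.bp_nonneg _ hb),
    app_sum _ _ _ (sh_sum _ P.ap_nonneg sap _ ha), app_sum _ _ _ (sh_sum _ P.bp_nonneg sbp _ hb)⟩
  have nB : ∏' i, (1 + (P.bp i : ℂ) * g) ≠ 0 := PP.tp_ne _ sbp P.bp_nonneg _ fun i => by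
    have := hb i
    exact_mod_cast (by linarith : (1 + P.bp i * g) ≠ 0)
  have nA : ∏' i, (1 + (P.ap i : ℂ) * (-g : ℝ)) ≠ 0 := PP.tp_ne _ sap P.ap_nonneg _ fun i => by
    have := ha i
    exact_mod_cast (by linarith : (1 + P.ap i * (-g)) ≠ 0)
  have hmB : ∀ i < J, ((g : ℂ) + P.bm i) ≠ 0 := fun i hi => by exact_mod_cast (hm i hi).1.ne'
  have hmA : ∀ i < J, ((P.am i : ℂ) - g) ≠ 0 := fun i hi => by exact_mod_cast (hm i hi).2.ne'
  refine ⟨Q, g, cexp (P.cp * g) * ((∏' i, (1 + (P.bp i : ℂ) * g)) / (∏' i, (1 + (P.ap i : ℂ) * (-g : ℝ)))) *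
    ∏ i ∈ Finset.range J, -(((g : ℂ) + P.bm i) / ((P.am i : ℂ) - g)), hg1, ?_, fun v hv => ?_⟩
  · refine mul_ne_zero (mul_ne_zero (Complex.exp_ne_zero _) (div_ne_zero nB nA)) (Finset.prod_ne_zero_iff.2 fun i hi => ?_)
    exact neg_ne_zero.2 (div_ne_zero (hmB i (Finset.mem_range.1 hi)) (hmA i (Finset.mem_range.1 hi)))
  have hz : (v + g).im ≠ 0 := by simpa using hv
  have hz0 : v + g ≠ 0 := fun h => hz (by rw [h]; rfl)
  have hzn : (-(v + g)).im ≠ 0 := by rw [neg_im]; exact neg_ne_zero.2 hz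
  have hvn : (-v).im ≠ 0 := by rw [neg_im]; exact neg_ne_zero.2 hv
  -- the three pieces
  have hA0 : ∏' i, (1 + (P.ap i : ℂ) * -(v + g)) ≠ 0 := PP.tp_ne _ sap P.ap_nonneg _ fun i => ne_im _ _ hzn
  have hp1 : HasProd (fun i => (1 + (P.bp i : ℂ) * (v + g)) / (1 + (P.ap i : ℂ) * -(v + g))) _ :=
    (mul_one_add _ P.bp_nonneg sbp (v + g)).hasProd.div₀ (mul_one_add _ P.ap_nonneg sap (-(v + g))).hasProd hA0
  have hp2 : HasProd (fun i => (1 + (P.bm i : ℂ) / (v + g)) / (1 - (P.am i : ℂ) / (v + g))) _ :=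
    hasProd_prod_of_ne_finset_one (s := Finset.range J) fun i hi => by
      obtain ⟨h1, h2⟩ := hJ i (by simpa using hi)
      simp [h1, h2]
  have hp : ∏' i, ((1 + (P.bp i : ℂ) * (v + g)) * (1 + (P.bm i : ℂ) / (v + g))) / ((1 - (P.ap i : ℂ) * (v + g)) * (1 - (P.am i : ℂ) / (v + g))) = _ :=
    (tprod_congr fun i => by rw [mul_neg, ← sub_eq_add_neg, mul_div_mul_comm]).trans (hp1.mul hp2).tprod_eq
  have eA := sh_tp _ P.ap_nonneg sap _ ha (-v)
  rw [show -v + ((-g : ℝ) : ℂ) = -(v + (g : ℂ)) by push_cast; ring] at eA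
  rw [AWParams.Phi, hp, hcm, eA, sh_tp _ P.bp_nonneg sbp g hb v]
  have qb : ∏' i, (1 + (Q.b i : ℂ) * v) = _ := app_tp J dB _ (sh_nonneg _ P.bp_nonneg _ hb) (sh_sum _ P.bp_nonneg sbp _ hb) v
  have qa : ∏' i, (1 - (Q.a i : ℂ) * v) = _ :=
    (tprod_congr fun i => by rw [sub_eq_add_neg, ← mul_neg]).trans <| app_tp J dA _ (sh_nonneg _ P.ap_nonneg _ ha) (sh_sum _ P.ap_nonneg sap _ ha) (-v)
  have hfp : ∏ i ∈ Finset.range J, (1 + (P.bm i : ℂ) / (v + g)) / (1 - (P.am i : ℂ) / (v + g)) =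
      (∏ i ∈ Finset.range J, -(((g : ℂ) + P.bm i) / ((P.am i : ℂ) - g))) * ((∏ i ∈ Finset.range J, (1 + (dB i : ℂ) * v)) / ∏ i ∈ Finset.range J, (1 + (dA i : ℂ) * -v)) := by
    rw [← Finset.prod_div_distrib, ← Finset.prod_mul_distrib]
    refine Finset.prod_congr rfl fun i hi => ?_
    have h1 := hmB i (Finset.mem_range.1 hi)
    have h2 := hmA i (Finset.mem_range.1 hi)
    have h3 : (v + g - P.am i) ≠ 0 := fun h => hv (by have := congrArg Complex.im h; simpa using this)
    have e1 : (1 + (P.bm i : ℂ) / (v + g)) / (1 - (P.am i : ℂ) / (v + g)) = (v + g + P.bm i) / (v + g - P.am i) := by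
      rw [one_add_div hz0, one_sub_div hz0, div_div_div_cancel_right₀ hz0]
    have e2 : 1 + (dB i : ℂ) * v = (v + g + P.bm i) / (g + P.bm i) := by
      simp only [dB]; push_cast; field_simp; ring
    have e3 : 1 + (dA i : ℂ) * -v = -(v + g - P.am i) / (P.am i - g) := by
      simp only [dA]; push_cast; field_simp; ring
    rw [e1, e2, e3]
    field_simp
  rw [PP.Psi, qb, qa, hfp, show (P.cp : ℂ) * (v + g) + ((0 : ℝ) : ℂ) / (v + g) = P.cp * g + P.cp * v by push_cast; ring, Complex.exp_add]
  simp only [div_eq_mul_inv, mul_inv]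
  ring

lemma gP_im (a y : ℝ) (hy : y ≠ 0) : (gammaP a y).im ≠ 0 := by
  have : (gammaP a y).im = y / √2 := by simp [gammaP, Complex.div_ofReal_im]
  rw [this]; positivity
lemma gM_im (a y : ℝ) (hy : y ≠ 0) : (gammaM a y).im ≠ 0 := by
  have : (gammaM a y).im = y / √2 := by simp [gammaM, Complex.div_ofReal_im]
  rw [this]; positivity

def lk (g t x : ℝ) : ℝ := x * (t - g) - (t - g) ^ 3 / 3

/-- reduction of the Airy wanderer kernel to the kernel with plus type parameters -/
lemma red (P : AWParams) (hcm : P.cm = 0) (hfin : ∃ J : ℕ, ∀ i, J ≤ i → P.am i = 0 ∧ P.bm i = 0) :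
    ∃ (Q : PP) (g : ℝ), ∀ t₁ x₁ t₂ x₂ : ℝ, Kabc P t₁ x₁ t₂ x₂ =
      cexp (lk g t₁ x₁) * (cexp (-lk g t₂ x₂) * (Q.KL (t₁ - g, x₁ - (t₁ - g) ^ 2) (t₂ - g, x₂ - (t₂ - g) ^ 2) : ℂ)) := by
  obtain ⟨Q, g, k, hg, hk, hPhi⟩ := Phi_red P hcm hfin
  refine ⟨Q, g, fun t₁ x₁ t₂ x₂ => ?_⟩
  have hg' := abs_lt.1 hg
  set c : ℂ := cexp (lk g t₁ x₁) * cexp (-lk g t₂ x₂) with hc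
  have e3 : K3 P (-t₁ - 1) (-t₂ + 1) t₁ x₁ t₂ x₂ = c * II (-1 - g) (1 - g) (Q.f₀ (t₁ - g) (x₁ - (t₁ - g) ^ 2)) (Q.g₀ (t₂ - g) (x₂ - (t₂ - g) ^ 2)) := by
    unfold K3 II
    rw [mul_left_comm c]
    congr 1
    rw [← MeasureTheory.integral_const_mul]
    refine integral_congr_ae ?_
    have hne : ∀ᵐ p : ℝ × ℝ, p.1 ≠ 0 ∧ p.2 ≠ 0 := by
      have h0 : ∀ᵐ y : ℝ, y ≠ 0 := by simp [ae_iff]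
      exact (Measure.quasiMeasurePreserving_fst.ae h0).and (Measure.quasiMeasurePreserving_snd.ae h0)
    filter_upwards [hne] with p hp
    have ev : gammaP (-t₁ - 1) p.1 = gammaP (-1 - g) p.1 - ((t₁ - g : ℝ) : ℂ) := by unfold gammaP; push_cast; ring
    have eu : gammaM (-t₂ + 1) p.2 = gammaM (1 - g) p.2 - ((t₂ - g : ℝ) : ℂ) := by unfold gammaM; push_cast; ring
    have h1 := hPhi _ (gP_im (-1 - g) p.1 hp.1)
    have h2 := hPhi _ (gM_im (1 - g) p.2 hp.2)
    unfold K3param K3Integrand IIf PP.f₀ PP.g₀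
    rw [ev, eu]
    set v := gammaP (-1 - g) p.1
    set u := gammaM (1 - g) p.2
    rw [show v - ((t₁ - g : ℝ) : ℂ) + t₁ = v + g by push_cast; ring, show u - ((t₂ - g : ℝ) : ℂ) + t₂ = u + g by push_cast; ring, h1, h2,
      show v + g - (u - ((t₂ - g : ℝ) : ℂ)) - t₂ = v - u by push_cast; ring, mul_div_mul_left _ _ hk]
    have ee : cexp ((v - ((t₁ - g : ℝ) : ℂ)) ^ 3 / 3 - x₁ * (v - ((t₁ - g : ℝ) : ℂ)) - (u - ((t₂ - g : ℝ) : ℂ)) ^ 3 / 3 + x₂ * (u - ((t₂ - g : ℝ) : ℂ))) =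
        c * (cexp (-((t₁ - g : ℝ) : ℂ) * v ^ 2 - ((x₁ - (t₁ - g) ^ 2 : ℝ) : ℂ) * v) * cexp (v ^ 3 / 3)) * (cexp (((t₂ - g : ℝ) : ℂ) * u ^ 2 + ((x₂ - (t₂ - g) ^ 2 : ℝ) : ℂ) * u) * (cexp (u ^ 3 / 3))⁻¹) := by
      rw [hc, ← Complex.exp_neg]
      simp only [← Complex.exp_add]
      congr 1
      unfold lk
      push_cast
      ring
    rw [ee]
    simp only [div_eq_mul_inv, mul_inv]
    ring
  have e1 : K1 (-t₁ - 1) (-t₂ + 1) t₁ x₁ t₂ x₂ = c * seg (-1 - g) (1 - g) (t₂ - g - (t₁ - g)) (x₂ - (t₂ - g) ^ 2 - (x₁ - (t₁ - g) ^ 2)) := by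
    unfold K1 seg
    rw [if_pos (by linarith), if_pos (by linarith), mul_left_comm c,
      show (-t₂ + 1 + t₂ - (-t₁ - 1 + t₁)) / 2 = (1 - g - (-1 - g)) / 2 by ring]
    congr 1
    rw [← intervalIntegral.integral_const_mul]
    refine intervalIntegral.integral_congr fun s _ => ?_
    rw [← mul_assoc c, hc, ← Complex.exp_add, ← Complex.exp_add]
    congr 2
    unfold K1seg segw lk
    push_cast
    ring
  have e2 : K2 t₁ x₁ t₂ x₂ = c * -(PP.gt (t₁ - g, x₁ - (t₁ - g) ^ 2) (t₂ - g, x₂ - (t₂ - g) ^ 2) : ℂ) := by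
    unfold K2 PP.gt
    by_cases h : t₁ < t₂
    · rw [if_pos h, if_pos (by simpa using h)]
      simp only [gp, sub_sub_sub_cancel_right]
      rw [hc]
      push_cast
      rw [mul_neg, neg_inj, mul_left_comm, ← Complex.exp_add, ← Complex.exp_add]
      congr 2
      unfold lk
      have ht : ((t₂ : ℂ) - t₁) ≠ 0 := by exact_mod_cast (sub_pos.2 h).ne'
      push_cast
      field_simp
      ring
    · rw [if_neg h, if_neg (by simpa using h)]; simp
  unfold Kabc KabcAt
  rw [e1, e2, e3, PP.KL]
  push_cast
  rw [Q.Sl_eq (-1 - g) (1 - g) (Q.adm_neg _ _ (by linarith) (by linarith)), ← mul_assoc, ← hc]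
  ring

lemma ereal_lt {a b : EReal} (h : a < b) (ha : a ≠ ⊥) (hb : b ≠ ⊤) : a.toReal < b.toReal := by
  rw [← EReal.coe_lt_coe_iff, EReal.coe_toReal (ne_top_of_lt h) ha, EReal.coe_toReal hb (ne_bot_of_gt h)]
  exact h

lemma descFactE_nat (k n : ℕ) : descFactE (k : ℝ≥0∞) n = (k.descFactorial n : ℝ≥0∞) := by
  unfold descFactE
  rw [Nat.descFactorial_eq_prod_range]
  push_cast
  rfl

open Classical in
lemma comb {I : Type} {r : ℕ} (n : Fin r → ℕ) (F : Fin r → Finset I) (hF : ∀ i j, i ≠ j → Disjoint (F i) (F j)) :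
    ∏ j, descFactE ((F j).card : ℝ≥0∞) (n j) =
    ∑' ι : ((j : Fin r) × Fin (n j)) → I, if Function.Injective ι then ∏ q, (if ι q ∈ F q.1 then (1 : ℝ≥0∞) else 0) else 0 := by
  let T : Set (((j : Fin r) × Fin (n j)) → I) := {ι | Function.Injective ι ∧ ∀ q, ι q ∈ F q.1}
  have e1 : ∀ ι : ((j : Fin r) × Fin (n j)) → I, (if Function.Injective ι then ∏ q, (if ι q ∈ F q.1 then (1 : ℝ≥0∞) else 0) else 0) = T.indicator 1 ι := by
    intro ι
    by_cases h1 : Function.Injective ι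
    · rw [if_pos h1]
      by_cases h2 : ∀ q, ι q ∈ F q.1
      · rw [Set.indicator_of_mem (show ι ∈ T from ⟨h1, h2⟩)]
        exact Finset.prod_eq_one fun q _ => if_pos (h2 q)
      · rw [Set.indicator_of_notMem (show ι ∉ T from fun h => h2 h.2)]
        push Not at h2
        obtain ⟨q, hq⟩ := h2
        exact Finset.prod_eq_zero (Finset.mem_univ q) (if_neg hq)
    · rw [if_neg h1, Set.indicator_of_notMem (show ι ∉ T from fun h => h1 h.1)]
  let e : T ≃ ((j : Fin r) → (Fin (n j) ↪ F j)) :=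
    { toFun := fun ι j => ⟨fun a => ⟨ι.1 ⟨j, a⟩, ι.2.2 ⟨j, a⟩⟩, fun a b h => by
        have := ι.2.1 (Subtype.ext_iff.1 h)
        simpa using this⟩
      invFun := fun f => ⟨fun q => (f q.1 q.2).1, by
        refine ⟨?_, fun q => (f q.1 q.2).2⟩
        rintro ⟨i, a⟩ ⟨j, b⟩ h
        simp only at h
        by_cases hij : i = j
        · subst hij
          rw [(f i).injective (Subtype.ext h)]
        · exact absurd h (fun h => Finset.disjoint_left.1 (hF i j hij) (f i a).2 (h ▸ (f j b).2))⟩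
      left_inv := fun ι => rfl
      right_inv := fun f => rfl }
  simp_rw [e1]
  rw [← tsum_subtype T (1 : (((j : Fin r) × Fin (n j)) → I) → ℝ≥0∞), ← e.symm.tsum_eq]
  simp only [Pi.one_apply, tsum_fintype, Finset.sum_const, Finset.card_univ, nsmul_eq_mul, mul_one, Fintype.card_pi, Fintype.card_embedding_eq, Fintype.card_coe, Fintype.card_fin]
  push_cast
  exact Finset.prod_congr rfl fun j _ => descFactE_nat _ _

lemma pi_sum {S : Type} [Fintype S] [DecidableEq S] {m : ℕ} (s : Fin m → ℝ) (c : ℝ → ℝ) :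
    (Measure.pi fun _ : S => (muA s).prod (volume : Measure ℝ)) =
      ∑ k : S → Fin m, (volume : Measure (S → ℝ)).map fun z q => (s (k q), z q + c (s (k q))) := by
  have hmk : ∀ k : S → Fin m, Measurable fun (z : S → ℝ) q => (s (k q), z q + c (s (k q))) := fun k =>
    measurable_pi_lambda _ fun q => measurable_const.prodMk ((measurable_pi_apply q).add_const _)
  refine Measure.pi_eq fun E hE => ?_
  have h1 : ∀ q, (muA s).prod volume (E q) = ∑ j, volume {x : ℝ | (s j, x + c (s j)) ∈ E q} := by
    intro q
    rw [Measure.prod_apply (hE q), muA, lintegral_sum_measure, tsum_fintype]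
    refine Finset.sum_congr rfl fun j _ => ?_
    rw [lintegral_dirac' _ (measurable_measure_prodMk_left (hE q)), ← measure_preimage_add_right volume (c (s j))]
    rfl
  simp_rw [h1]
  rw [Finset.prod_univ_sum, Fintype.piFinset_univ, Measure.finsetSum_apply]
  refine Finset.sum_congr rfl fun k _ => ?_
  rw [Measure.map_apply (hmk k) (MeasurableSet.univ_pi hE), ← volume_pi_pi]
  congr 1

namespace PP
variable (P : PP)

def good (t : ℝ) : Set XX := {y | ∀ i : ℕ, ev (i, t) y ≠ ⊥ ∧ ev (i, t) y ≠ ⊤ ∧ ev (i + 1, t) y < ev (i, t) y ∧ ∃ L, ev (L, t) y < ((-(i : ℝ) : ℝ) : EReal)}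

lemma good_meas (t : ℝ) : MeasurableSet (good t) := by
  have : good t = ⋂ i : ℕ, ((ev (i, t) ⁻¹' {⊥}ᶜ ∩ (ev (i, t) ⁻¹' {⊤}ᶜ ∩ ({y | ev (i + 1, t) y < ev (i, t) y} ∩ ⋃ L : ℕ, ev (L, t) ⁻¹' Set.Iio ((-(i : ℝ) : ℝ) : EReal))))) := by
    ext y; simp [good]
  rw [this]
  exact MeasurableSet.iInter fun i => (ev_meas _ (measurableSet_singleton _).compl).inter ((ev_meas _ (measurableSet_singleton _).compl).inter
    ((measurableSet_lt (ev_meas _) (ev_meas _)).inter (MeasurableSet.iUnion fun L => ev_meas _ measurableSet_Iio)))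

lemma good_ae (t : ℝ) : ∀ᵐ y ∂P.mu, y ∈ good t := by
  have h1 := ae_all_iff.2 fun k => P.ae_bot t k
  have h2 := ae_all_iff.2 fun i : ℕ => P.ae_ne t (i + 1) i (Nat.succ_ne_self i)
  filter_upwards [h1, h2, P.ae_top t, P.ae_fin t] with y h1 h2 h3' h4 i
  have h3 : ∀ i, ev (i, t) y ≠ ⊤ := fun i h => h3' (top_le_iff.1 (h ▸ ev_anti t y (Nat.zero_le i)))
  refine ⟨h1 i, h3 i, lt_of_le_of_ne (ev_anti t y (Nat.le_succ i)) fun h => ?_, ?_⟩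
  · have e : ((ev (i, t) y).toReal : EReal) = ev (i, t) y := EReal.coe_toReal (h3 i) (h1 i)
    exact h2 i _ (h.trans e.symm) e.symm
  · obtain ⟨L, hL⟩ := h4 i
    exact ⟨L, hL L le_rfl⟩

open Classical in
def YY (g : ℝ) (i : ℕ) (t : ℝ) (y : XX) : ℝ := if y ∈ good (t - g) then (ev (i, t - g) y).toReal + (t - g) ^ 2 else -i

lemma YY_meas (g : ℝ) (i : ℕ) (t : ℝ) : Measurable (YY g i t) :=
  Measurable.ite (good_meas _) ((measurable_ereal_toReal.comp (ev_meas _)).add_const _) measurable_const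

lemma YY_lt (g : ℝ) (i : ℕ) (t : ℝ) (y : XX) : YY g (i + 1) t y < YY g i t y := by
  unfold YY
  split_ifs with h
  · have := ereal_lt (h i).2.2.1 (h (i + 1)).1 (h i).2.1
    linarith
  · push_cast; linarith

lemma YY_fin (g t R : ℝ) (y : XX) : ∃ L, ∀ i, L ≤ i → YY g i t y < -R := by
  have hanti : StrictAnti fun i => YY g i t y := strictAnti_nat_of_succ_lt fun i => YY_lt g i t y
  suffices h : ∃ L, YY g L t y < -R by
    obtain ⟨L, hL⟩ := h
    exact ⟨L, fun i hi => (hanti.antitone hi).trans_lt hL⟩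
  by_cases h : y ∈ good (t - g)
  · obtain ⟨N, hN⟩ := exists_nat_ge (R + (t - g) ^ 2)
    obtain ⟨L, hL⟩ := (h N).2.2.2
    refine ⟨L, ?_⟩
    rw [YY, if_pos h]
    have := ereal_lt hL (h L).1 (EReal.coe_ne_top _)
    rw [EReal.toReal_coe] at this
    linarith
  · obtain ⟨N, hN⟩ := exists_nat_gt R
    exact ⟨N, by rw [YY, if_neg h]; linarith⟩

section
variable (g : ℝ) {m : ℕ} (s : Fin m → ℝ)

def pt (p : ℕ × Fin m) (y : XX) : ℝ × ℝ := (s p.2, YY g p.1 (s p.2) y)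

def MM (y : XX) : Measure (ℝ × ℝ) := Measure.sum fun p : ℕ × Fin m => Measure.dirac (pt g s p y)

lemma pt_meas (p : ℕ × Fin m) : Measurable (pt g s p) := measurable_const.prodMk (YY_meas _ _ _)

lemma pt_fin (B : Set (ℝ × ℝ)) (hb : Bornology.IsBounded B) (y : XX) : {p | pt g s p y ∈ B}.Finite := by
  obtain ⟨R, hR⟩ := hb.exists_norm_le
  choose L hL using fun j : Fin m => YY_fin g (s j) R y
  refine ((Finset.range (∑ j, L j)) ×ˢ (Finset.univ : Finset (Fin m))).finite_toSet.subset fun p hp => ?_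
  simp only [Finset.coe_product, Finset.coe_univ, Set.mem_prod, Finset.coe_range, Set.mem_Iio, Set.mem_univ, and_true]
  by_contra hcon
  push Not at hcon
  have h1 := hL p.2 p.1 ((Finset.single_le_sum (f := L) (fun _ _ => Nat.zero_le _) (Finset.mem_univ p.2)).trans hcon)
  have h2 := (norm_snd_le _).trans (hR _ hp)
  rw [Real.norm_eq_abs] at h2
  have h3 := (abs_le.1 h2).1
  simp only [pt] at h3
  linarith

lemma MM_apply (A : Set (ℝ × ℝ)) (hA : MeasurableSet A) (y : XX) : MM g s y A = ∑' p, A.indicator 1 (pt g s p y) := by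
  rw [MM, Measure.sum_apply _ hA]
  exact tsum_congr fun p => Measure.dirac_apply' _ hA

lemma MM_card (B : Set (ℝ × ℝ)) (hB : MeasurableSet B) (hb : Bornology.IsBounded B) (y : XX) : MM g s y B = (pt_fin g s B hb y).toFinset.card := by
  rw [MM_apply g s B hB, tsum_eq_sum (s := (pt_fin g s B hb y).toFinset) fun p hp => Set.indicator_of_notMem (by simpa using hp) _,
    Finset.sum_congr rfl fun p hp => Set.indicator_of_mem (show pt g s p y ∈ B by simpa using hp) _]
  simp

lemma MM_pp : IsPointProcess2 (MM g s) := by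
  refine ⟨fun A hA => ?_, fun y B hB hb => ⟨_, MM_card g s B hB hb y⟩⟩
  simp_rw [MM_apply g s A hA]
  exact Measurable.tsum fun p => (measurable_one.indicator hA).comp (pt_meas g s p)

end
end PP
end AW

namespace AW

namespace PP
variable (P : PP)

lemma det_red {S : Type} [Fintype S] [DecidableEq S] (Kk : ℝ → ℝ → ℝ → ℝ → ℂ) (g : ℝ)
    (hK : ∀ t₁ x₁ t₂ x₂ : ℝ, Kk t₁ x₁ t₂ x₂ = cexp (lk g t₁ x₁) * (cexp (-lk g t₂ x₂) * (P.KL (t₁ - g, x₁ - (t₁ - g) ^ 2) (t₂ - g, x₂ - (t₂ - g) ^ 2) : ℂ)))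
    (t z : S → ℝ) : Matrix.det (Matrix.of fun p q : S => Kk (t p) (z p + (t p - g) ^ 2) (t q) (z q + (t q - g) ^ 2)) = (P.DL (fun p => t p - g) z : ℂ) := by
  have e : (Matrix.of fun p q : S => Kk (t p) (z p + (t p - g) ^ 2) (t q) (z q + (t q - g) ^ 2)) =
      Matrix.of fun p q => cexp (lk g (t p) (z p + (t p - g) ^ 2)) * (Matrix.of fun p q => cexp (-lk g (t q) (z q + (t q - g) ^ 2)) *
        (Matrix.of fun p q => P.KL (t p - g, z p) (t q - g, z q)).map Complex.ofRealHom p q) p q := by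
    ext p q
    simp only [Matrix.of_apply, Matrix.map_apply, hK, add_sub_cancel_right]
    rfl
  rw [e, Matrix.det_mul_column, Matrix.det_mul_row, ← mul_assoc, ← Finset.prod_mul_distrib]
  simp only [← Complex.exp_add, add_neg_cancel, Complex.exp_zero, Finset.prod_const_one, one_mul]
  exact (RingHom.map_det Complex.ofRealHom _).symm

lemma MM_det (Kk : ℝ → ℝ → ℝ → ℝ → ℂ) (g : ℝ)
    (hK : ∀ t₁ x₁ t₂ x₂ : ℝ, Kk t₁ x₁ t₂ x₂ = cexp (lk g t₁ x₁) * (cexp (-lk g t₂ x₂) * (P.KL (t₁ - g, x₁ - (t₁ - g) ^ 2) (t₂ - g, x₂ - (t₂ - g) ^ 2) : ℂ)))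
    {m : ℕ} (s : Fin m → ℝ) (hs : Function.Injective s) : IsDeterminantalOn P.mu (MM g s) Kk s := by
  classical
  intro r n B hr hn hB hb hd
  let S := (j : Fin r) × Fin (n j)
  have : Nonempty S := ⟨⟨⟨0, hr⟩, ⟨0, hn _⟩⟩⟩
  let τ : (S → Fin m) → S → ℝ := fun k q => s (k q) - g
  let C : (S → Fin m) → S → Set ℝ := fun k q => {z | (s (k q), z + (s (k q) - g) ^ 2) ∈ B q.1}
  have hCm : ∀ k q, MeasurableSet (C k q) := fun k q =>
    (measurable_const.prodMk (measurable_id.add_const ((s (k q) - g) ^ 2)) : Measurable fun z : ℝ => (s (k q), z + (s (k q) - g) ^ 2)) (hB q.1)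
  have hCb : ∀ k q, Bornology.IsBounded (C k q) := by
    intro k q
    obtain ⟨R, hR⟩ := (hb q.1).exists_norm_le
    refine (Metric.isBounded_Icc (-R - (s (k q) - g) ^ 2) R).subset fun z hz => ?_
    have := (norm_snd_le _).trans (hR _ hz)
    rw [Real.norm_eq_abs] at this
    have h := abs_le.1 this
    simp only at h
    exact ⟨by linarith, by nlinarith⟩
  let H : (S → Fin m) → (S → ℝ) → ℝ≥0∞ := fun k z => ENNReal.ofReal (P.DL (τ k) z) * ∏ q, (C k q).indicator 1 (z q)
  have hc := fun k => P.mu_corr (τ k) (C k) (hCm k) (hCb k)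
  have hcsm : ∀ k, Measurable fun y => cs (τ k) (fun q => wC (C k q)) y := by
    refine fun k => cs_meas _ _ fun q => ?_
    obtain ⟨R, hR⟩ := (hCb k q).exists_norm_le
    exact wC_meas (max R 0) (le_max_right _ _) _ (fun x hx => (hR x hx).trans (le_max_left _ _)) (hCm k q)
  -- left side
  have hL : ∫⁻ y, ∏ j, descFactE (MM g s y (B j)) (n j) ∂P.mu = ∑ k, ∫⁻ z, H k z := by
    have hpt : ∀ᵐ y ∂P.mu, ∏ j, descFactE (MM g s y (B j)) (n j) = ∑ k, cs (τ k) (fun q => wC (C k q)) y := by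
      filter_upwards [ae_all_iff.2 fun j : Fin m => P.good_ae (s j - g)] with y hy
      have hM : ∀ j, MM g s y (B j) = _ := fun j => MM_card g s (B j) (hB j) (hb j) y
      simp_rw [hM]
      rw [comb n (fun j => (pt_fin g s (B j) (hb j) y).toFinset) (fun i j hij => Finset.disjoint_left.2 fun p h1 h2 =>
        Set.disjoint_left.1 (hd i j hij) (by simpa using h1) (by simpa using h2))]
      rw [← (Equiv.arrowProdEquivProdArrow S (fun _ => ℕ) (fun _ => Fin m)).symm.tsum_eq, ENNReal.tsum_prod', ENNReal.tsum_comm, tsum_fintype]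
      refine Finset.sum_congr rfl fun k _ => tsum_congr fun i => ?_
      have hiff : Function.Injective ((Equiv.arrowProdEquivProdArrow S (fun _ => ℕ) (fun _ => Fin m)).symm (i, k)) ↔ Function.Injective fun q => (τ k q, i q) := by
        constructor
        · intro h p q hpq
          simp only [τ, Prod.mk.injEq, sub_left_inj] at hpq
          exact h (Prod.ext hpq.2 (hs hpq.1))
        · intro h p q hpq
          have h1 : i p = i q := congrArg Prod.fst hpq
          have h2 : k p = k q := congrArg Prod.snd hpq
          exact h (by simp only [τ, h1, h2])
      by_cases hi : Function.Injective fun q => (τ k q, i q)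
      swap
      · exact (if_neg fun h => hi (hiff.1 h)).trans (if_neg hi).symm
      refine (if_pos (hiff.2 hi)).trans (Eq.trans (Finset.prod_congr rfl fun q _ => ?_) (if_pos hi).symm)
      · have hg := hy (k q)
        have e : ((ev (i q, s (k q) - g) y).toReal : EReal) = ev (i q, τ k q) y := EReal.coe_toReal (hg (i q)).2.1 (hg (i q)).1
        rw [← e]
        refine Eq.trans ?_ (wC_coe (C k q) _).symm
        rw [Set.indicator_apply]
        refine ite_congr (propext ?_) (fun _ => rfl) fun _ => rfl
        rw [Set.Finite.mem_toFinset]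
        change (s (k q), YY g (i q) (s (k q)) y) ∈ B q.1 ↔ _
        rw [YY, if_pos hg]
        rfl
    rw [lintegral_congr_ae hpt, lintegral_finsetSum _ fun k _ => hcsm k]
    exact Finset.sum_congr rfl fun k _ => (hc k).1
  have hHt : ∀ k, ∫⁻ z, H k z ≠ ⊤ := fun k => (hc k).2
  rw [hL]
  refine ⟨ENNReal.sum_ne_top.2 fun k _ => hHt k, ?_⟩
  -- right side
  have hHm : ∀ k, Measurable (H k) := fun k => (P.DL_meas _).ennreal_ofReal.mul
    (Finset.measurable_prod _ fun q _ => (measurable_one.indicator (hCm k q)).comp (measurable_pi_apply q))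
  have hT : MeasurableSet {x : S → ℝ × ℝ | ∀ p, x p ∈ B p.1} := by
    have : {x : S → ℝ × ℝ | ∀ p, x p ∈ B p.1} = Set.univ.pi fun p => B p.1 := by ext; simp
    rw [this]; exact MeasurableSet.univ_pi fun p => hB p.1
  have hemb : ∀ k : S → Fin m, MeasurableEmbedding fun (z : S → ℝ) (q : S) => (s (k q), z q + (s (k q) - g) ^ 2) := by
    intro k
    refine Measurable.measurableEmbedding (measurable_pi_lambda _ fun q => measurable_const.prodMk ((measurable_pi_apply q).add_const _)) ?_
    intro z z' h
    ext q
    have := congrArg Prod.snd (congrFun h q)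
    simpa using this
  let D : (S → ℝ × ℝ) → ℂ := {x : S → ℝ × ℝ | ∀ p, x p ∈ B p.1}.indicator fun x => Matrix.det (Matrix.of fun p q : S => Kk (x p).1 (x p).2 (x q).1 (x q).2)
  have hD : ∀ k (z : S → ℝ), D (fun q => (s (k q), z q + (s (k q) - g) ^ 2)) = ((H k z).toReal : ℂ) := by
    intro k z
    simp only [H, D]
    by_cases h : ∀ q, z q ∈ C k q
    · rw [Set.indicator_of_mem (show _ ∈ {x : S → ℝ × ℝ | ∀ p, x p ∈ B p.1} from h), Finset.prod_eq_one fun q _ => Set.indicator_of_mem (h q) _, mul_one, ENNReal.toReal_ofReal (P.DL_nonneg _ _)]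
      exact P.det_red Kk g hK (fun q => s (k q)) z
    · rw [Set.indicator_of_notMem (show _ ∉ {x : S → ℝ × ℝ | ∀ p, x p ∈ B p.1} from h)]
      push Not at h
      obtain ⟨q, hq⟩ := h
      rw [Finset.prod_eq_zero (Finset.mem_univ q) (Set.indicator_of_notMem hq _)]
      simp
  rw [← MeasureTheory.integral_indicator hT, pi_sum s fun t => (t - g) ^ 2, integral_finsetSum_measure, ENNReal.toReal_sum fun k _ => hHt k]
  · push_cast
    refine Finset.sum_congr rfl fun k _ => ?_
    rw [(hemb k).integral_map]
    refine Eq.trans ?_ (integral_congr_ae (Eventually.of_forall fun z => (hD k z).symm))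
    rw [integral_complex_ofReal, integral_toReal (hHm k).aemeasurable (ae_lt_top (hHm k) (hHt k))]
  · intro k _
    rw [(hemb k).integrable_map_iff]
    have : (D ∘ fun (z : S → ℝ) q => (s (k q), z q + (s (k q) - g) ^ 2)) = fun z => ((H k z).toReal : ℂ) := funext (hD k)
    change Integrable (D ∘ _) _
    rw [this]
    exact (integrable_toReal_of_lintegral_ne_top (hHm k).aemeasurable (hHt k)).ofReal

end PP
end AW

/-- Theorem 1.2 (`T2`): when `c⁻ = 0` and only finitely many of the `a_i⁻, b_i⁻`
are nonzero, the Airy wanderer point processes are carried by a single strictly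
ordered family of processes `Y_i : ℝ × Ω → ℝ`. -/
theorem stmt2 (P : AWParams) (hcm : P.cm = 0)
    (hfin : ∃ J : ℕ, ∀ i, J ≤ i → P.am i = 0 ∧ P.bm i = 0) :
    ∃ (Ω : Type) (_ : MeasurableSpace Ω) (Pr : Measure Ω),
      IsProbabilityMeasure Pr ∧
      ∃ Y : ℕ → ℝ → Ω → ℝ,
        (∀ i t, Measurable (Y i t)) ∧
        (∀ i t ω, Y (i + 1) t ω < Y i t ω) ∧
        ∀ (m : ℕ), 0 < m → ∀ s : Fin m → ℝ, StrictMono s →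
          ∀ M : Ω → Measure (ℝ × ℝ),
            (M = fun ω => Measure.sum fun p : ℕ × Fin m =>
              Measure.dirac (s p.2, Y p.1 (s p.2) ω)) →
            IsPointProcess2 M ∧ IsDeterminantalOn Pr M (Kabc P) s := by
  obtain ⟨Q, g, hK⟩ := AW.red P hcm hfin
  refine ⟨AW.XX, inferInstance, Q.mu, inferInstance, AW.PP.YY g, AW.PP.YY_meas g, AW.PP.YY_lt g, ?_⟩
  rintro m - s hs M rfl
  exact ⟨AW.PP.MM_pp g s, Q.MM_det (Kabc P) g hK s hs.injective⟩

end
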